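/- Let d ≥ 2, N ≥ 1, p ∈ (1,∞), Ω ⊆ ℝ^d open, and let A : Ω × ℝ^{N×d} → ℝ^{N×d} be a Carathéodory map for which there are α₀ > 0, α₁ ≥ 0 with |A(x,η)| ≤ α₁(1+|η|^{p−1}) and A(x,η)·η ≥ α₀|η|^p − α₁ for a.e. x ∈ Ω and all η. Let F : Ω × ℝ^{N×d} → ℝ be Carathéodory with Carathéodory gradient F_η(x,η) := ∂F/∂η(x,η) such that: (i) F_η(x,η) = lim_{λ→∞} A(x,λη)/λ^{p−1} for a.e. x and all η, and for every ε > 0 there is λ₀ > 0 with |F_η(x,η) − A(x,η)| ≤ ε|η|^{p−1} whenever |η| ≥ λ₀; (ii) for every ε > 0 there is δ > 0 with |F_η(x₁,η) − F_η(x₂,η)| ≤ ε|η|^{p−1} whenever x₁,x₂ ∈ Ω, |x₁−x₂| ≤ δ, and all η; (iii) F(x,·) ∈ C²(ℝ^{N×d}∖{0}) with α₀|η|^{p−2}|ξ|² ≤ (∂²F/∂η²)(x,η)[ξ,ξ] ≤ α₁|η|^{p−2}|ξ|² for all η ≠ 0, ξ, and a.e. x; (iv) the splitting condition holds: F_{η_i^α}(x,η)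 = Σ_{β=1}^N Σ_{j=1}^d A^{αβ}(x,η) b_{ij}(x) η_j^β, where A : Ω×ℝ^{N×d} → ℝ^{N×N} is symmetric Carathéodory with α₀|η|^{p−2}|μ|² ≤ Σ A^{αβ}(x,η)μ^α μ^β ≤ α₁|η|^{p−2}|μ|² for η ≠ 0, and b : Ω → ℝ^{d×d} is symmetric measurable with α₀|v|² ≤ Σ b_{ij}(x)v_i v_j ≤ α₁|v|². Then there exist q₀ > p+2 and R₀ > 0 such that for every q ∈ (p,q₀) there is c ≥ 0, depending only on d, N, α₀, α₁, p, q and F, so that for every G ∈ L^{q/(p−1)}_loc(Ω;ℝ^{N×d}) and every weak solution v ∈ W^{1,p}_loc(Ω;ℝ^N) of −div A(x,∇v) = −div G in Ω, one has ⨍_Q |∇v|^q ≤ c[1 + ⨍_{4Q}|G|^{q/(p−1)} + (⨍_{4Q}|∇v|^p)^{q/p}] for every cube Q with sidelength smaller than R₀ and 4Q ⊂ Ω. -/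

import Mathlib

open MeasureTheory Filter Metric Set
open scoped ENNReal Topology RealInnerProductSpace

noncomputable section

/-- `ℝ^d` with the Euclidean norm. -/
abbrev Ed (d : ℕ) : Type := EuclideanSpace ℝ (Fin d)
/-- `ℝ^N` with the Euclidean norm. -/
abbrev En (N : ℕ) : Type := EuclideanSpace ℝ (Fin N)
/-- The space of `N × d` matrices with the Euclidean (Frobenius) norm. -/
abbrev Mat (N d : ℕ) : Type := EuclideanSpace ℝ (Fin N × Fin d)

/-- The open axis-parallel cube with center `c` and sidelength `R`. -/
def cube {d : ℕ} (c : Ed d) (R : ℝ) : Set (Ed d) := {x | ∀ i, |x i - c i| < R / 2}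

/-- The `i`-th partial derivative of a scalar function. -/
def pder {d : ℕ} (φ : Ed d → ℝ) (i : Fin d) (x : Ed d) : ℝ :=
  fderiv ℝ φ x (EuclideanSpace.single i 1)

/-- `g` is the weak gradient of `f` on `U`: for every smooth compactly supported scalar test
function `φ` with support in `U` and all indices `a`, `i`,
`∫_U f^a ∂_i φ = −∫_U g^a_i φ`. -/
def IsWeakGrad {d : ℕ} {ι : Type} [Fintype ι] (U : Set (Ed d))
    (f : Ed d → EuclideanSpace ℝ ι) (g : Ed d → EuclideanSpace ℝ (ι × Fin d)) : Prop :=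
  ∀ φ : Ed d → ℝ, ContDiff ℝ (⊤ : ℕ∞) φ → HasCompactSupport φ → tsupport φ ⊆ U →
    ∀ (a : ι) (i : Fin d),
      ∫ x in U, f x a * pder φ i x = - ∫ x in U, g x (a, i) * φ x

/-- The classical gradient matrix of a (smooth) vector-valued function. -/
def clGrad {d N : ℕ} (φ : Ed d → En N) (x : Ed d) : Mat N d :=
  (WithLp.equiv 2 _).symm fun q => fderiv ℝ φ x (EuclideanSpace.single q.2 1) q.1

/-- `V(η) = |η|^{(p-2)/2} η` (so that `V(0) = 0`). -/
def Vm (p : ℝ) {ι : Type} [Fintype ι] (η : EuclideanSpace ℝ ι) : EuclideanSpace ℝ ι :=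
  ‖η‖ ^ ((p - 2) / 2) • η




/-- tensor product of vectors -/
def tens {N d : ℕ} (w : En N) (y : Ed d) : Mat N d := WithLp.toLp 2 fun q => w q.1 * y q.2

/-- application of a matrix to a vector -/
def app {N d : ℕ} (η : Mat N d) (x : Ed d) : En N := WithLp.toLp 2 fun a => ∑ j, η (a, j) * x j

lemma tens_apply {N d : ℕ} (w : En N) (y : Ed d) (q : Fin N × Fin d) :
    tens w y q = w q.1 * y q.2 := rfl

lemma app_apply {N d : ℕ} (η : Mat N d) (x : Ed d) (a : Fin N) :
    app η x a = ∑ j, η (a, j) * x j := rfl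

lemma inner_mat {ι : Type} [Fintype ι] (a b : EuclideanSpace ℝ ι) :
    ⟪a, b⟫ = ∑ q, a q * b q := by
  simp [PiLp.inner_apply, mul_comm]

lemma inner_tens {N d : ℕ} (m : Mat N d) (w : En N) (y : Ed d) :
    ⟪m, tens w y⟫ = ⟪app m y, w⟫ := by
  rw [inner_mat, inner_mat, Fintype.sum_prod_type]
  simp only [tens_apply, app_apply, Finset.sum_mul]
  refine Finset.sum_congr rfl fun a _ => Finset.sum_congr rfl fun j _ => by ring

lemma norm_sq_eq {ι : Type} [Fintype ι] (a : EuclideanSpace ℝ ι) :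
    ‖a‖ ^ 2 = ∑ q, a q ^ 2 := by
  rw [EuclideanSpace.norm_sq_eq]; simp

lemma norm_tens {N d : ℕ} (w : En N) (y : Ed d) : ‖tens w y‖ = ‖w‖ * ‖y‖ := by
  have : ‖tens w y‖ ^ 2 = (‖w‖ * ‖y‖) ^ 2 := by
    rw [mul_pow, norm_sq_eq, norm_sq_eq, norm_sq_eq, Fintype.sum_prod_type, Finset.sum_mul_sum]
    simp only [tens_apply, mul_pow]
  exact (pow_left_inj₀ (norm_nonneg _) (by positivity) two_ne_zero).1 this

lemma norm_app_le {N d : ℕ} (m : Mat N d) (y : Ed d) : ‖app m y‖ ≤ ‖m‖ * ‖y‖ := by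
  have h := real_inner_le_norm m (tens (app m y) y)
  rw [inner_tens, norm_tens, real_inner_self_eq_norm_sq] at h
  by_cases h0 : ‖app m y‖ = 0
  · rw [h0]; positivity
  · have : 0 < ‖app m y‖ := lt_of_le_of_ne (norm_nonneg _) (Ne.symm h0)
    nlinarith

/-- The frozen operator package. -/
structure Frozen {N d : ℕ} (p Λ : ℝ) (f : Mat N d → Mat N d) (Bm : Ed d →L[ℝ] Ed d) : Prop where
  cont : Continuous f
  zero : f 0 = 0
  mono : ∀ a b, (‖a‖ + ‖b‖) ^ (p - 2) * ‖a - b‖ ^ 2 ≤ Λ * ⟪f a - f b, a - b⟫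
  lip : ∀ a b, ‖f a - f b‖ ≤ Λ * ((‖a‖ + ‖b‖) ^ (p - 2) * ‖a - b‖)
  conv : ∀ a b, ⟪f a, b - a⟫ ≤ ⟪f b, b⟫ / p - ⟪f a, a⟫ / p
  symm : ∀ x y, ⟪Bm x, y⟫ = ⟪x, Bm y⟫
  lowB : ∀ x, ‖x‖ ^ 2 ≤ Λ * ⟪Bm x, x⟫
  normB : ∀ x, ‖Bm x‖ ≤ Λ * ‖x‖
  split : ∀ (η : Mat N d) (x : Ed d) (w : En N) (τ : ℝ), 0 < τ →
    2 * ⟪f η, tens w (Bm x)⟫ ≤ τ⁻¹ * ⟪f η, tens (app η x) (Bm x)⟫ +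
      τ * (Λ * (‖η‖ ^ (p - 2) * ‖w‖ ^ 2))

section pointwise

variable {E : Type} [NormedAddCommGroup E] [InnerProductSpace ℝ E]

lemma psd_bound (L : E →ₗ[ℝ] E) (c : ℝ) (hc : 0 < c)
    (hs : ∀ x y, ⟪L x, y⟫ = ⟪L y, x⟫)
    (h0 : ∀ x, 0 ≤ ⟪L x, x⟫) (h1 : ∀ x, ⟪L x, x⟫ ≤ c * ‖x‖ ^ 2) (x : E) :
    ‖L x‖ ^ 2 ≤ c * ⟪L x, x⟫ := by
  have h := h0 (x - c⁻¹ • L x)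
  have h2 := h1 (L x)
  have e : ⟪L (x - c⁻¹ • L x), x - c⁻¹ • L x⟫ =
      ⟪L x, x⟫ - 2 * c⁻¹ * ‖L x‖ ^ 2 + c⁻¹ * (c⁻¹ * ⟪L (L x), L x⟫) := by
    rw [map_sub, map_smul, inner_sub_left, inner_sub_right, inner_sub_right, inner_smul_left,
      inner_smul_left, inner_smul_right, inner_smul_right, real_inner_self_eq_norm_sq, hs (L x) x,
      real_inner_self_eq_norm_sq]
    simp; ring
  rw [e] at h
  have h3 : c⁻¹ * (c⁻¹ * ⟪L (L x), L x⟫) ≤ c⁻¹ * ‖L x‖ ^ 2 := by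
    apply mul_le_mul_of_nonneg_left _ (by positivity)
    rw [inv_mul_le_iff₀ hc]; exact h2
  have h4 : c⁻¹ * ‖L x‖ ^ 2 ≤ ⟪L x, x⟫ := by linarith
  rwa [inv_mul_le_iff₀ hc] at h4

lemma hess_exists [CompleteSpace E] (F : E → ℝ) (f : E → E)
    (hgrad : ∀ η, η ≠ 0 → HasGradientAt F (f η) η)
    (hC2 : ContDiffOn ℝ 2 F {0}ᶜ) (η : E) (hη : η ≠ 0) :
    ∃ L : E →L[ℝ] E, HasFDerivAt f L η ∧ (∀ x y, ⟪L x, y⟫ = ⟪L y, x⟫) ∧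
      ∀ x, ⟪L x, x⟫ = iteratedFDeriv ℝ 2 F η ![x, x] := by
  have hc : ContDiffAt ℝ 2 F η := hC2.contDiffAt (isOpen_compl_singleton.mem_nhds hη)
  have hd : DifferentiableAt ℝ (fderiv ℝ F) η :=
    (hc.fderiv_right (m := 1) (by norm_num)).differentiableAt (by norm_num)
  have hsym : IsSymmSndFDerivAt ℝ F η := hc.isSymmSndFDerivAt (by simp)
  let J : (StrongDual ℝ E) →L[ℝ] E :=
    { toFun := fun l => (InnerProductSpace.toDual ℝ E).symm l
      map_add' := fun a b => by simp
      map_smul' := fun c a => by simp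
      cont := (InnerProductSpace.toDual ℝ E).symm.continuous }
  have hJ : ∀ (l : StrongDual ℝ E) (y : E), ⟪J l, y⟫ = l y := fun l y =>
    InnerProductSpace.toDual_symm_apply
  refine ⟨J.comp (fderiv ℝ (fderiv ℝ F) η), ?_, ?_, ?_⟩
  · have h1 : HasFDerivAt (fun x => J (fderiv ℝ F x)) (J.comp (fderiv ℝ (fderiv ℝ F) η)) η :=
      J.hasFDerivAt.comp η hd.hasFDerivAt
    refine h1.congr_of_eventuallyEq ?_
    filter_upwards [isOpen_compl_singleton.mem_nhds hη] with x hx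
    have := (hgrad x hx).hasFDerivAt.fderiv
    rw [this]
    exact ((InnerProductSpace.toDual ℝ E).symm_apply_apply _).symm
  · intro x y
    show ⟪J _, y⟫ = ⟪J _, x⟫
    rw [hJ, hJ]; exact hsym x y
  · intro x
    show ⟪J _, x⟫ = _
    rw [hJ, iteratedFDeriv_two_apply]; simp

/-- properties along segments avoiding the origin -/
structure OpData (p a0 a1 : ℝ) (F : E → ℝ) (f : E → E) : Prop where
  cont : Continuous f
  zero : f 0 = 0
  grad : ∀ η, η ≠ 0 → HasFDerivAt F (innerSL ℝ (f η)) η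
  hom : ∀ t : ℝ, 0 < t → ∀ η, f (t • η) = t ^ (p - 1) • f η
  hess : ∀ η, η ≠ 0 → ∃ L : E →L[ℝ] E, HasFDerivAt f L η ∧
    ∀ x, a0 * ‖η‖ ^ (p - 2) * ‖x‖ ^ 2 ≤ ⟪L x, x⟫ ∧ ‖L x‖ ≤ a1 * ‖η‖ ^ (p - 2) * ‖x‖

variable {p a0 a1 : ℝ} {F : E → ℝ} {f : E → E}

lemma OpData.lip_seg (h : OpData p a0 a1 F f) (hp : 2 ≤ p) (h1 : 0 < a1) (a b : E)
    (hs : (0 : E) ∉ segment ℝ a b) :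
    ‖f a - f b‖ ≤ a1 * ((‖a‖ + ‖b‖) ^ (p - 2) * ‖a - b‖) := by
  have hne : ∀ x ∈ segment ℝ a b, x ≠ 0 := fun x hx h0 => hs (h0 ▸ hx)
  choose! L hL hL2 using h.hess
  have key := (convex_segment a b).norm_image_sub_le_of_norm_hasFDerivWithin_le
    (f := f) (f' := L) (C := a1 * (‖a‖ + ‖b‖) ^ (p - 2))
    (fun x hx => (hL x (hne x hx)).hasFDerivWithinAt) (fun x hx => by
      have hxn : ‖x‖ ≤ ‖a‖ + ‖b‖ := by
        have := (convexOn_norm (convex_univ : Convex ℝ (univ : Set E)))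
        obtain ⟨s, t, hs0, ht0, hst, rfl⟩ := hx
        calc ‖s • a + t • b‖ ≤ ‖s • a‖ + ‖t • b‖ := norm_add_le _ _
          _ = s * ‖a‖ + t * ‖b‖ := by
            rw [norm_smul, norm_smul, Real.norm_of_nonneg hs0, Real.norm_of_nonneg ht0]
          _ ≤ ‖a‖ + ‖b‖ := by
            have := norm_nonneg a; have := norm_nonneg b; nlinarith
      refine ContinuousLinearMap.opNorm_le_bound _ (by positivity) fun y => ?_
      refine ((hL2 x (hne x hx)) y).2.trans ?_
      have := Real.rpow_le_rpow (norm_nonneg x) hxn (by linarith : 0 ≤ p - 2)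
      gcongr) (right_mem_segment ℝ a b) (left_mem_segment ℝ a b)
  rw [mul_assoc] at key; exact key

lemma OpData.mono_seg_aux (h : OpData p a0 a1 F f) (hp : 2 ≤ p) (h0 : 0 < a0) (a b : E)
    (hs : (0 : E) ∉ segment ℝ a b) (hab : ‖b‖ ≤ ‖a‖) :
    a0 / 4 * (((‖a‖ + ‖b‖) / 4) ^ (p - 2) * ‖b - a‖ ^ 2) ≤ ⟪f b - f a, b - a⟫ := by
  choose! L hL hL2 using h.hess
  set G : ℝ → ℝ := fun t => ⟪f (a + t • (b - a)), b - a⟫ with hG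
  have hmem : ∀ t ∈ Icc (0:ℝ) 1, a + t • (b - a) ≠ 0 := by
    intro t ht h0
    apply hs
    rw [segment_eq_image']
    exact ⟨t, ht, h0⟩
  have hder : ∀ t ∈ Icc (0:ℝ) 1, HasDerivAt G ⟪L (a + t • (b - a)) (b - a), b - a⟫ t := by
    intro t ht
    have h1 : HasDerivAt (fun t : ℝ => a + t • (b - a)) (b - a) t := by
      simpa using ((hasDerivAt_id t).smul_const (b - a)).const_add a
    have h2 := (hL _ (hmem t ht)).comp_hasDerivAt t h1
    have h3 := h2.inner ℝ (hasDerivAt_const t (b - a))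
    simpa using h3
  have hcont : ContinuousOn G (Icc 0 1) := fun t ht => (hder t ht).continuousAt.continuousWithinAt
  obtain ⟨s, hs1, hs2⟩ := exists_hasDerivAt_eq_slope G _ (by norm_num : (0:ℝ) < 1 / 4)
    (hcont.mono (Icc_subset_Icc le_rfl (by norm_num)))
    (fun x hx => hder x ⟨hx.1.le, hx.2.le.trans (by norm_num)⟩)
  obtain ⟨t, ht1, ht2⟩ := exists_hasDerivAt_eq_slope G _ (by norm_num : (1/4:ℝ) < 1)
    (hcont.mono (Icc_subset_Icc (by norm_num) le_rfl))
    (fun x hx => hder x ⟨le_trans (by norm_num) hx.1.le, hx.2.le⟩)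
  have e1 : G 1 - G 0 = ⟪f b - f a, b - a⟫ := by simp [hG, inner_sub_left]
  have hs3 := (hL2 _ (hmem s ⟨hs1.1.le, hs1.2.le.trans (by norm_num)⟩) (b - a)).1
  have ht3 := (hL2 _ (hmem t ⟨le_trans (by norm_num) ht1.1.le, ht1.2.le⟩) (b - a)).1
  have ht4 : 0 ≤ ⟪L (a + t • (b - a)) (b - a), b - a⟫ := le_trans (by positivity) ht3
  rw [hs2] at hs3
  have hn : (‖a‖ + ‖b‖) / 4 ≤ ‖a + s • (b - a)‖ := by
    have e : a = (a + s • (b - a)) - s • (b - a) := by abel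
    have h5 : ‖a‖ ≤ ‖a + s • (b - a)‖ + ‖s • (b - a)‖ := by
      conv_lhs => rw [e]
      exact norm_sub_le _ _
    rw [norm_smul, Real.norm_of_nonneg hs1.1.le] at h5
    have h6 : ‖b - a‖ ≤ ‖b‖ + ‖a‖ := norm_sub_le _ _
    have := norm_nonneg (b - a)
    nlinarith [hs1.2]
  have h7 := Real.rpow_le_rpow (by positivity) hn (by linarith : 0 ≤ p - 2)
  have h8 : a0 * (((‖a‖ + ‖b‖) / 4) ^ (p - 2) * ‖b - a‖ ^ 2) ≤
      a0 * ‖a + s • (b - a)‖ ^ (p - 2) * ‖b - a‖ ^ 2 := by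
    rw [mul_assoc]; gcongr
  rw [← e1]
  rw [ht2] at ht4
  have h9 : 0 ≤ G 1 - G (1/4) := by
    rw [le_div_iff₀ (by norm_num)] at ht4; linarith
  have h10 := h8.trans hs3
  rw [le_div_iff₀ (by norm_num)] at h10
  linarith

lemma OpData.mono_seg (h : OpData p a0 a1 F f) (hp : 2 ≤ p) (h0 : 0 < a0) (a b : E)
    (hs : (0 : E) ∉ segment ℝ a b) :
    a0 / 4 * (((‖a‖ + ‖b‖) / 4) ^ (p - 2) * ‖a - b‖ ^ 2) ≤ ⟪f a - f b, a - b⟫ := by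
  rcases le_total ‖a‖ ‖b‖ with hab | hab
  · have := h.mono_seg_aux hp h0 b a (by rwa [segment_symm]) hab
    rwa [add_comm ‖b‖] at this
  · have := h.mono_seg_aux hp h0 a b hs hab
    rw [norm_sub_rev] at this
    have e : ⟪f a - f b, a - b⟫ = ⟪f b - f a, b - a⟫ := by
      rw [← neg_sub (f b), ← neg_sub b, inner_neg_neg]
    rwa [e]

/-- a perturbation of the segment avoids the origin -/
lemma seg_perturb (hdim : ∀ a : E, ∃ w : E, w ∉ Submodule.span ℝ {a}) (a b : E)
    (hs : (0 : E) ∈ segment ℝ a b) :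
    ∃ w : E, ∀ t : ℝ, t ≠ 0 → (0 : E) ∉ segment ℝ (a + t • w) (b + t • w) := by
  obtain ⟨w, hw⟩ := hdim (a - b)
  refine ⟨w, fun t ht h0 => hw ?_⟩
  obtain ⟨s, s', hs0, hs0', hss, e⟩ := hs
  obtain ⟨r, r', hr0, hr0', hrr, e'⟩ := h0
  have e2 : t • w = (s - r) • (a - b) := by
    have : t • w = (r • (a + t • w) + r' • (b + t • w)) - (r • a + r' • b) := by
      have : r • (t • w) + r' • (t • w) = t • w := by rw [← add_smul, hrr, one_smul]
      rw [smul_add, smul_add]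
      nth_rw 1 [← this]; abel
    rw [this, e', ← e]
    have h1 : s' = 1 - s := by linarith
    have h2 : r' = 1 - r := by linarith
    rw [h1, h2]; module
  rw [Submodule.mem_span_singleton]
  refine ⟨t⁻¹ * (s - r), ?_⟩
  rw [mul_smul, ← e2, smul_smul, inv_mul_cancel₀ ht, one_smul]

lemma seg_extend (hdim : ∀ a : E, ∃ w : E, w ∉ Submodule.span ℝ {a})
    (P Q : E → E → ℝ) (hP : Continuous fun z : E × E => P z.1 z.2)
    (hQ : Continuous fun z : E × E => Q z.1 z.2)
    (h : ∀ a b, (0 : E) ∉ segment ℝ a b → P a b ≤ Q a b) (a b : E) : P a b ≤ Q a b := by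
  by_cases hs : (0 : E) ∈ segment ℝ a b
  · obtain ⟨w, hw⟩ := seg_perturb hdim a b hs
    have hc : Continuous fun t : ℝ => ((a + t • w, b + t • w) : E × E) := by fun_prop
    have h1 : Tendsto (fun t : ℝ => P (a + t • w) (b + t • w)) (𝓝[≠] 0) (𝓝 (P a b)) := by
      have := ((hP.comp hc).tendsto 0).mono_left (nhdsWithin_le_nhds (s := {0}ᶜ))
      simpa [Function.comp_def] using this
    have h2 : Tendsto (fun t : ℝ => Q (a + t • w) (b + t • w)) (𝓝[≠] 0) (𝓝 (Q a b)) := by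
      have := ((hQ.comp hc).tendsto 0).mono_left (nhdsWithin_le_nhds (s := {0}ᶜ))
      simpa [Function.comp_def] using this
    refine le_of_tendsto_of_tendsto h1 h2 ?_
    filter_upwards [self_mem_nhdsWithin] with t ht
    exact h _ _ (hw t ht)
  · exact h a b hs

lemma OpData.lip (h : OpData p a0 a1 F f) (hp : 2 ≤ p) (h1 : 0 < a1)
    (hdim : ∀ a : E, ∃ w : E, w ∉ Submodule.span ℝ {a}) (a b : E) :
    ‖f a - f b‖ ≤ a1 * ((‖a‖ + ‖b‖) ^ (p - 2) * ‖a - b‖) := by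
  have := h.cont
  refine seg_extend hdim (fun a b => ‖f a - f b‖)
    (fun a b => a1 * ((‖a‖ + ‖b‖) ^ (p - 2) * ‖a - b‖)) (by fun_prop) ?_
    (fun a b hs => h.lip_seg hp h1 a b hs) a b
  have : Continuous fun z : E × E => (‖z.1‖ + ‖z.2‖) ^ (p - 2) :=
    Continuous.rpow_const (by fun_prop) fun _ => Or.inr (by linarith)
  fun_prop

lemma OpData.mono (h : OpData p a0 a1 F f) (hp : 2 ≤ p) (h0 : 0 < a0)
    (hdim : ∀ a : E, ∃ w : E, w ∉ Submodule.span ℝ {a}) (a b : E) :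
    a0 / 4 * (((‖a‖ + ‖b‖) / 4) ^ (p - 2) * ‖a - b‖ ^ 2) ≤ ⟪f a - f b, a - b⟫ := by
  have := h.cont
  refine seg_extend hdim (fun a b => a0 / 4 * (((‖a‖ + ‖b‖) / 4) ^ (p - 2) * ‖a - b‖ ^ 2))
    (fun a b => ⟪f a - f b, a - b⟫) ?_ (by fun_prop)
    (fun a b hs => h.mono_seg hp h0 a b hs) a b
  have : Continuous fun z : E × E => ((‖z.1‖ + ‖z.2‖) / 4) ^ (p - 2) :=
    Continuous.rpow_const (by fun_prop) fun _ => Or.inr (by linarith)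
  fun_prop

lemma OpData.mvt (h : OpData p a0 a1 F f) (a b : E) (hs : (0 : E) ∉ segment ℝ a b) :
    ∃ t ∈ Ioo (0:ℝ) 1, F b - F a = ⟪f (a + t • (b - a)), b - a⟫ := by
  have hmem : ∀ t ∈ Icc (0:ℝ) 1, a + t • (b - a) ≠ 0 := by
    intro t ht h0
    apply hs
    rw [segment_eq_image']
    exact ⟨t, ht, h0⟩
  have hder : ∀ t ∈ Icc (0:ℝ) 1, HasDerivAt (fun t : ℝ => F (a + t • (b - a)))
      ⟪f (a + t • (b - a)), b - a⟫ t := by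
    intro t ht
    have h1 : HasDerivAt (fun t : ℝ => a + t • (b - a)) (b - a) t := by
      simpa using ((hasDerivAt_id t).smul_const (b - a)).const_add a
    exact (h.grad _ (hmem t ht)).comp_hasDerivAt t h1
  obtain ⟨t, ht, e⟩ := exists_hasDerivAt_eq_slope _ _ (by norm_num : (0:ℝ) < 1)
    (fun t ht => (hder t ht).continuousAt.continuousWithinAt)
    (fun x hx => hder x ⟨hx.1.le, hx.2.le⟩)
  refine ⟨t, ht, ?_⟩
  rw [e]; simp

lemma OpData.radial (h : OpData p a0 a1 F f) (hp : 2 ≤ p) (η : E) (hη : η ≠ 0) (s : ℝ)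
    (hs : 0 < s) (hs1 : s ≤ 1) : F (s • η) - s ^ p * (⟪f η, η⟫ / p) = F η - ⟪f η, η⟫ / p := by
  rcases hs1.eq_or_lt with rfl | hs1
  · simp
  have hder : ∀ t : ℝ, 0 < t → HasDerivAt (fun t : ℝ => F (t • η) - t ^ p * (⟪f η, η⟫ / p)) 0 t := by
    intro t ht
    have h1 : HasDerivAt (fun t : ℝ => t • η) η t := by
      simpa using ((hasDerivAt_id t).smul_const η)
    have h2 := (h.grad (t • η) (smul_ne_zero ht.ne' hη)).comp_hasDerivAt t h1
    have h3 := (Real.hasDerivAt_rpow_const (x := t) (p := p) (Or.inl ht.ne')).mul_const (⟪f η, η⟫ / p)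
    have h5 : ⟪f (t • η), η⟫ - p * t ^ (p - 1) * (⟪f η, η⟫ / p) = 0 := by
      rw [h.hom t ht, inner_smul_left]
      have : p ≠ 0 := by linarith
      simp; field_simp; ring
    have h4 : HasDerivAt (fun t : ℝ => F (t • η) - t ^ p * (⟪f η, η⟫ / p))
      (⟪f (t • η), η⟫ - p * t ^ (p - 1) * (⟪f η, η⟫ / p)) t := h2.sub h3
    rwa [h5] at h4
  obtain ⟨t, ht, e⟩ := exists_hasDerivAt_eq_slope _ _ hs1
    (fun t ht => (hder t (hs.trans_le ht.1)).continuousAt.continuousWithinAt)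
    (fun x hx => hder x (hs.trans hx.1))
  have : 1 - s ≠ 0 := by linarith
  rw [eq_comm, div_eq_zero_iff] at e
  rcases e with e | e
  · simp at e; linarith
  · exact absurd e this

lemma OpData.nonneg (h : OpData p a0 a1 F f) (hp : 2 ≤ p) (h0 : 0 < a0)
    (hdim : ∀ a : E, ∃ w : E, w ∉ Submodule.span ℝ {a}) (a : E) : 0 ≤ ⟪f a, a⟫ := by
  have := h.mono hp h0 hdim a 0
  rw [h.zero, sub_zero, sub_zero] at this
  exact le_trans (by positivity) this

lemma OpData.potential (h : OpData p a0 a1 F f) (hp : 2 ≤ p) (h1 : 0 < a1)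
    (hdim : ∀ a : E, ∃ w : E, w ∉ Submodule.span ℝ {a}) (a b : E)
    (hs : (0 : E) ∉ segment ℝ a b) : F b - F a = ⟪f b, b⟫ / p - ⟪f a, a⟫ / p := by
  have ha : a ≠ 0 := fun e => hs (e ▸ left_mem_segment ℝ a b)
  have hb : b ≠ 0 := fun e => hs (e ▸ right_mem_segment ℝ a b)
  set K := a1 * (‖a‖ + ‖b‖ + ‖b - a‖) ^ (p - 2) * (‖a‖ + ‖b - a‖) * ‖b - a‖ +
    |⟪f b, b⟫ / p - ⟪f a, a⟫ / p| with hK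
  set D := (F b - ⟪f b, b⟫ / p) - (F a - ⟪f a, a⟫ / p) with hD
  have key : ∀ s : ℝ, 0 < s → s ≤ 1 → |D| ≤ s ^ p * K := by
    intro s hs0 hs1
    have ra := h.radial hp a ha s hs0 hs1
    have rb := h.radial hp b hb s hs0 hs1
    have hseg : (0 : E) ∉ segment ℝ (s • a) (s • b) := by
      rintro ⟨r, r', hr, hr', hrr, e⟩
      apply hs
      refine ⟨r, r', hr, hr', hrr, ?_⟩
      have : s • (r • a + r' • b) = 0 := by rw [← e]; module
      exact (smul_eq_zero.1 this).resolve_left hs0.ne'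
    obtain ⟨t, ht, e⟩ := h.mvt _ _ hseg
    have e2 : s • a + t • (s • b - s • a) = s • (a + t • (b - a)) := by module
    have e3 : s • b - s • a = s • (b - a) := by module
    rw [e2, e3, h.hom s hs0, inner_smul_left, inner_smul_right] at e
    simp only [conj_trivial] at e
    have e4 : s ^ (p - 1) * (s * ⟪f (a + t • (b - a)), b - a⟫) =
        s ^ p * ⟪f (a + t • (b - a)), b - a⟫ := by
      rw [← mul_assoc]
      congr 1
      nth_rw 2 [← Real.rpow_one s]
      rw [← Real.rpow_add hs0]; ring_nf
    rw [e4] at e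
    have e5 : D = s ^ p * (⟪f (a + t • (b - a)), b - a⟫ - (⟪f b, b⟫ / p - ⟪f a, a⟫ / p)) := by
      rw [hD, ← ra, ← rb]; linarith
    rw [e5, abs_mul, abs_of_pos (Real.rpow_pos_of_pos hs0 _)]
    gcongr
    refine (abs_sub _ _).trans ?_
    rw [hK]; gcongr
    refine (abs_real_inner_le_norm _ _).trans ?_
    gcongr
    have hl := h.lip hp h1 hdim (a + t • (b - a)) 0
    rw [h.zero, sub_zero, sub_zero, norm_zero, add_zero, ← mul_assoc] at hl
    have hn : ‖a + t • (b - a)‖ ≤ ‖a‖ + ‖b - a‖ := by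
      refine (norm_add_le _ _).trans ?_
      rw [norm_smul, Real.norm_of_nonneg ht.1.le]
      have := norm_nonneg (b - a)
      nlinarith [ht.2]
    refine hl.trans ?_
    gcongr
    linarith [norm_nonneg b]
  have hD0 : |D| ≤ 0 := by
    have ht : Tendsto (fun s : ℝ => s ^ p * K) (𝓝[>] 0) (𝓝 0) := by
      have h2 : Continuous fun s : ℝ => s ^ p * K :=
        (Continuous.rpow_const continuous_id fun _ => Or.inr (by linarith)).mul continuous_const
      have := (h2.tendsto 0).mono_left (nhdsWithin_le_nhds (s := Ioi 0))
      rwa [Real.zero_rpow (by linarith), zero_mul] at this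
    refine ge_of_tendsto ht ?_
    filter_upwards [Ioc_mem_nhdsGT (zero_lt_one (α := ℝ))] with s hs
    exact key s hs.1 hs.2
  have := abs_nonpos_iff.1 hD0
  rw [hD] at this; linarith

lemma OpData.conv (h : OpData p a0 a1 F f) (hp : 2 ≤ p) (h0 : 0 < a0) (h1 : 0 < a1)
    (hdim : ∀ a : E, ∃ w : E, w ∉ Submodule.span ℝ {a}) (a b : E) :
    ⟪f a, b - a⟫ ≤ ⟪f b, b⟫ / p - ⟪f a, a⟫ / p := by
  refine seg_extend hdim (fun a b => ⟪f a, b - a⟫) (fun a b => ⟪f b, b⟫ / p - ⟪f a, a⟫ / p)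
    ?_ ?_ ?_ a b
  · have := h.cont; fun_prop
  · have := h.cont; fun_prop
  intro a b hs
  rw [← h.potential hp h1 hdim a b hs]
  obtain ⟨t, ht, e⟩ := h.mvt a b hs
  rw [e]
  have := h.mono hp h0 hdim (a + t • (b - a)) a
  have h2 : 0 ≤ ⟪f (a + t • (b - a)) - f a, a + t • (b - a) - a⟫ := le_trans (by positivity) this
  rw [add_sub_cancel_left, inner_smul_right] at h2
  have h3 : 0 ≤ ⟪f (a + t • (b - a)) - f a, b - a⟫ := by
    by_contra hc
    push Not at hc
    nlinarith [ht.1]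
  rw [inner_sub_left] at h3
  linarith

end pointwise

section frozenof

lemma exists_not_span {N d : ℕ} (hd : 2 ≤ d) (hN : 1 ≤ N) (a : Mat N d) :
    ∃ w : Mat N d, w ∉ Submodule.span ℝ {a} := by
  by_contra h
  push Not at h
  have ht : Submodule.span ℝ {a} = ⊤ := Submodule.eq_top_iff'.2 h
  have h1 : Module.finrank ℝ (Submodule.span ℝ {a}) ≤ 1 := by
    simpa using finrank_span_le_card (R := ℝ) ({a} : Set (Mat N d))
  rw [ht, finrank_top, finrank_euclideanSpace] at h1
  simp at h1
  nlinarith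

/-- the ellipticity constant -/
def LamC (p a0 a1 : ℝ) : ℝ := 4 * 4 ^ (p - 2) / a0 + a1 + 1 / a0 + 1

lemma exists_inverse {d : ℕ} (a0 a1 : ℝ) (h0 : 0 < a0) (h1 : 0 < a1)
    (b : Matrix (Fin d) (Fin d) ℝ) (hsymm : ∀ i j, b i j = b j i)
    (hell : ∀ w : Ed d, a0 * ‖w‖ ^ 2 ≤ ∑ i, ∑ j, b i j * w i * w j ∧
      ∑ i, ∑ j, b i j * w i * w j ≤ a1 * ‖w‖ ^ 2) :
    ∃ Bm : Ed d →L[ℝ] Ed d, (∀ x i, x i = ∑ j, b i j * Bm x j) ∧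
      (∀ x y, ⟪Bm x, y⟫ = ⟪x, Bm y⟫) ∧ (∀ x, ‖x‖ ^ 2 ≤ a1 * ⟪Bm x, x⟫) ∧
      ∀ x, ‖Bm x‖ ≤ a0⁻¹ * ‖x‖ := by
  let T : Ed d →ₗ[ℝ] Ed d :=
    { toFun := fun x => WithLp.toLp 2 fun i => ∑ j, b i j * x j
      map_add' := fun x y => by
        ext i; simp [mul_add, Finset.sum_add_distrib]
      map_smul' := fun c x => by
        ext i; simp only [PiLp.smul_apply, smul_eq_mul, RingHom.id_apply, Finset.mul_sum]
        exact Finset.sum_congr rfl fun j _ => by ring }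
  have hT : ∀ x i, T x i = ∑ j, b i j * x j := fun x i => rfl
  have hTi : ∀ x y, ⟪T x, y⟫ = ∑ i, ∑ j, b i j * x j * y i := by
    intro x y
    rw [inner_mat]
    simp only [hT, Finset.sum_mul]
  have hTs : ∀ x y, ⟪T x, y⟫ = ⟪T y, x⟫ := by
    intro x y
    rw [hTi, hTi, Finset.sum_comm]
    refine Finset.sum_congr rfl fun i _ => Finset.sum_congr rfl fun j _ => ?_
    rw [hsymm]; ring
  have hTq : ∀ x, ⟪T x, x⟫ = ∑ i, ∑ j, b i j * x i * x j := by
    intro x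
    rw [hTi]
    refine Finset.sum_congr rfl fun i _ => Finset.sum_congr rfl fun j _ => by ring
  have hlow : ∀ x, a0 * ‖x‖ ^ 2 ≤ ⟪T x, x⟫ := fun x => (hTq x) ▸ (hell x).1
  have hup : ∀ x, ⟪T x, x⟫ ≤ a1 * ‖x‖ ^ 2 := fun x => (hTq x) ▸ (hell x).2
  have hinj : Function.Injective T := by
    rw [← LinearMap.ker_eq_bot, LinearMap.ker_eq_bot']
    intro x hx
    have := hlow x
    rw [hx, inner_zero_left] at this
    have h3 : ‖x‖ ^ 2 ≤ 0 := by
      by_contra hc; push Not at hc; nlinarith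
    have : ‖x‖ = 0 := by nlinarith [norm_nonneg x]
    exact norm_eq_zero.1 this
  let e := LinearEquiv.ofInjectiveEndo T hinj
  have he : ∀ x, T (e.symm x) = x := fun x => e.apply_symm_apply x
  refine ⟨LinearMap.toContinuousLinearMap (e.symm : Ed d →ₗ[ℝ] Ed d), ?_, ?_, ?_, ?_⟩
  · intro x i
    show x i = ∑ j, b i j * (e.symm x) j
    rw [← hT, he]
  · intro x y
    show ⟪e.symm x, y⟫ = ⟪x, e.symm y⟫
    conv_lhs => rw [← he y]
    rw [real_inner_comm, hTs, he]
  · intro x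
    show _ ≤ a1 * ⟪e.symm x, x⟫
    have := psd_bound T a1 h1 hTs (fun x => le_trans (by positivity) (hlow x)) hup (e.symm x)
    rw [he] at this
    rwa [real_inner_comm]
  · intro x
    show ‖e.symm x‖ ≤ _
    have := hlow (e.symm x)
    rw [he] at this
    have h2 := this.trans (real_inner_le_norm _ _)
    by_cases hz : ‖e.symm x‖ = 0
    · rw [hz]; positivity
    have hpos : 0 < ‖e.symm x‖ := lt_of_le_of_ne (norm_nonneg _) (Ne.symm hz)
    rw [inv_mul_eq_div, le_div_iff₀ h0]
    nlinarith

lemma frozen_of {d N : ℕ} (hd : 2 ≤ d) (hN : 1 ≤ N) (p a0 a1 : ℝ) (hp : 2 ≤ p)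
    (h0 : 0 < a0) (h1 : 0 < a1) (A : Mat N d → Mat N d)
    (F : Mat N d → ℝ) (f : Mat N d → Mat N d) (hcont : Continuous f)
    (hgrad : ∀ η : Mat N d, η ≠ 0 → HasGradientAt F (f η) η)
    (hasym : ∀ η : Mat N d, Filter.Tendsto (fun lam : ℝ => (lam ^ (p - 1))⁻¹ • A (lam • η))
        Filter.atTop (𝓝 (f η)))
    (hC2 : ContDiffOn ℝ 2 F {0}ᶜ ∧
      ∀ η : Mat N d, η ≠ 0 → ∀ ξ,
        a0 * ‖η‖ ^ (p - 2) * ‖ξ‖ ^ 2 ≤ iteratedFDeriv ℝ 2 F η ![ξ, ξ] ∧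
        iteratedFDeriv ℝ 2 F η ![ξ, ξ] ≤ a1 * ‖η‖ ^ (p - 2) * ‖ξ‖ ^ 2)
    (S : Mat N d → Matrix (Fin N) (Fin N) ℝ) (b : Matrix (Fin d) (Fin d) ℝ)
    (hSs : ∀ η a b, S η a b = S η b a)
    (hSe : ∀ η : Mat N d, η ≠ 0 → ∀ μ : En N,
      a0 * ‖η‖ ^ (p - 2) * ‖μ‖ ^ 2 ≤ ∑ a, ∑ b, S η a b * μ a * μ b ∧
      ∑ a, ∑ b, S η a b * μ a * μ b ≤ a1 * ‖η‖ ^ (p - 2) * ‖μ‖ ^ 2)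
    (hbs : ∀ i j, b i j = b j i)
    (hbe : ∀ w : Ed d, a0 * ‖w‖ ^ 2 ≤ ∑ i, ∑ j, b i j * w i * w j ∧
      ∑ i, ∑ j, b i j * w i * w j ≤ a1 * ‖w‖ ^ 2)
    (hsplit : ∀ (η : Mat N d) (a : Fin N) (i : Fin d),
      f η (a, i) = ∑ c : Fin N, ∑ j : Fin d, S η a c * b i j * η (c, j)) :
    ∃ Bm, Frozen p (LamC p a0 a1) f Bm := by
  obtain ⟨Bm, hB1, hB2, hB3, hB4⟩ := exists_inverse a0 a1 h0 h1 b hbs hbe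
  have hdim := exists_not_span (N := N) (d := d) hd hN
  have hz : f 0 = 0 := by
    ext q
    rw [hsplit 0 q.1 q.2]; simp
  have hop : OpData p a0 a1 F f := by
    refine ⟨hcont, hz, fun η hη => (hgrad η hη).hasFDerivAt, ?_, ?_⟩
    · intro t ht η
      have h2 := (hasym η).comp (tendsto_id.atTop_mul_const ht)
      have h3 := h2.const_smul (t ^ (p - 1))
      refine tendsto_nhds_unique (hasym (t • η)) (h3.congr' ?_)
      filter_upwards [eventually_gt_atTop 0] with lam hl
      simp only [Function.comp, id]
      rw [smul_smul, smul_smul, Real.mul_rpow hl.le ht.le, mul_inv]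
      congr 1
      have := (Real.rpow_pos_of_pos ht (p - 1)).ne'
      field_simp
    · intro η hη
      obtain ⟨L, hL1, hL2, hL3⟩ := hess_exists F f hgrad hC2.1 η hη
      refine ⟨L, hL1, fun x => ⟨by rw [hL3]; exact (hC2.2 η hη x).1, ?_⟩⟩
      have hpos : 0 < a1 * ‖η‖ ^ (p - 2) := by
        have := norm_pos_iff.2 hη; positivity
      have := psd_bound (L : Mat N d →ₗ[ℝ] Mat N d) (a1 * ‖η‖ ^ (p - 2)) hpos hL2
        (fun x => by
          show 0 ≤ ⟪L x, x⟫
          rw [hL3]; exact le_trans (by positivity) (hC2.2 η hη x).1)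
        (fun x => by
          show ⟪L x, x⟫ ≤ _
          rw [hL3]; exact (hC2.2 η hη x).2) x
      have h4 : ‖L x‖ ^ 2 ≤ (a1 * ‖η‖ ^ (p - 2) * ‖x‖) ^ 2 := by
        refine this.trans ?_
        have h5 : ⟪L x, x⟫ ≤ a1 * ‖η‖ ^ (p - 2) * ‖x‖ ^ 2 := by
          rw [hL3]; exact (hC2.2 η hη x).2
        refine (mul_le_mul_of_nonneg_left h5 hpos.le).trans (le_of_eq (by ring))
      exact (pow_le_pow_iff_left₀ (norm_nonneg _) (by positivity) two_ne_zero).1 h4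
  have hL1 : a1 ≤ LamC p a0 a1 := by
    unfold LamC
    have : 0 ≤ 4 * 4 ^ (p - 2) / a0 := by positivity
    have : 0 ≤ 1 / a0 := by positivity
    linarith
  have hL2 : a0⁻¹ ≤ LamC p a0 a1 := by
    unfold LamC
    have : 0 ≤ 4 * 4 ^ (p - 2) / a0 := by positivity
    rw [inv_eq_one_div]; linarith
  have hL3 : 4 * 4 ^ (p - 2) / a0 ≤ LamC p a0 a1 := by
    unfold LamC
    have : 0 ≤ 1 / a0 := by positivity
    linarith
  refine ⟨Bm, hcont, hz, ?_, ?_, hop.conv hp h0 h1 hdim, hB2, ?_, ?_, ?_⟩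
  · intro a b
    have h2 := hop.mono hp h0 hdim a b
    have h3 : 0 ≤ ⟪f a - f b, a - b⟫ := le_trans (by positivity) h2
    refine le_trans ?_ (mul_le_mul_of_nonneg_right hL3 h3)
    rw [Real.div_rpow (by positivity) (by norm_num)] at h2
    have h5 : (0:ℝ) < 4 ^ (p - 2) := by positivity
    refine le_trans (le_of_eq ?_) (mul_le_mul_of_nonneg_left h2 (by positivity))
    field_simp
  · intro a b
    exact (hop.lip hp h1 hdim a b).trans (mul_le_mul_of_nonneg_right hL1 (by positivity))
  · intro x
    refine (hB3 x).trans (mul_le_mul_of_nonneg_right hL1 ?_)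
    have := hB3 x
    by_contra hc; push Not at hc
    nlinarith [sq_nonneg ‖x‖]
  · intro x
    exact (hB4 x).trans (mul_le_mul_of_nonneg_right hL2 (norm_nonneg _))
  · intro η x w τ hτ
    by_cases hη : η = 0
    · rw [hη, hz, inner_zero_left, inner_zero_left]
      have : 0 ≤ LamC p a0 a1 := h1.le.trans hL1
      rw [mul_zero, mul_zero, zero_add]; positivity
    set m := app η x with hm
    have happ : ∀ a, app (f η) (Bm x) a = ∑ c, S η a c * m c := by
      intro a
      rw [app_apply]
      simp only [hsplit, hm, app_apply, Finset.sum_mul, Finset.mul_sum]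
      rw [Finset.sum_comm]
      refine Finset.sum_congr rfl fun c _ => ?_
      rw [Finset.sum_comm]
      refine Finset.sum_congr rfl fun j _ => ?_
      rw [hB1 x j, Finset.mul_sum, Finset.mul_sum]
      refine Finset.sum_congr rfl fun i _ => ?_
      rw [hbs j i]; ring
    have hin : ∀ w : En N, ⟪f η, tens w (Bm x)⟫ = ∑ a, ∑ c, S η a c * m c * w a := by
      intro w
      rw [inner_tens, inner_mat]
      simp only [happ, Finset.sum_mul]
    rw [hin w, hin m]
    have hq := (hSe η hη (m - τ • w)).1
    have hw := (hSe η hη w).2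
    have hq2 : 0 ≤ ∑ a, ∑ c, S η a c * (m - τ • w) a * (m - τ • w) c :=
      le_trans (by positivity) hq
    have hsw : ∑ a, ∑ c, S η a c * m a * w c = ∑ a, ∑ c, S η a c * m c * w a := by
      rw [Finset.sum_comm]
      refine Finset.sum_congr rfl fun a _ => Finset.sum_congr rfl fun c _ => ?_
      rw [hSs]
    have hmm : ∑ a, ∑ c, S η a c * m a * m c = ∑ a, ∑ c, S η a c * m c * m a :=
      Finset.sum_congr rfl fun a _ => Finset.sum_congr rfl fun c _ => by ring
    have hexp : ∑ a, ∑ c, S η a c * (m - τ • w) a * (m - τ • w) c =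
        ∑ a, ∑ c, S η a c * m c * m a - 2 * τ * ∑ a, ∑ c, S η a c * m c * w a +
          τ ^ 2 * ∑ a, ∑ c, S η a c * w a * w c := by
      have : ∑ a, ∑ c, S η a c * (m - τ • w) a * (m - τ • w) c =
          ∑ a, ∑ c, S η a c * m a * m c - τ * ∑ a, ∑ c, S η a c * m a * w c
          - τ * ∑ a, ∑ c, S η a c * m c * w a + τ ^ 2 * ∑ a, ∑ c, S η a c * w a * w c := by
        simp only [Finset.mul_sum, ← Finset.sum_sub_distrib, ← Finset.sum_add_distrib]
        refine Finset.sum_congr rfl fun a _ => Finset.sum_congr rfl fun c _ => ?_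
        simp; ring
      rw [this, hsw, hmm]; ring
    rw [hexp] at hq2
    have hw2 : ∑ a, ∑ c, S η a c * w a * w c ≤ LamC p a0 a1 * (‖η‖ ^ (p - 2) * ‖w‖ ^ 2) := by
      refine hw.trans ?_
      rw [mul_assoc]; gcongr
    have h6 : 2 * τ * ∑ a, ∑ c, S η a c * m c * w a ≤ ∑ a, ∑ c, S η a c * m c * m a
        + τ ^ 2 * (LamC p a0 a1 * (‖η‖ ^ (p - 2) * ‖w‖ ^ 2)) := by
      nlinarith [sq_nonneg τ]
    have h7 := mul_le_mul_of_nonneg_left h6 (inv_nonneg.2 hτ.le)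
    refine le_trans (le_of_eq ?_) (h7.trans (le_of_eq ?_))
    · field_simp
    · field_simp

lemma p_ge_two {d N : ℕ} (hd : 2 ≤ d) (hN : 1 ≤ N) (p a0 a1 : ℝ) (h0 : 0 < a0)
    (S : Mat N d → Matrix (Fin N) (Fin N) ℝ) (hS : Continuous S)
    (hSe : ∀ η : Mat N d, η ≠ 0 → ∀ μ : En N,
      a0 * ‖η‖ ^ (p - 2) * ‖μ‖ ^ 2 ≤ ∑ a, ∑ b, S η a b * μ a * μ b ∧
      ∑ a, ∑ b, S η a b * μ a * μ b ≤ a1 * ‖η‖ ^ (p - 2) * ‖μ‖ ^ 2) : 2 ≤ p ∧ a0 ≤ a1 := by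
  obtain ⟨η, hη⟩ : ∃ η : Mat N d, ‖η‖ = 1 :=
    ⟨EuclideanSpace.single (⟨0, by omega⟩, ⟨0, by omega⟩) 1, by simp⟩
  obtain ⟨μ, hμ⟩ : ∃ μ : En N, ‖μ‖ = 1 := ⟨EuclideanSpace.single ⟨0, by omega⟩ 1, by simp⟩
  have hη0 : η ≠ 0 := by rw [← norm_pos_iff, hη]; norm_num
  constructor
  · by_contra hp
    push Not at hp
    obtain ⟨Z, hZd⟩ : ∃ Z : ℝ → ℝ, ∀ t, Z t = ∑ a, ∑ b, S (t • η) a b * μ a * μ b := ⟨_, fun _ => rfl⟩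
    have hZ : Continuous Z := by
      have h1 : Continuous fun t : ℝ => t • η := by fun_prop
      have : Continuous fun t : ℝ => S (t • η) := hS.comp h1
      rw [funext hZd]
      refine continuous_finsetSum _ fun a _ => continuous_finsetSum _ fun b _ => ?_
      have h2 : Continuous fun t : ℝ => S (t • η) a b := (continuous_apply_apply a b).comp this
      exact (h2.mul continuous_const).mul continuous_const
    have h1 : ∀ t : ℝ, 0 < t → a0 * t ^ (p - 2) ≤ Z t := by
      intro t ht
      have := (hSe (t • η) (smul_ne_zero ht.ne' hη0) μ).1
      rw [norm_smul, hη, hμ, Real.norm_of_nonneg ht.le] at this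
      rw [hZd]; simpa using this
    have h2 : Tendsto (fun t : ℝ => a0 * t ^ (p - 2)) (𝓝[>] 0) atTop :=
      (tendsto_rpow_neg_nhdsGT_zero (by linarith)).const_mul_atTop h0
    have h3 : Tendsto Z (𝓝[>] 0) atTop := by
      refine tendsto_atTop_mono' _ ?_ h2
      filter_upwards [self_mem_nhdsWithin] with t ht using h1 t ht
    exact not_tendsto_atTop_of_tendsto_nhds ((hZ.tendsto 0).mono_left nhdsWithin_le_nhds) h3
  · have := hSe η hη0 μ
    rw [hη, hμ] at this
    simp only [Real.one_rpow] at this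
    linarith [this.1, this.2]

end frozenof

section lptools

/-- exponent -/
abbrev PP (p : ℝ) : ℝ≥0∞ := ENNReal.ofReal p

lemma PP_ne_top {p : ℝ} : PP p ≠ ⊤ := ENNReal.ofReal_ne_top
lemma PP_ne_zero {p : ℝ} (hp : 2 ≤ p) : PP p ≠ 0 := by
  simp [PP]; linarith
lemma PP_toReal {p : ℝ} (hp : 2 ≤ p) : (PP p).toReal = p := ENNReal.toReal_ofReal (by linarith)
lemma one_le_PP {p : ℝ} (hp : 2 ≤ p) : 1 ≤ PP p := by
  rw [PP, ← ENNReal.ofReal_one]; exact ENNReal.ofReal_le_ofReal (by linarith)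

variable {X E E' : Type*} [MeasurableSpace X] {μ : Measure X}
  [NormedAddCommGroup E] [NormedAddCommGroup E']

lemma memLp_int {p : ℝ} (hp : 2 ≤ p) {f : X → E} (hf : MemLp f (PP p) μ) :
    Integrable (fun x => ‖f x‖ ^ p) μ := by
  have := hf.integrable_norm_rpow (PP_ne_zero hp) PP_ne_top
  rwa [PP_toReal hp] at this

lemma memLp_of_int {p : ℝ} (hp : 2 ≤ p) {f : X → E} (hm : AEStronglyMeasurable f μ)
    (hf : Integrable (fun x => ‖f x‖ ^ p) μ) : MemLp f (PP p) μ := by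
  refine (integrable_norm_rpow_iff hm (PP_ne_zero hp) PP_ne_top).1 ?_
  rwa [PP_toReal hp]

lemma eLpNorm_eq_int {p : ℝ} (hp : 2 ≤ p) {f : X → E} (hf : MemLp f (PP p) μ) :
    eLpNorm f (PP p) μ = ENNReal.ofReal ((∫ x, ‖f x‖ ^ p ∂μ) ^ (p⁻¹)) := by
  rw [hf.eLpNorm_eq_integral_rpow_norm (PP_ne_zero hp) PP_ne_top, PP_toReal hp]

lemma intp_nonneg (p : ℝ) (f : X → E) : 0 ≤ ∫ x, ‖f x‖ ^ p ∂μ :=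
  integral_nonneg fun x => Real.rpow_nonneg (norm_nonneg _) _

/-- `L^p` convergence of a sequence. -/
structure LimP (p : ℝ) (μ : Measure X) (φ : ℕ → X → E) (u : X → E) : Prop where
  memu : MemLp u (PP p) μ
  mem : ∀ k, MemLp (φ k) (PP p) μ
  lim : Tendsto (fun k => eLpNorm (φ k - u) (PP p) μ) atTop (𝓝 0)

lemma LimP.int {p : ℝ} (hp : 2 ≤ p) {φ : ℕ → X → E} {u : X → E} (h : LimP p μ φ u) :
    Tendsto (fun k => ∫ x, ‖φ k x - u x‖ ^ p ∂μ) atTop (𝓝 0) := by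
  have h1 := h.lim
  have h2 : ∀ k, ∫ x, ‖φ k x - u x‖ ^ p ∂μ = (eLpNorm (φ k - u) (PP p) μ).toReal ^ p := by
    intro k
    rw [eLpNorm_eq_int hp ((h.mem k).sub h.memu), ENNReal.toReal_ofReal (by
      exact Real.rpow_nonneg (intp_nonneg _ _) _), Real.rpow_inv_rpow (intp_nonneg _ _) (by linarith)]
    rfl
  have h3 := (ENNReal.tendsto_toReal ENNReal.zero_ne_top).comp h1
  have h4 := h3.rpow_const (p := p) (Or.inr (by linarith))
  rw [ENNReal.toReal_zero, Real.zero_rpow (by linarith)] at h4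
  exact h4.congr fun k => (h2 k).symm

lemma LimP.of_int {p : ℝ} (hp : 2 ≤ p) {φ : ℕ → X → E} {u : X → E} (hu : MemLp u (PP p) μ)
    (hφ : ∀ k, MemLp (φ k) (PP p) μ)
    (h : Tendsto (fun k => ∫ x, ‖φ k x - u x‖ ^ p ∂μ) atTop (𝓝 0)) : LimP p μ φ u := by
  refine ⟨hu, hφ, ?_⟩
  have h4 := h.rpow_const (p := p⁻¹) (Or.inr (by positivity))
  rw [Real.zero_rpow (by positivity)] at h4
  have h5 := ENNReal.tendsto_ofReal h4
  rw [ENNReal.ofReal_zero] at h5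
  refine h5.congr fun k => ?_
  rw [eLpNorm_eq_int hp ((hφ k).sub hu)]; rfl

lemma LimP.add {p : ℝ} (hp : 2 ≤ p) {φ ψ : ℕ → X → E} {u v : X → E} (h : LimP p μ φ u)
    (h' : LimP p μ ψ v) : LimP p μ (fun k x => φ k x + ψ k x) (fun x => u x + v x) := by
  refine ⟨h.memu.add h'.memu, fun k => (h.mem k).add (h'.mem k), ?_⟩
  have h3 := h.lim.add h'.lim
  rw [add_zero] at h3
  refine tendsto_of_tendsto_of_tendsto_of_le_of_le tendsto_const_nhds h3 (fun _ => zero_le) fun k => ?_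
  have : (fun x => φ k x + ψ k x) - (fun x => u x + v x) = (φ k - u) + (ψ k - v) := by
    ext x; simp; abel
  simp only
  rw [this]
  exact eLpNorm_add_le ((h.mem k).sub h.memu).1 ((h'.mem k).sub h'.memu).1 (one_le_PP hp)

lemma LimP.neg {p : ℝ} {φ : ℕ → X → E} {u : X → E} (h : LimP p μ φ u) :
    LimP p μ (fun k x => - φ k x) (fun x => - u x) := by
  refine ⟨h.memu.neg, fun k => (h.mem k).neg, h.lim.congr fun k => ?_⟩
  rw [← eLpNorm_neg]; congr 1; ext x; simp; abel

lemma LimP.sub {p : ℝ} (hp : 2 ≤ p) {φ ψ : ℕ → X → E} {u v : X → E} (h : LimP p μ φ u)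
    (h' : LimP p μ ψ v) : LimP p μ (fun k x => φ k x - ψ k x) (fun x => u x - v x) := by
  simp only [sub_eq_add_neg]
  exact h.add hp h'.neg

lemma LimP.const {p : ℝ} {u : X → E} (h : MemLp u (PP p) μ) : LimP p μ (fun _ => u) u :=
  ⟨h, fun _ => h, by simp⟩

lemma LimP.lipmap {p : ℝ} {φ : ℕ → X → E} {u : X → E} (h : LimP p μ φ u)
    (T : X → E → E') (C : ℝ) (hT : ∀ k, AEStronglyMeasurable (fun x => T x (φ k x)) μ)
    (hTu : AEStronglyMeasurable (fun x => T x (u x)) μ)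
    (h0 : ∀ᵐ x ∂μ, ∀ a, ‖T x a‖ ≤ C * ‖a‖)
    (h1 : ∀ᵐ x ∂μ, ∀ a b, ‖T x a - T x b‖ ≤ C * ‖a - b‖) :
    LimP p μ (fun k x => T x (φ k x)) (fun x => T x (u x)) := by
  refine ⟨h.memu.of_le_mul hTu (h0.mono fun x hx => hx _),
    fun k => (h.mem k).of_le_mul (hT k) (h0.mono fun x hx => hx _), ?_⟩
  have h3 := ENNReal.Tendsto.const_mul h.lim (Or.inr (ENNReal.ofReal_ne_top (r := C)))
  rw [mul_zero] at h3
  refine tendsto_of_tendsto_of_tendsto_of_le_of_le tendsto_const_nhds h3 (fun _ => zero_le) fun k => ?_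
  refine eLpNorm_le_mul_eLpNorm_of_ae_le_mul (h1.mono fun x hx => ?_) _
  simpa using hx (φ k x) (u x)

lemma LimP.mono_measure {p : ℝ} {φ : ℕ → X → E} {u : X → E} (h : LimP p μ φ u) {ν : Measure X}
    (hν : ν ≤ μ) : LimP p ν φ u :=
  ⟨h.memu.mono_measure hν, fun k => (h.mem k).mono_measure hν,
    tendsto_of_tendsto_of_tendsto_of_le_of_le tendsto_const_nhds h.lim (fun _ => zero_le)
      fun _ => eLpNorm_mono_measure _ hν⟩

lemma LimP.congr_fun {p : ℝ} {φ ψ : ℕ → X → E} {u v : X → E} (h : LimP p μ φ u)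
    (h1 : ∀ k, φ k =ᵐ[μ] ψ k) (h2 : u =ᵐ[μ] v) : LimP p μ ψ v := by
  refine ⟨h.memu.ae_eq h2, fun k => (h.mem k).ae_eq (h1 k), h.lim.congr fun k => ?_⟩
  exact eLpNorm_congr_ae ((h1 k).sub h2)

lemma LimP.comp_mp {p : ℝ} {φ : ℕ → X → E} {u : X → E} (h : LimP p μ φ u) {Y : Type*}
    [MeasurableSpace Y] {ν : Measure Y} {T : Y → X} (hT : MeasurePreserving T ν μ) :
    LimP p ν (fun k y => φ k (T y)) (fun y => u (T y)) := by
  refine ⟨h.memu.comp_measurePreserving hT, fun k => (h.mem k).comp_measurePreserving hT,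
    h.lim.congr fun k => ?_⟩
  exact (eLpNorm_comp_measurePreserving ((h.mem k).sub h.memu).1 hT).symm

lemma LimP.norm_int {p : ℝ} (hp : 2 ≤ p) {φ : ℕ → X → E} {u : X → E} (h : LimP p μ φ u) :
    Tendsto (fun k => ∫ x, ‖φ k x‖ ^ p ∂μ) atTop (𝓝 (∫ x, ‖u x‖ ^ p ∂μ)) := by
  have key : Tendsto (fun k => eLpNorm (φ k) (PP p) μ) atTop (𝓝 (eLpNorm u (PP p) μ)) := by
    have hl : Tendsto (fun k => eLpNorm u (PP p) μ - eLpNorm (φ k - u) (PP p) μ) atTop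
        (𝓝 (eLpNorm u (PP p) μ)) := by
      have := ENNReal.Tendsto.sub (tendsto_const_nhds (x := eLpNorm u (PP p) μ)) h.lim
        (Or.inl h.memu.2.ne)
      rwa [tsub_zero] at this
    have hr : Tendsto (fun k => eLpNorm u (PP p) μ + eLpNorm (φ k - u) (PP p) μ) atTop
        (𝓝 (eLpNorm u (PP p) μ)) := by
      have := (tendsto_const_nhds (x := eLpNorm u (PP p) μ)).add h.lim
      rwa [add_zero] at this
    refine tendsto_of_tendsto_of_tendsto_of_le_of_le hl hr (fun k => ?_) (fun k => ?_)
    · simp only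
      rw [tsub_le_iff_right]
      have : u = φ k - (φ k - u) := by abel
      conv_lhs => rw [this]
      exact eLpNorm_sub_le (h.mem k).1 ((h.mem k).sub h.memu).1 (one_le_PP hp)
    · have : φ k = u + (φ k - u) := by abel
      conv_lhs => rw [this]
      exact eLpNorm_add_le h.memu.1 ((h.mem k).sub h.memu).1 (one_le_PP hp)
  have h2 : ∀ w : X → E, MemLp w (PP p) μ →
      ∫ x, ‖w x‖ ^ p ∂μ = (eLpNorm w (PP p) μ).toReal ^ p := by
    intro w hw
    rw [eLpNorm_eq_int hp hw, ENNReal.toReal_ofReal (by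
      exact Real.rpow_nonneg (intp_nonneg _ _) _), Real.rpow_inv_rpow (intp_nonneg _ _) (by linarith)]
  have h3 := (ENNReal.tendsto_toReal h.memu.2.ne).comp key
  have h4 := h3.rpow_const (p := p) (Or.inr (by linarith))
  rw [← h2 u h.memu] at h4
  exact h4.congr fun k => (h2 _ (h.mem k)).symm

lemma young3 {p a b c : ℝ} (hp : 2 ≤ p) (ha : 0 ≤ a) (hb : 0 ≤ b) (hc : 0 ≤ c) :
    a ^ (p - 2) * b * c ≤ a ^ p + b ^ p + c ^ p := by
  obtain ⟨m, hm⟩ : ∃ m, m = max a (max b c) := ⟨_, rfl⟩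
  have ham : a ≤ m := hm ▸ le_max_left _ _
  have hbm : b ≤ m := hm ▸ (le_max_left _ _).trans (le_max_right _ _)
  have hcm : c ≤ m := hm ▸ (le_max_right _ _).trans (le_max_right _ _)
  have hm0 : 0 ≤ m := ha.trans ham
  have h1 : a ^ (p - 2) * b * c ≤ m ^ (p - 2) * m * m := by
    have := Real.rpow_le_rpow ha ham (by linarith : 0 ≤ p - 2)
    gcongr
  have h2 : m ^ (p - 2) * m * m ≤ m ^ p := by
    rcases hm0.eq_or_lt with h | h
    · rw [← h]; simp; exact Real.rpow_nonneg le_rfl _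
    · rw [mul_assoc, ← sq, ← Real.rpow_two, ← Real.rpow_add h]; simp
  have h3 : m ^ p ≤ a ^ p + b ^ p + c ^ p := by
    have := Real.rpow_nonneg ha p
    have := Real.rpow_nonneg hb p
    have := Real.rpow_nonneg hc p
    rw [hm]
    rcases max_choice a (max b c) with h | h
    · rw [h]; linarith
    · rw [h]
      rcases max_choice b c with h | h
      · rw [h]; linarith
      · rw [h]; linarith
  linarith

lemma young2 {p a b : ℝ} (hp : 2 ≤ p) (ha : 0 ≤ a) (hb : 0 ≤ b) :
    a ^ (p - 1) * b ≤ a ^ p + b ^ p := by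
  obtain ⟨m, hm⟩ : ∃ m, m = max a b := ⟨_, rfl⟩
  have ham : a ≤ m := hm ▸ le_max_left _ _
  have hbm : b ≤ m := hm ▸ le_max_right _ _
  have hm0 : 0 ≤ m := ha.trans ham
  have h1 : a ^ (p - 1) * b ≤ m ^ (p - 1) * m := by
    have := Real.rpow_le_rpow ha ham (by linarith : 0 ≤ p - 1)
    gcongr
  have h2 : m ^ (p - 1) * m ≤ m ^ p := by
    rcases hm0.eq_or_lt with h | h
    · rw [← h]; simp; exact Real.rpow_nonneg le_rfl _
    · rw [← Real.rpow_add_one h.ne']; simp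
  have h3 : m ^ p ≤ a ^ p + b ^ p := by
    have := Real.rpow_nonneg ha p
    have := Real.rpow_nonneg hb p
    rw [hm]
    rcases max_choice a b with h | h <;> rw [h] <;> linarith
  linarith

lemma add_rpow_le {p a b : ℝ} (hp : 2 ≤ p) (ha : 0 ≤ a) (hb : 0 ≤ b) :
    (a + b) ^ p ≤ 2 ^ p * (a ^ p + b ^ p) := by
  obtain ⟨m, hm⟩ : ∃ m, m = max a b := ⟨_, rfl⟩
  have ham : a ≤ m := hm ▸ le_max_left _ _
  have hbm : b ≤ m := hm ▸ le_max_right _ _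
  have hm0 : 0 ≤ m := ha.trans ham
  have h1 : (a + b) ^ p ≤ (2 * m) ^ p :=
    Real.rpow_le_rpow (by positivity) (by linarith) (by linarith)
  rw [Real.mul_rpow (by norm_num) hm0] at h1
  have h3 : m ^ p ≤ a ^ p + b ^ p := by
    have := Real.rpow_nonneg ha p
    have := Real.rpow_nonneg hb p
    rw [hm]
    rcases max_choice a b with h | h <;> rw [h] <;> linarith
  exact h1.trans (by gcongr)

end lptools

section lpinner

variable {X E : Type*} [MeasurableSpace X] {μ : Measure X}
  [NormedAddCommGroup E] [InnerProductSpace ℝ E]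

/-- dual exponent -/
abbrev QQ (p : ℝ) : ℝ≥0∞ := ENNReal.ofReal (p / (p - 1))

lemma dual_int {p : ℝ} (hp : 2 ≤ p) {f : X → E} (hf : MemLp f (QQ p) μ) :
    Integrable (fun x => ‖f x‖ ^ (p / (p - 1))) μ := by
  have h : 0 < p / (p - 1) := div_pos (by linarith) (by linarith)
  have := hf.integrable_norm_rpow (by simp [QQ, h]) ENNReal.ofReal_ne_top
  rwa [ENNReal.toReal_ofReal h.le] at this

lemma dual_young {p a b : ℝ} (hp : 2 ≤ p) (ha : 0 ≤ a) (hb : 0 ≤ b) :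
    a * b ≤ a ^ (p / (p - 1)) + b ^ p := by
  have := young2 hp (Real.rpow_nonneg ha (1 / (p - 1))) hb
  rw [← Real.rpow_mul ha, ← Real.rpow_mul ha] at this
  have h1 : 1 / (p - 1) * (p - 1) = 1 := by
    have : p - 1 ≠ 0 := by linarith
    field_simp
  rwa [h1, Real.rpow_one, one_div_mul_eq_div] at this

lemma dual_integrable {p : ℝ} (hp : 2 ≤ p) {f g : X → E} (hf : MemLp f (QQ p) μ)
    (hg : MemLp g (PP p) μ) : Integrable (fun x => ⟪f x, g x⟫) μ := by
  refine ((dual_int hp hf).add (memLp_int hp hg)).mono' (hf.1.inner hg.1)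
    (Eventually.of_forall fun x => ?_)
  exact (norm_inner_le_norm _ _).trans (dual_young hp (norm_nonneg _) (norm_nonneg _))

lemma dual_conv {p : ℝ} (hp : 2 ≤ p) : (p / (p - 1)).HolderConjugate p := by
  rw [Real.holderConjugate_comm]
  exact Real.HolderConjugate.conjExponent (by linarith)

lemma dual_bound {p : ℝ} (hp : 2 ≤ p) {f g : X → E} (hf : MemLp f (QQ p) μ)
    (hg : MemLp g (PP p) μ) : |∫ x, ⟪f x, g x⟫ ∂μ| ≤
      (∫ x, ‖f x‖ ^ (p / (p - 1)) ∂μ) ^ (1 / (p / (p - 1))) * (∫ x, ‖g x‖ ^ p ∂μ) ^ (1 / p) := by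
  have h1 := integral_mul_le_Lp_mul_Lq_of_nonneg (μ := μ) (dual_conv hp)
    (f := fun x => ‖f x‖) (g := fun x => ‖g x‖) (Eventually.of_forall fun _ => norm_nonneg _)
    (Eventually.of_forall fun _ => norm_nonneg _) hf.norm hg.norm
  refine le_trans ?_ h1
  rw [← Real.norm_eq_abs]
  refine (norm_integral_le_integral_norm _).trans (integral_mono_of_nonneg
    (Eventually.of_forall fun _ => norm_nonneg _) ?_ (Eventually.of_forall fun x => norm_inner_le_norm _ _))
  refine ((dual_int hp hf).add (memLp_int hp hg)).mono' (hf.1.norm.mul hg.1.norm)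
    (Eventually.of_forall fun x => ?_)
  rw [Real.norm_of_nonneg (by positivity)]
  exact dual_young hp (norm_nonneg _) (norm_nonneg _)

lemma LimP.pair {p : ℝ} (hp : 2 ≤ p) {f : X → E} (hf : MemLp f (QQ p) μ) {φ : ℕ → X → E}
    {u : X → E} (h : LimP p μ φ u) :
    Tendsto (fun k => ∫ x, ⟪f x, φ k x⟫ ∂μ) atTop (𝓝 (∫ x, ⟪f x, u x⟫ ∂μ)) := by
  rw [tendsto_iff_norm_sub_tendsto_zero]
  have h1 := (h.int hp).rpow_const (p := 1 / p) (Or.inr (by positivity))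
  rw [Real.zero_rpow (by positivity)] at h1
  have h2 := h1.const_mul ((∫ x, ‖f x‖ ^ (p / (p - 1)) ∂μ) ^ (1 / (p / (p - 1))))
  rw [mul_zero] at h2
  refine tendsto_of_tendsto_of_tendsto_of_le_of_le tendsto_const_nhds h2 (fun _ => norm_nonneg _)
    fun k => ?_
  have h3 := dual_bound hp hf ((h.mem k).sub h.memu)
  simp only
  rw [← integral_sub (dual_integrable hp hf (h.mem k)) (dual_integrable hp hf h.memu),
    Real.norm_eq_abs]
  simp only [← inner_sub_right]
  exact h3

end lpinner

section smooth

variable {d N : ℕ}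

/-- gradient vector of a scalar function -/
def gr (η : Ed d → ℝ) (x : Ed d) : Ed d := WithLp.toLp 2 fun i => pder η i x

lemma gr_apply (η : Ed d → ℝ) (x : Ed d) (i : Fin d) : gr η x i = pder η i x := rfl

lemma clGrad_apply (φ : Ed d → En N) (x : Ed d) (q : Fin N × Fin d) :
    clGrad φ x q = fderiv ℝ φ x (EuclideanSpace.single q.2 1) q.1 := rfl

lemma ed_sum (h : Ed d) : h = ∑ j, h j • EuclideanSpace.single j (1:ℝ) := by
  ext i
  simp [Pi.single_apply]

lemma fderiv_eq_app (φ : Ed d → En N) (x h : Ed d) : fderiv ℝ φ x h = app (clGrad φ x) h := by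
  conv_lhs => rw [ed_sum h]
  rw [map_sum]
  ext a
  simp only [map_smul, app_apply, clGrad_apply, smul_eq_mul,
    WithLp.ofLp_sum, Finset.sum_apply, WithLp.ofLp_smul, Pi.smul_apply]
  exact Finset.sum_congr rfl fun j _ => mul_comm _ _

lemma fderiv_eq_gr (η : Ed d → ℝ) (x h : Ed d) : fderiv ℝ η x h = ⟪gr η x, h⟫ := by
  conv_lhs => rw [ed_sum h]
  rw [map_sum, inner_mat]
  refine Finset.sum_congr rfl fun j _ => ?_
  rw [map_smul, smul_eq_mul, mul_comm]; rfl

lemma norm_gr_le (η : Ed d → ℝ) (x : Ed d) : ‖gr η x‖ ≤ ‖fderiv ℝ η x‖ := by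
  have h1 : ‖gr η x‖ ^ 2 ≤ ‖fderiv ℝ η x‖ * ‖gr η x‖ := by
    rw [← real_inner_self_eq_norm_sq, ← fderiv_eq_gr]
    exact (le_abs_self _).trans ((fderiv ℝ η x).le_opNorm _)
  by_cases h0 : ‖gr η x‖ = 0
  · rw [h0]; positivity
  · have : 0 < ‖gr η x‖ := lt_of_le_of_ne (norm_nonneg _) (Ne.symm h0)
    nlinarith

/-- `clGrad` as a continuous linear image of the derivative. -/
def gradL (d N : ℕ) : (Ed d →L[ℝ] En N) →ₗ[ℝ] Mat N d where
  toFun L := WithLp.toLp 2 fun q => L (EuclideanSpace.single q.2 1) q.1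
  map_add' a b := by ext q; simp
  map_smul' c a := by ext q; simp

lemma clGrad_eq (φ : Ed d → En N) (x : Ed d) : clGrad φ x = gradL d N (fderiv ℝ φ x) := rfl

lemma clGrad_cont {φ : Ed d → En N} (h : ContDiff ℝ (⊤ : ℕ∞) φ) : Continuous (clGrad φ) := by
  have h1 : Continuous (gradL d N) := LinearMap.continuous_of_finiteDimensional _
  exact h1.comp (h.continuous_fderiv (by simp))

lemma gr_cont {η : Ed d → ℝ} (h : ContDiff ℝ (⊤ : ℕ∞) η) : Continuous (gr η) := by
  have h1 := h.continuous_fderiv (by simp)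
  refine (PiLp.continuous_toLp 2 _).comp (continuous_pi fun i => ?_)
  exact h1.clm_apply continuous_const

lemma clGrad_sub {φ ψ : Ed d → En N} (h : ContDiff ℝ (⊤ : ℕ∞) φ) (h' : ContDiff ℝ (⊤ : ℕ∞) ψ)
    (x : Ed d) : clGrad (fun y => φ y - ψ y) x = clGrad φ x - clGrad ψ x := by
  rw [clGrad_eq, clGrad_eq, clGrad_eq, ← map_sub]
  congr 1
  exact fderiv_fun_sub (h.differentiable (by simp) x) (h'.differentiable (by simp) x)

lemma clGrad_add {φ ψ : Ed d → En N} (h : ContDiff ℝ (⊤ : ℕ∞) φ) (h' : ContDiff ℝ (⊤ : ℕ∞) ψ)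
    (x : Ed d) : clGrad (fun y => φ y + ψ y) x = clGrad φ x + clGrad ψ x := by
  rw [clGrad_eq, clGrad_eq, clGrad_eq, ← map_add]
  congr 1
  exact fderiv_fun_add (h.differentiable (by simp) x) (h'.differentiable (by simp) x)

lemma clGrad_const_smul (c : ℝ) {φ : Ed d → En N} (h : ContDiff ℝ (⊤ : ℕ∞) φ)
    (x : Ed d) : clGrad (fun y => c • φ y) x = c • clGrad φ x := by
  rw [clGrad_eq, clGrad_eq, ← map_smul]
  congr 1
  exact fderiv_fun_const_smul (h.differentiable (by simp) x) c

lemma clGrad_const (c : En N) (x : Ed d) : clGrad (fun _ : Ed d => c) x = 0 := by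
  rw [clGrad_eq]; simp

lemma clGrad_shift (φ : Ed d → En N) (h x : Ed d) :
    clGrad (fun y => φ (y + h)) x = clGrad φ (x + h) := by
  rw [clGrad_eq, clGrad_eq, fderiv_comp_add_right]

lemma clGrad_smul {η : Ed d → ℝ} {φ : Ed d → En N} (h : ContDiff ℝ (⊤ : ℕ∞) η)
    (h' : ContDiff ℝ (⊤ : ℕ∞) φ) (x : Ed d) :
    clGrad (fun y => η y • φ y) x = η x • clGrad φ x + tens (φ x) (gr η x) := by
  have h1 := fderiv_fun_smul (h.differentiable (by simp) x) (h'.differentiable (by simp) x)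
  ext q
  rw [clGrad_apply, h1]
  simp only [PiLp.add_apply, PiLp.smul_apply, tens_apply, clGrad_apply, gr_apply, pder]
  simp [mul_comm]

lemma clGrad_tsupport (φ : Ed d → En N) {x : Ed d} (hx : x ∉ tsupport φ) : clGrad φ x = 0 := by
  rw [clGrad_eq, image_eq_zero_of_notMem_tsupport (fun h => hx (tsupport_fderiv_subset ℝ h)), map_zero]

lemma gr_tsupport (φ : Ed d → ℝ) {x : Ed d} (hx : x ∉ tsupport φ) : gr φ x = 0 := by
  have := image_eq_zero_of_notMem_tsupport (fun h => hx (tsupport_fderiv_subset ℝ h)) (f := fderiv ℝ φ)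
  ext i
  simp [gr_apply, pder, this]

lemma norm_sub_le_lint {φ : Ed d → En N} (hφ : ContDiff ℝ (⊤ : ℕ∞) φ) (x h : Ed d) :
    ‖φ (x + h) - φ x‖ₑ ≤ ∫⁻ t in Icc (0:ℝ) 1, ‖h‖ₑ * ‖clGrad φ (x + t • h)‖ₑ := by
  have hd : ∀ t : ℝ, HasDerivAt (fun t : ℝ => φ (x + t • h)) (app (clGrad φ (x + t • h)) h) t := by
    intro t
    rw [← fderiv_eq_app]
    have h1 := (hφ.differentiable (by simp) (x + t • h)).hasFDerivAt
    have h2 : HasDerivAt (fun t : ℝ => x + t • h) h t := by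
      simpa using ((hasDerivAt_id t).smul_const h).const_add x
    exact h1.comp_hasDerivAt t h2
  have hc : Continuous fun t : ℝ => app (clGrad φ (x + t • h)) h := by
    simp only [← fderiv_eq_app]
    have := hφ.continuous_fderiv (by simp)
    fun_prop
  have h1 := intervalIntegral.integral_eq_sub_of_hasDerivAt (fun t _ => hd t)
    (hc.intervalIntegrable 0 1)
  simp only [one_smul, zero_smul, add_zero] at h1
  rw [← h1, intervalIntegral.integral_of_le zero_le_one, integral_Icc_eq_integral_Ioc.symm]
  refine (enorm_integral_le_lintegral_enorm _).trans (lintegral_mono fun t => ?_)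
  rw [← ofReal_norm, ← ofReal_norm, ← ofReal_norm, ← ENNReal.ofReal_mul (norm_nonneg _)]
  refine ENNReal.ofReal_le_ofReal ((norm_app_le _ _).trans (le_of_eq (mul_comm _ _)))

lemma lint_jensen {X : Type*} [MeasurableSpace X] {μ : Measure X} [IsProbabilityMeasure μ] {p : ℝ}
    (hp : 2 ≤ p) {f : X → ℝ≥0∞} (hf : AEMeasurable f μ) :
    (∫⁻ x, f x ∂μ) ^ p ≤ ∫⁻ x, f x ^ p ∂μ := by
  have h := ENNReal.lintegral_mul_le_Lp_mul_Lq μ (dual_conv hp).symm hf (aemeasurable_const (b := 1))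
  simp only [Pi.mul_apply, mul_one, ENNReal.one_rpow, lintegral_const, measure_univ] at h
  rw [one_div] at h
  have := ENNReal.rpow_le_rpow h (by linarith : 0 ≤ p)
  rwa [ENNReal.rpow_inv_rpow (by linarith)] at this

lemma shift_lint_le {r s : ℝ} {z h : Ed d} (hs : s + ‖h‖ ≤ r) {F : Ed d → ℝ≥0∞} :
    ∫⁻ x in ball z s, F (x + h) ≤ ∫⁻ x in ball z r, F x := by
  have h1 : MeasurePreserving (fun x : Ed d => x + h) volume volume :=
    measurePreserving_add_right volume h
  have h2 := h1.restrict_preimage_emb (measurableEmbedding_addRight h) (ball z r)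
  rw [← h2.lintegral_comp_emb (measurableEmbedding_addRight h)]
  refine lintegral_mono_set fun x hx => ?_
  simp only [mem_preimage, mem_ball] at hx ⊢
  calc dist (x + h) z ≤ dist (x + h) x + dist x z := dist_triangle _ _ _
    _ < r := by
      rw [dist_eq_norm (x + h) x, add_sub_cancel_left]; linarith

lemma W1_smooth {p : ℝ} (hp : 2 ≤ p) {φ : Ed d → En N} (hφ : ContDiff ℝ (⊤ : ℕ∞) φ) {r s : ℝ}
    {z h : Ed d} (hs : s + ‖h‖ ≤ r) :
    ∫⁻ x in ball z s, ‖φ (x + h) - φ x‖ₑ ^ p ≤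
      ‖h‖ₑ ^ p * ∫⁻ x in ball z r, ‖clGrad φ x‖ₑ ^ p := by
  have hpr : IsProbabilityMeasure (volume.restrict (Icc (0:ℝ) 1)) := ⟨by simp⟩
  have hcc := clGrad_cont hφ
  calc ∫⁻ x in ball z s, ‖φ (x + h) - φ x‖ₑ ^ p
      ≤ ∫⁻ x in ball z s, ∫⁻ t in Icc (0:ℝ) 1, (‖h‖ₑ * ‖clGrad φ (x + t • h)‖ₑ) ^ p := by
        refine lintegral_mono fun x => ?_
        refine (ENNReal.rpow_le_rpow (norm_sub_le_lint hφ x h) (by linarith)).trans ?_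
        refine lint_jensen hp ?_
        have : Continuous fun t : ℝ => clGrad φ (x + t • h) := by fun_prop
        exact (this.enorm.measurable.const_mul _).aemeasurable
    _ = ∫⁻ t in Icc (0:ℝ) 1, ∫⁻ x in ball z s, (‖h‖ₑ * ‖clGrad φ (x + t • h)‖ₑ) ^ p := by
        refine lintegral_lintegral_swap ?_
        have : Continuous fun q : Ed d × ℝ => clGrad φ (q.1 + q.2 • h) := by fun_prop
        exact ((this.enorm.measurable.const_mul _).pow_const p).aemeasurable
    _ ≤ ∫⁻ t in Icc (0:ℝ) 1, ‖h‖ₑ ^ p * ∫⁻ x in ball z r, ‖clGrad φ x‖ₑ ^ p := by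
        refine setLIntegral_mono' measurableSet_Icc fun t ht => ?_
        simp only [ENNReal.mul_rpow_of_nonneg _ _ (by linarith : (0:ℝ) ≤ p)]
        have : Continuous fun x : Ed d => clGrad φ (x + t • h) := by fun_prop
        rw [lintegral_const_mul _ (this.enorm.measurable.pow_const p)]
        refine mul_le_mul' le_rfl ?_
        refine shift_lint_le (h := t • h) (F := fun x => ‖clGrad φ x‖ₑ ^ p) ?_
        have h3 : ‖t • h‖ ≤ ‖h‖ := by
          rw [norm_smul, Real.norm_of_nonneg ht.1]
          exact mul_le_of_le_one_left (norm_nonneg _) ht.2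
        linarith
    _ = _ := by simp

end smooth

section intlin
variable {X : Type*} [MeasurableSpace X] {μ : Measure X}

lemma int_le2 {a b1 b2 : X → ℝ} {c1 c2 : ℝ} (ia : Integrable a μ) (i1 : Integrable b1 μ)
    (i2 : Integrable b2 μ) (h : ∀ᵐ x ∂μ, a x ≤ c1 * b1 x + c2 * b2 x) :
    ∫ x, a x ∂μ ≤ c1 * (∫ x, b1 x ∂μ) + c2 * ∫ x, b2 x ∂μ := by
  rw [← integral_const_mul, ← integral_const_mul,
    ← integral_add (i1.const_mul c1) (i2.const_mul c2)]
  exact integral_mono_ae ia ((i1.const_mul c1).add (i2.const_mul c2)) h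

lemma int_le1 {a b1 : X → ℝ} {c1 : ℝ} (ia : Integrable a μ) (i1 : Integrable b1 μ)
    (h : ∀ᵐ x ∂μ, a x ≤ c1 * b1 x) :
    ∫ x, a x ∂μ ≤ c1 * (∫ x, b1 x ∂μ) := by
  rw [← integral_const_mul]
  exact integral_mono_ae ia (i1.const_mul c1) h

lemma int_le3 {a b1 b2 b3 : X → ℝ} {c1 c2 c3 : ℝ} (ia : Integrable a μ) (i1 : Integrable b1 μ)
    (i2 : Integrable b2 μ) (i3 : Integrable b3 μ)
    (h : ∀ᵐ x ∂μ, a x ≤ c1 * b1 x + c2 * b2 x + c3 * b3 x) :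
    ∫ x, a x ∂μ ≤ c1 * (∫ x, b1 x ∂μ) + c2 * (∫ x, b2 x ∂μ) + c3 * ∫ x, b3 x ∂μ := by
  have h1 := int_le2 (c1 := 1) (c2 := c3) ia ((i1.const_mul c1).add (i2.const_mul c2)) i3
    (h.mono fun x hx => by simpa using hx)
  rw [one_mul] at h1
  refine h1.trans (le_of_eq ?_)
  congr 1
  rw [← integral_const_mul, ← integral_const_mul]
  exact integral_add (i1.const_mul c1) (i2.const_mul c2)

lemma int_le4 {a b1 b2 b3 b4 : X → ℝ} {c1 c2 c3 c4 : ℝ} (ia : Integrable a μ)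
    (i1 : Integrable b1 μ) (i2 : Integrable b2 μ) (i3 : Integrable b3 μ) (i4 : Integrable b4 μ)
    (h : ∀ᵐ x ∂μ, a x ≤ c1 * b1 x + c2 * b2 x + c3 * b3 x + c4 * b4 x) :
    ∫ x, a x ∂μ ≤ c1 * (∫ x, b1 x ∂μ) + c2 * (∫ x, b2 x ∂μ) + c3 * (∫ x, b3 x ∂μ) +
      c4 * ∫ x, b4 x ∂μ := by
  have h1 := int_le3 (c1 := 1) (c2 := c3) (c3 := c4) ia ((i1.const_mul c1).add (i2.const_mul c2))
    i3 i4 (h.mono fun x hx => by simpa using hx)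
  rw [one_mul] at h1
  refine h1.trans (le_of_eq ?_)
  congr 2
  rw [← integral_const_mul, ← integral_const_mul]
  exact integral_add (i1.const_mul c1) (i2.const_mul c2)

end intlin

section appr

variable {d N : ℕ}

/-- approximability of a pair (function, gradient) by smooth functions on a ball -/
def Appr (p : ℝ) (z : Ed d) (r : ℝ) (u : Ed d → En N) (g : Ed d → Mat N d) : Prop :=
  ∃ φ : ℕ → Ed d → En N, (∀ k, ContDiff ℝ (⊤ : ℕ∞) (φ k)) ∧
    LimP p (volume.restrict (ball z r)) φ u ∧
    LimP p (volume.restrict (ball z r)) (fun k => clGrad (φ k)) g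

/-- closure of gradients of test functions -/
def TestG (p : ℝ) (z : Ed d) (r : ℝ) (h : Ed d → Mat N d) : Prop :=
  ∃ φ : ℕ → Ed d → En N, (∀ k, ContDiff ℝ (⊤ : ℕ∞) (φ k)) ∧ (∀ k, HasCompactSupport (φ k)) ∧
    (∀ k, tsupport (φ k) ⊆ ball z r) ∧
    LimP p (volume.restrict (ball z r)) (fun k => clGrad (φ k)) h

/-- solutions of the frozen system on a ball -/
def Sol (f : Mat N d → Mat N d) (z : Ed d) (r : ℝ) (g : Ed d → Mat N d) : Prop :=
  ∀ φ : Ed d → En N, ContDiff ℝ (⊤ : ℕ∞) φ → HasCompactSupport φ → tsupport φ ⊆ ball z r →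
    ∫ x in ball z r, ⟪f (g x), clGrad φ x⟫ = 0

lemma Appr.memu {p : ℝ} {z : Ed d} {r : ℝ} {u : Ed d → En N} {g : Ed d → Mat N d}
    (h : Appr p z r u g) : MemLp u (PP p) (volume.restrict (ball z r)) := by
  obtain ⟨φ, _, h2, _⟩ := h; exact h2.memu

lemma Appr.memg {p : ℝ} {z : Ed d} {r : ℝ} {u : Ed d → En N} {g : Ed d → Mat N d}
    (h : Appr p z r u g) : MemLp g (PP p) (volume.restrict (ball z r)) := by
  obtain ⟨φ, _, _, h2⟩ := h; exact h2.memu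

lemma Appr.mono {p : ℝ} {z z' : Ed d} {r s : ℝ} {u : Ed d → En N} {g : Ed d → Mat N d}
    (h : Appr p z r u g) (hs : ball z' s ⊆ ball z r) : Appr p z' s u g := by
  obtain ⟨φ, h1, h2, h3⟩ := h
  have hm := Measure.restrict_mono (μ := (volume : Measure (Ed d))) hs le_rfl
  exact ⟨φ, h1, h2.mono_measure hm, h3.mono_measure hm⟩

lemma ball_shift {z h : Ed d} {r s : ℝ} (hs : s + ‖h‖ ≤ r) :
    ball z s ⊆ (fun x : Ed d => x + h) ⁻¹' (ball z r) := by
  intro x hx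
  simp only [mem_preimage, mem_ball] at hx ⊢
  calc dist (x + h) z ≤ dist (x + h) x + dist x z := dist_triangle _ _ _
    _ < r := by
      rw [dist_eq_norm (x + h) x, add_sub_cancel_left]; linarith

lemma LimP.shift {E : Type*} [NormedAddCommGroup E] {p : ℝ} {z h : Ed d} {r s : ℝ}
    (hs : s + ‖h‖ ≤ r) {φ : ℕ → Ed d → E} {u : Ed d → E}
    (hl : LimP p (volume.restrict (ball z r)) φ u) :
    LimP p (volume.restrict (ball z s)) (fun k x => φ k (x + h)) (fun x => u (x + h)) := by
  have h1 : MeasurePreserving (fun x : Ed d => x + h) volume volume :=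
    measurePreserving_add_right volume h
  have h2 := h1.restrict_preimage_emb (measurableEmbedding_addRight h) (ball z r)
  exact (hl.comp_mp h2).mono_measure (Measure.restrict_mono (ball_shift hs) le_rfl)

lemma Appr.shift {p : ℝ} {z h : Ed d} {r s : ℝ} {u : Ed d → En N} {g : Ed d → Mat N d}
    (hu : Appr p z r u g) (hs : s + ‖h‖ ≤ r) :
    Appr p z s (fun x => u (x + h)) (fun x => g (x + h)) := by
  obtain ⟨φ, h1, h2, h3⟩ := hu
  refine ⟨fun k x => φ k (x + h), fun k => (h1 k).comp (contDiff_id.add contDiff_const),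
    h2.shift hs, ?_⟩
  refine (h3.shift hs).congr_fun (fun k => Eventually.of_forall fun x => ?_) (ae_eq_refl _)
  exact (clGrad_shift _ _ _).symm

lemma Appr.sub {p : ℝ} (hp : 2 ≤ p) {z : Ed d} {r : ℝ} {u u' : Ed d → En N} {g g' : Ed d → Mat N d}
    (hu : Appr p z r u g) (hu' : Appr p z r u' g') :
    Appr p z r (fun x => u x - u' x) (fun x => g x - g' x) := by
  obtain ⟨φ, h1, h2, h3⟩ := hu
  obtain ⟨φ', h1', h2', h3'⟩ := hu'
  refine ⟨fun k x => φ k x - φ' k x, fun k => (h1 k).sub (h1' k), h2.sub hp h2', ?_⟩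
  refine (h3.sub hp h3').congr_fun (fun k => Eventually.of_forall fun x => ?_) (ae_eq_refl _)
  exact (clGrad_sub (h1 k) (h1' k) x).symm

lemma memLp_ball_cont {E : Type*} [NormedAddCommGroup E] {p : ℝ}
    {φ : Ed d → E} (h : Continuous φ) (z : Ed d) (r : ℝ) :
    MemLp φ (PP p) (volume.restrict (ball z r)) := by
  have h1 : MemLp φ (PP p) (volume.restrict (closedBall z r)) := by
    obtain ⟨C, hC⟩ := (isCompact_closedBall z r).exists_bound_of_continuousOn h.continuousOn
    have : IsFiniteMeasure (volume.restrict (closedBall z r)) :=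
      ⟨by simpa using measure_closedBall_lt_top⟩
    refine MemLp.of_bound ?_ C ?_
    · exact (h.continuousOn.aestronglyMeasurable_of_isCompact
        (isCompact_closedBall z r) measurableSet_closedBall)
    · exact (ae_restrict_iff' measurableSet_closedBall).2 (Eventually.of_forall hC)
  exact h1.mono_measure (Measure.restrict_mono ball_subset_closedBall le_rfl)

lemma appr_smooth {p : ℝ} (z : Ed d) (r : ℝ) {φ : Ed d → En N} (h : ContDiff ℝ (⊤ : ℕ∞) φ) :
    Appr p z r φ (clGrad φ) :=
  ⟨fun _ => φ, fun _ => h, LimP.const (memLp_ball_cont h.continuous z r),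
    LimP.const (memLp_ball_cont (clGrad_cont h) z r)⟩

lemma Appr.sub_const {p : ℝ} (hp : 2 ≤ p) {z : Ed d} {r : ℝ} {u : Ed d → En N} {g : Ed d → Mat N d}
    (hu : Appr p z r u g) (c : En N) : Appr p z r (fun x => u x - c) g := by
  have h1 := hu.sub hp (appr_smooth (p := p) z r (contDiff_const (c := c)))
  simpa [clGrad_const] using h1

lemma tens_smul_sub (a b : En N) (y : Ed d) : tens a y - tens b y = tens (a - b) y := by
  ext q; simp [tens_apply]; ring

lemma tens_cont : Continuous fun q : En N × Ed d => tens q.1 q.2 := by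
  refine (PiLp.continuous_toLp 2 _).comp (continuous_pi fun i => ?_)
  fun_prop

lemma app_cont : Continuous fun q : Mat N d × Ed d => app q.1 q.2 := by
  refine (PiLp.continuous_toLp 2 _).comp (continuous_pi fun i => ?_)
  fun_prop

lemma cpt_bdd {E : Type*} [NormedAddCommGroup E] {η : Ed d → E} (h : Continuous η)
    (hc : HasCompactSupport η) : ∃ C, 0 ≤ C ∧ ∀ x, ‖η x‖ ≤ C := by
  obtain ⟨C, hC⟩ := h.bounded_above_of_compact_support hc
  exact ⟨C, (norm_nonneg _).trans (hC 0), hC⟩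

lemma gr_cpt {η : Ed d → ℝ} (hc : HasCompactSupport η) : HasCompactSupport (gr η) :=
  HasCompactSupport.of_support_subset_isCompact hc fun x hx => by
    by_contra h
    exact hx (gr_tsupport _ h)

lemma LimP.smul_bdd {E : Type*} [NormedAddCommGroup E] [NormedSpace ℝ E] {X : Type*}
    [MeasurableSpace X] {μ : Measure X} {p : ℝ} {φ : ℕ → X → E} {u : X → E} (h : LimP p μ φ u)
    {η : X → ℝ} (hη : AEStronglyMeasurable η μ) {C : ℝ} (hC : ∀ x, ‖η x‖ ≤ C) :
    LimP p μ (fun k x => η x • φ k x) (fun x => η x • u x) := by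
  refine h.lipmap (fun x a => η x • a) C (fun k => hη.smul (h.mem k).1) (hη.smul h.memu.1) ?_ ?_
  · refine Eventually.of_forall fun x a => ?_
    rw [norm_smul]; gcongr; exact hC x
  · refine Eventually.of_forall fun x a b => ?_
    rw [← smul_sub, norm_smul]; gcongr; exact hC x

lemma LimP.tens_bdd {X : Type*}
    [MeasurableSpace X] {μ : Measure X} {p : ℝ} {φ : ℕ → X → En N} {u : X → En N} (h : LimP p μ φ u)
    {η : X → Ed d} (hη : AEStronglyMeasurable η μ) {C : ℝ} (hC : ∀ x, ‖η x‖ ≤ C) :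
    LimP p μ (fun k x => tens (φ k x) (η x)) (fun x => tens (u x) (η x)) := by
  refine h.lipmap (fun x a => tens a (η x)) C
    (fun k => tens_cont.comp_aestronglyMeasurable ((h.mem k).1.prodMk hη))
    (tens_cont.comp_aestronglyMeasurable (h.memu.1.prodMk hη)) ?_ ?_
  · refine Eventually.of_forall fun x a => ?_
    rw [norm_tens, mul_comm]; gcongr; exact hC x
  · refine Eventually.of_forall fun x a b => ?_
    rw [tens_smul_sub, norm_tens, mul_comm]; gcongr; exact hC x

lemma Appr.prod {p : ℝ} (hp : 2 ≤ p) {z : Ed d} {r : ℝ} {u : Ed d → En N} {g : Ed d → Mat N d}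
    (hu : Appr p z r u g) {η : Ed d → ℝ} (h : ContDiff ℝ (⊤ : ℕ∞) η) (hc : HasCompactSupport η)
    (hs : tsupport η ⊆ ball z r) :
    TestG p z r (fun x => η x • g x + tens (u x) (gr η x)) := by
  obtain ⟨φ, h1, h2, h3⟩ := hu
  obtain ⟨C, _, hC⟩ := cpt_bdd h.continuous hc
  obtain ⟨C', _, hC'⟩ := cpt_bdd (gr_cont h) (gr_cpt hc)
  refine ⟨fun k x => η x • φ k x, fun k => h.smul (h1 k), fun k => hc.smul_right,
    fun k => (tsupport_smul_subset_left _ _).trans hs, ?_⟩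
  refine ((h3.smul_bdd h.continuous.aestronglyMeasurable hC).add hp
    (h2.tens_bdd (gr_cont h).aestronglyMeasurable hC')).congr_fun
    (fun k => Eventually.of_forall fun x => ?_) (ae_eq_refl _)
  exact (clGrad_smul h (h1 k) x).symm

lemma lint_eq_int {X E : Type*} [MeasurableSpace X] {μ : Measure X} [NormedAddCommGroup E] {p : ℝ}
    (hp : 2 ≤ p) {f : X → E} (hf : MemLp f (PP p) μ) :
    ∫⁻ x, ‖f x‖ₑ ^ p ∂μ = ENNReal.ofReal (∫ x, ‖f x‖ ^ p ∂μ) := by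
  rw [ofReal_integral_eq_lintegral_ofReal (memLp_int hp hf)
    (Eventually.of_forall fun x => Real.rpow_nonneg (norm_nonneg _) _)]
  refine lintegral_congr fun x => ?_
  rw [← ENNReal.ofReal_rpow_of_nonneg (norm_nonneg _) (by linarith), ofReal_norm]

lemma Appr.W1 {p : ℝ} (hp : 2 ≤ p) {z h : Ed d} {r s : ℝ} {u : Ed d → En N} {g : Ed d → Mat N d}
    (hu : Appr p z r u g) (hs : s + ‖h‖ ≤ r) :
    ∫ x in ball z s, ‖u (x + h) - u x‖ ^ p ≤ ‖h‖ ^ p * ∫ x in ball z r, ‖g x‖ ^ p := by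
  obtain ⟨φ, h1, h2, h3⟩ := hu
  have hsr : ball z s ⊆ ball z r := ball_subset_ball (by linarith [norm_nonneg h])
  have hl := ((h2.shift hs).sub hp (h2.mono_measure (Measure.restrict_mono hsr le_rfl)))
  refine le_of_tendsto_of_tendsto' (hl.norm_int hp) ((h3.norm_int hp).const_mul (‖h‖ ^ p)) fun k => ?_
  have := W1_smooth hp (h1 k) (z := z) hs
  rw [lint_eq_int hp (hl.mem k), lint_eq_int hp (h3.mem k), ← ofReal_norm,
    ENNReal.ofReal_rpow_of_nonneg (norm_nonneg _) (by linarith),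
    ← ENNReal.ofReal_mul (by positivity)] at this
  exact (ENNReal.ofReal_le_ofReal_iff (mul_nonneg (by positivity) (intp_nonneg _ _))).1 this

lemma Sol.mono {f : Mat N d → Mat N d} {z z' : Ed d} {r s : ℝ} {g : Ed d → Mat N d}
    (h : Sol f z r g) (hs : ball z' s ⊆ ball z r) : Sol f z' s g := by
  intro φ h1 h2 h3
  rw [← h φ h1 h2 (h3.trans hs)]
  have hz : ∀ x, x ∉ ball z' s → ⟪f (g x), clGrad φ x⟫ = 0 := fun x hx => by
    rw [clGrad_tsupport φ (fun h => hx (h3 h)), inner_zero_right]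
  rw [setIntegral_eq_integral_of_forall_compl_eq_zero hz,
    setIntegral_eq_integral_of_forall_compl_eq_zero fun x hx => hz x fun h => hx (hs h)]

lemma Sol.shift {f : Mat N d → Mat N d} {z h : Ed d} {r s : ℝ} {g : Ed d → Mat N d}
    (hg : Sol f z r g) (hs : s + ‖h‖ ≤ r) : Sol f z s (fun x => g (x + h)) := by
  intro φ h1 h2 h3
  have hts : tsupport (fun x => φ (x + -h)) ⊆ (fun x : Ed d => x + -h) ⁻¹' (tsupport φ) :=
    tsupport_comp_subset_preimage φ (by fun_prop)
  have hb : tsupport (fun x => φ (x + -h)) ⊆ ball z r := by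
    intro x hx
    have := ball_shift hs (h3 (hts hx))
    simpa using this
  have h4 := hg (fun x => φ (x + -h)) (h1.comp (contDiff_id.add contDiff_const))
    (h2.comp_homeomorph (Homeomorph.addRight (-h))) hb
  have hz : ∀ x, x ∉ ball z s → ⟪f (g (x + h)), clGrad φ x⟫ = 0 := fun x hx => by
    rw [clGrad_tsupport φ (fun h => hx (h3 h)), inner_zero_right]
  have hz' : ∀ x, x ∉ ball z r → ⟪f (g x), clGrad (fun x => φ (x + -h)) x⟫ = 0 := fun x hx => by
    rw [clGrad_tsupport _ (fun h => hx (hb h)), inner_zero_right]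
  rw [setIntegral_eq_integral_of_forall_compl_eq_zero hz, ← h4,
    setIntegral_eq_integral_of_forall_compl_eq_zero hz',
    ← integral_add_right_eq_self (fun x => ⟪f (g x), clGrad (fun x => φ (x + -h)) x⟫) h]
  refine integral_congr_ae (Eventually.of_forall fun x => ?_)
  simp [clGrad_shift]

end appr

section frozenlp

variable {d N : ℕ} {p Λ : ℝ} {f : Mat N d → Mat N d} {Bm : Ed d →L[ℝ] Ed d}

lemma rpow_two_split {p x : ℝ} (hp : 2 ≤ p) (hx : 0 ≤ x) : x ^ (p - 2) * x ^ 2 = x ^ p := by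
  rcases hx.eq_or_lt with h | h
  · rw [← h, Real.zero_rpow (by linarith : p ≠ 0)]; simp
  · rw [← Real.rpow_two, ← Real.rpow_add h]; simp

lemma rpow_two_split' {p x : ℝ} (hp : 2 ≤ p) (hx : 0 ≤ x) : x ^ (p - 2) * x = x ^ (p - 1) := by
  rcases hx.eq_or_lt with h | h
  · rw [← h, Real.zero_rpow (by linarith : p - 1 ≠ 0)]; simp
  · rw [← Real.rpow_add_one h.ne']; congr 1; ring

lemma Frozen.growth (h : Frozen p Λ f Bm) (hp : 2 ≤ p) (a : Mat N d) : ‖f a‖ ≤ Λ * ‖a‖ ^ (p - 1) := by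
  have := h.lip a 0
  rwa [h.zero, sub_zero, sub_zero, norm_zero, add_zero, rpow_two_split' hp (norm_nonneg _)] at this

lemma Frozen.coer (h : Frozen p Λ f Bm) (hp : 2 ≤ p) (a : Mat N d) : ‖a‖ ^ p ≤ Λ * ⟪f a, a⟫ := by
  have := h.mono a 0
  rwa [h.zero, sub_zero, sub_zero, norm_zero, add_zero, rpow_two_split hp (norm_nonneg _)] at this

lemma Frozen.monop (h : Frozen p Λ f Bm) (hp : 2 ≤ p) (a b : Mat N d) :
    ‖a - b‖ ^ p ≤ Λ * ⟪f a - f b, a - b⟫ := by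
  refine le_trans ?_ (h.mono a b)
  rw [← rpow_two_split hp (norm_nonneg (a - b))]
  have := Real.rpow_le_rpow (norm_nonneg _) (norm_sub_le a b) (by linarith : 0 ≤ p - 2)
  gcongr

variable {X : Type*} [MeasurableSpace X] {μ : Measure X}

lemma memLp_dual_of_le {X E E' : Type*} [MeasurableSpace X] {μ : Measure X} [NormedAddCommGroup E]
    [NormedAddCommGroup E'] {p C : ℝ} (hp : 2 ≤ p) {g : X → E} (hg : MemLp g (PP p) μ)
    {F : X → E'} (hF : AEStronglyMeasurable F μ) (hle : ∀ᵐ x ∂μ, ‖F x‖ ≤ C * ‖g x‖ ^ (p - 1)) :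
    MemLp F (QQ p) μ := by
  have h1 := hg.norm_rpow_div (ENNReal.ofReal (p - 1))
  have h2 : PP p / ENNReal.ofReal (p - 1) = QQ p := by
    rw [PP, QQ, ENNReal.ofReal_div_of_pos (by linarith)]
  rw [h2, ENNReal.toReal_ofReal (by linarith)] at h1
  refine h1.of_le_mul (c := C) hF (hle.mono fun x hx => ?_)
  rwa [Real.norm_of_nonneg (Real.rpow_nonneg (norm_nonneg _) _)]

lemma Frozen.memDual (h : Frozen p Λ f Bm) (hp : 2 ≤ p) {g : X → Mat N d} (hg : MemLp g (PP p) μ) :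
    MemLp (fun x => f (g x)) (QQ p) μ :=
  memLp_dual_of_le hp hg (h.cont.comp_aestronglyMeasurable hg.1)
    (Eventually.of_forall fun _ => h.growth hp _)

lemma Sol.test (h : Frozen p Λ f Bm) (hp : 2 ≤ p) {z : Ed d} {r : ℝ} {g k : Ed d → Mat N d}
    (hs : Sol f z r g) (hg : MemLp g (PP p) (volume.restrict (ball z r))) (hk : TestG p z r k) :
    ∫ x in ball z r, ⟪f (g x), k x⟫ = 0 := by
  obtain ⟨φ, h1, h2, h3, h4⟩ := hk
  have := LimP.pair hp (h.memDual hp hg) h4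
  refine tendsto_nhds_unique this (tendsto_const_nhds.congr fun k => ?_)
  exact (hs (φ k) (h1 k) (h2 k) (h3 k)).symm

lemma Frozen.limdiff (h : Frozen p Λ f Bm) (hΛ : 0 ≤ Λ) (hp : 2 ≤ p) {φ : ℕ → X → Mat N d} {g k : X → Mat N d}
    (hl : LimP p μ φ g) (hk : MemLp k (PP p) μ) :
    Tendsto (fun n => ∫ x, ⟪f (φ n x), k x⟫ ∂μ) atTop (𝓝 (∫ x, ⟪f (g x), k x⟫ ∂μ)) := by
  rw [Metric.tendsto_atTop]
  -- pointwise Young inequality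
  have key : ∀ δ : ℝ, 0 < δ → ∀ a b c : Mat N d, |⟪f a - f b, c⟫| ≤
      Λ * (δ ^ p * (2 ^ p * (‖a‖ ^ p + ‖b‖ ^ p) + ‖c‖ ^ p) + (δ ^ (1 - p)) ^ p * ‖a - b‖ ^ p) := by
    intro δ hδ a b c
    have h1 := (abs_real_inner_le_norm (f a - f b) c).trans
      (mul_le_mul_of_nonneg_right (h.lip a b) (norm_nonneg _))
    refine h1.trans ?_
    rw [mul_assoc]
    refine mul_le_mul_of_nonneg_left ?_ hΛ
    have h2 := young3 (p := p) (a := δ * (‖a‖ + ‖b‖)) (b := δ * ‖c‖) (c := δ ^ (1 - p) * ‖a - b‖) hp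
      (by positivity) (by positivity) (by positivity)
    rw [Real.mul_rpow hδ.le (by positivity), Real.mul_rpow hδ.le (by positivity),
      Real.mul_rpow hδ.le (by positivity), Real.mul_rpow (by positivity) (by positivity)] at h2
    have h3 := add_rpow_le hp (norm_nonneg a) (norm_nonneg b)
    have h4 : δ ^ (p - 2) * δ * δ ^ (1 - p) = 1 := by
      rw [← Real.rpow_add_one hδ.ne', ← Real.rpow_add hδ,
        (by ring : p - 2 + 1 + (1 - p) = 0), Real.rpow_zero]
    calc (‖a‖ + ‖b‖) ^ (p - 2) * ‖a - b‖ * ‖c‖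
        = (δ ^ (p - 2) * δ * δ ^ (1 - p)) * ((‖a‖ + ‖b‖) ^ (p - 2) * ‖a - b‖ * ‖c‖) := by
          rw [h4, one_mul]
      _ = δ ^ (p - 2) * (‖a‖ + ‖b‖) ^ (p - 2) * (δ * ‖c‖) * (δ ^ (1 - p) * ‖a - b‖) := by ring
      _ ≤ _ := h2
      _ ≤ _ := by
        have h5 := mul_le_mul_of_nonneg_left h3 (Real.rpow_nonneg hδ.le p)
        linarith
  -- integrated
  have key2 : ∀ δ : ℝ, 0 < δ → ∀ n, dist (∫ x, ⟪f (φ n x), k x⟫ ∂μ) (∫ x, ⟪f (g x), k x⟫ ∂μ) ≤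
      Λ * (δ ^ p * (2 ^ p * ((∫ x, ‖φ n x‖ ^ p ∂μ) + (∫ x, ‖g x‖ ^ p ∂μ)) + ∫ x, ‖k x‖ ^ p ∂μ) +
        (δ ^ (1 - p)) ^ p * ∫ x, ‖φ n x - g x‖ ^ p ∂μ) := by
    intro δ hδ n
    have i1 := memLp_int hp (hl.mem n)
    have i2 := memLp_int hp hl.memu
    have i3 := memLp_int hp hk
    have i4 : Integrable (fun x => ‖φ n x - g x‖ ^ p) μ := memLp_int hp ((hl.mem n).sub hl.memu)
    have j1 := dual_integrable hp (h.memDual hp (hl.mem n)) hk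
    have j2 := dual_integrable hp (h.memDual hp hl.memu) hk
    rw [Real.dist_eq, ← integral_sub j1 j2]
    refine (abs_integral_le_integral_abs).trans ?_
    have := int_le4 (μ := μ) (a := fun x => |⟪f (φ n x), k x⟫ - ⟪f (g x), k x⟫|)
      (c1 := Λ * (δ ^ p * 2 ^ p)) (c2 := Λ * (δ ^ p * 2 ^ p)) (c3 := Λ * δ ^ p)
      (c4 := Λ * (δ ^ (1 - p)) ^ p) (j1.sub j2).abs i1 i2 i3 i4
      (Eventually.of_forall fun x => by
        rw [← inner_sub_left]
        exact (key δ hδ _ _ _).trans (le_of_eq (by ring)))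
    exact this.trans (le_of_eq (by ring))
  intro ε hε
  obtain ⟨M, hM⟩ := (hl.norm_int hp).bddAbove_range
  have hM' : ∀ n, ∫ x, ‖φ n x‖ ^ p ∂μ ≤ M := fun n => hM ⟨n, rfl⟩
  have hM0 : 0 ≤ M := (intp_nonneg _ _).trans (hM' 0)
  obtain ⟨K, hK⟩ : ∃ K, K = 2 ^ p * (M + (∫ x, ‖g x‖ ^ p ∂μ)) + ∫ x, ‖k x‖ ^ p ∂μ := ⟨_, rfl⟩
  have hg0 : 0 ≤ ∫ x, ‖g x‖ ^ p ∂μ := intp_nonneg _ _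
  have hk0 : 0 ≤ ∫ x, ‖k x‖ ^ p ∂μ := intp_nonneg _ _
  have hK0 : 0 ≤ K := by rw [hK]; positivity
  obtain ⟨δ, hδ, hδ2⟩ : ∃ δ : ℝ, 0 < δ ∧ Λ * (δ ^ p * K) < ε / 2 := by
    refine ⟨(ε / (4 * (Λ * K + 1))) ^ (p⁻¹), by positivity, ?_⟩
    rw [Real.rpow_inv_rpow (by positivity) (by linarith)]
    have : 0 ≤ Λ * K := by positivity
    rw [← mul_assoc, mul_comm Λ, mul_assoc, div_mul_eq_mul_div, div_lt_div_iff₀ (by positivity) (by norm_num)]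
    nlinarith
  have h6 := ((hl.int hp).const_mul (Λ * (δ ^ (1 - p)) ^ p))
  rw [mul_zero] at h6
  obtain ⟨n0, hn0⟩ := eventually_atTop.1 (h6.eventually (gt_mem_nhds (half_pos hε)))
  refine ⟨n0, fun n hn => (key2 δ hδ n).trans_lt ?_⟩
  have h7 := hn0 n hn
  have h8 : 2 ^ p * ((∫ x, ‖φ n x‖ ^ p ∂μ) + (∫ x, ‖g x‖ ^ p ∂μ)) + ∫ x, ‖k x‖ ^ p ∂μ ≤ K := by
    rw [hK]; have := hM' n; gcongr
  have h9 := mul_le_mul_of_nonneg_left (mul_le_mul_of_nonneg_left h8 (Real.rpow_nonneg hδ.le p)) hΛ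
  rw [mul_add]
  linarith

end frozenlp

section mollify

variable {d N : ℕ}

lemma transl_cont {E : Type*} [NormedAddCommGroup E] {p : ℝ} (hp : 2 ≤ p) {V : Ed d → E}
    (hV : MemLp V (PP p) volume) :
    Tendsto (fun t : Ed d => eLpNorm (fun x => V (x + t) - V x) (PP p) volume) (𝓝 0) (𝓝 0) := by
  have : Fact (1 ≤ PP p) := ⟨one_le_PP hp⟩
  have : Fact (PP p ≠ ⊤) := ⟨PP_ne_top⟩
  have h1 : Continuous fun t : Ed d => (DomAddAct.mk t) +ᵥ (hV.toLp V) := by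
    have : Continuous fun t : Ed d => DomAddAct.mk t := DomAddAct.continuous_mk
    exact this.vadd continuous_const
  have h2 := (h1.tendsto 0)
  have h3 : (DomAddAct.mk (0 : Ed d)) +ᵥ (hV.toLp V) = hV.toLp V := by
    simp
  rw [h3, tendsto_iff_edist_tendsto_0] at h2
  refine h2.congr fun t => ?_
  rw [Lp.edist_def]
  refine eLpNorm_congr_ae ?_
  have h4 := DomAddAct.vadd_Lp_ae_eq (DomAddAct.mk t) (hV.toLp V)
  have h5 := hV.coeFn_toLp
  have h6 := (measurePreserving_add_right (volume : Measure (Ed d)) t).quasiMeasurePreserving.ae h5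
  filter_upwards [h4, h5, h6] with x a b c
  simp only [Pi.sub_apply]
  rw [a, b]
  simp only [Equiv.symm_apply_apply, vadd_eq_add]
  rw [add_comm t x, c]

lemma poincare_aux {p : ℝ} (hp : 2 ≤ p) {z : Ed d} {s : ℝ} (hs : 0 < s) {u : Ed d → En N}
    {g : Ed d → Mat N d} (hu : Appr p z (3 * s) u g) (hm : StronglyMeasurable u) :
    ∃ c : En N, ∫ x in ball z s, ‖u x - c‖ ^ p ≤
      2 ^ d * (2 * s) ^ p * ∫ x in ball z (3 * s), ‖g x‖ ^ p := by
  obtain ⟨I, hI⟩ : ∃ I, I = ∫ x in ball z (3 * s), ‖g x‖ ^ p := ⟨_, rfl⟩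
  have hI0 : 0 ≤ I := hI ▸ intp_nonneg _ _
  have hmeas : Measurable fun q : Ed d × Ed d => ‖u q.1 - u q.2‖ₑ ^ p :=
    (((hm.comp_measurable measurable_fst).sub (hm.comp_measurable measurable_snd)).enorm).pow_const p
  have hmeas2 : Measurable fun q : Ed d × Ed d => ‖u (q.1 + q.2) - u q.1‖ₑ ^ p :=
    (((hm.comp_measurable (measurable_fst.add measurable_snd)).sub
      (hm.comp_measurable measurable_fst)).enorm).pow_const p
  have h1 : ∫⁻ x in ball z s, ∫⁻ y in ball z s, ‖u y - u x‖ₑ ^ p ≤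
      volume (ball (0 : Ed d) (2 * s)) * ENNReal.ofReal ((2 * s) ^ p * I) := by
    calc ∫⁻ x in ball z s, ∫⁻ y in ball z s, ‖u y - u x‖ₑ ^ p
        ≤ ∫⁻ x in ball z s, ∫⁻ h in ball (0 : Ed d) (2 * s), ‖u (x + h) - u x‖ₑ ^ p := by
          refine setLIntegral_mono' measurableSet_ball fun x hx => ?_
          have h1 : MeasurePreserving (fun y : Ed d => x + y) volume volume :=
            measurePreserving_add_left volume x
          have h2 := h1.restrict_preimage_emb (measurableEmbedding_addLeft x) (ball z s)
          rw [← h2.lintegral_comp_emb (measurableEmbedding_addLeft x)]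
          refine lintegral_mono_set fun y hy => ?_
          simp only [mem_preimage, mem_ball, dist_zero_right] at hy hx ⊢
          have : ‖y‖ = dist (x + y) x := by rw [dist_eq_norm, add_sub_cancel_left]
          rw [this]
          calc dist (x + y) x ≤ dist (x + y) z + dist x z := dist_triangle_right _ _ _
            _ < 2 * s := by linarith
      _ = ∫⁻ h in ball (0 : Ed d) (2 * s), ∫⁻ x in ball z s, ‖u (x + h) - u x‖ₑ ^ p :=
          lintegral_lintegral_swap hmeas2.aemeasurable
      _ ≤ ∫⁻ h in ball (0 : Ed d) (2 * s), ENNReal.ofReal ((2 * s) ^ p * I) := by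
          refine setLIntegral_mono' measurableSet_ball fun h hh => ?_
          have hh' : ‖h‖ < 2 * s := by simpa using hh
          have h3 := hu.W1 hp (h := h) (s := s) (by linarith)
          have hmem : MemLp (fun x => u (x + h) - u x) (PP p) (volume.restrict (ball z s)) :=
            ((hu.shift (h := h) (s := s) (by linarith)).sub hp
              (hu.mono (z' := z) (s := s) (ball_subset_ball (by linarith)))).memu
          rw [lint_eq_int hp hmem]
          refine ENNReal.ofReal_le_ofReal (h3.trans ?_)
          rw [← hI]
          gcongr
      _ = _ := by rw [setLIntegral_const, mul_comm]
  have hpos : volume (ball z s) ≠ 0 := (measure_ball_pos _ _ hs).ne'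
  have hfin : volume (ball z s) ≠ ⊤ := measure_ball_lt_top.ne
  obtain ⟨y, hy, hy2⟩ := exists_le_setLAverage (μ := volume) (s := ball z s)
    (f := fun x => ∫⁻ y in ball z s, ‖u y - u x‖ₑ ^ p) hpos hfin
    (hmeas.lintegral_prod_left' (μ := volume.restrict (ball z s))).aemeasurable
  refine ⟨u y, ?_⟩
  rw [setLAverage_eq] at hy2
  have h4 := hy2.trans (ENNReal.div_le_div_right h1 _)
  have hvol : volume (ball (0 : Ed d) (2 * s)) = ENNReal.ofReal (2 ^ d) * volume (ball z s) := by
    rw [Measure.addHaar_ball_center (volume : Measure (Ed d)) z s,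
      Measure.addHaar_ball_mul_of_pos (volume : Measure (Ed d)) 0 (by norm_num : (0:ℝ) < 2) s]
    simp
  have hmem : MemLp (fun x => u x - u y) (PP p) (volume.restrict (ball z s)) :=
    ((hu.mono (z' := z) (s := s) (ball_subset_ball (by linarith))).sub_const hp (u y)).memu
  rw [lint_eq_int hp hmem, hvol, mul_right_comm, ENNReal.mul_div_cancel_right hpos hfin,
    ← ENNReal.ofReal_mul (by positivity), ← mul_assoc] at h4
  rw [← hI]
  exact (ENNReal.ofReal_le_ofReal_iff (by positivity)).1 h4

lemma Appr.congr {p : ℝ} {z : Ed d} {r : ℝ} {u u' : Ed d → En N} {g g' : Ed d → Mat N d}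
    (h : Appr p z r u g) (hu : u =ᵐ[volume.restrict (ball z r)] u')
    (hg : g =ᵐ[volume.restrict (ball z r)] g') : Appr p z r u' g' := by
  obtain ⟨φ, h1, h2, h3⟩ := h
  exact ⟨φ, h1, h2.congr_fun (fun _ => ae_eq_refl _) hu, h3.congr_fun (fun _ => ae_eq_refl _) hg⟩

lemma poincare {p : ℝ} (hp : 2 ≤ p) {z : Ed d} {s : ℝ} (hs : 0 < s) {u : Ed d → En N}
    {g : Ed d → Mat N d} (hu : Appr p z (3 * s) u g) :
    ∃ c : En N, ∫ x in ball z s, ‖u x - c‖ ^ p ≤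
      2 ^ d * (2 * s) ^ p * ∫ x in ball z (3 * s), ‖g x‖ ^ p := by
  have hae := hu.memu.1.ae_eq_mk
  obtain ⟨c, hc⟩ := poincare_aux hp hs (hu.congr hae (ae_eq_refl _)) hu.memu.1.stronglyMeasurable_mk
  refine ⟨c, le_trans (le_of_eq ?_) hc⟩
  have h2 : ∀ᵐ x ∂volume.restrict (ball z s), u x = hu.memu.1.mk u x :=
    ae_restrict_of_ae_restrict_of_subset (ball_subset_ball (by linarith)) hae
  refine integral_congr_ae (h2.mono fun x hx => ?_)
  simp only
  rw [hx]

end mollify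

section mollify2

variable {d N : ℕ}

/-- mollification -/
def mol {E : Type*} [NormedAddCommGroup E] [NormedSpace ℝ E] (ρ : Ed d → ℝ) (V : Ed d → E)
    (x : Ed d) : E := ∫ y, ρ (x - y) • V y

lemma mol_eq {E : Type*} [NormedAddCommGroup E] [NormedSpace ℝ E] (ρ : Ed d → ℝ) (V : Ed d → E) :
    mol ρ V = convolution V ρ (ContinuousLinearMap.lsmul ℝ ℝ).flip volume := by
  ext x; rfl

lemma mol_eq' {E : Type*} [NormedAddCommGroup E] [NormedSpace ℝ E] (ρ : Ed d → ℝ) (V : Ed d → E)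
    (x : Ed d) : mol ρ V x = ∫ y, ρ y • V (x - y) := by
  rw [← integral_sub_left_eq_self _ _ x]; simp [mol]

lemma mol_smooth {E : Type*} [NormedAddCommGroup E] [NormedSpace ℝ E] {ρ : Ed d → ℝ}
    (hρ : ContDiff ℝ (⊤ : ℕ∞) ρ) (hc : HasCompactSupport ρ) {V : Ed d → E}
    (hV : LocallyIntegrable V volume) : ContDiff ℝ (⊤ : ℕ∞) (mol ρ V) := by
  rw [mol_eq]
  exact hc.contDiff_convolution_right _ hV hρ

lemma mol_deriv {E : Type*} [NormedAddCommGroup E] [NormedSpace ℝ E] {ρ : Ed d → ℝ}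
    (hρ : ContDiff ℝ (⊤ : ℕ∞) ρ) (hc : HasCompactSupport ρ) {V : Ed d → E}
    (hV : LocallyIntegrable V volume) (x e : Ed d) :
    fderiv ℝ (mol ρ V) x e = ∫ y, (fderiv ℝ ρ (x - y) e) • V y := by
  rw [mol_eq, (hc.hasFDerivAt_convolution_right _ hV (hρ.of_le (by exact_mod_cast le_top)) x).fderiv,
    convolution_precompR_apply _ hV (hc.fderiv ℝ) (hρ.continuous_fderiv (by simp))]
  rfl

lemma mol_integrable {E : Type*} [NormedAddCommGroup E] [NormedSpace ℝ E] {ρ : Ed d → ℝ}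
    (hρ : Continuous ρ) (hc : HasCompactSupport ρ) {V : Ed d → E}
    (hV : LocallyIntegrable V volume) (x : Ed d) : Integrable fun y => ρ (x - y) • V y := by
  have := hc.convolutionExists_right (ContinuousLinearMap.lsmul ℝ ℝ).flip hV hρ x
  exact this

lemma mol_bound {p : ℝ} (hp : 2 ≤ p) {E : Type*} [NormedAddCommGroup E] [NormedSpace ℝ E]
    [CompleteSpace E]
    {ρ : Ed d → ℝ} {δ : ℝ} (hρ : Continuous ρ) (hc : HasCompactSupport ρ) (h0 : ∀ x, 0 ≤ ρ x)
    (h1 : ∫ x, ρ x = 1) (hs : ∀ x, δ ≤ ‖x‖ → ρ x = 0)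
    {V : Ed d → E} (hm : StronglyMeasurable V) (hV : LocallyIntegrable V volume) {c : ℝ≥0∞}
    (hle : ∀ t : Ed d, ‖t‖ < δ → ∫⁻ x, ‖V (x + t) - V x‖ₑ ^ p ≤ c) :
    ∫⁻ x, ‖mol ρ V x - V x‖ₑ ^ p ≤ c := by
  have hρi : Integrable ρ := hρ.integrable_of_hasCompactSupport hc
  have hρm : Measurable fun t => ENNReal.ofReal (ρ t) := hρ.measurable.ennreal_ofReal
  let P : Measure (Ed d) := volume.withDensity fun t => ENNReal.ofReal (ρ t)
  have hP1 : ∫⁻ t, ENNReal.ofReal (ρ t) = 1 := by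
    rw [← ofReal_integral_eq_lintegral_ofReal hρi (ae_of_all _ h0), h1]; simp
  have hP : IsProbabilityMeasure P := ⟨by
    simp [P, withDensity_apply, hP1]⟩
  have hmeas2 : Measurable fun q : Ed d × Ed d => ‖V (q.1 - q.2) - V q.1‖ₑ ^ p :=
    (((hm.comp_measurable (measurable_fst.sub measurable_snd)).sub
      (hm.comp_measurable measurable_fst)).enorm).pow_const p
  have hmeas1 : ∀ x, Measurable fun t => ‖V (x - t) - V x‖ₑ := fun x =>
    ((hm.comp_measurable (measurable_const.sub measurable_id)).sub stronglyMeasurable_const).enorm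
  have key : ∀ x, ‖mol ρ V x - V x‖ₑ ^ p ≤ ∫⁻ t, ENNReal.ofReal (ρ t) * ‖V (x - t) - V x‖ₑ ^ p := by
    intro x
    have hi : Integrable fun t => ρ t • V (x - t) := by
      have := (mol_integrable hρ hc hV x).comp_sub_left x
      simpa using this
    have e1 : mol ρ V x - V x = ∫ t, ρ t • (V (x - t) - V x) := by
      simp_rw [smul_sub]
      rw [integral_sub hi (hρi.smul_const _), integral_smul_const, h1, one_smul, mol_eq']
    have e2 : ‖mol ρ V x - V x‖ₑ ≤ ∫⁻ t, ‖V (x - t) - V x‖ₑ ∂P := by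
      rw [e1, lintegral_withDensity_eq_lintegral_mul _ hρm (hmeas1 x)]
      refine (enorm_integral_le_lintegral_enorm _).trans (le_of_eq (lintegral_congr fun t => ?_))
      rw [enorm_smul, Real.enorm_eq_ofReal (h0 t)]; rfl
    refine (ENNReal.rpow_le_rpow e2 (by linarith)).trans ((lint_jensen hp (hmeas1 x).aemeasurable).trans ?_)
    rw [lintegral_withDensity_eq_lintegral_mul _ hρm ((hmeas1 x).pow_const p)]
    rfl
  calc ∫⁻ x, ‖mol ρ V x - V x‖ₑ ^ p
      ≤ ∫⁻ x, ∫⁻ t, ENNReal.ofReal (ρ t) * ‖V (x - t) - V x‖ₑ ^ p := lintegral_mono key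
    _ = ∫⁻ t, ∫⁻ x, ENNReal.ofReal (ρ t) * ‖V (x - t) - V x‖ₑ ^ p := by
        refine lintegral_lintegral_swap (Measurable.aemeasurable ?_)
        exact (hρm.comp measurable_snd).mul hmeas2
    _ ≤ ∫⁻ t, ENNReal.ofReal (ρ t) * c := by
        refine lintegral_mono fun t => ?_
        have hh : Measurable fun x => ‖V (x - t) - V x‖ₑ ^ p :=
          hmeas2.comp (measurable_id.prodMk measurable_const)
        rw [lintegral_const_mul _ hh]
        by_cases ht : ‖t‖ < δ
        · refine mul_le_mul_right ?_ _
          have := hle (-t) (by simpa using ht)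
          simpa [sub_eq_add_neg] using this
        · rw [hs t (not_lt.1 ht)]; simp
    _ = c := by rw [lintegral_mul_const _ hρm, hP1, one_mul]

lemma lint_eq_eLpNorm {X E : Type*} [MeasurableSpace X] {μ : Measure X} [NormedAddCommGroup E] {p : ℝ}
    (hp : 2 ≤ p) (f : X → E) : ∫⁻ x, ‖f x‖ₑ ^ p ∂μ = eLpNorm f (PP p) μ ^ p := by
  rw [eLpNorm_eq_lintegral_rpow_enorm_toReal (PP_ne_zero hp) PP_ne_top, PP_toReal hp,
    ← ENNReal.rpow_mul, one_div_mul_cancel (by linarith), ENNReal.rpow_one]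

lemma mol_eLp {p : ℝ} (hp : 2 ≤ p) {E : Type*} [NormedAddCommGroup E] [NormedSpace ℝ E]
    [CompleteSpace E]
    {ρ : Ed d → ℝ} {δ : ℝ} (hρ : Continuous ρ) (hc : HasCompactSupport ρ) (h0 : ∀ x, 0 ≤ ρ x)
    (h1 : ∫ x, ρ x = 1) (hs : ∀ x, δ ≤ ‖x‖ → ρ x = 0)
    {V : Ed d → E} (hV : MemLp V (PP p) volume) {c : ℝ≥0∞}
    (hle : ∀ t : Ed d, ‖t‖ < δ → eLpNorm (fun x => V (x + t) - V x) (PP p) volume ≤ c) :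
    eLpNorm (fun x => mol ρ V x - V x) (PP p) volume ≤ c := by
  have hV1 := hV.1
  have e1 : mol ρ V = mol ρ (hV1.mk V) := by
    ext1 x
    refine integral_congr_ae ?_
    filter_upwards [hV1.ae_eq_mk] with y hy
    rw [hy]
  have e2 : (fun x => mol ρ V x - V x) =ᵐ[volume] fun x => mol ρ (hV1.mk V) x - hV1.mk V x := by
    rw [← e1]
    filter_upwards [hV1.ae_eq_mk] with y hy
    rw [← hy]
  have hV' : MemLp (hV1.mk V) (PP p) volume := hV.ae_eq hV1.ae_eq_mk
  rw [eLpNorm_congr_ae e2]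
  have := mol_bound hp hρ hc h0 h1 hs hV1.stronglyMeasurable_mk
    (hV'.locallyIntegrable (one_le_PP hp)) (c := c ^ p) ?_
  · rw [lint_eq_eLpNorm hp] at this
    exact (ENNReal.rpow_le_rpow_iff (by linarith)).1 this
  · intro t ht
    rw [lint_eq_eLpNorm hp]
    refine ENNReal.rpow_le_rpow ?_ (by linarith)
    refine le_trans (le_of_eq (eLpNorm_congr_ae ?_)) (hle t ht)
    have h6 := (measurePreserving_add_right (volume : Measure (Ed d)) t).quasiMeasurePreserving.ae
      hV1.ae_eq_mk
    filter_upwards [hV1.ae_eq_mk, h6] with x a b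
    rw [← a, ← b]

lemma mol_lim {p : ℝ} (hp : 2 ≤ p) {E : Type*} [NormedAddCommGroup E] [NormedSpace ℝ E]
    [CompleteSpace E]
    {ρ : ℕ → Ed d → ℝ} {δ : ℕ → ℝ} (hρ : ∀ k, ContDiff ℝ (⊤ : ℕ∞) (ρ k))
    (hc : ∀ k, HasCompactSupport (ρ k)) (h0 : ∀ k x, 0 ≤ ρ k x)
    (h1 : ∀ k, ∫ x, ρ k x = 1) (hs : ∀ k x, δ k ≤ ‖x‖ → ρ k x = 0)
    (hδ : Tendsto δ atTop (𝓝 0))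
    {V : Ed d → E} (hV : MemLp V (PP p) volume) :
    LimP p volume (fun k => mol (ρ k) V) V := by
  have hloc := hV.locallyIntegrable (one_le_PP hp)
  have hfin : ∀ t : Ed d, eLpNorm (fun x => V (x + t) - V x) (PP p) volume ≤
      2 * eLpNorm V (PP p) volume := by
    intro t
    have hmp := measurePreserving_add_right (volume : Measure (Ed d)) t
    have ht : MemLp (fun x => V (x + t)) (PP p) volume := hV.comp_measurePreserving hmp
    refine (eLpNorm_sub_le ht.1 hV.1 (one_le_PP hp)).trans (le_of_eq ?_)
    rw [two_mul]
    congr 1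
    exact eLpNorm_comp_measurePreserving hV.1 hmp
  have hmem : ∀ k, MemLp (fun x => mol (ρ k) V x - V x) (PP p) volume := fun k =>
    ⟨((mol_smooth (hρ k) (hc k) hloc).continuous.aestronglyMeasurable).sub hV.1,
      (mol_eLp hp (hρ k).continuous (hc k) (h0 k) (h1 k) (hs k) hV (fun t _ => hfin t)).trans_lt
        (ENNReal.mul_lt_top (by simp) hV.2)⟩
  refine ⟨hV, fun k => ?_, ?_⟩
  · have := (hmem k).add hV
    refine this.ae_eq (ae_of_all _ fun x => ?_)
    simp
  · rw [ENNReal.tendsto_nhds_zero]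
    intro ε hε
    have h2 := ENNReal.tendsto_nhds_zero.1 (transl_cont hp hV) ε hε
    obtain ⟨r, hr, h3⟩ := Metric.eventually_nhds_iff.1 h2
    filter_upwards [hδ.eventually (gt_mem_nhds hr)] with k hk
    exact mol_eLp hp (hρ k).continuous (hc k) (h0 k) (h1 k) (hs k) hV
      (fun t ht => h3 (by simpa using ht.trans hk))

lemma mol_exists (d : ℕ) {δ : ℝ} (hδ : 0 < δ) : ∃ ρ : Ed d → ℝ, ContDiff ℝ (⊤ : ℕ∞) ρ ∧
    HasCompactSupport ρ ∧ (∀ x, 0 ≤ ρ x) ∧ ∫ x, ρ x = 1 ∧ (∀ x, δ ≤ ‖x‖ → ρ x = 0) := by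
  let b : ContDiffBump (0 : Ed d) := ⟨δ / 2, δ, by positivity, by linarith⟩
  refine ⟨b.normed volume, b.contDiff_normed, b.hasCompactSupport_normed,
    fun x => b.nonneg_normed x, b.integral_normed, fun x hx => ?_⟩
  have h := b.support_normed_eq (μ := (volume : Measure (Ed d)))
  by_contra h1
  have h2 : x ∈ Function.support (b.normed volume) := h1
  rw [h] at h2
  have : ‖x‖ < δ := by simpa [b] using h2
  linarith

lemma appr_of_weak {p : ℝ} (hp : 2 ≤ p) {Ω : Set (Ed d)} (hΩ : IsOpen Ω) {v : Ed d → En N}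
    {gv : Ed d → Mat N d}
    (hm : ∀ K : Set (Ed d), IsCompact K → K ⊆ Ω →
            MemLp v (ENNReal.ofReal p) (volume.restrict K) ∧
            MemLp gv (ENNReal.ofReal p) (volume.restrict K))
    (hw : IsWeakGrad Ω v gv) {z : Ed d} {r : ℝ} (hr : closedBall z r ⊆ Ω) : Appr p z r v gv := by
  obtain ⟨δ, hδ, hδΩ⟩ := (isCompact_closedBall z r).exists_cthickening_subset_open hΩ hr
  obtain ⟨K, hK⟩ : ∃ K, K = cthickening δ (closedBall z r) := ⟨_, rfl⟩
  rw [← hK] at hδΩ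
  have hKc : IsCompact K := hK ▸ (isCompact_closedBall z r).cthickening
  have hKm : MeasurableSet K := hKc.measurableSet
  obtain ⟨hv, hgv⟩ := hm K hKc hδΩ
  have hV : MemLp (K.indicator v) (PP p) volume := (memLp_indicator_iff_restrict hKm).2 hv
  have hG : MemLp (K.indicator gv) (PP p) volume := (memLp_indicator_iff_restrict hKm).2 hgv
  have hVl := hV.locallyIntegrable (one_le_PP hp)
  have hGl := hG.locallyIntegrable (one_le_PP hp)
  have hδk : ∀ k : ℕ, 0 < δ / (k + 1) := fun k => by positivity
  choose ρ h1 h2 h3 h4 h5 using fun k => mol_exists d (hδk k)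
  have ht : Tendsto (fun k : ℕ => δ / ((k : ℝ) + 1)) atTop (𝓝 0) := by
    have := (tendsto_one_div_add_atTop_nhds_zero_nat (𝕜 := ℝ)).const_mul δ
    simpa [div_eq_mul_inv] using this
  have hsub : ball z r ⊆ K := hK ▸ (ball_subset_closedBall.trans (self_subset_cthickening _))
  have hL1 := (mol_lim hp h1 h2 h3 h4 h5 ht hV).mono_measure (ν := volume.restrict (ball z r))
    Measure.restrict_le_self
  have hL2 := (mol_lim hp h1 h2 h3 h4 h5 ht hG).mono_measure (ν := volume.restrict (ball z r))
    Measure.restrict_le_self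
  refine ⟨fun k => mol (ρ k) (K.indicator v), fun k => mol_smooth (h1 k) (h2 k) hVl,
    hL1.congr_fun (fun k => ae_of_all _ fun x => rfl) ?_, hL2.congr_fun (fun k => ?_) ?_⟩
  · filter_upwards [ae_restrict_mem measurableSet_ball] with x hx
    exact indicator_of_mem (hsub hx) _
  · filter_upwards [ae_restrict_mem measurableSet_ball] with x hx
    have hout : ∀ y, y ∉ K → δ / (k + 1) < ‖x - y‖ := by
      intro y hy
      by_contra hcon
      refine hy (hK ▸ mem_cthickening_of_dist_le y x δ _ (ball_subset_closedBall hx) ?_)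
      rw [dist_comm, dist_eq_norm]
      refine (not_lt.1 hcon).trans (div_le_self hδ.le ?_)
      linarith [(Nat.cast_nonneg k : (0:ℝ) ≤ k)]
    obtain ⟨ψ, hψ⟩ : ∃ ψ : Ed d → ℝ, ψ = fun y => ρ k (x - y) := ⟨_, rfl⟩
    have hψs : ContDiff ℝ (⊤ : ℕ∞) ψ := hψ ▸ (h1 k).comp (contDiff_const.sub contDiff_id)
    have hsupp : tsupport ψ ⊆ K := by
      refine closure_minimal (fun y hy => ?_) hKc.isClosed
      by_contra hyK
      exact hy (hψ ▸ h5 k _ (hout y hyK).le)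
    have hψc : HasCompactSupport ψ := hKc.of_isClosed_subset (isClosed_tsupport _) hsupp
    have hfd : ∀ (i : Fin d) y, pder ψ i y = - fderiv ℝ (ρ k) (x - y) (EuclideanSpace.single i 1) := by
      intro i y
      rw [pder, hψ]
      have e1 : HasFDerivAt (fun y => ρ k (x - y))
          ((fderiv ℝ (ρ k) (x - y)).comp (-ContinuousLinearMap.id ℝ (Ed d))) y :=
        ((h1 k).differentiable (by simp) (x - y)).hasFDerivAt.comp y
          ((hasFDerivAt_id y).const_sub x)
      rw [e1.fderiv]; simp
    ext q
    obtain ⟨a, i⟩ := q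
    rw [clGrad_apply, mol_deriv (h1 k) (h2 k) hVl]
    have hpi : Integrable fun y => (fderiv ℝ (ρ k) (x - y) (EuclideanSpace.single i 1)) •
        K.indicator v y := mol_integrable (ρ := fun y => fderiv ℝ (ρ k) y (EuclideanSpace.single i 1))
        (((h1 k).continuous_fderiv (by simp)).clm_apply continuous_const)
        (((h2 k).fderiv ℝ).comp_left (g := fun L : Ed d →L[ℝ] ℝ => L (EuclideanSpace.single i 1)) rfl) hVl x
    have hpg := mol_integrable (h1 k).continuous (h2 k) hGl x
    have t1 := (EuclideanSpace.proj a : En N →L[ℝ] ℝ).integral_comp_comm hpi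
    have t2 := (EuclideanSpace.proj (a, i) : Mat N d →L[ℝ] ℝ).integral_comp_comm hpg
    have w := hw ψ hψs hψc (hsupp.trans hδΩ) a i
    have s1 : ∫ y in Ω, v y a * pder ψ i y =
        ∫ y, - (fderiv ℝ (ρ k) (x - y) (EuclideanSpace.single i 1) * (K.indicator v y) a) := by
      rw [← integral_indicator hΩ.measurableSet]
      refine integral_congr_ae (ae_of_all _ fun y => ?_)
      by_cases hy : y ∈ K
      · simp only [indicator_of_mem (hδΩ hy), indicator_of_mem hy, hfd]; ring
      · have : pder ψ i y = 0 := by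
          rw [← gr_apply, gr_tsupport ψ (fun h => hy (hsupp h))]; rfl
        simp [hy, indicator, this]
    have s2 : ∫ y in Ω, gv y (a, i) * ψ y = ∫ y, ρ k (x - y) * (K.indicator gv y) (a, i) := by
      rw [← integral_indicator hΩ.measurableSet]
      refine integral_congr_ae (ae_of_all _ fun y => ?_)
      by_cases hy : y ∈ K
      · simp only [indicator_of_mem (hδΩ hy), indicator_of_mem hy, hψ]; ring
      · have : ψ y = 0 := by
          by_contra h; exact hy (hsupp (subset_tsupport _ h))
        simp [hy, indicator, this]
    rw [s1, s2, integral_neg, neg_inj] at w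
    simp only [PiLp.proj_apply, PiLp.smul_apply, smul_eq_mul] at t1 t2
    rw [← t1]
    refine Eq.trans t2.symm w.symm
  · filter_upwards [ae_restrict_mem measurableSet_ball] with x hx
    exact indicator_of_mem (hsub hx) _

end mollify2

section dq

variable {d N : ℕ}

lemma app_sub (a b : Mat N d) (e : Ed d) : app (a - b) e = app a e - app b e := by
  ext i; simp [app_apply, sub_mul, Finset.sum_sub_distrib]

lemma app_smul (a : Mat N d) (t : ℝ) (e : Ed d) : app a (t • e) = t • app a e := by
  ext i; simp only [app_apply, PiLp.smul_apply, smul_eq_mul, Finset.mul_sum]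
  exact Finset.sum_congr rfl fun j _ => by ring

lemma dq_smooth {p : ℝ} (hp : 2 ≤ p) {φ : Ed d → En N} (hφ : ContDiff ℝ (⊤ : ℕ∞) φ) (z e : Ed d)
    (s : ℝ) {t : ℕ → ℝ} (ht0 : ∀ n, t n ≠ 0) (ht : Tendsto t atTop (𝓝 0)) :
    LimP p (volume.restrict (ball z s)) (fun n x => (t n)⁻¹ • (φ (x + t n • e) - φ x))
      (fun x => app (clGrad φ x) e) := by
  have hd : Differentiable ℝ φ := hφ.differentiable (by simp)
  have hc1 : Continuous fun x => app (clGrad φ x) e :=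
    app_cont.comp ((clGrad_cont hφ).prodMk continuous_const)
  have hc2 : ∀ n, Continuous fun x => (t n)⁻¹ • (φ (x + t n • e) - φ x) := fun n =>
    by have := hφ.continuous; fun_prop
  obtain ⟨T, hT⟩ : ∃ T, ∀ n, |t n| ≤ T := by
    obtain ⟨T, hT⟩ := ht.abs.bddAbove_range
    exact ⟨T, fun n => hT ⟨n, rfl⟩⟩
  have hT0 : 0 ≤ T := (abs_nonneg _).trans (hT 0)
  obtain ⟨C, hC⟩ := (isCompact_closedBall z (s + T * ‖e‖)).exists_bound_of_continuousOn
    (hφ.continuous_fderiv (by simp)).continuousOn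
  refine LimP.of_int hp (memLp_ball_cont hc1 z s) (fun n => memLp_ball_cont (hc2 n) z s) ?_
  have h0 : (0:ℝ) = ∫ x in ball z s, (0:ℝ) := by simp
  rw [h0]
  refine tendsto_integral_of_dominated_convergence (fun _ => (C * ‖e‖ + C * ‖e‖) ^ p) (fun n => ?_)
    ?_ (fun n => ?_) ?_
  · exact ((((hc2 n).sub hc1).norm).rpow_const (fun _ => Or.inr (by linarith))).aestronglyMeasurable
  · exact integrableOn_const measure_ball_lt_top.ne
  · filter_upwards [ae_restrict_mem measurableSet_ball] with x hx
    have hx' : ‖x - z‖ < s := by simpa [dist_eq_norm] using hx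
    have hxm : x ∈ closedBall z (s + T * ‖e‖) := by
      simp only [mem_closedBall, dist_eq_norm]; nlinarith [norm_nonneg e, mul_nonneg hT0 (norm_nonneg e)]
    have hxm2 : x + t n • e ∈ closedBall z (s + T * ‖e‖) := by
      simp only [mem_closedBall, dist_eq_norm]
      have : x + t n • e - z = (x - z) + t n • e := by abel
      rw [this]
      refine (norm_add_le _ _).trans ?_
      rw [norm_smul, Real.norm_eq_abs]
      nlinarith [norm_nonneg e, hT n, mul_le_mul_of_nonneg_right (hT n) (norm_nonneg e)]
    have hC0 : 0 ≤ C := (norm_nonneg _).trans (hC x hxm)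
    have h1 : ‖(t n)⁻¹ • (φ (x + t n • e) - φ x)‖ ≤ C * ‖e‖ := by
      have := (convex_closedBall z (s + T * ‖e‖)).norm_image_sub_le_of_norm_fderiv_le
        (fun x _ => hd x) hC hxm hxm2
      rw [add_sub_cancel_left, norm_smul] at this
      rw [norm_smul, norm_inv, inv_mul_le_iff₀ (norm_pos_iff.2 (ht0 n))]
      linarith
    have h2 : ‖app (clGrad φ x) e‖ ≤ C * ‖e‖ := by
      rw [← fderiv_eq_app]
      exact (ContinuousLinearMap.le_opNorm _ _).trans
        (mul_le_mul_of_nonneg_right (hC x hxm) (norm_nonneg _))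
    rw [Real.norm_of_nonneg (by positivity)]
    exact Real.rpow_le_rpow (norm_nonneg _) ((norm_sub_le _ _).trans (add_le_add h1 h2)) (by linarith)
  · refine ae_of_all _ fun x => ?_
    have h1 : HasLineDerivAt ℝ φ (fderiv ℝ φ x e) x e := (hd x).hasFDerivAt.hasLineDerivAt e
    have h2 := h1.tendsto_slope_zero
    have h3 : Tendsto t atTop (𝓝[≠] 0) :=
      tendsto_nhdsWithin_iff.2 ⟨ht, Eventually.of_forall ht0⟩
    have h4 := h2.comp h3
    rw [fderiv_eq_app] at h4
    have h5 := (tendsto_iff_norm_sub_tendsto_zero.1 h4).rpow_const (p := p) (Or.inr (by linarith))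
    simpa [Real.zero_rpow (by linarith : p ≠ 0)] using h5

lemma Appr.dq {p : ℝ} (hp : 2 ≤ p) {z e : Ed d} {r s : ℝ} {u : Ed d → En N} {g : Ed d → Mat N d}
    (hu : Appr p z r u g) {t : ℕ → ℝ} (ht0 : ∀ n, t n ≠ 0) (ht : Tendsto t atTop (𝓝 0))
    (hs : ∀ n, s + ‖t n • e‖ ≤ r) :
    LimP p (volume.restrict (ball z s)) (fun n x => (t n)⁻¹ • (u (x + t n • e) - u x))
      (fun x => app (g x) e) := by
  have hsr : s ≤ r := by linarith [hs 0, norm_nonneg (t 0 • e)]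
  have hus : Appr p z s u g := hu.mono (ball_subset_ball hsr)
  have happ : ∀ {h : Ed d → Mat N d}, MemLp h (PP p) (volume.restrict (ball z s)) →
      MemLp (fun x => app (h x) e) (PP p) (volume.restrict (ball z s)) := by
    intro h hh
    refine hh.of_le_mul (c := ‖e‖) ?_ (ae_of_all _ fun x => ?_)
    · exact app_cont.comp_aestronglyMeasurable (hh.1.prodMk aestronglyMeasurable_const)
    · rw [mul_comm]; exact norm_app_le _ _
  have hm : ∀ n, MemLp (fun x => (t n)⁻¹ • (u (x + t n • e) - u x)) (PP p)
      (volume.restrict (ball z s)) := fun n =>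
    ((hu.shift (hs n)).memu.sub hus.memu).const_smul (t n)⁻¹
  refine ⟨happ hus.memg, hm, ?_⟩
  have hp1 := one_le_PP hp
  obtain ⟨φ, h1, h2, h3⟩ := id hu
  -- difference bound
  have key : ∀ k n, eLpNorm ((fun x => (t n)⁻¹ • (u (x + t n • e) - u x)) - fun x => app (g x) e)
      (PP p) (volume.restrict (ball z s)) ≤
      2 * (ENNReal.ofReal ‖e‖ * eLpNorm (clGrad (φ k) - g) (PP p) (volume.restrict (ball z r))) +
      eLpNorm ((fun x => (t n)⁻¹ • (φ k (x + t n • e) - φ k x)) - fun x => app (clGrad (φ k) x) e)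
      (PP p) (volume.restrict (ball z s)) := by
    intro k n
    have hw : Appr p z r (fun x => φ k x - u x) (fun x => clGrad (φ k) x - g x) :=
      (appr_smooth z r (h1 k)).sub hp hu
    have hm1 : MemLp (fun x => (t n)⁻¹ • (φ k (x + t n • e) - u (x + t n • e) - (φ k x - u x)))
        (PP p) (volume.restrict (ball z s)) :=
      ((hw.shift (hs n)).memu.sub (hw.mono (ball_subset_ball hsr)).memu).const_smul (t n)⁻¹
    have e1 : eLpNorm (fun x => (t n)⁻¹ • (φ k (x + t n • e) - u (x + t n • e) - (φ k x - u x)))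
        (PP p) (volume.restrict (ball z s)) ≤
        ENNReal.ofReal ‖e‖ * eLpNorm (clGrad (φ k) - g) (PP p) (volume.restrict (ball z r)) := by
      rw [eLpNorm_eq_int hp hm1]
      have : eLpNorm (clGrad (φ k) - g) (PP p) (volume.restrict (ball z r)) = _ :=
        eLpNorm_eq_int hp hw.memg
      rw [this, ← ENNReal.ofReal_mul (norm_nonneg _)]
      refine ENNReal.ofReal_le_ofReal ?_
      have e3 := hw.W1 hp (hs n)
      have e4 : ∫ x in ball z s, ‖(t n)⁻¹ • (φ k (x + t n • e) - u (x + t n • e) - (φ k x - u x))‖ ^ p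
          ≤ ‖e‖ ^ p * ∫ x in ball z r, ‖clGrad (φ k) x - g x‖ ^ p := by
        have e5 : ∀ x, ‖(t n)⁻¹ • (φ k (x + t n • e) - u (x + t n • e) - (φ k x - u x))‖ ^ p =
            (‖t n‖ ^ p)⁻¹ * ‖φ k (x + t n • e) - u (x + t n • e) - (φ k x - u x)‖ ^ p := by
          intro x
          rw [norm_smul, Real.mul_rpow (norm_nonneg _) (norm_nonneg _), norm_inv,
            Real.inv_rpow (norm_nonneg _)]
        simp_rw [e5]
        have hpos : 0 < ‖t n‖ ^ p := Real.rpow_pos_of_pos (norm_pos_iff.2 (ht0 n)) _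
        rw [integral_const_mul, inv_mul_le_iff₀ hpos]
        rw [norm_smul, Real.mul_rpow (norm_nonneg _) (norm_nonneg _), mul_assoc] at e3
        exact e3
      refine (Real.rpow_le_rpow (intp_nonneg _ _) e4 (by positivity)).trans (le_of_eq ?_)
      rw [Real.mul_rpow (by positivity) (intp_nonneg _ _), Real.rpow_rpow_inv (norm_nonneg _) (by linarith)]
      rfl
    have e2 : eLpNorm (fun x => app (clGrad (φ k) x - g x) e) (PP p) (volume.restrict (ball z s)) ≤
        ENNReal.ofReal ‖e‖ * eLpNorm (clGrad (φ k) - g) (PP p) (volume.restrict (ball z r)) := by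
      refine (eLpNorm_le_mul_eLpNorm_of_ae_le_mul (g := clGrad (φ k) - g) (c := ‖e‖)
        (ae_of_all _ fun x => ?_) _).trans ?_
      · rw [mul_comm]; exact norm_app_le _ _
      · gcongr
    have hms : MemLp ((fun x => (t n)⁻¹ • (φ k (x + t n • e) - φ k x)) - fun x => app (clGrad (φ k) x) e)
        (PP p) (volume.restrict (ball z s)) :=
      ((dq_smooth hp (h1 k) z e s ht0 ht).mem n).sub (dq_smooth hp (h1 k) z e s ht0 ht).memu
    have hma := happ (hw.mono (ball_subset_ball hsr)).memg
    have e6 : ((fun x => (t n)⁻¹ • (u (x + t n • e) - u x)) - fun x => app (g x) e) =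
        (((fun x => (t n)⁻¹ • (φ k (x + t n • e) - φ k x)) - fun x => app (clGrad (φ k) x) e) +
        fun x => app (clGrad (φ k) x - g x) e) -
        (fun x => (t n)⁻¹ • (φ k (x + t n • e) - u (x + t n • e) - (φ k x - u x))) := by
      ext1 x
      simp only [Pi.sub_apply, Pi.add_apply, app_sub, smul_sub]
      abel
    rw [e6]
    refine (eLpNorm_sub_le (hms.add hma).1 hm1.1 hp1).trans ?_
    refine (add_le_add (eLpNorm_add_le hms.1 hma.1 hp1) le_rfl).trans ?_
    refine (add_le_add (add_le_add le_rfl e2) e1).trans (le_of_eq ?_)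
    ring
  have hlim1 : Tendsto (fun k => 2 * (ENNReal.ofReal ‖e‖ *
      eLpNorm (clGrad (φ k) - g) (PP p) (volume.restrict (ball z r)))) atTop (𝓝 0) := by
    have := ENNReal.Tendsto.const_mul (ENNReal.Tendsto.const_mul h3.lim
      (Or.inr (ENNReal.ofReal_ne_top (r := ‖e‖)))) (Or.inr (ENNReal.ofNat_ne_top (n := 2)))
    simpa using this
  rw [ENNReal.tendsto_nhds_zero]
  intro ε hε
  have hε2 : 0 < ε / 2 := ENNReal.half_pos hε.ne'
  obtain ⟨k, hk⟩ := (ENNReal.tendsto_nhds_zero.1 hlim1 (ε / 2) hε2).exists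
  filter_upwards [ENNReal.tendsto_nhds_zero.1 (dq_smooth hp (h1 k) z e s ht0 ht).lim (ε / 2) hε2]
    with n hn
  exact (key k n).trans ((add_le_add hk hn).trans (by rw [ENNReal.add_halves]))

end dq

section exist

variable {d N : ℕ} {p Λ : ℝ} {f : Mat N d → Mat N d} {Bm : Ed d →L[ℝ] Ed d}

/-- complete convergence in `L^p` -/
lemma LimP.of_cauchy {X E : Type*} [MeasurableSpace X] {μ : Measure X} [NormedAddCommGroup E]
    [CompleteSpace E] {p : ℝ} (hp : 2 ≤ p) {φ : ℕ → X → E} (hφ : ∀ k, MemLp (φ k) (PP p) μ)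
    (hc : ∀ ε > 0, ∃ n, ∀ k ≥ n, ∀ l ≥ n, ∫ x, ‖φ k x - φ l x‖ ^ p ∂μ ≤ ε) :
    ∃ u, LimP p μ φ u := by
  have : Fact (1 ≤ PP p) := ⟨one_le_PP hp⟩
  have hcs : CauchySeq fun k => (hφ k).toLp (φ k) := by
    rw [EMetric.cauchySeq_iff]
    intro ε hε
    obtain ⟨ε', h0, h1⟩ : ∃ ε' : ℝ, 0 < ε' ∧ ENNReal.ofReal ε' < ε := by
      obtain ⟨q, h0, h1⟩ := ENNReal.lt_iff_exists_nnreal_btwn.1 hε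
      exact ⟨q, by exact_mod_cast h0, by simpa using h1⟩
    obtain ⟨n, hn⟩ := hc (ε' ^ p) (by positivity)
    refine ⟨n, fun k hk l hl => ?_⟩
    rw [Lp.edist_toLp_toLp, eLpNorm_eq_int hp ((hφ k).sub (hφ l))]
    refine lt_of_le_of_lt (ENNReal.ofReal_le_ofReal ?_) h1
    have := Real.rpow_le_rpow (intp_nonneg _ _) (hn k hk l hl) (z := p⁻¹) (by positivity)
    rwa [Real.rpow_rpow_inv h0.le (by linarith)] at this
  obtain ⟨L, hL⟩ := cauchySeq_tendsto_of_complete hcs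
  refine ⟨L, Lp.memLp L, hφ, ?_⟩
  have := (Lp.tendsto_Lp_iff_tendsto_eLpNorm' _ _).1 hL
  refine this.congr fun k => eLpNorm_congr_ae ?_
  filter_upwards [(hφ k).coeFn_toLp] with x hx
  simp [hx]

lemma Frozen.uconv (h : Frozen p Λ f Bm) (hp : 2 ≤ p) (hΛ : 0 < Λ) (a b : Mat N d) :
    2 * (⟪f ((1/2:ℝ) • (a + b)), (1/2:ℝ) • (a + b)⟫ / p) + 2 * Λ⁻¹ * (1/4) ^ p * ‖a - b‖ ^ p ≤
      ⟪f a, a⟫ / p + ⟪f b, b⟫ / p := by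
  have key : ∀ m c : Mat N d, ⟪f m, m⟫ / p + ⟪f m, c - m⟫ + Λ⁻¹ * (1/2) ^ p * ‖c - m‖ ^ p ≤
      ⟪f c, c⟫ / p := by
    intro m c
    obtain ⟨w, hw⟩ : ∃ w, w = (1/2:ℝ) • (m + c) := ⟨_, rfl⟩
    have h1 := h.conv m w
    have h2 := h.conv w c
    have e1 : w - m = (1/2:ℝ) • (c - m) := by rw [hw]; module
    have e2 : c - w = (1/2:ℝ) • (c - m) := by rw [hw]; module
    have h3 := h.monop hp w m
    rw [e1] at h1 h3
    rw [e2] at h2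
    rw [norm_smul, Real.mul_rpow (norm_nonneg _) (norm_nonneg _)] at h3
    have e3 : ‖(1/2:ℝ)‖ = 1/2 := by norm_num
    rw [e3, inner_sub_left] at h3
    have h4 : Λ⁻¹ * (1/2) ^ p * ‖c - m‖ ^ p ≤ ⟪f w, (1/2:ℝ) • (c - m)⟫ - ⟪f m, (1/2:ℝ) • (c - m)⟫ := by
      rw [mul_assoc, inv_mul_le_iff₀ hΛ]; exact h3
    have e4 : ⟪f m, (1/2:ℝ) • (c - m)⟫ = (1/2) * ⟪f m, c - m⟫ := by
      rw [real_inner_smul_right]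
    linarith
  obtain ⟨m, hm⟩ : ∃ m, m = (1/2:ℝ) • (a + b) := ⟨_, rfl⟩
  have h1 := key m a
  have h2 := key m b
  have e1 : a - m = (1/2:ℝ) • (a - b) := by rw [hm]; module
  have e2 : b - m = -((1/2:ℝ) • (a - b)) := by rw [hm]; module
  rw [e1] at h1
  rw [e2, inner_neg_right, norm_neg] at h2
  rw [norm_smul, Real.mul_rpow (norm_nonneg _) (norm_nonneg _)] at h1 h2
  have e3 : ‖(1/2:ℝ)‖ = 1/2 := by norm_num
  have e5 : (1/4:ℝ) ^ p = (1/2) ^ p * (1/2) ^ p := by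
    rw [← Real.mul_rpow (by norm_num) (by norm_num)]; norm_num
  rw [e3] at h1 h2
  rw [← hm, e5]
  linarith

lemma Frozen.phi_int {X : Type*} [MeasurableSpace X] {μ : Measure X} (h : Frozen p Λ f Bm)
    (hp : 2 ≤ p) {g : X → Mat N d} (hg : MemLp g (PP p) μ) :
    Integrable (fun x => ⟪f (g x), g x⟫ / p) μ :=
  (dual_integrable hp (h.memDual hp hg) hg).div_const p

lemma poincare0 (hp : 2 ≤ p) (hd : 1 ≤ d) {z : Ed d} {r : ℝ} (hr : 0 < r) {φ : Ed d → En N}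
    (h1 : ContDiff ℝ (⊤ : ℕ∞) φ) (h3 : tsupport φ ⊆ ball z r) :
    ∫ x in ball z r, ‖φ x‖ ^ p ≤ (2 * r) ^ p * ∫ x in ball z r, ‖clGrad φ x‖ ^ p := by
  obtain ⟨e, he⟩ : ∃ e : Ed d, ‖e‖ = 2 * r :=
    ⟨EuclideanSpace.single ⟨0, hd⟩ (2 * r), by simp [abs_of_pos hr]⟩
  have hw := (appr_smooth (p := p) z (r + 2 * r) h1).W1 hp (h := e) (s := r) (by rw [he])
  rw [he] at hw
  have e1 : ∫ x in ball z r, ‖φ (x + e) - φ x‖ ^ p = ∫ x in ball z r, ‖φ x‖ ^ p := by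
    refine setIntegral_congr_fun measurableSet_ball fun x hx => ?_
    have : φ (x + e) = 0 := by
      refine image_eq_zero_of_notMem_tsupport fun hh => ?_
      have h4 := h3 hh
      simp only [mem_ball, dist_eq_norm] at h4 hx
      have : e = (x + e - z) - (x - z) := by abel
      have h5 : ‖e‖ ≤ ‖x + e - z‖ + ‖x - z‖ := by
        conv_lhs => rw [this]
        exact norm_sub_le _ _
      linarith
    simp only [this, zero_sub, norm_neg]
  rw [e1] at hw
  refine hw.trans (le_of_eq ?_)
  congr 1
  refine setIntegral_eq_of_subset_of_forall_sdiff_eq_zero measurableSet_ball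
    (ball_subset_ball (by linarith)) fun x hx => ?_
  rw [clGrad_tsupport φ fun hh => hx.2 (h3 hh), norm_zero, Real.zero_rpow (by linarith)]

/-- existence of the comparison map -/
lemma comparison_exists (h : Frozen p Λ f Bm) (hp : 2 ≤ p) (hΛ : 0 < Λ) (hd : 1 ≤ d) {z : Ed d}
    {r : ℝ} (hr : 0 < r) {v : Ed d → En N} {gv : Ed d → Mat N d} (hv : Appr p z r v gv) :
    ∃ u g, Appr p z r u g ∧ Sol f z r g ∧ TestG p z r (fun x => g x - gv x) := by
  let T : Set (Ed d → En N) := {φ | ContDiff ℝ (⊤ : ℕ∞) φ ∧ HasCompactSupport φ ∧ tsupport φ ⊆ ball z r}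
  let J : (Ed d → En N) → ℝ := fun φ =>
    ∫ x in ball z r, ⟪f (gv x + clGrad φ x), gv x + clGrad φ x⟫ / p
  have hmem : ∀ φ ∈ T, MemLp (fun x => gv x + clGrad φ x) (PP p) (volume.restrict (ball z r)) :=
    fun φ hφ => hv.memg.add (memLp_ball_cont (clGrad_cont hφ.1) z r)
  have hpos : ∀ a : Mat N d, 0 ≤ ⟪f a, a⟫ / p := fun a => by
    have h1 := h.coer hp a
    have h2 : 0 ≤ ‖a‖ ^ p := by positivity
    exact div_nonneg (by_contra fun hn => by nlinarith) (by linarith)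
  have hJ0 : ∀ φ, 0 ≤ J φ := fun φ => integral_nonneg fun x => hpos _
  have hT0 : (fun _ => 0 : Ed d → En N) ∈ T :=
    ⟨contDiff_const, HasCompactSupport.zero, by
      have : tsupport (fun _ => 0 : Ed d → En N) = ∅ := tsupport_eq_empty_iff.2 rfl
      rw [this]; exact empty_subset _⟩
  have hTadd : ∀ φ ∈ T, ∀ ψ ∈ T, (fun x => φ x + ψ x) ∈ T := fun φ hφ ψ hψ =>
    ⟨hφ.1.add hψ.1, hφ.2.1.add hψ.2.1, (tsupport_add φ ψ).trans (union_subset hφ.2.2 hψ.2.2)⟩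
  have hTsmul : ∀ (c : ℝ), ∀ φ ∈ T, (fun x => c • φ x) ∈ T := fun c φ hφ =>
    ⟨hφ.1.const_smul c, hφ.2.1.smul_left (f := fun _ => c),
      (tsupport_smul_subset_right (fun _ => c) φ).trans hφ.2.2⟩
  have hbdd : BddBelow (J '' T) := ⟨0, by rintro _ ⟨φ, -, rfl⟩; exact hJ0 φ⟩
  have hne : (J '' T).Nonempty := ⟨_, _, hT0, rfl⟩
  obtain ⟨m, hm⟩ : ∃ m, m = sInf (J '' T) := ⟨_, rfl⟩
  have hle : ∀ φ ∈ T, m ≤ J φ := fun φ hφ => hm ▸ csInf_le hbdd ⟨φ, hφ, rfl⟩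
  have hex : ∀ k : ℕ, ∃ φ ∈ T, J φ < m + 1 / ((k : ℝ) + 1) := fun k => by
    have h1 : sInf (J '' T) < m + 1 / ((k : ℝ) + 1) := by
      rw [← hm]; have : 0 < 1 / ((k : ℝ) + 1) := by positivity
      linarith
    obtain ⟨_, ⟨φ, hφ, rfl⟩, h2⟩ := exists_lt_of_csInf_lt hne h1
    exact ⟨φ, hφ, h2⟩
  choose φ hφT hφJ using hex
  have hlim0 := tendsto_one_div_add_atTop_nhds_zero_nat (𝕜 := ℝ)
  -- Cauchy
  have hc0 : 0 < Λ * 4 ^ p := by positivity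
  have hcau : ∀ k l, ∫ x in ball z r, ‖clGrad (φ k) x - clGrad (φ l) x‖ ^ p ≤
      Λ * 4 ^ p * (1 / ((k : ℝ) + 1) + 1 / ((l : ℝ) + 1)) := by
    intro k l
    obtain ⟨ψ, hψ⟩ : ∃ ψ : Ed d → En N, ψ = fun x => (1/2:ℝ) • (φ k x + φ l x) := ⟨_, rfl⟩
    have hψT : ψ ∈ T := hψ ▸ hTsmul (1/2) _ (hTadd _ (hφT k) _ (hφT l))
    have hgψ : ∀ x, gv x + clGrad ψ x =
        (1/2:ℝ) • ((gv x + clGrad (φ k) x) + (gv x + clGrad (φ l) x)) := by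
      intro x
      rw [hψ, clGrad_const_smul _ ((hφT k).1.add (hφT l).1), clGrad_add (hφT k).1 (hφT l).1]
      module
    have hml : MemLp (fun x => clGrad (φ k) x - clGrad (φ l) x) (PP p) (volume.restrict (ball z r)) :=
      (memLp_ball_cont (clGrad_cont (hφT k).1) z r).sub (memLp_ball_cont (clGrad_cont (hφT l).1) z r)
    have hi := int_le3 (c1 := 1) (c2 := 1) (c3 := -2) (memLp_int hp hml |>.const_mul (2 * Λ⁻¹ * (1/4) ^ p))
      (h.phi_int hp (hmem _ (hφT k))) (h.phi_int hp (hmem _ (hφT l))) (h.phi_int hp (hmem _ hψT))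
      (ae_of_all _ fun x => by
        have := h.uconv hp hΛ (gv x + clGrad (φ k) x) (gv x + clGrad (φ l) x)
        rw [← hgψ x, add_sub_add_left_eq_sub] at this
        linarith)
    rw [integral_const_mul] at hi
    have h1 := hle ψ hψT
    have h2 := hφJ k
    have h3 := hφJ l
    simp only [J] at h1 h2 h3
    have e4 : Λ * 4 ^ p * (Λ⁻¹ * (1/4) ^ p) = 1 := by
      rw [one_div, Real.inv_rpow (by norm_num)]
      field_simp
    have h5 : (2 * Λ⁻¹ * (1/4) ^ p) * ∫ x in ball z r, ‖clGrad (φ k) x - clGrad (φ l) x‖ ^ p ≤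
        1 / ((k : ℝ) + 1) + 1 / ((l : ℝ) + 1) := by linarith
    have h6 := mul_le_mul_of_nonneg_left h5 hc0.le
    have h7 : Λ * 4 ^ p * ((2 * Λ⁻¹ * (1/4) ^ p) *
        ∫ x in ball z r, ‖clGrad (φ k) x - clGrad (φ l) x‖ ^ p) =
        2 * ∫ x in ball z r, ‖clGrad (φ k) x - clGrad (φ l) x‖ ^ p := by
      linear_combination (2 * ∫ x in ball z r, ‖clGrad (φ k) x - clGrad (φ l) x‖ ^ p) * e4
    have h8 : 0 ≤ ∫ x in ball z r, ‖clGrad (φ k) x - clGrad (φ l) x‖ ^ p := intp_nonneg _ _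
    linarith
  have hsmall : ∀ C : ℝ, 0 < C → ∀ ε > 0, ∃ n : ℕ, ∀ k ≥ n, ∀ l ≥ n,
      C * (1 / ((k : ℝ) + 1) + 1 / ((l : ℝ) + 1)) ≤ ε := by
    intro C hC ε hε
    obtain ⟨n, hn⟩ := eventually_atTop.1 (hlim0.eventually (gt_mem_nhds (show 0 < ε / (2 * C) by positivity)))
    refine ⟨n, fun k hk l hl => ?_⟩
    have := hn k hk
    have := hn l hl
    have e : C * (ε / (2 * C) + ε / (2 * C)) = ε := by field_simp; ring
    rw [← e]
    gcongr
  obtain ⟨W, hW⟩ := LimP.of_cauchy (μ := volume.restrict (ball z r)) hp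
    (φ := fun k => clGrad (φ k)) (fun k => memLp_ball_cont (clGrad_cont (hφT k).1) z r)
    (fun ε hε => by
      obtain ⟨n, hn⟩ := hsmall _ hc0 ε hε
      exact ⟨n, fun k hk l hl => (hcau k l).trans (hn k hk l hl)⟩)
  obtain ⟨w, hw⟩ := LimP.of_cauchy (μ := volume.restrict (ball z r)) hp
    (φ := φ) (fun k => memLp_ball_cont ((hφT k).1.continuous) z r)
    (fun ε hε => by
      obtain ⟨n, hn⟩ := hsmall ((2 * r) ^ p * (Λ * 4 ^ p)) (by positivity) ε hε
      refine ⟨n, fun k hk l hl => le_trans ?_ (hn k hk l hl)⟩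
      have hT : (fun x => φ k x - φ l x) ∈ T := by
        have := hTadd _ (hφT k) _ (hTsmul (-1) _ (hφT l))
        simpa [sub_eq_add_neg] using this
      refine (poincare0 hp hd hr hT.1 hT.2.2).trans ?_
      rw [mul_assoc]
      refine mul_le_mul_of_nonneg_left ?_ (by positivity)
      refine le_trans (le_of_eq ?_) (hcau k l)
      simp_rw [clGrad_sub (hφT k).1 (hφT l).1])
  have hgl : LimP p (volume.restrict (ball z r)) (fun k x => gv x + clGrad (φ k) x)
      (fun x => gv x + W x) := (LimP.const hv.memg).add hp hW
  -- Euler-Lagrange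
  have hEL : ∀ ψ ∈ T, 0 ≤ ∫ x in ball z r, ⟪f (gv x + W x), clGrad ψ x⟫ := by
    intro ψ hψ
    have hψm : MemLp (clGrad ψ) (PP p) (volume.restrict (ball z r)) :=
      memLp_ball_cont (clGrad_cont hψ.1) z r
    have step : ∀ t : ℝ, 0 < t → 0 ≤ ∫ x in ball z r, ⟪f ((gv x + W x) + t • clGrad ψ x), clGrad ψ x⟫ := by
      intro t ht
      have hl : LimP p (volume.restrict (ball z r)) (fun k x => (gv x + clGrad (φ k) x) + t • clGrad ψ x)
          (fun x => (gv x + W x) + t • clGrad ψ x) := hgl.add hp (LimP.const (hψm.const_smul t))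
      have hlim := h.limdiff hΛ.le hp hl hψm
      have hbd : ∀ k : ℕ, -(t⁻¹ * (1 / ((k : ℝ) + 1))) ≤
          ∫ x in ball z r, ⟪f ((gv x + clGrad (φ k) x) + t • clGrad ψ x), clGrad ψ x⟫ := by
        intro k
        have hT2 : (fun x => φ k x + t • ψ x) ∈ T := hTadd _ (hφT k) _ (hTsmul t _ hψ)
        have hgg : ∀ x, gv x + clGrad (fun x => φ k x + t • ψ x) x =
            (gv x + clGrad (φ k) x) + t • clGrad ψ x := by
          intro x
          rw [clGrad_add (hφT k).1 (hψ.1.const_smul t), clGrad_const_smul t hψ.1, add_assoc]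
        have h1 := hle _ hT2
        have h2 := hφJ k
        simp only [J, hgg] at h1 h2
        have hi := int_le2 (c1 := 1) (c2 := t) (h.phi_int hp (hl.mem k)) (h.phi_int hp (hmem _ (hφT k)))
          (dual_integrable hp (h.memDual hp (hl.mem k)) hψm)
          (ae_of_all _ fun x => by
            have := h.conv ((gv x + clGrad (φ k) x) + t • clGrad ψ x) (gv x + clGrad (φ k) x)
            have e1 : gv x + clGrad (φ k) x - ((gv x + clGrad (φ k) x) + t • clGrad ψ x) =
              -(t • clGrad ψ x) := by abel
            rw [e1, inner_neg_right, real_inner_smul_right] at this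
            linarith)
        have h5 : -(1 / ((k : ℝ) + 1)) ≤ t * ∫ x in ball z r,
          ⟪f ((gv x + clGrad (φ k) x) + t • clGrad ψ x), clGrad ψ x⟫ := by linarith
        rw [← mul_neg, inv_mul_le_iff₀ ht]
        exact h5
      have hl0 : Tendsto (fun k : ℕ => -(t⁻¹ * (1 / ((k : ℝ) + 1)))) atTop (𝓝 0) := by
        simpa using (hlim0.const_mul t⁻¹).neg
      exact le_of_tendsto_of_tendsto' hl0 hlim hbd
    have hl : LimP p (volume.restrict (ball z r))
        (fun (k : ℕ) x => (gv x + W x) + (1 / ((k : ℝ) + 1)) • clGrad ψ x) (fun x => gv x + W x) := by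
      refine ⟨hgl.memu, fun k => hgl.memu.add (hψm.const_smul (1 / ((k : ℝ) + 1))), ?_⟩
      have e1 : ∀ k : ℕ, eLpNorm ((fun x => (gv x + W x) + (1 / ((k : ℝ) + 1)) • clGrad ψ x) -
          fun x => gv x + W x) (PP p) (volume.restrict (ball z r)) =
          ENNReal.ofReal (1 / ((k : ℝ) + 1)) * eLpNorm (clGrad ψ) (PP p) (volume.restrict (ball z r)) := by
        intro k
        have : ((fun x => (gv x + W x) + (1 / ((k : ℝ) + 1)) • clGrad ψ x) - fun x => gv x + W x) =
            (1 / ((k : ℝ) + 1)) • clGrad ψ := by ext1 x; simp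
        rw [this, eLpNorm_const_smul, Real.enorm_eq_ofReal (by positivity)]
      simp_rw [e1]
      have := ENNReal.Tendsto.mul_const (ENNReal.tendsto_ofReal hlim0) (Or.inr hψm.2.ne)
      simpa using this
    exact ge_of_tendsto' (h.limdiff hΛ.le hp hl hψm) fun k => step _ (by positivity)
  obtain ⟨vk, hv1, hv2, hv3⟩ := hv
  refine ⟨fun x => v x + w x, fun x => gv x + W x, ⟨fun k x => vk k x + φ k x,
    fun k => (hv1 k).add (hφT k).1, hv2.add hp hw, ?_⟩, ?_, ⟨φ, fun k => (hφT k).1,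
    fun k => (hφT k).2.1, fun k => (hφT k).2.2, ?_⟩⟩
  · refine (hv3.add hp hW).congr_fun (fun k => ae_of_all _ fun x => ?_) (ae_of_all _ fun x => rfl)
    exact (clGrad_add (hv1 k) (hφT k).1 x).symm
  · intro ψ h1 h2 h3
    refine le_antisymm ?_ (hEL ψ ⟨h1, h2, h3⟩)
    have := hEL _ (hTsmul (-1) ψ ⟨h1, h2, h3⟩)
    simp only [clGrad_const_smul (-1) h1, real_inner_smul_right, integral_const_mul] at this
    linarith
  · refine hW.congr_fun (fun k => ae_of_all _ fun x => rfl) (ae_of_all _ fun x => ?_)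
    simp

end exist

section comp

variable {d N : ℕ} {p Λ : ℝ} {f : Mat N d → Mat N d} {Bm : Ed d →L[ℝ] Ed d}

lemma dual_young_eps (hp : 2 ≤ p) {θ : ℝ} (hθ : 0 < θ) : ∃ K, 0 ≤ K ∧ ∀ a b : ℝ, 0 ≤ a → 0 ≤ b →
    a * b ≤ θ * b ^ p + K * a ^ (p / (p - 1)) := by
  obtain ⟨κ, hκ⟩ : ∃ κ, κ = θ ^ p⁻¹ := ⟨_, rfl⟩
  have hκ0 : 0 < κ := hκ ▸ Real.rpow_pos_of_pos hθ _
  have hκp : κ ^ p = θ := by rw [hκ, Real.rpow_inv_rpow hθ.le (by linarith)]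
  refine ⟨(κ⁻¹) ^ (p / (p - 1)), by positivity, fun a b ha hb => ?_⟩
  have := dual_young hp (a := κ⁻¹ * a) (b := κ * b) (by positivity) (by positivity)
  rw [Real.mul_rpow (by positivity) ha, Real.mul_rpow (by positivity) hb, hκp] at this
  have e : κ⁻¹ * a * (κ * b) = a * b := by field_simp
  linarith

lemma TestG.pair_eq (hp : 2 ≤ p) {z : Ed d} {r : ℝ} {a G h : Ed d → Mat N d}
    (ha : MemLp a (QQ p) (volume.restrict (ball z r)))
    (hG : MemLp G (QQ p) (volume.restrict (ball z r)))
    (heq : ∀ φ : Ed d → En N, ContDiff ℝ (⊤ : ℕ∞) φ → HasCompactSupport φ → tsupport φ ⊆ ball z r →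
      ∫ x in ball z r, ⟪a x, clGrad φ x⟫ = ∫ x in ball z r, ⟪G x, clGrad φ x⟫)
    (hh : TestG p z r h) :
    ∫ x in ball z r, ⟪a x, h x⟫ = ∫ x in ball z r, ⟪G x, h x⟫ := by
  obtain ⟨φ, h1, h2, h3, h4⟩ := hh
  refine tendsto_nhds_unique (h4.pair hp ha) ?_
  refine (h4.pair hp hG).congr fun k => ?_
  rw [heq (φ k) (h1 k) (h2 k) (h3 k)]

lemma comparison (hp : 2 ≤ p) (hΛ : 0 < Λ) (hd : 1 ≤ d) : ∃ C, 0 ≤ C ∧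
    ∀ (f : Mat N d → Mat N d) (Bm : Ed d →L[ℝ] Ed d), Frozen p Λ f Bm →
    ∀ (z : Ed d) (r ε K : ℝ) (v : Ed d → En N) (gv a G : Ed d → Mat N d), 0 < r → 0 ≤ ε →
    Λ * ε ≤ 1 / 4 → 0 ≤ K → Appr p z r v gv →
    MemLp a (QQ p) (volume.restrict (ball z r)) →
    MemLp G (QQ p) (volume.restrict (ball z r)) →
    (∀ φ : Ed d → En N, ContDiff ℝ (⊤ : ℕ∞) φ → HasCompactSupport φ → tsupport φ ⊆ ball z r →
      ∫ x in ball z r, ⟪a x, clGrad φ x⟫ = ∫ x in ball z r, ⟪G x, clGrad φ x⟫) →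
    (∀ᵐ x ∂volume.restrict (ball z r), ‖f (gv x) - a x‖ ≤ ε * ‖gv x‖ ^ (p - 1) + K) →
    ∃ u g, Appr p z r u g ∧ Sol f z r g ∧ ∫ x in ball z r, ‖gv x - g x‖ ^ p ≤
      2 * Λ * ε * (∫ x in ball z r, ‖gv x‖ ^ p) +
      C * ∫ x in ball z r, (K + ‖G x‖) ^ (p / (p - 1)) := by
  obtain ⟨K0, hK0, hK⟩ := dual_young_eps (p := p) hp (θ := 1 / (4 * Λ)) (by positivity)
  refine ⟨2 * (Λ * K0), by positivity, ?_⟩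
  intro f Bm h z r ε K v gv a G hr hε hε4 hK1 hv ha hG heq hle
  obtain ⟨u, g, hu, hs, ht⟩ := comparison_exists h hp hΛ hd hr hv
  refine ⟨u, g, hu, hs, ?_⟩
  have hgm := hu.memg
  have hvm := hv.memg
  have htm : MemLp (fun x => gv x - g x) (PP p) (volume.restrict (ball z r)) := hvm.sub hgm
  have e1 := hs.test h hp hgm ht
  have e2 := ht.pair_eq hp ha hG heq
  have hfg := h.memDual hp hgm
  have hfv := h.memDual hp hvm
  have i1 := dual_integrable hp hfg htm
  have i2 := dual_integrable hp hfv htm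
  have i3 := dual_integrable hp ha htm
  have i4 := dual_integrable hp hG htm
  have e1' : ∫ x in ball z r, ⟪f (g x), gv x - g x⟫ = 0 := by
    have : ∀ x, ⟪f (g x), gv x - g x⟫ = - ⟪f (g x), g x - gv x⟫ := fun x => by
      rw [← inner_neg_right, neg_sub]
    simp_rw [this, integral_neg, e1, neg_zero]
  have e2' : ∫ x in ball z r, ⟪a x, gv x - g x⟫ = ∫ x in ball z r, ⟪G x, gv x - g x⟫ := by
    have : ∀ (b : Ed d → Mat N d) x, ⟪b x, gv x - g x⟫ = - ⟪b x, g x - gv x⟫ := fun b x => by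
      rw [← inner_neg_right, neg_sub]
    simp_rw [this, integral_neg, e2]
  have iK : Integrable (fun x => (K + ‖G x‖) ^ (p / (p - 1))) (volume.restrict (ball z r)) := by
    have : IsFiniteMeasure (volume.restrict (ball z r)) := ⟨by simpa using measure_ball_lt_top⟩
    have hc : MemLp (fun _ : Ed d => K) (QQ p) (volume.restrict (ball z r)) :=
      memLp_const (μ := volume.restrict (ball z r)) K
    have := dual_int hp (hc.add hG.norm)
    refine this.congr (ae_of_all _ fun x => ?_)
    simp only [Pi.add_apply]
    rw [Real.norm_of_nonneg (by positivity)]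
  have ih := memLp_int hp htm
  have iv := memLp_int hp hvm
  -- pointwise
  have hpt : ∀ᵐ x ∂volume.restrict (ball z r), (1/2:ℝ) * ‖gv x - g x‖ ^ p ≤
      (Λ * ε) * ‖gv x‖ ^ p + (Λ * K0) * (K + ‖G x‖) ^ (p / (p - 1)) +
      Λ * (⟪a x, gv x - g x⟫ - ⟪G x, gv x - g x⟫) + (-Λ) * ⟪f (g x), gv x - g x⟫ := by
    filter_upwards [hle] with x hx
    have h1 := h.monop hp (gv x) (g x)
    rw [inner_sub_left] at h1
    have h2 : ⟪f (gv x) - a x, gv x - g x⟫ ≤ (ε * ‖gv x‖ ^ (p - 1) + K) * ‖gv x - g x‖ :=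
      (real_inner_le_norm _ _).trans (mul_le_mul_of_nonneg_right hx (norm_nonneg _))
    rw [inner_sub_left] at h2
    have h3 := real_inner_le_norm (G x) (gv x - g x)
    have h4 := young2 hp (norm_nonneg (gv x)) (norm_nonneg (gv x - g x))
    have h5 := hK (K + ‖G x‖) ‖gv x - g x‖ (by positivity) (norm_nonneg _)
    have h6 : ⟪f (gv x), gv x - g x⟫ ≤ ε * (‖gv x‖ ^ p + ‖gv x - g x‖ ^ p) +
        (1 / (4 * Λ) * ‖gv x - g x‖ ^ p + K0 * (K + ‖G x‖) ^ (p / (p - 1))) +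
        ⟪a x, gv x - g x⟫ - ⟪G x, gv x - g x⟫ := by
      have := mul_le_mul_of_nonneg_left h4 hε
      have h7 := (abs_le.1 (abs_real_inner_le_norm (G x) (gv x - g x))).1
      nlinarith
    have h8 := mul_le_mul_of_nonneg_left h6 hΛ.le
    have e5 : Λ * (1 / (4 * Λ) * ‖gv x - g x‖ ^ p) = 1/4 * ‖gv x - g x‖ ^ p := by field_simp
    have h9 : Λ * ε * ‖gv x - g x‖ ^ p ≤ 1/4 * ‖gv x - g x‖ ^ p :=
      mul_le_mul_of_nonneg_right hε4 (by positivity)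
    nlinarith
  have hi := int_le4 (ih.const_mul (1/2)) iv iK (i3.sub i4) i1 hpt
  have e6 : ∫ x in ball z r, ((fun x => ⟪a x, gv x - g x⟫) - fun x => ⟪G x, gv x - g x⟫) x = 0 := by
    rw [integral_sub' i3 i4, e2', sub_self]
  rw [integral_const_mul, e1', e6] at hi
  linarith

end comp

section stepA

variable {d N : ℕ} {p Λ : ℝ}

lemma cutoff (d : ℕ) : ∃ C, 0 ≤ C ∧ ∀ (z : Ed d) (ρ : ℝ), 0 < ρ → ∃ ζ : Ed d → ℝ,
    ContDiff ℝ (⊤ : ℕ∞) (fun x => ζ x ^ 2) ∧ HasCompactSupport (fun x => ζ x ^ 2) ∧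
    tsupport (fun x => ζ x ^ 2) ⊆ ball z (7 / 8 * ρ) ∧ Continuous ζ ∧
    (∀ x, 0 ≤ ζ x) ∧ (∀ x, ζ x ≤ 1) ∧ (∀ x ∈ ball z (ρ / 2), ζ x = 1) ∧
    ∀ x, ‖gr (fun x => ζ x ^ 2) x‖ ≤ C / ρ * ζ x := by
  let b : ContDiffBump (0 : Ed d) := ⟨1 / 2, 3 / 4, by norm_num, by norm_num⟩
  have hbs : ContDiff ℝ (⊤ : ℕ∞) b := b.contDiff
  obtain ⟨C, hC0, hC⟩ := cpt_bdd (hbs.continuous_fderiv (by simp)) (b.hasCompactSupport.fderiv ℝ)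
  refine ⟨2 * C, by positivity, fun z ρ hρ => ?_⟩
  obtain ⟨ζ, hζ⟩ : ∃ ζ : Ed d → ℝ, ζ = fun x => b (ρ⁻¹ • (x - z)) := ⟨_, rfl⟩
  have hζs : ContDiff ℝ (⊤ : ℕ∞) ζ :=
    hζ ▸ hbs.comp ((contDiff_id.sub contDiff_const).const_smul ρ⁻¹)
  have hout : ∀ x, 3 / 4 * ρ < ‖x - z‖ → ζ x = 0 := by
    intro x hx
    rw [hζ]
    refine b.zero_of_le_dist ?_
    rw [dist_zero_right, norm_smul, norm_inv, Real.norm_of_nonneg hρ.le]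
    change (3 / 4 : ℝ) ≤ _
    rw [le_inv_mul_iff₀ hρ]; linarith
  have hsub : tsupport (fun x => ζ x ^ 2) ⊆ closedBall z (3 / 4 * ρ) := by
    refine closure_minimal (fun x hx => ?_) isClosed_closedBall
    rw [mem_closedBall, dist_eq_norm]
    by_contra hcon
    exact hx (by simp [hout x (not_le.1 hcon)])
  refine ⟨ζ, hζs.pow 2, (isCompact_closedBall z _).of_isClosed_subset (isClosed_tsupport _) hsub,
    hsub.trans (closedBall_subset_ball (by linarith)), hζs.continuous,
    fun x => hζ ▸ b.nonneg, fun x => hζ ▸ b.le_one, fun x hx => ?_, fun x => ?_⟩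
  · rw [hζ]
    refine b.one_of_mem_closedBall ?_
    rw [mem_ball, dist_eq_norm] at hx
    rw [mem_closedBall, dist_zero_right, norm_smul, norm_inv, Real.norm_of_nonneg hρ.le]
    change _ ≤ (1 / 2 : ℝ)
    rw [inv_mul_le_iff₀ hρ]; linarith
  · have h1 : HasFDerivAt (fun x : Ed d => ρ⁻¹ • (x - z)) (ρ⁻¹ • ContinuousLinearMap.id ℝ (Ed d)) x :=
      ((hasFDerivAt_id x).sub_const z).const_smul ρ⁻¹
    have h2 : HasFDerivAt ζ ((fderiv ℝ b (ρ⁻¹ • (x - z))).comp (ρ⁻¹ • ContinuousLinearMap.id ℝ (Ed d))) x := by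
      rw [hζ]
      exact ((hbs.differentiable (by simp) _).hasFDerivAt).comp x h1
    have h3 := h2.pow 2
    refine (norm_gr_le _ _).trans ?_
    rw [h3.fderiv]
    have hn : 0 ≤ ζ x := hζ ▸ b.nonneg
    have h4 : ‖(fderiv ℝ b (ρ⁻¹ • (x - z))).comp (ρ⁻¹ • ContinuousLinearMap.id ℝ (Ed d))‖ ≤ C / ρ := by
      rw [ContinuousLinearMap.comp_smul, ContinuousLinearMap.comp_id, norm_smul, norm_inv,
        Real.norm_of_nonneg hρ.le, inv_mul_eq_div]
      gcongr
      exact hC _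
    rw [norm_smul]
    have h5 : ‖2 • ζ x ^ (2 - 1)‖ = 2 * ζ x := by
      simp [abs_of_nonneg hn]
    rw [h5]
    calc 2 * ζ x * _ ≤ 2 * ζ x * (C / ρ) := mul_le_mul_of_nonneg_left h4 (by positivity)
      _ = 2 * C / ρ * ζ x := by ring

lemma stepA_alg {k sp P s I1 I2 c w h ap bp wp hp2 T L : ℝ} (h8 : k ^ 2 * sp ≤ k ^ 2 * (P * s ^ 2))
    (h9 : k ^ 2 * (P * s ^ 2) ≤ k ^ 2 * (L * I1))
    (h10 : 2 * (L * ((L * (P * s)) * (w * (c * k)))) ≤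
        k ^ 2 * (P * s ^ 2) + L ^ 4 * c ^ 2 * (P * w ^ 2))
    (h11 : L ^ 4 * c ^ 2 * (P * w ^ 2) ≤ L ^ 4 * c ^ 2 * (h ^ 2 * (T * (ap + bp) + 2 * (hp2 * wp))))
    (h12 : L * (-((L * (P * s)) * (w * (c * k)))) ≤ L * I2) :
    k ^ 2 * sp ≤ (2 * L) * (k ^ 2 * I1 + I2) + (L ^ 4 * c ^ 2 * h ^ 2 * T) * ap +
      (L ^ 4 * c ^ 2 * h ^ 2 * T) * bp + (L ^ 4 * c ^ 2 * h ^ 2 * 2 * hp2) * wp := by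
  linarith

set_option maxHeartbeats 1000000 in
lemma stepA (hp : 2 ≤ p) (hΛ : 0 < Λ) : ∃ C, 0 ≤ C ∧
    ∀ (f : Mat N d → Mat N d) (Bm : Ed d →L[ℝ] Ed d), Frozen p Λ f Bm →
    ∀ (z h : Ed d) (ρ : ℝ) (u : Ed d → En N) (g : Ed d → Mat N d), 0 < ρ → Appr p z ρ u g →
    Sol f z ρ g → ‖h‖ ≤ ρ / 8 →
    ∫ x in ball z (ρ / 2), ‖g (x + h) - g x‖ ^ p ≤
      C * (‖h‖ / ρ) ^ 2 * ∫ x in ball z ρ, ‖g x‖ ^ p := by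
  obtain ⟨C0, hC0, hcut⟩ := cutoff d
  refine ⟨Λ ^ 4 * C0 ^ 2 * (2 * 2 ^ p + 2), by positivity, ?_⟩
  intro f Bm hf z h ρ u g hρ hu hs hh
  by_cases h0 : h = 0
  · simp [h0, Real.zero_rpow (by linarith : p ≠ 0)]
  have hh0 : 0 < ‖h‖ := norm_pos_iff.2 h0
  obtain ⟨ζ, z1, z2, z3, z4, z5, z6, z7, z8⟩ := hcut z ρ hρ
  have hsh : 7 / 8 * ρ + ‖h‖ ≤ ρ := by linarith
  have hsub : ball z (7 / 8 * ρ) ⊆ ball z ρ := ball_subset_ball (by linarith)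
  have hu0 := hu.mono hsub
  have hu1 := hu.shift hsh
  have hw := hu1.sub hp hu0
  have hs0 := hs.mono hsub
  have hs1 := hs.shift hsh
  have htest := hw.prod hp z1 z2 z3
  have hg0 := hu0.memg
  have hg1 := hu1.memg
  have t0 := hs0.test hf hp hg0 htest
  have t1 := hs1.test hf hp hg1 htest
  have htm : MemLp (fun x => ζ x ^ 2 • (g (x + h) - g x) +
      tens (u (x + h) - u x) (gr (fun x => ζ x ^ 2) x)) (PP p) (volume.restrict (ball z (7/8 * ρ))) := by
    obtain ⟨φ, _, _, _, hl⟩ := htest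
    exact hl.memu
  have i0 := dual_integrable hp (hf.memDual hp hg0) htm
  have i1 := dual_integrable hp (hf.memDual hp hg1) htm
  have iw := memLp_int hp hw.memu
  have iw1 := memLp_int hp hg1
  have iw0 := memLp_int hp hg0
  have igw := memLp_int hp hw.memg
  have iz : Integrable (fun x => ζ x ^ 2 * ‖g (x + h) - g x‖ ^ p) (volume.restrict (ball z (7/8 * ρ))) := by
    refine igw.bdd_mul (c := 1) (z4.pow 2).aestronglyMeasurable (ae_of_all _ fun x => ?_)
    rw [Real.norm_of_nonneg (by positivity)]
    have := z5 x; have := z6 x; nlinarith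
  obtain ⟨c, hc⟩ : ∃ c, c = C0 / ρ := ⟨_, rfl⟩
  have hc0 : 0 ≤ c := hc ▸ by positivity
  have hpt : ∀ x, ζ x ^ 2 * ‖g (x + h) - g x‖ ^ p ≤
      (2 * Λ) * (⟪f (g (x + h)), ζ x ^ 2 • (g (x + h) - g x) +
        tens (u (x + h) - u x) (gr (fun x => ζ x ^ 2) x)⟫ -
        ⟪f (g x), ζ x ^ 2 • (g (x + h) - g x) +
        tens (u (x + h) - u x) (gr (fun x => ζ x ^ 2) x)⟫) +
      (Λ ^ 4 * c ^ 2 * ‖h‖ ^ 2 * 2 ^ p) * ‖g (x + h)‖ ^ p +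
      (Λ ^ 4 * c ^ 2 * ‖h‖ ^ 2 * 2 ^ p) * ‖g x‖ ^ p +
      (Λ ^ 4 * c ^ 2 * ‖h‖ ^ 2 * 2 * (‖h‖ ^ p)⁻¹) * ‖u (x + h) - u x‖ ^ p := by
    intro x
    obtain ⟨a, ha⟩ : ∃ a, a = g (x + h) := ⟨_, rfl⟩
    obtain ⟨b, hb⟩ : ∃ b, b = g x := ⟨_, rfl⟩
    obtain ⟨w, hw'⟩ : ∃ w, w = u (x + h) - u x := ⟨_, rfl⟩
    obtain ⟨k, hk⟩ : ∃ k, k = ζ x := ⟨_, rfl⟩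
    obtain ⟨G, hG⟩ : ∃ G, G = gr (fun x => ζ x ^ 2) x := ⟨_, rfl⟩
    have hz8 := z8 x
    have hk0 := z5 x
    rw [← ha, ← hb, ← hw', ← hk, ← hG]
    rw [← hG, ← hk, ← hc] at hz8
    rw [← hk] at hk0
    obtain ⟨m, hm⟩ : ∃ m, m = ‖a‖ + ‖b‖ := ⟨_, rfl⟩
    obtain ⟨P, hP⟩ : ∃ P, P = m ^ (p - 2) := ⟨_, rfl⟩
    obtain ⟨s, hs'⟩ : ∃ s, s = ‖a - b‖ := ⟨_, rfl⟩
    have hm0 : 0 ≤ m := hm ▸ by positivity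
    have hP0 : 0 ≤ P := hP ▸ by positivity
    have hs0' : 0 ≤ s := hs' ▸ norm_nonneg _
    have hsm : s ≤ m := hs' ▸ hm ▸ norm_sub_le a b
    have h1 := hf.mono a b
    have h2 := hf.lip a b
    rw [← hm, ← hP, ← hs'] at h1 h2
    have h3 : s ^ p ≤ P * s ^ 2 := by
      rw [← rpow_two_split hp hs0', hP]
      gcongr
    have h4 : ⟪f a, k ^ 2 • (a - b) + tens w G⟫ - ⟪f b, k ^ 2 • (a - b) + tens w G⟫ =
        k ^ 2 * ⟪f a - f b, a - b⟫ + ⟪f a - f b, tens w G⟫ := by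
      rw [← inner_sub_left, inner_add_right, real_inner_smul_right]
    have h5 : |⟪f a - f b, tens w G⟫| ≤ (Λ * (P * s)) * (‖w‖ * (c * k)) := by
      refine (abs_real_inner_le_norm _ _).trans ?_
      rw [norm_tens]
      gcongr
    have h6 := (abs_le.1 h5).1
    have h7 : P * ‖w‖ ^ 2 ≤ ‖h‖ ^ 2 * (2 ^ p * (‖a‖ ^ p + ‖b‖ ^ p) + 2 * ((‖h‖ ^ p)⁻¹ * ‖w‖ ^ p)) := by
      have e1 := young3 hp hm0 (b := ‖h‖⁻¹ * ‖w‖) (c := ‖h‖⁻¹ * ‖w‖) (by positivity) (by positivity)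
      rw [Real.mul_rpow (by positivity) (by positivity), Real.inv_rpow (by positivity), ← hP] at e1
      have e2 := add_rpow_le hp (norm_nonneg a) (norm_nonneg b)
      rw [← hm] at e2
      have e3 : P * ‖w‖ ^ 2 = ‖h‖ ^ 2 * (P * (‖h‖⁻¹ * ‖w‖) * (‖h‖⁻¹ * ‖w‖)) := by field_simp
      rw [e3]
      refine mul_le_mul_of_nonneg_left ?_ (by positivity)
      linarith
    rw [← hs']
    rw [h4]
    have h8 : k ^ 2 * s ^ p ≤ k ^ 2 * (P * s ^ 2) := mul_le_mul_of_nonneg_left h3 (by positivity)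
    have h9 : k ^ 2 * (P * s ^ 2) ≤ k ^ 2 * (Λ * ⟪f a - f b, a - b⟫) :=
      mul_le_mul_of_nonneg_left h1 (by positivity)
    have h10 : 2 * (Λ * ((Λ * (P * s)) * (‖w‖ * (c * k)))) ≤
        k ^ 2 * (P * s ^ 2) + Λ ^ 4 * c ^ 2 * (P * ‖w‖ ^ 2) := by
      have e1 := mul_nonneg hP0 (sq_nonneg (k * s - Λ ^ 2 * c * ‖w‖))
      nlinarith
    have h11 := mul_le_mul_of_nonneg_left h7 (show 0 ≤ Λ ^ 4 * c ^ 2 by positivity)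
    have h12 := mul_le_mul_of_nonneg_left h6 hΛ.le
    exact stepA_alg h8 h9 h10 h11 h12
  have hi := int_le4 iz (i1.sub i0) iw1 iw0 iw (ae_of_all _ hpt)
  have e0 : ∫ x in ball z (7/8 * ρ), ((fun x => ⟪f (g (x + h)), ζ x ^ 2 • (g (x + h) - g x) +
        tens (u (x + h) - u x) (gr (fun x => ζ x ^ 2) x)⟫) - fun x =>
        ⟪f (g x), ζ x ^ 2 • (g (x + h) - g x) +
        tens (u (x + h) - u x) (gr (fun x => ζ x ^ 2) x)⟫) x = 0 := by
    rw [integral_sub' i1 i0, t0, t1, sub_zero]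
  rw [e0] at hi
  obtain ⟨I, hI⟩ : ∃ I, I = ∫ x in ball z ρ, ‖g x‖ ^ p := ⟨_, rfl⟩
  have hI0 : 0 ≤ I := hI ▸ intp_nonneg _ _
  have b1 : ∫ x in ball z (7/8 * ρ), ‖g x‖ ^ p ≤ I := hI ▸
    setIntegral_mono_set (memLp_int hp hu.memg) (ae_of_all _ fun x => by positivity)
      hsub.eventuallyLE
  have b2 : ∫ x in ball z (7/8 * ρ), ‖g (x + h)‖ ^ p ≤ I := by
    have := shift_lint_le (z := z) hsh (F := fun x => ‖g x‖ₑ ^ p)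
    rw [lint_eq_int hp hg1, lint_eq_int hp hu.memg, ← hI] at this
    exact (ENNReal.ofReal_le_ofReal_iff hI0).1 this
  have b3 := hu.W1 hp hsh
  rw [← hI] at b3
  have b4 : ∫ x in ball z (ρ / 2), ‖g (x + h) - g x‖ ^ p ≤
      ∫ x in ball z (7/8 * ρ), ζ x ^ 2 * ‖g (x + h) - g x‖ ^ p := by
    have : ∫ x in ball z (ρ / 2), ‖g (x + h) - g x‖ ^ p =
        ∫ x in ball z (ρ / 2), ζ x ^ 2 * ‖g (x + h) - g x‖ ^ p :=
      setIntegral_congr_fun measurableSet_ball fun x hx => by simp [z7 x hx]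
    rw [this]
    exact setIntegral_mono_set iz (ae_of_all _ fun x => by
      have := z5 x
      positivity)
      (ball_subset_ball (by linarith)).eventuallyLE
  have hhp : 0 < ‖h‖ ^ p := by positivity
  obtain ⟨D, hD⟩ : ∃ D, D = Λ ^ 4 * c ^ 2 * ‖h‖ ^ 2 := ⟨_, rfl⟩
  have hD0 : 0 ≤ D := hD ▸ by positivity
  rw [← hD] at hi
  have c1 := mul_le_mul_of_nonneg_left b2 (show 0 ≤ D * 2 ^ p by positivity)
  have c2 := mul_le_mul_of_nonneg_left b1 (show 0 ≤ D * 2 ^ p by positivity)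
  have c3 : D * 2 * (‖h‖ ^ p)⁻¹ * ∫ x in ball z (7/8 * ρ), ‖u (x + h) - u x‖ ^ p ≤ D * 2 * I := by
    have := mul_le_mul_of_nonneg_left b3 (show 0 ≤ D * 2 * (‖h‖ ^ p)⁻¹ by positivity)
    refine this.trans (le_of_eq ?_)
    field_simp
  have e5 : Λ ^ 4 * C0 ^ 2 * (2 * 2 ^ p + 2) * (‖h‖ / ρ) ^ 2 * I = D * (2 * 2 ^ p + 2) * I := by
    rw [hD, hc]; field_simp
  rw [← hI, e5]
  linarith

end stepA

section innervar

variable {d N : ℕ} {p Λ : ℝ} {f : Mat N d → Mat N d} {Bm : Ed d →L[ℝ] Ed d}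

/-- difference quotients of a test function against an integrable function -/
lemma dq_dom {η : Ed d → ℝ} (h1 : ContDiff ℝ (⊤ : ℕ∞) η) (h2 : HasCompactSupport η) (e : Ed d)
    {Φ : Ed d → ℝ} (hΦ : Integrable Φ) {t : ℕ → ℝ} (ht0 : ∀ n, t n ≠ 0)
    (ht : Tendsto t atTop (𝓝 0)) :
    Tendsto (fun n => ∫ x, ((t n)⁻¹ * (η (x - t n • e) - η x)) * Φ x) atTop
      (𝓝 (∫ x, (-⟪gr η x, e⟫) * Φ x)) := by
  obtain ⟨K, hK⟩ := h1.lipschitzWith_of_hasCompactSupport h2 (by simp)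
  refine tendsto_integral_of_dominated_convergence (fun x => (K * ‖e‖) * ‖Φ x‖) ?_
    (hΦ.norm.const_mul _) ?_ ?_
  · intro n
    refine AEStronglyMeasurable.mul ?_ hΦ.1
    have := h1.continuous
    exact (by fun_prop : Continuous fun x => (t n)⁻¹ * (η (x - t n • e) - η x)).aestronglyMeasurable
  · intro n
    refine ae_of_all _ fun x => ?_
    rw [norm_mul, norm_mul]
    refine mul_le_mul_of_nonneg_right ?_ (norm_nonneg _)
    have h3 := hK.dist_le_mul (x - t n • e) x
    rw [dist_eq_norm, dist_eq_norm, sub_sub_cancel_left, norm_neg, norm_smul] at h3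
    have h4 : 0 < ‖t n‖ := norm_pos_iff.2 (ht0 n)
    rw [norm_inv, inv_mul_le_iff₀ h4]
    linarith
  · refine ae_of_all _ fun x => ?_
    refine Tendsto.mul_const _ ?_
    have hd : HasDerivAt (fun s : ℝ => η (x - s • e)) (-⟪gr η x, e⟫) 0 := by
      have h5 : HasFDerivAt η (fderiv ℝ η x) (x - (0:ℝ) • e) := by
        simpa using (h1.differentiable (by simp) x).hasFDerivAt
      have h6 : HasDerivAt (fun s : ℝ => x - s • e) (-e) 0 := by
        have := ((hasDerivAt_id (0:ℝ)).smul_const e).const_sub x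
        simpa using this
      have h7 := h5.comp_hasDerivAt (0:ℝ) h6
      have h7' : fderiv ℝ η x (-e) = -⟪gr η x, e⟫ := by rw [map_neg, fderiv_eq_gr]
      rw [← h7']
      exact h7
    have h8 := hd.tendsto_slope_zero
    have h9 : Tendsto t atTop (𝓝[≠] 0) := tendsto_nhdsWithin_iff.2 ⟨ht, Eventually.of_forall ht0⟩
    have h10 := h8.comp h9
    simpa [Function.comp_def] using h10

set_option maxHeartbeats 1000000 in
lemma inner_var_le (hp : 2 ≤ p) (hf : Frozen p Λ f Bm) {z : Ed d} {r' r : ℝ} (hr : r' < r)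
    {u : Ed d → En N} {g : Ed d → Mat N d} (hu : Appr p z r u g) (hs : Sol f z r g) {η : Ed d → ℝ}
    (h1 : ContDiff ℝ (⊤ : ℕ∞) η) (h2 : HasCompactSupport η) (h3 : tsupport η ⊆ ball z r')
    (h0 : ∀ x, 0 ≤ η x) (e : Ed d) :
    ∫ x in ball z r, (⟪f (g x), g x⟫ / p) * ⟪gr η x, e⟫ ≤
      ∫ x in ball z r, ⟪f (g x), tens (app (g x) e) (gr η x)⟫ := by
  obtain ⟨ε, hε, hεe⟩ : ∃ ε > 0, r' + ε * ‖e‖ ≤ r := by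
    refine ⟨(r - r') / (‖e‖ + 1), div_pos (by linarith) (by positivity), ?_⟩
    have : (r - r') / (‖e‖ + 1) * ‖e‖ ≤ (r - r') := by
      rw [div_mul_eq_mul_div, div_le_iff₀ (by positivity)]
      nlinarith [norm_nonneg e]
    linarith
  obtain ⟨t, ht⟩ : ∃ t : ℕ → ℝ, t = fun n : ℕ => ε / ((n:ℝ) + 1) := ⟨_, rfl⟩
  have htp : ∀ n, 0 < t n := fun n => by rw [ht]; positivity
  have htl : Tendsto t atTop (𝓝 0) := by
    rw [ht]
    have := (tendsto_one_div_add_atTop_nhds_zero_nat (𝕜 := ℝ)).const_mul ε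
    simpa [div_eq_mul_inv] using this
  have hts : ∀ n, r' + ‖t n • e‖ ≤ r := fun n => by
    rw [norm_smul, Real.norm_of_nonneg (htp n).le]
    have : t n ≤ ε := by
      rw [ht]; exact div_le_self hε.le (by have : (0:ℝ) ≤ n := n.cast_nonneg
                                           linarith)
    nlinarith [norm_nonneg e]
  have hsub : ball z r' ⊆ ball z r := ball_subset_ball hr.le
  have hu0 := hu.mono hsub
  have hs0 := hs.mono hsub
  have hg0 := hu0.memg
  have hD := hf.memDual hp hg0
  obtain ⟨Cη, hCη, hCη'⟩ := cpt_bdd h1.continuous h2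
  obtain ⟨Cg, hCg, hCg'⟩ := cpt_bdd (gr_cont h1) (gr_cpt h2)
  obtain ⟨Φ, hΦ⟩ : ∃ Φ : Ed d → ℝ, Φ = (ball z r).indicator (fun x => ⟪f (g x), g x⟫ / p) := ⟨_, rfl⟩
  have hΦi : Integrable Φ := by
    rw [hΦ, integrable_indicator_iff measurableSet_ball]
    exact hf.phi_int hp hu.memg
  have key : ∀ n, -∫ x in ball z r', ⟪f (g x), tens ((t n)⁻¹ • (u (x + t n • e) - u x)) (gr η x)⟫ ≤
      ∫ x, ((t n)⁻¹ * (η (x - t n • e) - η x)) * Φ x := by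
    intro n
    have hu1 := hu.shift (hts n)
    have hw := hu1.sub hp hu0
    have htest := hw.prod hp h1 h2 h3
    have t0 := hs0.test hf hp hg0 htest
    have hg1 := hu1.memg
    have m1 : MemLp (fun x => tens (u (x + t n • e) - u x) (gr η x)) (PP p)
        (volume.restrict (ball z r')) :=
      ((LimP.const hw.memu).tens_bdd (gr_cont h1).aestronglyMeasurable hCg').memu
    have i1 := dual_integrable hp hD m1
    have i2 : Integrable (fun x => η x * (⟪f (g x), (g (x + t n • e) - g x)⟫))
        (volume.restrict (ball z r')) :=
      (dual_integrable hp hD hw.memg).bdd_mul (c := Cη) h1.continuous.aestronglyMeasurable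
        (ae_of_all _ hCη')
    have i3 : Integrable (fun x => η x * (⟪f (g (x + t n • e)), g (x + t n • e)⟫ / p))
        (volume.restrict (ball z r')) :=
      (hf.phi_int hp hg1).bdd_mul (c := Cη) h1.continuous.aestronglyMeasurable
        (ae_of_all _ hCη')
    have i4 : Integrable (fun x => η x * (⟪f (g x), g x⟫ / p))
        (volume.restrict (ball z r')) :=
      (hf.phi_int hp hg0).bdd_mul (c := Cη) h1.continuous.aestronglyMeasurable
        (ae_of_all _ hCη')
    have e1 : ∫ x in ball z r', ⟪f (g x), tens (u (x + t n • e) - u x) (gr η x)⟫ =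
        - ∫ x in ball z r', η x * (⟪f (g x), (g (x + t n • e) - g x)⟫) := by
      simp only [inner_add_right, real_inner_smul_right] at t0
      rw [integral_add i2 i1] at t0
      linarith
    have e2 : ∫ x in ball z r', ⟪f (g x), tens ((t n)⁻¹ • (u (x + t n • e) - u x)) (gr η x)⟫ =
        (t n)⁻¹ * ∫ x in ball z r', ⟪f (g x), tens (u (x + t n • e) - u x) (gr η x)⟫ := by
      rw [← integral_const_mul]
      refine integral_congr_ae (ae_of_all _ fun x => ?_)
      simp only [inner_tens, real_inner_smul_right]
    have e3 : ∫ x in ball z r', η x * (⟪f (g x), (g (x + t n • e) - g x)⟫) ≤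
        (∫ x in ball z r', η x * (⟪f (g (x + t n • e)), g (x + t n • e)⟫ / p)) -
        ∫ x in ball z r', η x * (⟪f (g x), g x⟫ / p) := by
      rw [← integral_sub i3 i4]
      refine integral_mono i2 (i3.sub i4) fun x => ?_
      have := mul_le_mul_of_nonneg_left (hf.conv (g x) (g (x + t n • e))) (h0 x)
      simp only
      linarith
    have hz : ∀ x, x ∉ ball z r' → η x = 0 := fun x hx => image_eq_zero_of_notMem_tsupport
      fun h => hx (h3 h)
    have e4 : ∫ x in ball z r', η x * (⟪f (g x), g x⟫ / p) = ∫ x, η x * Φ x := by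
      refine Eq.trans ?_ (setIntegral_eq_integral_of_forall_compl_eq_zero (s := ball z r')
        (fun x hx => by rw [hz x hx, zero_mul]))
      refine setIntegral_congr_fun measurableSet_ball fun x hx => ?_
      simp only [hΦ]
      rw [indicator_of_mem (hsub hx)]
    have e5 : ∫ x in ball z r', η x * (⟪f (g (x + t n • e)), g (x + t n • e)⟫ / p) =
        ∫ x, η (x - t n • e) * Φ x := by
      rw [← integral_add_right_eq_self (fun x => η (x - t n • e) * Φ x) (t n • e)]
      refine Eq.trans ?_ (setIntegral_eq_integral_of_forall_compl_eq_zero (s := ball z r')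
        (fun x hx => by rw [add_sub_cancel_right, hz x hx, zero_mul]))
      refine setIntegral_congr_fun measurableSet_ball fun x hx => ?_
      simp only [hΦ, add_sub_cancel_right]
      have hmem : x + t n • e ∈ ball z r := by
        have := hts n
        rw [mem_ball, dist_eq_norm] at hx ⊢
        have h9 : x + t n • e - z = (x - z) + t n • e := by abel
        rw [h9]
        exact lt_of_le_of_lt (norm_add_le _ _) (by linarith)
      rw [indicator_of_mem hmem]
    have i5 : Integrable (fun x => η x * Φ x) := hΦi.bdd_mul (c := Cη)
      h1.continuous.aestronglyMeasurable (ae_of_all _ hCη')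
    have i6 : Integrable (fun x => η (x - t n • e) * Φ x) := hΦi.bdd_mul (c := Cη)
      (h1.continuous.comp (continuous_id.sub continuous_const)).aestronglyMeasurable
        (ae_of_all _ fun x => hCη' _)
    have e6 : ∫ x, ((t n)⁻¹ * (η (x - t n • e) - η x)) * Φ x =
        (t n)⁻¹ * ((∫ x, η (x - t n • e) * Φ x) - ∫ x, η x * Φ x) := by
      rw [← integral_sub i6 i5, ← integral_const_mul]
      congr 1; ext x; ring
    rw [e6, e2, e1, ← e4, ← e5]
    have := mul_le_mul_of_nonneg_left e3 (inv_nonneg.2 (htp n).le)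
    linarith
  have l1 := dq_dom h1 h2 e hΦi (fun n => (htp n).ne') htl
  have l2 := (LimP.pair hp hD ((hu.dq hp (fun n => (htp n).ne') htl hts).tens_bdd
    (gr_cont h1).aestronglyMeasurable hCg')).neg
  have l3 := le_of_tendsto_of_tendsto' l2 l1 key
  have hzg : ∀ x, x ∉ ball z r' → gr η x = 0 := fun x hx => gr_tsupport _ fun h => hx (h3 h)
  have f1 : ∫ x in ball z r, (⟪f (g x), g x⟫ / p) * ⟪gr η x, e⟫ = ∫ x, ⟪gr η x, e⟫ * Φ x := by
    refine Eq.trans ?_ (setIntegral_eq_integral_of_forall_compl_eq_zero (s := ball z r)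
        (fun x hx => by rw [hzg x (fun h => hx (hsub h)), inner_zero_left, zero_mul]))
    refine setIntegral_congr_fun measurableSet_ball fun x hx => ?_
    simp only [hΦ]
    rw [indicator_of_mem hx, mul_comm]
  have f2 : ∫ x in ball z r, ⟪f (g x), tens (app (g x) e) (gr η x)⟫ =
      ∫ x in ball z r', ⟪f (g x), tens (app (g x) e) (gr η x)⟫ := by
    refine (setIntegral_eq_of_subset_of_forall_sdiff_eq_zero measurableSet_ball hsub
      fun x hx => ?_)
    rw [hzg x hx.2, inner_tens]
    have : app (f (g x)) 0 = 0 := by ext a; simp [app_apply]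
    rw [this, inner_zero_left]
  rw [f1, f2]
  have f3 : ∫ x, (-⟪gr η x, e⟫) * Φ x = -∫ x, ⟪gr η x, e⟫ * Φ x := by
    rw [← integral_neg]; congr 1; ext x; ring
  rw [f3] at l3
  linarith

lemma inner_var (hp : 2 ≤ p) (hf : Frozen p Λ f Bm) {z : Ed d} {r' r : ℝ} (hr : r' < r)
    {u : Ed d → En N} {g : Ed d → Mat N d} (hu : Appr p z r u g) (hs : Sol f z r g) {η : Ed d → ℝ}
    (h1 : ContDiff ℝ (⊤ : ℕ∞) η) (h2 : HasCompactSupport η) (h3 : tsupport η ⊆ ball z r')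
    (h0 : ∀ x, 0 ≤ η x) (e : Ed d) :
    ∫ x in ball z r, ⟪f (g x), tens (app (g x) e) (gr η x)⟫ =
    ∫ x in ball z r, (⟪f (g x), g x⟫ / p) * ⟪gr η x, e⟫ := by
  have a1 := inner_var_le hp hf hr hu hs h1 h2 h3 h0 e
  have a2 := inner_var_le hp hf hr hu hs h1 h2 h3 h0 (-e)
  have b1 : ∀ x, ⟪f (g x), tens (app (g x) (-e)) (gr η x)⟫ =
      -⟪f (g x), tens (app (g x) e) (gr η x)⟫ := by
    intro x
    rw [inner_tens, inner_tens, ← inner_neg_right]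
    congr 1; ext a; simp [app_apply]
  simp only [b1, inner_neg_right, mul_neg, integral_neg] at a2
  linarith

end innervar

section domvar

variable {d N : ℕ} {p Λ : ℝ} {f : Mat N d → Mat N d} {Bm : Ed d →L[ℝ] Ed d}

lemma memLp_app {p : ℝ} {X : Type*} [MeasurableSpace X] {μ : Measure X}
    {g : X → Mat N d} (hg : MemLp g (PP p) μ) {e : X → Ed d}
    (he : AEStronglyMeasurable e μ) {C : ℝ} (hC : ∀ᵐ x ∂μ, ‖e x‖ ≤ C) :
    MemLp (fun x => app (g x) (e x)) (PP p) μ := by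
  refine hg.of_le_mul (c := C) (app_cont.comp_aestronglyMeasurable (hg.1.prodMk he))
    (hC.mono fun x hx => ?_)
  refine (norm_app_le _ _).trans ?_
  rw [mul_comm]
  exact mul_le_mul_of_nonneg_right hx (norm_nonneg _)

lemma app_zero_right (m : Mat N d) : app m (0 : Ed d) = 0 := by ext a; simp [app_apply]
lemma app_add_right (m : Mat N d) (x y : Ed d) : app m (x + y) = app m x + app m y := by
  ext a; simp [app_apply, mul_add, Finset.sum_add_distrib]

lemma gr_smul_add {a ψ : Ed d → ℝ} (ha : ContDiff ℝ (⊤ : ℕ∞) a) (hψ : ContDiff ℝ (⊤ : ℕ∞) ψ)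
    (x : Ed d) : gr (fun x => a x * ψ x) x = a x • gr ψ x + ψ x • gr a x := by
  refine ext_inner_right ℝ fun h => ?_
  rw [← fderiv_eq_gr, inner_add_left, real_inner_smul_left, real_inner_smul_left, ← fderiv_eq_gr,
    ← fderiv_eq_gr, fderiv_fun_mul (ha.differentiable (by simp) x) (hψ.differentiable (by simp) x)]
  simp

lemma domain_var (hp : 2 ≤ p) (hf : Frozen p Λ f Bm) {y : Ed d} {r' ρ : ℝ} (hr : r' < ρ)
    {u : Ed d → En N} {g : Ed d → Mat N d} (hu : Appr p y ρ u g) (hs : Sol f y ρ g) {ψ : Ed d → ℝ}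
    (h1 : ContDiff ℝ (⊤ : ℕ∞) ψ) (h2 : HasCompactSupport ψ) (h3 : tsupport ψ ⊆ ball y r')
    (h0 : ∀ x, 0 ≤ ψ x) :
    ∫ x in ball y ρ, (⟪f (g x), tens (app (g x) (x - y)) (gr ψ x)⟫ -
      (⟪f (g x), g x⟫ / p) * ⟪gr ψ x, x - y⟫ + (p - d) * ((⟪f (g x), g x⟫ / p) * ψ x)) = 0 := by
  obtain ⟨e, he⟩ : ∃ e : Fin d → Ed d, e = fun k => EuclideanSpace.single k (1:ℝ) := ⟨_, rfl⟩
  obtain ⟨M, hM⟩ : ∃ M : Fin d → Ed d → Ed d → ℝ, M = fun k x v =>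
      ⟪f (g x), tens (app (g x) (e k)) v⟫ - (⟪f (g x), g x⟫ / p) * ⟪v, e k⟫ := ⟨_, rfl⟩
  have hD := hf.memDual hp hu.memg
  have hi : ∀ (ζ : Ed d → ℝ), ContDiff ℝ (⊤ : ℕ∞) ζ → HasCompactSupport ζ → ∀ k,
      Integrable (fun x => M k x (gr ζ x)) (volume.restrict (ball y ρ)) ∧
      (tsupport ζ ⊆ ball y r' → (∀ x, 0 ≤ ζ x) → ∫ x in ball y ρ, M k x (gr ζ x) = 0) := by
    intro ζ a1 a2 k
    obtain ⟨C, hC, hC'⟩ := cpt_bdd (gr_cont a1) (gr_cpt a2)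
    have i1 : Integrable (fun x => ⟪f (g x), tens (app (g x) (e k)) (gr ζ x)⟫)
        (volume.restrict (ball y ρ)) :=
      dual_integrable hp hD ((LimP.const (memLp_app hu.memg aestronglyMeasurable_const
        (ae_of_all _ fun _ => le_rfl))).tens_bdd (gr_cont a1).aestronglyMeasurable hC').memu
    have i2 : Integrable (fun x => (⟪f (g x), g x⟫ / p) * ⟪gr ζ x, e k⟫)
        (volume.restrict (ball y ρ)) := by
      refine (hf.phi_int hp hu.memg).mul_bdd (c := C * ‖e k‖)
        ((gr_cont a1).inner continuous_const).aestronglyMeasurable (ae_of_all _ fun x => ?_)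
      exact (norm_inner_le_norm _ _).trans (by gcongr; exact hC' x)
    refine ⟨by rw [hM]; exact i1.sub i2, fun a3 a4 => ?_⟩
    rw [hM]
    simp only
    rw [integral_sub i1 i2, inner_var hp hf hr hu hs a1 a2 a3 a4, sub_self]
  obtain ⟨X, hX⟩ : ∃ X : Fin d → Ed d → ℝ, X = fun k x => x k - y k + r' := ⟨_, rfl⟩
  have hXs : ∀ k, ContDiff ℝ (⊤ : ℕ∞) (X k) := fun k => by
    rw [hX]
    have : ContDiff ℝ (⊤ : ℕ∞) (fun x : Ed d => x k) := contDiff_piLp_apply 2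
    fun_prop
  have hXg : ∀ k x, gr (X k) x = e k := by
    intro k x
    refine ext_inner_right ℝ fun h => ?_
    rw [← fderiv_eq_gr]
    have : HasFDerivAt (X k) (EuclideanSpace.proj k : Ed d →L[ℝ] ℝ) x := by
      rw [hX]
      exact (((EuclideanSpace.proj k : Ed d →L[ℝ] ℝ).hasFDerivAt (x := x)).sub_const _).add_const _
    rw [this.fderiv, he]
    simp [EuclideanSpace.inner_single_left]
  have hk : ∀ k, Integrable (fun x => (x k - y k) * M k x (gr ψ x) + ψ x * M k x (e k))
      (volume.restrict (ball y ρ)) ∧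
      ∫ x in ball y ρ, ((x k - y k) * M k x (gr ψ x) + ψ x * M k x (e k)) = 0 := by
    intro k
    have b1 : ContDiff ℝ (⊤ : ℕ∞) (fun x => X k x * ψ x) := (hXs k).mul h1
    have b2 : HasCompactSupport (fun x => X k x * ψ x) := h2.mul_left
    have b3 : tsupport (fun x => X k x * ψ x) ⊆ ball y r' :=
      (tsupport_mul_subset_right (f := X k) (g := ψ)).trans h3
    have b4 : ∀ x, 0 ≤ X k x * ψ x := by
      intro x
      by_cases hx : x ∈ ball y r'
      · refine mul_nonneg ?_ (h0 x)
        have := PiLp.norm_apply_le (x - y) k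
        rw [mem_ball, dist_eq_norm] at hx
        have h4 : |(x - y) k| < r' := lt_of_le_of_lt this hx
        have h5 := (abs_lt.1 h4).1
        simp only [PiLp.sub_apply] at h5
        rw [hX]; simp only; linarith
      · rw [image_eq_zero_of_notMem_tsupport fun h => hx (h3 h), mul_zero]
    obtain ⟨c1, c2⟩ := hi _ b1 b2 k
    obtain ⟨c3, c4⟩ := hi _ h1 h2 k
    have hfe : (fun x => (x k - y k) * M k x (gr ψ x) + ψ x * M k x (e k)) =
        fun x => M k x (gr (fun x => X k x * ψ x) x) - r' * M k x (gr ψ x) := by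
      ext x
      rw [gr_smul_add (hXs k) h1, hXg, hM, hX]
      simp only [inner_tens, app_add_right, app_smul, inner_add_left, real_inner_smul_left]
      ring
    rw [hfe]
    refine ⟨c1.sub (c3.const_mul _), ?_⟩
    rw [integral_sub c1 (c3.const_mul _), integral_const_mul, c2 b3 b4, c4 h3 h0]
    simp
  have hsum := integral_finsetSum Finset.univ (fun k _ => (hk k).1)
  simp only [(hk _).2, Finset.sum_const_zero] at hsum
  rw [← hsum]
  refine integral_congr_ae (ae_of_all _ fun x => ?_)
  simp only
  rw [Finset.sum_add_distrib, ← Finset.mul_sum, hM]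
  simp only [mul_sub, Finset.sum_sub_distrib]
  have s1 : ∑ k, (x k - y k) * ⟪f (g x), tens (app (g x) (e k)) (gr ψ x)⟫ =
      ⟪f (g x), tens (app (g x) (x - y)) (gr ψ x)⟫ := by
    have : app (g x) (x - y) = ∑ k, (x k - y k) • app (g x) (e k) := by
      ext a
      simp [app_apply, he, mul_comm]
    rw [inner_tens, this, inner_sum]
    refine Finset.sum_congr rfl fun k _ => ?_
    rw [inner_tens, real_inner_smul_right]
  have s2 : ∑ k, (x k - y k) * (⟪f (g x), g x⟫ / p * ⟪gr ψ x, e k⟫) =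
      ⟪f (g x), g x⟫ / p * ⟪gr ψ x, x - y⟫ := by
    rw [inner_mat (gr ψ x) (x - y), Finset.mul_sum]
    refine Finset.sum_congr rfl fun k _ => ?_
    rw [he]; simp [EuclideanSpace.inner_single_right]; ring
  have s3 : ∑ k, ⟪f (g x), tens (app (g x) (e k)) (e k)⟫ = ⟪f (g x), g x⟫ := by
    rw [← inner_sum]
    congr 1
    ext ⟨a, j⟩
    simp [tens_apply, app_apply, he, Finset.sum_apply]
  have s4 : ∀ k, ⟪e k, e k⟫ = (1:ℝ) := fun k => by rw [he]; simp [EuclideanSpace.inner_single_left]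
  rw [s1, s2, s3]
  simp only [s4, Finset.sum_const, Finset.card_univ, Fintype.card_fin, nsmul_eq_mul]
  have : p ≠ 0 := by linarith
  field_simp

/-- one-dimensional cutoff profile -/
structure Chi (χ : ℝ → ℝ) (K : ℝ) : Prop where
  smooth : ContDiff ℝ (⊤ : ℕ∞) χ
  K0 : 0 ≤ K
  nonneg : ∀ s, 0 ≤ χ s
  le_one : ∀ s, χ s ≤ 1
  one : ∀ s, s ≤ 1 / 2 → χ s = 1
  zero : ∀ s, 1 ≤ s → χ s = 0
  dneg : ∀ s, deriv χ s ≤ 0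
  dzero : ∀ s, 1 < s → deriv χ s = 0
  dbd : ∀ s, |deriv χ s| ≤ K
  anti : Antitone χ

lemma chi_exists : ∃ (χ : ℝ → ℝ) (K : ℝ), Chi χ K := by
  obtain ⟨χ, hχ⟩ : ∃ χ : ℝ → ℝ, χ = fun s => Real.smoothTransition (2 - 2 * s) := ⟨_, rfl⟩
  have h1 : ContDiff ℝ (⊤ : ℕ∞) χ := by
    rw [hχ]
    exact Real.smoothTransition.contDiff.comp (by fun_prop)
  have hmono : Antitone χ := by
    rw [hχ]
    intro a b hab
    exact Real.smoothTransition.monotone (by linarith)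
  have h5 : ∀ s, s ≤ 1 / 2 → χ s = 1 := fun s hs => by
    rw [hχ]; exact Real.smoothTransition.one_of_one_le (by linarith)
  have h6 : ∀ s, 1 ≤ s → χ s = 0 := fun s hs => by
    rw [hχ]; exact Real.smoothTransition.zero_of_nonpos (by linarith)
  have hd1 : ∀ s, 1 < s → deriv χ s = 0 := fun s hs => by
    have : χ =ᶠ[𝓝 s] fun _ => 0 := by
      filter_upwards [lt_mem_nhds hs] with x hx using h6 x hx.le
    rw [this.deriv_eq]; simp
  have hd2 : ∀ s, s < 1/2 → deriv χ s = 0 := fun s hs => by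
    have : χ =ᶠ[𝓝 s] fun _ => 1 := by
      filter_upwards [gt_mem_nhds hs] with x hx using h5 x hx.le
    rw [this.deriv_eq]; simp
  obtain ⟨K, hK⟩ := (isCompact_Icc (a := (1/2:ℝ)) (b := 1)).exists_bound_of_continuousOn
    (f := deriv χ) (h1.continuous_deriv (by simp)).continuousOn
  have hK0 : 0 ≤ K := (norm_nonneg _).trans (hK 1 ⟨by norm_num, le_rfl⟩)
  refine ⟨χ, K, h1, hK0, fun s => ?_, fun s => ?_, h5, h6, fun s => hmono.deriv_nonpos, hd1, fun s => ?_, hmono⟩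
  · rw [hχ]; exact Real.smoothTransition.nonneg _
  · rw [hχ]; exact Real.smoothTransition.le_one _
  · by_cases a : 1 < s
    · rw [hd1 s a]; simpa
    by_cases b : s < 1/2
    · rw [hd2 s b]; simpa
    · exact hK s ⟨by linarith, by linarith⟩

end domvar

section decay1

variable {d N : ℕ} {p Λ K : ℝ} {f : Mat N d → Mat N d} {Bm : Ed d →L[ℝ] Ed d} {χ : ℝ → ℝ}

/-- quadratic form centred at `y` -/
def qf (Bm : Ed d →L[ℝ] Ed d) (y x : Ed d) : ℝ := ⟪Bm (x - y), x - y⟫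

def psi (Bm : Ed d →L[ℝ] Ed d) (χ : ℝ → ℝ) (y : Ed d) (r : ℝ) (x : Ed d) : ℝ :=
  χ (qf Bm y x / r ^ 2)

lemma qf_smooth (Bm : Ed d →L[ℝ] Ed d) (y : Ed d) : ContDiff ℝ (⊤ : ℕ∞) (qf Bm y) := by
  unfold qf
  exact (Bm.contDiff.comp (contDiff_id.sub contDiff_const)).inner ℝ (contDiff_id.sub contDiff_const)

lemma qf_cont (Bm : Ed d →L[ℝ] Ed d) (y : Ed d) : Continuous (qf Bm y) := (qf_smooth Bm y).continuous

lemma psi_smooth (hχ : Chi χ K) (y : Ed d) (r : ℝ) : ContDiff ℝ (⊤ : ℕ∞) (psi Bm χ y r) := by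
  unfold psi
  exact hχ.smooth.comp ((qf_smooth Bm y).div_const _)

lemma psi_gr (hf : Frozen p Λ f Bm) (hχ : Chi χ K) (y : Ed d) (r : ℝ) (x : Ed d) :
    gr (psi Bm χ y r) x = (deriv χ (qf Bm y x / r ^ 2) * (2 / r ^ 2)) • Bm (x - y) := by
  refine ext_inner_right ℝ fun h => ?_
  rw [← fderiv_eq_gr]
  have h1 : HasFDerivAt (qf Bm y) (fderiv ℝ (qf Bm y) x) x :=
    ((qf_smooth Bm y).differentiable (by simp) x).hasFDerivAt
  have h2 : fderiv ℝ (qf Bm y) x h = 2 * ⟪Bm (x - y), h⟫ := by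
    have a1 : HasFDerivAt (fun x => x - y) (ContinuousLinearMap.id ℝ (Ed d)) x :=
      (hasFDerivAt_id x).sub_const y
    have a2 : HasFDerivAt (fun x => Bm (x - y)) (Bm.comp (ContinuousLinearMap.id ℝ (Ed d))) x :=
      Bm.hasFDerivAt.comp x a1
    have a3 := a2.inner ℝ a1
    have : HasFDerivAt (qf Bm y) _ x := a3
    rw [this.fderiv]
    have a4 : (fderivInnerCLM ℝ (Bm (x - y), x - y) ∘SL
      (Bm ∘SL ContinuousLinearMap.id ℝ (Ed d)).prod (ContinuousLinearMap.id ℝ (Ed d))) h =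
        ⟪Bm (x - y), h⟫ + ⟪Bm h, x - y⟫ := by
      rw [ContinuousLinearMap.comp_apply, fderivInnerCLM_apply]; rfl
    have a5 : ⟪Bm h, x - y⟫ = ⟪Bm (x - y), h⟫ := by rw [hf.symm h (x - y), real_inner_comm h]
    rw [a4, a5]
    ring
  have h3 : HasDerivAt χ (deriv χ (qf Bm y x / r ^ 2)) (qf Bm y x / r ^ 2) :=
    (hχ.smooth.differentiable (by simp) _).hasDerivAt
  have h4 : HasFDerivAt (fun x => qf Bm y x / r ^ 2) ((r ^ 2)⁻¹ • fderiv ℝ (qf Bm y) x) x := by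
    have := h1.const_smul ((r ^ 2)⁻¹)
    refine this.congr_of_eventuallyEq (Eventually.of_forall fun x => ?_)
    simp [div_eq_inv_mul]
  have h5 : HasFDerivAt (psi Bm χ y r) _ x := h3.comp_hasFDerivAt x h4
  rw [h5.fderiv, real_inner_smul_left]
  simp [h2]
  ring

lemma qf_nonneg (hf : Frozen p Λ f Bm) (hΛ : 1 ≤ Λ) (y x : Ed d) : 0 ≤ qf Bm y x := by
  have := hf.lowB (x - y)
  unfold qf
  by_contra h
  push Not at h
  nlinarith [sq_nonneg ‖x - y‖]

lemma qf_out (hf : Frozen p Λ f Bm) (hΛ : 1 ≤ Λ) {y x : Ed d} {r : ℝ} (hr : 0 < r)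
    (h : Λ * r < ‖x - y‖) : 1 < qf Bm y x / r ^ 2 := by
  rw [lt_div_iff₀ (by positivity), one_mul]
  have h1 := hf.lowB (x - y)
  have h2 : (Λ * r) ^ 2 < ‖x - y‖ ^ 2 := pow_lt_pow_left₀ h (by positivity) two_ne_zero
  have h3 : Λ * r ^ 2 ≤ (Λ * r) ^ 2 := by nlinarith [sq_nonneg r]
  unfold qf
  nlinarith

lemma qf_in (hf : Frozen p Λ f Bm) (hΛ : 1 ≤ Λ) {y x : Ed d} {s R : ℝ} (hs : 0 < s)
    (h : ‖x - y‖ ≤ s) (hR : 2 * Λ * s ≤ R) : qf Bm y x / R ^ 2 ≤ 1 / 2 := by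
  have hR0 : 0 < R := lt_of_lt_of_le (by positivity) hR
  rw [div_le_iff₀ (by positivity)]
  have h1 := real_inner_le_norm (Bm (x - y)) (x - y)
  have h2 := hf.normB (x - y)
  have h3 : ‖Bm (x - y)‖ * ‖x - y‖ ≤ (Λ * s) * s := by
    refine mul_le_mul (h2.trans (by gcongr)) h (norm_nonneg _) (by positivity)
  have h4 : (2 * Λ * s) ^ 2 ≤ R ^ 2 := pow_le_pow_left₀ (by positivity) hR 2
  unfold qf
  nlinarith [mul_nonneg (sub_nonneg.2 hΛ) (sq_nonneg s), mul_pos (zero_lt_one.trans_le hΛ) (pow_pos hs 2)]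

lemma psi_supp (hf : Frozen p Λ f Bm) (hΛ : 1 ≤ Λ) (hχ : Chi χ K) (y : Ed d) {r : ℝ} (hr : 0 < r) :
    tsupport (psi Bm χ y r) ⊆ closedBall y (Λ * r) := by
  refine closure_minimal ?_ isClosed_closedBall
  intro x hx
  rw [mem_closedBall, dist_eq_norm]
  by_contra h
  push Not at h
  exact hx (hχ.zero _ (qf_out hf hΛ hr h).le)

lemma psi_cpt (hf : Frozen p Λ f Bm) (hΛ : 1 ≤ Λ) (hχ : Chi χ K) (y : Ed d) {r : ℝ} (hr : 0 < r) :
    HasCompactSupport (psi Bm χ y r) :=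
  (isCompact_closedBall y (Λ * r)).of_isClosed_subset (isClosed_tsupport _) (psi_supp hf hΛ hχ y hr)

def Ic (p : ℝ) (f : Mat N d → Mat N d) (Bm : Ed d →L[ℝ] Ed d) (χ : ℝ → ℝ) (y : Ed d) (ρ : ℝ)
    (g : Ed d → Mat N d) (r : ℝ) : ℝ :=
  ∫ x in ball y ρ, (⟪f (g x), g x⟫ / p) * χ (qf Bm y x / r ^ 2)

def Jc (p : ℝ) (f : Mat N d → Mat N d) (Bm : Ed d →L[ℝ] Ed d) (χ : ℝ → ℝ) (y : Ed d) (ρ : ℝ)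
    (g : Ed d → Mat N d) (r : ℝ) : ℝ :=
  ∫ x in ball y ρ, (⟪f (g x), g x⟫ / p) * (-(2 * (qf Bm y x / r ^ 2) * deriv χ (qf Bm y x / r ^ 2)))

def Dc (f : Mat N d → Mat N d) (Bm : Ed d →L[ℝ] Ed d) (χ : ℝ → ℝ) (y : Ed d) (ρ : ℝ)
    (g : Ed d → Mat N d) (r : ℝ) : ℝ :=
  ∫ x in ball y ρ, (-(deriv χ (qf Bm y x / r ^ 2)) * (2 / r ^ 2)) *
    ⟪f (g x), tens (app (g x) (x - y)) (Bm (x - y))⟫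

lemma chi_sbd (hχ : Chi χ K) {s : ℝ} (hs : 0 ≤ s) : |s * deriv χ s| ≤ K := by
  by_cases h : 1 < s
  · rw [hχ.dzero s h]; simpa using hχ.K0
  · push Not at h
    rw [abs_mul, abs_of_nonneg hs]
    have := hχ.dbd s
    nlinarith [abs_nonneg (deriv χ s)]

lemma phi_nonneg (hp : 2 ≤ p) (hf : Frozen p Λ f Bm) (hΛ : 1 ≤ Λ) (a : Mat N d) : 0 ≤ ⟪f a, a⟫ / p := by
  have h1 := hf.coer hp a
  have h2 : 0 ≤ ‖a‖ ^ p := by positivity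
  have h3 : 0 ≤ ⟪f a, a⟫ := by
    by_contra h; push Not at h; nlinarith
  exact div_nonneg h3 (by linarith)

variable {y : Ed d} {ρ : ℝ} {g : Ed d → Mat N d}

lemma Ic_int (hp : 2 ≤ p) (hf : Frozen p Λ f Bm) (hχ : Chi χ K)
    (hg : MemLp g (PP p) (volume.restrict (ball y ρ))) (r : ℝ) :
    Integrable (fun x => (⟪f (g x), g x⟫ / p) * χ (qf Bm y x / r ^ 2)) (volume.restrict (ball y ρ)) := by
  refine (hf.phi_int hp hg).mul_bdd (c := 1)
    (psi_smooth (Bm := Bm) hχ y r).continuous.aestronglyMeasurable (ae_of_all _ fun x => ?_)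
  rw [Real.norm_of_nonneg (hχ.nonneg _)]
  exact hχ.le_one _

lemma Jc_cont (hχ : Chi χ K) (r : ℝ) : Continuous fun x =>
    (-(2 * (qf Bm y x / r ^ 2) * deriv χ (qf Bm y x / r ^ 2))) := by
  have h1 := qf_cont Bm y
  have h2 : Continuous (deriv χ) := hχ.smooth.continuous_deriv (by simp)
  fun_prop

lemma Ic_deriv (hp : 2 ≤ p) (hf : Frozen p Λ f Bm) (hΛ : 1 ≤ Λ) (hχ : Chi χ K)
    (hg : MemLp g (PP p) (volume.restrict (ball y ρ))) {r : ℝ} (hr : 0 < r) :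
    HasDerivAt (Ic p f Bm χ y ρ g) (Jc p f Bm χ y ρ g r / r) r := by
  have key := hasDerivAt_integral_of_dominated_loc_of_deriv_le (μ := volume.restrict (ball y ρ))
    (F := fun s x => (⟪f (g x), g x⟫ / p) * χ (qf Bm y x / s ^ 2))
    (F' := fun s x => (⟪f (g x), g x⟫ / p) *
      (-(2 * (qf Bm y x / s ^ 2) * deriv χ (qf Bm y x / s ^ 2)) / s))
    (bound := fun x => (2 * K / (r / 2)) * (⟪f (g x), g x⟫ / p)) (x₀ := r) (s := Ioi (r / 2))
    (Ioi_mem_nhds (by linarith)) (Eventually.of_forall fun s => (Ic_int hp hf hχ hg s).1)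
    (Ic_int hp hf hχ hg r)
    ((hf.phi_int hp hg).1.mul ((Jc_cont hχ r).div_const r).aestronglyMeasurable)
    (ae_of_all _ fun x s hs => ?_) ((hf.phi_int hp hg).const_mul _) (ae_of_all _ fun x s hs => ?_)
  · have h2 := key.2
    unfold Ic Jc
    have e : (∫ x in ball y ρ, (⟪f (g x), g x⟫ / p) *
        (-(2 * (qf Bm y x / r ^ 2) * deriv χ (qf Bm y x / r ^ 2)))) / r = ∫ x in ball y ρ,
        (⟪f (g x), g x⟫ / p) * (-(2 * (qf Bm y x / r ^ 2) * deriv χ (qf Bm y x / r ^ 2)) / r) := by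
      rw [← integral_div]
      congr 1; ext x; ring
    rw [e]
    exact h2
  · rw [mem_Ioi] at hs
    have hs0 : 0 < s := by linarith
    rw [norm_mul, Real.norm_of_nonneg (phi_nonneg hp hf hΛ _), mul_comm]
    refine mul_le_mul_of_nonneg_right ?_ (phi_nonneg hp hf hΛ _)
    rw [Real.norm_eq_abs, abs_div, abs_of_pos hs0, abs_neg, mul_assoc, abs_mul, abs_two]
    have h1 := chi_sbd hχ (div_nonneg (qf_nonneg hf hΛ y x) (sq_nonneg s))
    have := hχ.K0
    gcongr
  · rw [mem_Ioi] at hs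
    have hs0 : 0 < s := by linarith
    refine HasDerivAt.const_mul _ ?_
    have h3 : HasDerivAt χ (deriv χ (qf Bm y x / s ^ 2)) (qf Bm y x / s ^ 2) :=
      (hχ.smooth.differentiable (by simp) _).hasDerivAt
    have h4 : HasDerivAt (fun s : ℝ => qf Bm y x / s ^ 2) (-(2 * (qf Bm y x / s ^ 2)) / s) s := by
      have := (hasDerivAt_const s (qf Bm y x)).div (hasDerivAt_pow 2 s) (by positivity)
      refine this.congr_deriv ?_
      field_simp
      ring
    have h5 := h3.comp s h4
    refine h5.congr_deriv ?_
    ring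

lemma D_int (hp : 2 ≤ p) (hf : Frozen p Λ f Bm) (hΛ : 1 ≤ Λ) (hχ : Chi χ K)
    (hg : MemLp g (PP p) (volume.restrict (ball y ρ))) {r : ℝ} (hr : 0 < r) :
    Integrable (fun x => (-(deriv χ (qf Bm y x / r ^ 2)) * (2 / r ^ 2)) *
      ⟪f (g x), tens (app (g x) (x - y)) (Bm (x - y))⟫) (volume.restrict (ball y ρ)) := by
  have h1 := psi_smooth (Bm := Bm) hχ y r
  obtain ⟨C, hC, hC'⟩ := cpt_bdd (gr_cont h1) (gr_cpt (psi_cpt hf hΛ hχ y hr))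
  have h2 : MemLp (fun x => app (g x) (x - y)) (PP p) (volume.restrict (ball y ρ)) := by
    refine memLp_app hg (C := ρ) (continuous_id.sub continuous_const).aestronglyMeasurable ?_
    refine (ae_restrict_iff' measurableSet_ball).2 (ae_of_all _ fun x hx => ?_)
    rw [mem_ball, dist_eq_norm] at hx
    exact hx.le
  have h3 := (dual_integrable hp (hf.memDual hp hg) ((LimP.const h2).tens_bdd
    (gr_cont h1).aestronglyMeasurable hC').memu).neg
  refine h3.congr (ae_of_all _ fun x => ?_)
  simp only [Pi.neg_apply, psi_gr hf hχ, inner_tens, app_smul, real_inner_smul_left]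
  ring

lemma JID (hp : 2 ≤ p) (hf : Frozen p Λ f Bm) (hΛ : 1 ≤ Λ) (hχ : Chi χ K) {u : Ed d → En N}
    (hu : Appr p y ρ u g) (hs : Sol f y ρ g) {r : ℝ} (hr : 0 < r) (hrρ : Λ * r < ρ) :
    Jc p f Bm χ y ρ g r = (d - p) * Ic p f Bm χ y ρ g r + Dc f Bm χ y ρ g r := by
  have h := domain_var (r' := (Λ * r + ρ) / 2) hp hf (by linarith) hu hs
    (psi_smooth (Bm := Bm) hχ y r)
    (psi_cpt hf hΛ hχ y hr) ((psi_supp hf hΛ hχ y hr).trans (closedBall_subset_ball (by linarith)))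
    (fun x => hχ.nonneg _)
  have iD := D_int hp hf hΛ hχ hu.memg hr
  have iI := Ic_int (Bm := Bm) hp hf hχ hu.memg r
  have iJ : Integrable (fun x => (⟪f (g x), g x⟫ / p) *
      (-(2 * (qf Bm y x / r ^ 2) * deriv χ (qf Bm y x / r ^ 2)))) (volume.restrict (ball y ρ)) := by
    refine (hf.phi_int hp hu.memg).mul_bdd (c := 2 * K) (Jc_cont hχ r).aestronglyMeasurable
      (ae_of_all _ fun x => ?_)
    rw [Real.norm_eq_abs, abs_neg, mul_assoc, abs_mul, abs_two]
    have h1 := chi_sbd hχ (div_nonneg (qf_nonneg hf hΛ y x) (sq_nonneg r))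
    linarith
  have e : ∀ x, (⟪f (g x), tens (app (g x) (x - y)) (gr (psi Bm χ y r) x)⟫ -
      (⟪f (g x), g x⟫ / p) * ⟪gr (psi Bm χ y r) x, x - y⟫ +
        (p - d) * ((⟪f (g x), g x⟫ / p) * psi Bm χ y r x)) =
      (⟪f (g x), g x⟫ / p) *
      (-(2 * (qf Bm y x / r ^ 2) * deriv χ (qf Bm y x / r ^ 2))) -
      (-(deriv χ (qf Bm y x / r ^ 2)) * (2 / r ^ 2)) *
      ⟪f (g x), tens (app (g x) (x - y)) (Bm (x - y))⟫ +
      (p - d) * ((⟪f (g x), g x⟫ / p) * χ (qf Bm y x / r ^ 2)) := by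
    intro x
    simp only [psi_gr hf hχ, inner_tens, app_smul, real_inner_smul_left]
    rw [show ⟪Bm (x - y), x - y⟫ = qf Bm y x from rfl, show psi Bm χ y r x = χ (qf Bm y x / r ^ 2) from rfl]
    ring
  simp only [e] at h
  rw [integral_add (by exact iJ.sub iD) (iI.const_mul _), integral_sub iJ iD, integral_const_mul] at h
  unfold Jc Ic Dc
  linarith

lemma Dc_pt (hf : Frozen p Λ f Bm) (a : Mat N d) (x : Ed d) :
    0 ≤ ⟪f a, tens (app a x) (Bm x)⟫ := by
  have := hf.split a x 0 1 one_pos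
  simp [inner_tens] at this
  rw [inner_tens]
  exact this

lemma Dc_nonneg (hf : Frozen p Λ f Bm) (hχ : Chi χ K) (r : ℝ) : 0 ≤ Dc f Bm χ y ρ g r := by
  refine integral_nonneg fun x => mul_nonneg (mul_nonneg ?_ (by positivity)) (Dc_pt hf _ _)
  have := hχ.dneg (qf Bm y x / r ^ 2)
  linarith

end decay1

section decay2

variable {d N : ℕ} {p Λ K : ℝ} {f : Mat N d → Mat N d} {Bm : Ed d →L[ℝ] Ed d} {χ : ℝ → ℝ}
  {y : Ed d} {ρ : ℝ} {g : Ed d → Mat N d}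

lemma caccio (hp : 2 ≤ p) (hf : Frozen p Λ f Bm) (hΛ : 1 ≤ Λ) (hχ : Chi χ K) {u : Ed d → En N}
    (hu : Appr p y ρ u g) (hs : Sol f y ρ g) {r : ℝ} (hr : 0 < r) (hrρ : 6 * Λ * r ≤ ρ)
    {τ : ℝ} (hτ : 0 < τ) :
    p * Ic p f Bm χ y ρ g r ≤ τ⁻¹ / 2 * Dc f Bm χ y ρ g r +
      τ * (Λ * K * (1 + 2 * (2 ^ d * (4 * Λ) ^ p))) * ∫ x in ball y (6 * Λ * r), ‖g x‖ ^ p := by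
  have hΛ0 : 0 < Λ := by linarith
  have hK := hχ.K0
  have hΛr : 0 < Λ * r := by positivity
  obtain ⟨c, hc⟩ := poincare hp (s := 2 * Λ * r) (by positivity)
    (hu.mono (ball_subset_ball (by linarith) : ball y (3 * (2 * Λ * r)) ⊆ ball y ρ))
  have hw := hu.sub_const hp c
  have ht := hw.prod hp (psi_smooth (Bm := Bm) hχ y r) (psi_cpt hf hΛ hχ y hr)
    ((psi_supp hf hΛ hχ y hr).trans (closedBall_subset_ball (by linarith)))
  have h0 := hs.test hf hp hu.memg ht
  have hkm := ht.choose_spec.2.2.2.memu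
  have i1 := dual_integrable hp (hf.memDual hp hu.memg) hkm
  have i2 := D_int hp hf hΛ hχ hu.memg hr
  have i3 : Integrable ((ball y (2 * Λ * r)).indicator fun x => ‖g x‖ ^ p)
      (volume.restrict (ball y ρ)) := (memLp_int hp hu.memg).indicator measurableSet_ball
  have i4 : Integrable ((ball y (2 * Λ * r)).indicator fun x => ‖u x - c‖ ^ p)
      (volume.restrict (ball y ρ)) := (memLp_int hp hw.memu).indicator measurableSet_ball
  have key := int_le4 (c1 := 1) (c2 := τ⁻¹ / 2) (c3 := τ * (Λ * K))
    (c4 := τ * (Λ * K) * (2 * (r⁻¹) ^ p)) ((Ic_int hp hf hχ hu.memg r).const_mul p) i1 i2 i3 i4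
    (ae_of_all _ fun x => ?_)
  · have e3 : ∀ F : Ed d → ℝ, ∫ x in ball y ρ, (ball y (2 * Λ * r)).indicator F x =
        ∫ x in ball y (2 * Λ * r), F x := fun F => by
      rw [setIntegral_indicator measurableSet_ball, inter_eq_right.2 (ball_subset_ball (by linarith))]
    rw [h0, e3, e3, integral_const_mul] at key
    have h6 : ∫ x in ball y (2 * Λ * r), ‖g x‖ ^ p ≤ ∫ x in ball y (6 * Λ * r), ‖g x‖ ^ p := by
      refine setIntegral_mono_set ?_ (ae_of_all _ fun x => by positivity)
        (ball_subset_ball (by linarith)).eventuallyLE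
      exact memLp_int hp (hu.memg.mono_measure (Measure.restrict_mono (ball_subset_ball (by linarith)) le_rfl))
    have h7 : r⁻¹ ^ p * ∫ x in ball y (2 * Λ * r), ‖u x - c‖ ^ p ≤
        2 ^ d * (4 * Λ) ^ p * ∫ x in ball y (6 * Λ * r), ‖g x‖ ^ p := by
      calc _ ≤ r⁻¹ ^ p * (2 ^ d * (2 * (2 * Λ * r)) ^ p * ∫ x in ball y (3 * (2 * Λ * r)), ‖g x‖ ^ p) := by
            gcongr
        _ = _ := by
            have e1 : (2 * (2 * Λ * r)) ^ p = (4 * Λ) ^ p * r ^ p := by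
              rw [← Real.mul_rpow (by positivity) hr.le]; ring_nf
            have e2 : r⁻¹ ^ p * r ^ p = 1 := by
              rw [← Real.mul_rpow (by positivity) hr.le, inv_mul_cancel₀ hr.ne', Real.one_rpow]
            rw [e1, show 3 * (2 * Λ * r) = 6 * Λ * r by ring]
            linear_combination (2 ^ d * (4 * Λ) ^ p * ∫ x in ball y (6 * Λ * r), ‖g x‖ ^ p) * e2
    have hA : 0 ≤ τ * (Λ * K) := by positivity
    have := mul_le_mul_of_nonneg_left h6 hA
    have := mul_le_mul_of_nonneg_left h7 hA
    unfold Ic Dc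
    linarith
  · rw [psi_gr hf hχ, inner_add_right, inner_smul_right]
    have hp0 : p ≠ 0 := by linarith
    set m := -(deriv χ (qf Bm y x / r ^ 2)) * (2 / r ^ 2) with hm
    have hm0 : 0 ≤ m := by
      have := hχ.dneg (qf Bm y x / r ^ 2)
      exact mul_nonneg (by linarith) (by positivity)
    have e1 : ⟪f (g x), tens (u x - c) ((deriv χ (qf Bm y x / r ^ 2) * (2 / r ^ 2)) • Bm (x - y))⟫
        = - (m * ⟪f (g x), tens (u x - c) (Bm (x - y))⟫) := by
      rw [inner_tens, inner_tens, app_smul, inner_smul_left, hm]; simp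
    rw [e1]
    have h1 := mul_le_mul_of_nonneg_left (hf.split (g x) (x - y) (u x - c) τ hτ) hm0
    have h2 : m * (τ * (Λ * (‖g x‖ ^ (p - 2) * ‖u x - c‖ ^ 2))) ≤
        2 * (τ * (Λ * K) * (ball y (2 * Λ * r)).indicator (fun x => ‖g x‖ ^ p) x +
        τ * (Λ * K) * (2 * (r⁻¹) ^ p) * (ball y (2 * Λ * r)).indicator (fun x => ‖u x - c‖ ^ p) x) := by
      by_cases hx : x ∈ ball y (2 * Λ * r)
      · rw [indicator_of_mem hx, indicator_of_mem hx]
        have a1 : m ≤ K * (2 * r⁻¹ ^ 2) := by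
          have := hχ.dbd (qf Bm y x / r ^ 2)
          have := neg_le_abs (deriv χ (qf Bm y x / r ^ 2))
          rw [hm, show 2 / r ^ 2 = 2 * r⁻¹ ^ 2 by rw [inv_pow]; rfl]
          gcongr; linarith
        have a2 := young3 hp (norm_nonneg (g x)) (show 0 ≤ r⁻¹ * ‖u x - c‖ by positivity)
          (show 0 ≤ r⁻¹ * ‖u x - c‖ by positivity)
        rw [Real.mul_rpow (by positivity) (norm_nonneg _)] at a2
        calc _ ≤ (K * (2 * r⁻¹ ^ 2)) * (τ * (Λ * (‖g x‖ ^ (p - 2) * ‖u x - c‖ ^ 2))) := by gcongr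
          _ = 2 * (τ * (Λ * K)) * (‖g x‖ ^ (p - 2) * (r⁻¹ * ‖u x - c‖) * (r⁻¹ * ‖u x - c‖)) := by ring
          _ ≤ 2 * (τ * (Λ * K)) * _ := mul_le_mul_of_nonneg_left a2 (by positivity)
          _ = _ := by ring
      · rw [indicator_of_notMem hx, indicator_of_notMem hx]
        have : m = 0 := by
          rw [hm, hχ.dzero _ (qf_out hf hΛ hr ?_)]
          · simp
          · rw [mem_ball, dist_eq_norm] at hx; push Not at hx; linarith
        simp [this]
    have e2 : p * (⟪f (g x), g x⟫ / p * χ (qf Bm y x / r ^ 2)) =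
      psi Bm χ y r x * ⟪f (g x), g x⟫ := by rw [psi]; field_simp
    rw [e2]
    linarith

lemma Ic_low (hp : 2 ≤ p) (hf : Frozen p Λ f Bm) (hΛ : 1 ≤ Λ) (hχ : Chi χ K)
    (hg : MemLp g (PP p) (volume.restrict (ball y ρ))) {s R : ℝ} (hs : 0 < s) (hsρ : s ≤ ρ)
    (hR : 2 * Λ * s ≤ R) :
    ∫ x in ball y s, ‖g x‖ ^ p ≤ Λ * p * Ic p f Bm χ y ρ g R := by
  have i3 : Integrable ((ball y s).indicator fun x => ‖g x‖ ^ p)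
      (volume.restrict (ball y ρ)) := (memLp_int hp hg).indicator measurableSet_ball
  have key := int_le1 (c1 := Λ * p) i3 (Ic_int hp hf hχ hg R) (ae_of_all _ fun x => ?_)
  · rwa [setIntegral_indicator measurableSet_ball, inter_eq_right.2 (ball_subset_ball hsρ)] at key
  · have h0 := phi_nonneg hp hf hΛ (g x)
    have hp0 : 0 < p := by linarith
    by_cases hx : x ∈ ball y s
    · rw [indicator_of_mem hx, hχ.one _ (qf_in hf hΛ hs ?_ hR), mul_one]
      · have := hf.coer hp (g x)
        calc _ ≤ _ := this
          _ = _ := by field_simp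
      · rw [mem_ball, dist_eq_norm] at hx; exact hx.le
    · rw [indicator_of_notMem hx]
      exact mul_nonneg (by positivity) (mul_nonneg h0 (hχ.nonneg _))

lemma Ic_up (hp : 2 ≤ p) (hf : Frozen p Λ f Bm) (hΛ : 1 ≤ Λ) (hχ : Chi χ K)
    (hg : MemLp g (PP p) (volume.restrict (ball y ρ))) (r : ℝ) :
    Ic p f Bm χ y ρ g r ≤ Λ * ∫ x in ball y ρ, ‖g x‖ ^ p := by
  refine int_le1 (Ic_int hp hf hχ hg r) (memLp_int hp hg) (ae_of_all _ fun x => ?_)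
  have h0 := phi_nonneg hp hf hΛ (g x)
  have h1 : ⟪f (g x), g x⟫ ≤ Λ * ‖g x‖ ^ p := by
    have e : ‖g x‖ ^ (p - 1) * ‖g x‖ = ‖g x‖ ^ p := by
      rcases (norm_nonneg (g x)).eq_or_lt with h | h
      · rw [← h, Real.zero_rpow (by linarith : p ≠ 0)]; simp
      · rw [← Real.rpow_add_one h.ne']; ring_nf
    calc _ ≤ ‖f (g x)‖ * ‖g x‖ := real_inner_le_norm _ _
      _ ≤ (Λ * ‖g x‖ ^ (p - 1)) * ‖g x‖ := by gcongr; exact hf.growth hp _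
      _ = _ := by rw [mul_assoc, e]
  calc _ ≤ ⟪f (g x), g x⟫ / p * 1 := by gcongr; exact hχ.le_one _
    _ ≤ ⟪f (g x), g x⟫ := by
      rw [mul_one]
      refine div_le_self ?_ (by linarith)
      have := mul_nonneg h0 (by linarith : 0 ≤ p)
      rwa [div_mul_cancel₀ _ (by linarith : p ≠ 0)] at this
    _ ≤ _ := h1

end decay2

section decay3

lemma hole_iter {θ K : ℝ} (h0 : 0 < θ) (h1 : θ < 1) (hK : 1 < K) :
    ∃ ε : ℝ, 0 < ε ∧ ε ≤ 1 ∧ ∀ (a : ℝ) (E : ℝ → ℝ), 0 < a → 0 ≤ E a →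
      (∀ s t, 0 < s → s ≤ t → t ≤ a → E s ≤ E t) → (∀ s, 0 < s → K * s ≤ a → E s ≤ θ * E (K * s)) →
      ∀ s, 0 < s → s ≤ a → E s ≤ θ⁻¹ * (s / a) ^ ε * E a := by
  have hlK : 0 < Real.log K := Real.log_pos hK
  have hlθ : Real.log θ < 0 := Real.log_neg h0 h1
  have hK0 : 0 < K := by linarith
  refine ⟨min 1 (-Real.log θ / Real.log K), lt_min one_pos (div_pos (by linarith) hlK), min_le_left _ _, ?_⟩
  obtain ⟨ε, hε⟩ : ∃ ε, ε = min 1 (-Real.log θ / Real.log K) := ⟨_, rfl⟩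
  rw [← hε]
  have hε0 : 0 < ε := hε ▸ lt_min one_pos (div_pos (by linarith) hlK)
  have hθ : θ ≤ (K⁻¹) ^ ε := by
    have h2 : ε * Real.log K ≤ -Real.log θ := by
      rw [← le_div_iff₀ hlK, hε]; exact min_le_right _ _
    rw [Real.inv_rpow hK0.le, ← Real.rpow_neg hK0.le, Real.rpow_def_of_pos hK0]
    calc θ = Real.exp (Real.log θ) := (Real.exp_log h0).symm
      _ ≤ _ := Real.exp_le_exp.2 (by linarith)
  intro a E ha hE hm hh
  have hn : ∀ n : ℕ, ∀ s, 0 < s → K ^ n * s ≤ a → E s ≤ θ ^ n * E a := by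
    intro n
    induction n with
    | zero => intro s hs hsa; simpa using hm s a hs (by simpa using hsa) le_rfl
    | succ n ih =>
      intro s hs hsa
      have e : K ^ n * (K * s) = K ^ (n + 1) * s := by ring
      have h3 := ih (K * s) (by positivity) (by rw [e]; exact hsa)
      have h4 : K * s ≤ a := by
        refine le_trans ?_ (e.trans_le hsa)
        exact le_mul_of_one_le_left (by positivity) (one_le_pow₀ hK.le)
      calc E s ≤ θ * E (K * s) := hh s hs h4
        _ ≤ θ * (θ ^ n * E a) := by gcongr
        _ = _ := by ring
  intro s hs hsa
  obtain ⟨n, hn1, hn2⟩ := exists_nat_pow_near (x := a / s) (by rwa [le_div_iff₀ hs, one_mul]) hK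
  have h5 := hn n s hs (by rwa [le_div_iff₀ hs] at hn1)
  refine h5.trans ?_
  gcongr
  have h6 : θ ^ (n + 1) ≤ (s / a) ^ ε := by
    calc θ ^ (n + 1) ≤ ((K⁻¹) ^ ε) ^ (n + 1) := by gcongr
      _ = ((K⁻¹) ^ (n + 1)) ^ ε := by
        rw [← Real.rpow_natCast ((K⁻¹) ^ ε), ← Real.rpow_mul (by positivity), mul_comm,
          Real.rpow_mul (by positivity), Real.rpow_natCast]
      _ ≤ _ := by
        refine Real.rpow_le_rpow (by positivity) ?_ hε0.le
        rw [inv_pow, ← inv_div]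
        exact inv_anti₀ (by positivity) hn2.le
  calc θ ^ n = θ⁻¹ * θ ^ (n + 1) := by rw [pow_succ]; field_simp
    _ ≤ _ := by gcongr

lemma rpow_le_abs {x e : ℝ} (hx : 1 ≤ x) : x ^ e ≤ x ^ |e| :=
  Real.rpow_le_rpow_of_exponent_le hx (le_abs_self e)

lemma rpow_le_abs' {x κ e : ℝ} (hκ : 1 ≤ κ) (hx : x ≤ 1) (h : κ⁻¹ ≤ x) : x ^ e ≤ κ ^ |e| := by
  have hκ0 : 0 < κ := by linarith
  have hx0 : 0 < x := lt_of_lt_of_le (by positivity) h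
  rcases le_total 0 e with h1 | h1
  · exact (Real.rpow_le_one hx0.le hx h1).trans (Real.one_le_rpow hκ (abs_nonneg _))
  · rw [abs_of_nonpos h1]
    calc x ^ e ≤ (κ⁻¹) ^ e := Real.rpow_le_rpow_of_nonpos (by positivity) h h1
      _ = _ := by rw [Real.inv_rpow hκ0.le, Real.rpow_neg hκ0.le]

variable {d N : ℕ} {p Λ K : ℝ} {f : Mat N d → Mat N d} {Bm : Ed d →L[ℝ] Ed d} {χ : ℝ → ℝ}
  {y : Ed d} {ρ : ℝ} {g : Ed d → Mat N d}

def Ec (p : ℝ) (f : Mat N d → Mat N d) (Bm : Ed d →L[ℝ] Ed d) (χ : ℝ → ℝ) (y : Ed d) (ρ : ℝ)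
    (g : Ed d → Mat N d) (r : ℝ) : ℝ := r ^ (p - d) * Ic p f Bm χ y ρ g r

lemma Ic_nonneg (hp : 2 ≤ p) (hf : Frozen p Λ f Bm) (hΛ : 1 ≤ Λ) (hχ : Chi χ K) (r : ℝ) :
    0 ≤ Ic p f Bm χ y ρ g r :=
  integral_nonneg fun x => mul_nonneg (phi_nonneg hp hf hΛ _) (hχ.nonneg _)

lemma Ec_deriv (hp : 2 ≤ p) (hf : Frozen p Λ f Bm) (hΛ : 1 ≤ Λ) (hχ : Chi χ K) {u : Ed d → En N}
    (hu : Appr p y ρ u g) (hs : Sol f y ρ g) {r : ℝ} (hr : 0 < r) (hrρ : Λ * r < ρ) :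
    HasDerivAt (Ec p f Bm χ y ρ g) (r ^ (p - d) * Dc f Bm χ y ρ g r / r) r := by
  have h1 := Ic_deriv hp hf hΛ hχ hu.memg hr
  have h2 := Real.hasDerivAt_rpow_const (x := r) (p := p - d) (Or.inl hr.ne')
  have h3 := h2.mul h1
  refine h3.congr_deriv ?_
  rw [JID hp hf hΛ hχ hu hs hr hrρ, Real.rpow_sub_one hr.ne']
  field_simp
  ring

lemma Ec_mono (hp : 2 ≤ p) (hf : Frozen p Λ f Bm) (hΛ : 1 ≤ Λ) (hχ : Chi χ K) {u : Ed d → En N}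
    (hu : Appr p y ρ u g) (hs : Sol f y ρ g) {a b : ℝ} (ha : 0 < a) (hab : a ≤ b) (hb : Λ * b < ρ) :
    Ec p f Bm χ y ρ g a ≤ Ec p f Bm χ y ρ g b := by
  have hΛ0 : 0 < Λ := by linarith
  have hd : ∀ r ∈ Icc a b, HasDerivAt (Ec p f Bm χ y ρ g) (r ^ (p - d) * Dc f Bm χ y ρ g r / r) r :=
    fun r hr => Ec_deriv hp hf hΛ hχ hu hs (ha.trans_le hr.1)
      (lt_of_le_of_lt (mul_le_mul_of_nonneg_left hr.2 hΛ0.le) hb)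
  refine monotoneOn_of_deriv_nonneg (convex_Icc a b) (fun r hr => (hd r hr).continuousAt.continuousWithinAt)
    (fun r hr => ?_) (fun r hr => ?_) (left_mem_Icc.2 hab) (right_mem_Icc.2 hab) hab
  · exact (hd r (interior_subset hr)).differentiableAt.differentiableWithinAt
  · have hr' := interior_subset hr
    rw [(hd r hr').deriv]
    have := ha.trans_le hr'.1
    have := Dc_nonneg (y := y) (ρ := ρ) (g := g) hf hχ r
    positivity

lemma Ec_hole (hp : 2 ≤ p) (hΛ : 1 ≤ Λ) (hχ : Chi χ K) : ∃ θ : ℝ, 0 < θ ∧ θ < 1 ∧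
    ∀ (f : Mat N d → Mat N d) (Bm : Ed d →L[ℝ] Ed d), Frozen p Λ f Bm →
    ∀ (y : Ed d) (ρ : ℝ) (u : Ed d → En N) (g : Ed d → Mat N d),
    Appr p y ρ u g → Sol f y ρ g → ∀ s, 0 < s → Λ * (24 * Λ ^ 2 * s) < ρ →
    Ec p f Bm χ y ρ g s ≤ θ * Ec p f Bm χ y ρ g (24 * Λ ^ 2 * s) := by
  have hK0 := hχ.K0
  have hΛ0 : 0 < Λ := by linarith
  have hΛ2 : 1 ≤ Λ ^ 2 := one_le_pow₀ hΛ
  obtain ⟨C, hC⟩ : ∃ C, C = (Λ * K * (1 + 2 * (2 ^ d * (4 * Λ) ^ p))) * (Λ * p) * (24 * Λ ^ 2) ^ |p - d| :=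
    ⟨_, rfl⟩
  have hC0 : 0 ≤ C := by rw [hC]; positivity
  obtain ⟨τ, hτ⟩ : ∃ τ, τ = (C + 1)⁻¹ := ⟨_, rfl⟩
  have hτ0 : 0 < τ := by rw [hτ]; positivity
  have hτC : τ * C ≤ 1 := by
    rw [hτ, inv_mul_le_iff₀ (by positivity)]; linarith
  refine ⟨(τ⁻¹ + 1) / (τ⁻¹ + p), by positivity, ?_, ?_⟩
  · rw [div_lt_one (by positivity)]; linarith
  intro f Bm hf y ρ u g hu hs s hs0 hsρ
  have hΛs : 0 < Λ * s := by positivity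
  have hΛs2 : Λ * s ≤ Λ ^ 2 * (Λ * s) := le_mul_of_one_le_left hΛs.le hΛ2
  have hd : ∀ r ∈ Icc s (2 * s), HasDerivAt (Ec p f Bm χ y ρ g) (r ^ (p - d) * Dc f Bm χ y ρ g r / r) r :=
    fun r hr => Ec_deriv hp hf hΛ hχ hu hs (hs0.trans_le hr.1)
      (lt_of_le_of_lt (mul_le_mul_of_nonneg_left hr.2 hΛ0.le) (by linarith))
  obtain ⟨r, hr, hsl⟩ := exists_hasDerivAt_eq_slope (Ec p f Bm χ y ρ g)
    (fun r => r ^ (p - d) * Dc f Bm χ y ρ g r / r) (by linarith : s < 2 * s)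
    (fun r hr => (hd r hr).continuousAt.continuousWithinAt) (fun r hr => hd r (Ioo_subset_Icc_self hr))
  have hr0 : 0 < r := hs0.trans hr.1
  have hΛr : Λ * r ≤ Λ * (2 * s) := by gcongr; exact hr.2.le
  have m1 := Ec_mono (a := s) (b := 2 * s) hp hf hΛ hχ hu hs hs0 (by linarith) (by linarith)
  have m2 := Ec_mono (a := s) (b := r) hp hf hΛ hχ hu hs hs0 hr.1.le (by linarith)
  have m3 := Ec_mono (a := 2 * s) (b := 24 * Λ ^ 2 * s) hp hf hΛ hχ hu hs (by linarith) (by nlinarith) hsρ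
  have c1 := caccio hp hf hΛ hχ hu hs hr0 (by linarith) hτ0
  have c2 := Ic_low (s := 6 * Λ * r) (R := 24 * Λ ^ 2 * s) hp hf hΛ hχ hu.memg (by positivity) (by linarith)
    (by nlinarith [hr.2])
  set E1 := Ec p f Bm χ y ρ g s
  set E2 := Ec p f Bm χ y ρ g (24 * Λ ^ 2 * s) with hE2
  have hD : r ^ (p - d) * Dc f Bm χ y ρ g r ≤ 2 * (E2 - E1) := by
    have e1 : r ^ (p - d) * Dc f Bm χ y ρ g r = (r / s) * (Ec p f Bm χ y ρ g (2 * s) - E1) := by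
      have : 2 * s - s = s := by ring
      rw [this] at hsl
      field_simp at hsl ⊢
      linarith
    rw [e1]
    have : r / s ≤ 2 := by rw [div_le_iff₀ hs0]; exact hr.2.le
    exact mul_le_mul this (by linarith) (by linarith) (by norm_num)
  have hI : r ^ (p - d) * Ic p f Bm χ y ρ g (24 * Λ ^ 2 * s) ≤ (24 * Λ ^ 2) ^ |p - d| * E2 := by
    have e1 : r ^ (p - d) * Ic p f Bm χ y ρ g (24 * Λ ^ 2 * s) = (r / (24 * Λ ^ 2 * s)) ^ (p - d) * E2 := by
      rw [hE2, Ec, Real.div_rpow hr0.le (by positivity)]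
      have : 0 < (24 * Λ ^ 2 * s) ^ (p - d) := by positivity
      field_simp
    rw [e1]
    have hE0 : 0 ≤ E2 := mul_nonneg (by positivity) (Ic_nonneg hp hf hΛ hχ _)
    refine mul_le_mul_of_nonneg_right (rpow_le_abs' (by linarith) ?_ ?_) hE0
    · rw [div_le_one (by positivity)]; nlinarith [hr.2]
    · rw [le_div_iff₀ (by positivity)]
      field_simp
      exact hr.1.le
  have hrp : 0 < r ^ (p - d) := by positivity
  have hB : 0 ≤ Λ * K * (1 + 2 * (2 ^ d * (4 * Λ) ^ p)) := by positivity
  have main : p * Ec p f Bm χ y ρ g r ≤ τ⁻¹ * (E2 - E1) + τ * C * E2 := by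
    calc p * Ec p f Bm χ y ρ g r = r ^ (p - d) * (p * Ic p f Bm χ y ρ g r) := by rw [Ec]; ring
      _ ≤ r ^ (p - d) * (τ⁻¹ / 2 * Dc f Bm χ y ρ g r + τ * (Λ * K * (1 + 2 * (2 ^ d * (4 * Λ) ^ p))) *
          (Λ * p * Ic p f Bm χ y ρ g (24 * Λ ^ 2 * s))) := by
        gcongr
        refine c1.trans ?_
        gcongr
      _ = τ⁻¹ / 2 * (r ^ (p - d) * Dc f Bm χ y ρ g r) + τ * (Λ * K * (1 + 2 * (2 ^ d * (4 * Λ) ^ p))) *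
          (Λ * p * (r ^ (p - d) * Ic p f Bm χ y ρ g (24 * Λ ^ 2 * s))) := by ring
      _ ≤ τ⁻¹ / 2 * (2 * (E2 - E1)) + τ * (Λ * K * (1 + 2 * (2 ^ d * (4 * Λ) ^ p))) *
          (Λ * p * ((24 * Λ ^ 2) ^ |p - d| * E2)) := by gcongr
      _ = _ := by rw [hC]; ring
  have hE0 : 0 ≤ E2 := mul_nonneg (by positivity) (Ic_nonneg hp hf hΛ hχ _)
  have h9 := mul_le_mul_of_nonneg_right hτC hE0
  have h10 : p * E1 ≤ p * Ec p f Bm χ y ρ g r := by gcongr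
  rw [div_mul_eq_mul_div, le_div_iff₀ (by positivity)]
  linarith

lemma decay (d N : ℕ) {p Λ : ℝ} (hp : 2 ≤ p) (hΛ : 1 ≤ Λ) : ∃ ε C : ℝ, 0 < ε ∧ ε ≤ 1 ∧ 0 ≤ C ∧
    ∀ (f : Mat N d → Mat N d) (Bm : Ed d →L[ℝ] Ed d), Frozen p Λ f Bm →
    ∀ (y : Ed d) (ρ : ℝ) (u : Ed d → En N) (g : Ed d → Mat N d),
    Appr p y ρ u g → Sol f y ρ g → ∀ r, 0 < r → r ≤ ρ →
    ∫ x in ball y r, ‖g x‖ ^ p ≤ C * (r / ρ) ^ (d - p + ε) * ∫ x in ball y ρ, ‖g x‖ ^ p := by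
  obtain ⟨χ, K, hχ⟩ := chi_exists
  have hΛ0 : 0 < Λ := by linarith
  have hΛ2 : 1 ≤ Λ ^ 2 := one_le_pow₀ hΛ
  obtain ⟨θ, h0, h1, hh⟩ := Ec_hole (d := d) (N := N) hp hΛ hχ
  obtain ⟨ε, hε0, hε1, hit⟩ := hole_iter h0 h1 (by linarith : 1 < 24 * Λ ^ 2)
  have hθ1 : 1 ≤ θ⁻¹ := (one_le_inv₀ h0).2 h1.le
  refine ⟨ε, Λ * p * Λ * θ⁻¹ * (4 * Λ ^ 2) ^ |d - p + ε|, hε0, hε1, by positivity, ?_⟩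
  intro f Bm hf y ρ u g hu hs r hr hrρ
  have hρ : 0 < ρ := hr.trans_le hrρ
  set M := ∫ x in ball y ρ, ‖g x‖ ^ p with hM
  have hM0 : 0 ≤ M := intp_nonneg p g
  set e := d - p + ε with he
  rcases le_or_gt (2 * Λ * r) (ρ / (2 * Λ)) with hc | hc
  · obtain ⟨a, ha⟩ : ∃ a, a = ρ / (2 * Λ) := ⟨_, rfl⟩
    have ha0 : 0 < a := by rw [ha]; positivity
    have haρ : Λ * a < ρ := by rw [ha]; field_simp; linarith
    rw [← ha] at hc
    have k1 := hit a (Ec p f Bm χ y ρ g) ha0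
      (mul_nonneg (by positivity) (Ic_nonneg hp hf hΛ hχ _))
      (fun s t hs1 hst hta => Ec_mono hp hf hΛ hχ hu hs hs1 hst
        (lt_of_le_of_lt (mul_le_mul_of_nonneg_left hta hΛ0.le) haρ))
      (fun s hs1 hsa => hh f Bm hf y ρ u g hu hs s hs1
        (lt_of_le_of_lt (mul_le_mul_of_nonneg_left hsa hΛ0.le) haρ)) (2 * Λ * r) (by positivity) hc
    have k2 := Ic_low (s := r) (R := 2 * Λ * r) hp hf hΛ hχ hu.memg hr hrρ le_rfl
    have k3 := Ic_up hp hf hΛ hχ hu.memg a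
    have hq : 2 * Λ * r / a = 4 * Λ ^ 2 * (r / ρ) := by rw [ha]; field_simp; ring
    have hIc : Ic p f Bm χ y ρ g (2 * Λ * r) ≤ θ⁻¹ * (2 * Λ * r / a) ^ e * Ic p f Bm χ y ρ g a := by
      have e1 : Ic p f Bm χ y ρ g (2 * Λ * r) = (2 * Λ * r) ^ (d - p) * Ec p f Bm χ y ρ g (2 * Λ * r) := by
        rw [Ec, ← mul_assoc, ← Real.rpow_add (by positivity)]; simp
      have e2 : Ec p f Bm χ y ρ g a = (a ^ (d - p))⁻¹ * Ic p f Bm χ y ρ g a := by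
        rw [Ec, ← Real.rpow_neg ha0.le]; simp
      have e3 : (2 * Λ * r / a) ^ e = (2 * Λ * r) ^ (d - p) * (a ^ (d - p))⁻¹ * (2 * Λ * r / a) ^ ε := by
        rw [he, Real.rpow_add (by positivity), Real.div_rpow (by positivity) ha0.le]; rfl
      rw [e1, e3]
      rw [e2] at k1
      calc _ ≤ (2 * Λ * r) ^ (d - p) * _ := mul_le_mul_of_nonneg_left k1 (by positivity)
        _ = _ := by ring
    calc _ ≤ _ := k2
      _ ≤ Λ * p * (θ⁻¹ * (2 * Λ * r / a) ^ e * (Λ * M)) := by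
        gcongr
        exact hIc.trans (by gcongr)
      _ = Λ * p * Λ * θ⁻¹ * (4 * Λ ^ 2) ^ e * (r / ρ) ^ e * M := by
        rw [hq, Real.mul_rpow (by positivity) (by positivity)]; ring
      _ ≤ _ := by
        have h8 : (4 * Λ ^ 2) ^ e ≤ (4 * Λ ^ 2) ^ |e| := rpow_le_abs (by linarith)
        gcongr ?_ * _ * _
        exact mul_le_mul_of_nonneg_left h8 (by positivity)
  · have h2 : ∫ x in ball y r, ‖g x‖ ^ p ≤ M :=
      setIntegral_mono_set (memLp_int hp hu.memg) (ae_of_all _ fun x => by positivity)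
        (ball_subset_ball hrρ).eventuallyLE
    have h3 : (4 * Λ ^ 2)⁻¹ ≤ r / ρ := by
      rw [le_div_iff₀ hρ, inv_mul_le_iff₀ (by positivity)]
      rw [div_lt_iff₀ (by positivity)] at hc
      nlinarith
    have h4 := rpow_le_abs' (e := -e) (by linarith : 1 ≤ 4 * Λ ^ 2) ((div_le_one hρ).2 hrρ) h3
    rw [abs_neg, Real.rpow_neg (by positivity), inv_le_iff_one_le_mul₀ (by positivity)] at h4
    have h5 : 1 ≤ Λ * p * Λ * θ⁻¹ := by
      have : 1 ≤ Λ * p := by nlinarith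
      have : 1 ≤ Λ * p * Λ := by nlinarith
      nlinarith
    calc _ ≤ 1 * 1 * M := by simpa using h2
      _ ≤ (Λ * p * Λ * θ⁻¹) * ((4 * Λ ^ 2) ^ |e| * (r / ρ) ^ e) * M := by gcongr
      _ = _ := by ring

end decay3

section higher

variable {d N : ℕ} {p Λ : ℝ}

lemma enorm_rp {E : Type*} [NormedAddCommGroup E] (hp : 2 ≤ p) (a : E) :
    ‖a‖ₑ ^ p = ENNReal.ofReal (‖a‖ ^ p) := by
  rw [← ENNReal.ofReal_rpow_of_nonneg (norm_nonneg _) (by linarith), ofReal_norm]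

lemma enorm_split {E : Type*} [NormedAddCommGroup E] (hp : 2 ≤ p) (a b : E) :
    ‖a‖ₑ ^ p ≤ ENNReal.ofReal (2 ^ p) * (‖b - a‖ₑ ^ p + ‖b‖ₑ ^ p) := by
  rw [enorm_rp hp, enorm_rp hp, enorm_rp hp, ← ENNReal.ofReal_add (by positivity) (by positivity),
    ← ENNReal.ofReal_mul (by positivity)]
  refine ENNReal.ofReal_le_ofReal ?_
  refine le_trans ?_ (add_rpow_le hp (norm_nonneg _) (norm_nonneg _))
  refine Real.rpow_le_rpow (norm_nonneg _) ?_ (by linarith)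
  have := norm_sub_le b (b - a)
  rw [sub_sub_cancel] at this
  linarith

/-- the part of the energy above a level -/
def hi (p lam : ℝ) (a : Mat N d) : ℝ≥0∞ := if lam < ‖a‖ then ‖a‖ₑ ^ p else 0

lemma hi_le (p lam : ℝ) (a : Mat N d) : hi p lam a ≤ ‖a‖ₑ ^ p := by
  unfold hi; split_ifs <;> simp

lemma hi_split (hp : 2 ≤ p) (lam : ℝ) (a b : Mat N d) :
    hi p (2 * lam) a ≤ ENNReal.ofReal (2 ^ p) * (‖b - a‖ₑ ^ p + hi p lam b) := by
  unfold hi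
  split_ifs with h1 h2
  · exact enorm_split hp a b
  · rw [add_zero, enorm_rp hp, enorm_rp hp, ← ENNReal.ofReal_mul (by positivity),
      ← Real.mul_rpow (by positivity) (by positivity)]
    refine ENNReal.ofReal_le_ofReal (Real.rpow_le_rpow (norm_nonneg _) ?_ (by linarith))
    have := norm_sub_le b (b - a)
    rw [sub_sub_cancel] at this
    push Not at h2
    linarith
  · exact zero_le
  · exact zero_le

lemma hi_meas (p lam : ℝ) : Measurable (hi p lam : Mat N d → ℝ≥0∞) := by
  unfold hi
  exact Measurable.ite (measurableSet_lt measurable_const measurable_norm) (by fun_prop) measurable_const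

lemma lint_shift_ball (x : Ed d) (r : ℝ) {F : Ed d → ℝ≥0∞} :
    ∫⁻ h in ball 0 r, F (x + h) = ∫⁻ w in ball x r, F w := by
  have h1 : MeasurePreserving (fun h : Ed d => x + h) volume volume :=
    measurePreserving_add_left volume x
  have := h1.setLIntegral_comp_preimage_emb (measurableEmbedding_addLeft x) F (ball x r)
  rw [← this]
  congr 2
  ext h; simp [dist_eq_norm]

lemma Sol.congr {f : Mat N d → Mat N d} {z : Ed d} {r : ℝ} {g g' : Ed d → Mat N d}
    (h : Sol f z r g) (hg : g =ᵐ[volume.restrict (ball z r)] g') : Sol f z r g' := by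
  intro φ h1 h2 h3
  rw [← h φ h1 h2 h3]
  refine integral_congr_ae ?_
  filter_upwards [hg] with x hx
  rw [hx]

def om (d : ℕ) : ℝ := (volume (ball (0 : Ed d) 1)).toReal

lemma om_pos : 0 < om d :=
  ENNReal.toReal_pos (measure_ball_pos _ _ one_pos).ne' measure_ball_lt_top.ne

lemma vol_ball (x : Ed d) {r : ℝ} (hr : 0 < r) : volume (ball x r) = ENNReal.ofReal (r ^ d * om d) := by
  rw [Measure.addHaar_ball_of_pos volume x hr, om, ENNReal.ofReal_mul (by positivity),
    ENNReal.ofReal_toReal measure_ball_lt_top.ne]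
  simp

lemma higher_pt (hp : 2 ≤ p) {g : Ed d → Mat N d} (hg : Measurable g) {x : Ed d} {r lam : ℝ} (hr : 0 < r)
    (hlam : 0 < lam) (hx : lam < ‖g x‖)
    (hB : ENNReal.ofReal (2 ^ p) * ∫⁻ w in ball x r, ‖g w‖ₑ ^ p ≤ ENNReal.ofReal (r ^ d * om d * lam ^ p / 2)) :
    ENNReal.ofReal (r ^ d * om d) * ‖g x‖ₑ ^ p ≤
      ENNReal.ofReal (2 * 2 ^ p) * ∫⁻ h in ball 0 r, ‖g (x + h) - g x‖ₑ ^ p := by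
  have ho := om_pos (d := d)
  set V := ENNReal.ofReal (r ^ d * om d) with hV
  have h1 : ‖g x‖ₑ ^ p * V ≤ ENNReal.ofReal (2 ^ p) * ((∫⁻ h in ball 0 r, ‖g (x + h) - g x‖ₑ ^ p) +
      ∫⁻ w in ball x r, ‖g w‖ₑ ^ p) := by
    have e1 : ∫⁻ h in ball (0 : Ed d) r, ‖g x‖ₑ ^ p = ‖g x‖ₑ ^ p * V := by
      rw [setLIntegral_const, vol_ball _ hr]
    rw [← e1, ← lint_shift_ball x r (F := fun w => ‖g w‖ₑ ^ p), ← lintegral_add_right,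
      ← lintegral_const_mul]
    · exact lintegral_mono fun h => enorm_split hp _ _
    · fun_prop
    · fun_prop
  have h2 : ENNReal.ofReal (2 ^ p) * ∫⁻ w in ball x r, ‖g w‖ₑ ^ p ≤ (V * ‖g x‖ₑ ^ p) / 2 := by
    refine hB.trans ?_
    have e2 : ∀ c : ℝ, ENNReal.ofReal c / 2 = ENNReal.ofReal (c / 2) := fun c => by
      rw [ENNReal.ofReal_div_of_pos two_pos]; simp
    rw [enorm_rp hp, hV, ← ENNReal.ofReal_mul (by positivity), e2]
    gcongr
  have h3 : V * ‖g x‖ₑ ^ p ≠ ∞ := by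
    rw [enorm_rp hp]; exact ENNReal.mul_ne_top ENNReal.ofReal_ne_top ENNReal.ofReal_ne_top
  rw [mul_add, mul_comm _ V] at h1
  have h4 : V * ‖g x‖ₑ ^ p / 2 ≤ ENNReal.ofReal (2 ^ p) * ∫⁻ h in ball 0 r, ‖g (x + h) - g x‖ₑ ^ p := by
    refine ENNReal.le_of_add_le_add_right (a := V * ‖g x‖ₑ ^ p / 2) ?_ ?_
    · exact ENNReal.div_ne_top h3 two_ne_zero
    · rw [ENNReal.add_halves]
      exact h1.trans (by gcongr)
  calc V * ‖g x‖ₑ ^ p = 2 * (V * ‖g x‖ₑ ^ p / 2) := by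
        rw [ENNReal.mul_div_cancel two_ne_zero (by simp)]
    _ ≤ 2 * (ENNReal.ofReal (2 ^ p) * ∫⁻ h in ball 0 r, ‖g (x + h) - g x‖ₑ ^ p) := by gcongr
    _ = _ := by rw [ENNReal.ofReal_mul (by norm_num), mul_assoc]; simp

lemma higher (d N : ℕ) {p Λ : ℝ} (hp : 2 ≤ p) (hΛ : 1 ≤ Λ) : ∃ γ C : ℝ, 2 < p * γ ∧ 0 ≤ C ∧
    ∀ (f : Mat N d → Mat N d) (Bm : Ed d →L[ℝ] Ed d), Frozen p Λ f Bm →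
    ∀ (z : Ed d) (ρ : ℝ) (u : Ed d → En N) (g : Ed d → Mat N d), 0 < ρ →
    Appr p z ρ u g → Sol f z ρ g → ∀ lam, 0 < lam →
    ∫⁻ x in ball z (ρ / 2), hi p lam (g x) ≤ ENNReal.ofReal
      (C * ((∫ x in ball z ρ, ‖g x‖ ^ p) / ρ ^ d / lam ^ p) ^ γ * ∫ x in ball z ρ, ‖g x‖ ^ p) := by
  obtain ⟨ε, C1, hε0, hε1, hC1, hdec⟩ := decay d N hp hΛ
  obtain ⟨CA, hCA, hA⟩ := stepA (d := d) (N := N) hp (by linarith : 0 < Λ)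
  have ho := om_pos (d := d)
  obtain ⟨κ, hκ⟩ : ∃ κ, κ = p - ε := ⟨_, rfl⟩
  have hκ0 : 0 < κ := by linarith
  obtain ⟨C2, hC2⟩ : ∃ C2, C2 = 2 * 2 ^ p * C1 * 2 ^ (d - p + ε) / om d + 1 := ⟨_, rfl⟩
  have hC20 : 0 < C2 := by rw [hC2]; positivity
  refine ⟨2 / κ, (256 + 2 * 2 ^ p * CA) * C2 ^ (2 / κ), ?_, by positivity, ?_⟩
  · rw [mul_div_assoc', lt_div_iff₀ hκ0]; nlinarith
  intro f Bm hf z ρ u g0 hρ hu0 hs0 lam hlam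
  obtain ⟨g, hg, hgg⟩ : ∃ g : Ed d → Mat N d, Measurable g ∧ g0 =ᵐ[volume.restrict (ball z ρ)] g :=
    ⟨hu0.memg.1.mk g0, hu0.memg.1.stronglyMeasurable_mk.measurable, hu0.memg.1.ae_eq_mk⟩
  have hu := hu0.congr (ae_eq_refl _) hgg
  have hs := hs0.congr hgg
  have e1 : ∫ x in ball z ρ, ‖g0 x‖ ^ p = ∫ x in ball z ρ, ‖g x‖ ^ p :=
    integral_congr_ae (hgg.mono fun x hx => by simp only; rw [hx])
  have e2 : ∫⁻ x in ball z (ρ / 2), hi p lam (g0 x) = ∫⁻ x in ball z (ρ / 2), hi p lam (g x) := by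
    refine lintegral_congr_ae ?_
    filter_upwards [ae_restrict_of_ae_restrict_of_subset (ball_subset_ball (by linarith : ρ / 2 ≤ ρ)) hgg]
      with x hx
    rw [hx]
  rw [e1, e2]
  clear e1 e2
  have hmem := hu.memg
  obtain ⟨I, hI⟩ : ∃ I, I = ∫ x in ball z ρ, ‖g x‖ ^ p := ⟨_, rfl⟩
  rw [← hI]
  have htriv : ∫⁻ x in ball z (ρ / 2), hi p lam (g x) ≤ ENNReal.ofReal I := by
    rw [hI, ← lint_eq_int hp hmem]
    exact (lintegral_mono fun x => hi_le _ _ _).trans (lintegral_mono_set (ball_subset_ball (by linarith)))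
  have hI0 : 0 ≤ I := hI ▸ intp_nonneg p g
  rcases hI0.eq_or_lt with hz | hIpos
  · rw [← hz] at htriv ⊢; simpa using htriv
  obtain ⟨M, hM⟩ : ∃ M, M = I / ρ ^ d := ⟨_, rfl⟩
  have hM0 : 0 < M := by rw [hM]; positivity
  rw [← hM]
  obtain ⟨Y, hY⟩ : ∃ Y, Y = C2 * (M / lam ^ p) := ⟨_, rfl⟩
  have hY0 : 0 < Y := by rw [hY]; positivity
  have hYγ : Y ^ (2 / κ) = C2 ^ (2 / κ) * (M / lam ^ p) ^ (2 / κ) := by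
    rw [hY, Real.mul_rpow (by positivity) (by positivity)]
  obtain ⟨t, ht⟩ : ∃ t, t = Y ^ (1 / κ) := ⟨_, rfl⟩
  have ht0 : 0 < t := by rw [ht]; positivity
  have ht2 : t ^ 2 = Y ^ (2 / κ) := by
    rw [ht, ← Real.rpow_natCast, ← Real.rpow_mul hY0.le]; congr 1; push_cast; ring
  have htκ : t ^ κ = Y := by
    rw [ht, ← Real.rpow_mul hY0.le, one_div_mul_cancel hκ0.ne', Real.rpow_one]
  have hgoal : (256 + 2 * 2 ^ p * CA) * C2 ^ (2 / κ) * (M / lam ^ p) ^ (2 / κ) * I =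
      (256 + 2 * 2 ^ p * CA) * t ^ 2 * I := by rw [ht2, hYγ]; ring
  rw [hgoal]
  rcases le_or_gt t (1 / 16) with hc | hc
  · obtain ⟨r, hr⟩ : ∃ r, r = ρ * t := ⟨_, rfl⟩
    have hr0 : 0 < r := by rw [hr]; positivity
    have hrρ : r ≤ ρ / 16 := by rw [hr]; nlinarith
    have hpt : ∀ x ∈ ball z (ρ / 2), ENNReal.ofReal (r ^ d * om d) * hi p lam (g x) ≤
        ENNReal.ofReal (2 * 2 ^ p) * ∫⁻ h in ball 0 r, ‖g (x + h) - g x‖ₑ ^ p := by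
      intro x hx
      unfold hi
      split_ifs with hl
      · refine higher_pt hp hg hr0 hlam hl ?_
        have hsub : ball x (ρ / 2) ⊆ ball z ρ := ball_subset_ball' (by rw [mem_ball] at hx; linarith)
        have k1 := hdec f Bm hf x (ρ / 2) u g (hu.mono hsub) (hs.mono hsub) r hr0 (by linarith)
        have k2 : ∫ w in ball x (ρ / 2), ‖g w‖ ^ p ≤ I := by
          rw [hI]
          exact setIntegral_mono_set (memLp_int hp hmem) (ae_of_all _ fun x => by positivity) hsub.eventuallyLE
        have hmr : MemLp g (PP p) (volume.restrict (ball x r)) :=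
          hmem.mono_measure (Measure.restrict_mono ((ball_subset_ball (by linarith)).trans hsub) le_rfl)
        rw [lint_eq_int hp hmr, ← ENNReal.ofReal_mul (by positivity)]
        refine ENNReal.ofReal_le_ofReal ?_
        have e3 : (r / (ρ / 2)) ^ (d - p + ε) = 2 ^ (d - p + ε) * (t ^ d / Y) := by
          rw [hr, show ρ * t / (ρ / 2) = 2 * t by field_simp, Real.mul_rpow (by norm_num) ht0.le,
            show (d : ℝ) - p + ε = d - κ by rw [hκ]; ring, Real.rpow_sub ht0, htκ, Real.rpow_natCast]
        have e4 : I = M * ρ ^ d := by rw [hM]; field_simp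
        calc 2 ^ p * ∫ w in ball x r, ‖g w‖ ^ p ≤ 2 ^ p * (C1 * (r / (ρ / 2)) ^ (d - p + ε) * I) := by
              gcongr
              exact k1.trans (by gcongr)
          _ = (2 * 2 ^ p * C1 * 2 ^ (d - p + ε) / om d) * (t ^ d * ρ ^ d * om d) / 2 * (M / Y) := by
              rw [e3, e4]; field_simp
          _ ≤ C2 * (t ^ d * ρ ^ d * om d) / 2 * (M / Y) := by
              gcongr; rw [hC2]; linarith
          _ = _ := by
              rw [hY, hr, mul_pow]; field_simp
      · simp
    have hmeas2 : Measurable fun q : Ed d × Ed d => ‖g (q.1 + q.2) - g q.1‖ₑ ^ p := by fun_prop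
    have hInt : ENNReal.ofReal (r ^ d * om d) * ∫⁻ x in ball z (ρ / 2), hi p lam (g x) ≤
        ENNReal.ofReal (r ^ d * om d) * ENNReal.ofReal (2 * 2 ^ p * CA * t ^ 2 * I) := by
      calc _ = ∫⁻ x in ball z (ρ / 2), ENNReal.ofReal (r ^ d * om d) * hi p lam (g x) :=
            (lintegral_const_mul _ ((hi_meas p lam).comp hg)).symm
        _ ≤ ∫⁻ x in ball z (ρ / 2), ENNReal.ofReal (2 * 2 ^ p) *
            ∫⁻ h in ball 0 r, ‖g (x + h) - g x‖ₑ ^ p := setLIntegral_mono' measurableSet_ball hpt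
        _ = ENNReal.ofReal (2 * 2 ^ p) * ∫⁻ x in ball z (ρ / 2),
            ∫⁻ h in ball 0 r, ‖g (x + h) - g x‖ₑ ^ p :=
            lintegral_const_mul _ hmeas2.lintegral_prod_right'
        _ = ENNReal.ofReal (2 * 2 ^ p) * ∫⁻ h in ball 0 r,
            ∫⁻ x in ball z (ρ / 2), ‖g (x + h) - g x‖ₑ ^ p := by
            rw [lintegral_lintegral_swap hmeas2.aemeasurable]
        _ ≤ ENNReal.ofReal (2 * 2 ^ p) * ∫⁻ h in ball (0 : Ed d) r,
            ENNReal.ofReal (CA * t ^ 2 * I) := by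
            refine mul_le_mul_right ?_ _
            refine setLIntegral_mono' (measurableSet_ball (x := (0 : Ed d)) (ε := r)) fun h hh => ?_
            have hh' : ‖h‖ < r := by simpa using hh
            have hm2 : MemLp (fun x => g (x + h) - g x) (PP p) (volume.restrict (ball z (ρ / 2))) :=
              (hu.shift (by linarith)).memg.sub
                (hmem.mono_measure (Measure.restrict_mono (ball_subset_ball (by linarith)) le_rfl))
            rw [lint_eq_int hp hm2]
            refine ENNReal.ofReal_le_ofReal ?_
            refine (hA f Bm hf z h ρ u g hρ hu hs (by linarith)).trans ?_
            rw [← hI]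
            have : ‖h‖ / ρ ≤ t := by rw [div_le_iff₀ hρ]; linarith
            gcongr
        _ = _ := by
            rw [setLIntegral_const, vol_ball _ hr0, ← mul_assoc, ← ENNReal.ofReal_mul (by positivity),
              mul_comm (ENNReal.ofReal _)]
            ring_nf
    have hV0 : ENNReal.ofReal (r ^ d * om d) ≠ 0 := by
      have : 0 < r ^ d * om d := by positivity
      simpa using this
    refine ((ENNReal.mul_le_mul_iff_right hV0 ENNReal.ofReal_ne_top).1 hInt).trans ?_
    refine ENNReal.ofReal_le_ofReal ?_
    gcongr
    linarith
  · refine htriv.trans (ENNReal.ofReal_le_ofReal ?_)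
    have h5 : 1 ≤ 256 * t ^ 2 := by nlinarith
    have h6 : 1 ≤ (256 + 2 * 2 ^ p * CA) * t ^ 2 := by
      have : 0 ≤ 2 * 2 ^ p * CA * t ^ 2 := by positivity
      linarith
    nlinarith

end higher

section layercake

variable {X : Type*} [MeasurableSpace X] {μ : Measure X}

lemma layer_trunc {h k : X → ℝ} (hh : Measurable h) (hk : Measurable k) (h0 : ∀ x, 0 ≤ h x)
    (k0 : ∀ x, 0 ≤ k x) {η K c t0 σ T : ℝ} (hη : 0 ≤ η) (hK : 0 < K) (hc : 0 < c) (ht0 : 0 ≤ t0)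
    (hσ : 0 < σ) (hT : 0 ≤ T) (hfin : ∫⁻ x, ENNReal.ofReal (h x) ∂μ ≠ ∞) (hKc : 1 ≤ 2 * K / c)
    (hsm : 2 * η * (2 * K / c) ^ σ ≤ 1 / 2)
    (hgl : ∀ t, 0 < t → t0 ≤ t → ∫⁻ x in {x | K * t < h x}, ENNReal.ofReal (h x) ∂μ ≤
      ENNReal.ofReal η * ∫⁻ x in {x | c * t < h x + k x}, ENNReal.ofReal (h x + k x) ∂μ) :
    ∫⁻ x, ENNReal.ofReal (h x) * ENNReal.ofReal (min (h x / K) T ^ σ) ∂μ ≤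
      2 * (ENNReal.ofReal (t0 ^ σ) * (∫⁻ x, ENNReal.ofReal (h x) ∂μ) + ENNReal.ofReal (2 * η) *
        ∫⁻ x, ENNReal.ofReal (k x) * ENNReal.ofReal ((2 * k x / c) ^ σ) ∂μ) := by
  set ν := μ.withDensity fun x => ENNReal.ofReal (h x) with hν
  set ν' := μ.withDensity fun x => ENNReal.ofReal (k x) with hν'
  have wd : ∀ F : X → ℝ, Measurable F → ∫⁻ x, ENNReal.ofReal (F x ^ σ) ∂ν =
      ∫⁻ x, ENNReal.ofReal (h x) * ENNReal.ofReal (F x ^ σ) ∂μ := fun F hF => by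
    rw [hν, lintegral_withDensity_eq_lintegral_mul _ hh.ennreal_ofReal (by fun_prop)]; rfl
  have wd' : ∀ F : X → ℝ, Measurable F → ∫⁻ x, ENNReal.ofReal (F x ^ σ) ∂ν' =
      ∫⁻ x, ENNReal.ofReal (k x) * ENNReal.ofReal (F x ^ σ) ∂μ := fun F hF => by
    rw [hν', lintegral_withDensity_eq_lintegral_mul _ hk.ennreal_ofReal (by fun_prop)]; rfl
  have hνu : ν univ = ∫⁻ x, ENNReal.ofReal (h x) ∂μ := by
    rw [hν, withDensity_apply _ MeasurableSet.univ, Measure.restrict_univ]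
  have lc : ∀ (m : Measure X) (F : X → ℝ), Measurable F → (∀ x, 0 ≤ F x) →
      ∫⁻ x, ENNReal.ofReal (F x ^ σ) ∂m =
      ENNReal.ofReal σ * ∫⁻ t in Ioi 0, m {x | t < F x} * ENNReal.ofReal (t ^ (σ - 1)) :=
    fun m F hF h0 => lintegral_rpow_eq_lintegral_meas_lt_mul m (ae_of_all _ h0) hF.aemeasurable hσ
  have mF1 : Measurable fun x => min (h x / K) T := by fun_prop
  have mF2 : Measurable fun x => min (2 * h x / c) T := by fun_prop
  have mF3 : Measurable fun x => 2 * k x / c := by fun_prop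
  have mF0 : Measurable fun _ : X => t0 := measurable_const
  have pF1 : ∀ x, 0 ≤ min (h x / K) T := fun x => le_min (div_nonneg (h0 x) hK.le) hT
  have pF2 : ∀ x, 0 ≤ min (2 * h x / c) T := fun x =>
    le_min (div_nonneg (mul_nonneg two_pos.le (h0 x)) hc.le) hT
  have pF3 : ∀ x, 0 ≤ 2 * k x / c := fun x => div_nonneg (mul_nonneg two_pos.le (k0 x)) hc.le
  have mm : ∀ (m : Measure X) (F : X → ℝ), Measurable fun t : ℝ => m {x | t < F x} * ENNReal.ofReal (t ^ (σ - 1)) := by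
    intro m F
    refine Measurable.mul (Antitone.measurable fun a b hab => measure_mono fun x hx => ?_) (by fun_prop)
    exact lt_of_le_of_lt hab hx
  -- level set estimate
  have key : ∀ t : ℝ, 0 < t → ν {x | t < min (h x / K) T} ≤ ν {x | t < t0} +
      ENNReal.ofReal (2 * η) * (ν {x | t < min (2 * h x / c) T} + ν' {x | t < 2 * k x / c}) := by
    intro t ht
    by_cases htt : t < t0
    · refine le_add_right (measure_mono fun x _ => htt)
    push Not at htt
    by_cases htT : t < T
    swap
    · have : {x | t < min (h x / K) T} = ∅ := by
        ext x; simp [lt_min_iff, htT]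
      rw [this]; simp
    refine le_add_left ?_
    have s1 : {x | t < min (h x / K) T} = {x | K * t < h x} := by
      ext x; simp only [lt_min_iff, mem_ofPred_eq, lt_div_iff₀ hK, htT, and_true, mul_comm]
    have s2 : {x | t < min (2 * h x / c) T} = {x | c * t < 2 * h x} := by
      ext x; simp only [lt_min_iff, mem_ofPred_eq, lt_div_iff₀ hc, htT, and_true, mul_comm c]
    have s3 : {x | t < 2 * k x / c} = {x | c * t < 2 * k x} := by
      ext x; simp only [mem_ofPred_eq, lt_div_iff₀ hc, mul_comm c]
    have M1 : MeasurableSet {x | K * t < h x} := measurableSet_lt measurable_const hh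
    have M2 : MeasurableSet {x | c * t < 2 * h x} := measurableSet_lt measurable_const (hh.const_mul 2)
    have M3 : MeasurableSet {x | c * t < 2 * k x} := measurableSet_lt measurable_const (hk.const_mul 2)
    have M4 : MeasurableSet {x | c * t < h x + k x} := measurableSet_lt measurable_const (hh.add hk)
    rw [s1, s2, s3, hν, hν', withDensity_apply _ M1, withDensity_apply _ M2, withDensity_apply _ M3]
    refine (hgl t ht htt).trans ?_
    rw [mul_comm 2 η, ENNReal.ofReal_mul hη, mul_assoc]
    refine mul_le_mul_right ?_ _
    rw [← lintegral_indicator M4, ← lintegral_indicator M2, ← lintegral_indicator M3, ← lintegral_add_left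
      (hh.ennreal_ofReal.indicator M2), ← lintegral_const_mul _ ((hh.ennreal_ofReal.indicator M2).fun_add
      (hk.ennreal_ofReal.indicator M3))]
    refine lintegral_mono fun x => ?_
    by_cases hx : x ∈ {x | c * t < h x + k x}
    swap
    · rw [indicator_of_notMem hx]; exact zero_le
    rw [indicator_of_mem hx]
    simp only [mem_ofPred_eq] at hx
    rcases le_total (k x) (h x) with hkh | hkh
    · have : x ∈ {x | c * t < 2 * h x} := by show c * t < 2 * h x; linarith
      rw [indicator_of_mem this, mul_add, ← ENNReal.ofReal_mul two_pos.le]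
      exact le_add_right (ENNReal.ofReal_le_ofReal (by linarith))
    · have : x ∈ {x | c * t < 2 * k x} := by show c * t < 2 * k x; linarith
      rw [indicator_of_mem this, mul_add, ← ENNReal.ofReal_mul two_pos.le]
      exact le_add_left (ENNReal.ofReal_le_ofReal (by linarith))
  have F2F1 : ∀ x, ENNReal.ofReal (min (2 * h x / c) T ^ σ) ≤
      ENNReal.ofReal ((2 * K / c) ^ σ) * ENNReal.ofReal (min (h x / K) T ^ σ) := by
    intro x
    rw [← ENNReal.ofReal_mul (by positivity), ← Real.mul_rpow (by positivity) (pF1 x)]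
    refine ENNReal.ofReal_le_ofReal (Real.rpow_le_rpow (pF2 x) ?_ hσ.le)
    rcases min_cases (h x / K) T with ⟨h1, _⟩ | ⟨h1, _⟩
    · rw [h1]
      refine (min_le_left _ _).trans (le_of_eq ?_)
      field_simp
    · rw [h1]
      exact (min_le_right _ _).trans (le_mul_of_one_le_left hT hKc)
  have main : ∫⁻ x, ENNReal.ofReal (min (h x / K) T ^ σ) ∂ν ≤ ∫⁻ x, ENNReal.ofReal (t0 ^ σ) ∂ν +
      ENNReal.ofReal (2 * η) * (∫⁻ x, ENNReal.ofReal (min (2 * h x / c) T ^ σ) ∂ν +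
        ∫⁻ x, ENNReal.ofReal ((2 * k x / c) ^ σ) ∂ν') := by
    rw [lc ν _ mF1 pF1, lc ν _ mF0 (fun _ => ht0), lc ν _ mF2 pF2, lc ν' _ mF3 pF3, ← mul_add, mul_left_comm,
      ← mul_add]
    refine mul_le_mul_right ?_ _
    rw [← lintegral_add_left (mm _ _), ← lintegral_const_mul _ ((mm _ _).fun_add (mm _ _)),
      ← lintegral_add_left (mm _ _)]
    refine setLIntegral_mono' measurableSet_Ioi fun t ht => ?_
    rw [← add_mul, ← mul_assoc, ← add_mul]
    exact mul_le_mul_left (key t ht) _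
  obtain ⟨Z, hZ⟩ : ∃ Z, Z = ∫⁻ x, ENNReal.ofReal (min (h x / K) T ^ σ) ∂ν := ⟨_, rfl⟩
  have hZfin : Z ≠ ∞ := by
    have : Z ≤ ENNReal.ofReal (T ^ σ) * ν univ := by
      rw [hZ, ← lintegral_const]
      exact lintegral_mono fun x => ENNReal.ofReal_le_ofReal
        (Real.rpow_le_rpow (pF1 x) (min_le_right _ _) hσ.le)
    refine ne_top_of_le_ne_top (ENNReal.mul_ne_top ENNReal.ofReal_ne_top (hνu ▸ hfin)) this
  have hF2 : ENNReal.ofReal (2 * η) * ∫⁻ x, ENNReal.ofReal (min (2 * h x / c) T ^ σ) ∂ν ≤ Z / 2 := by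
    calc _ ≤ ENNReal.ofReal (2 * η) * (ENNReal.ofReal ((2 * K / c) ^ σ) * Z) := by
          refine mul_le_mul_right ?_ _
          rw [hZ, ← lintegral_const_mul _ (by fun_prop)]
          exact lintegral_mono F2F1
      _ = ENNReal.ofReal (2 * η * (2 * K / c) ^ σ) * Z := by
          rw [← mul_assoc, ← ENNReal.ofReal_mul (by positivity)]
      _ ≤ ENNReal.ofReal (1 / 2) * Z := by gcongr
      _ = Z / 2 := by
          rw [ENNReal.div_eq_inv_mul, one_div, ENNReal.ofReal_inv_of_pos two_pos]; simp
  rw [← hZ, mul_add, lintegral_const, hνu, wd' _ mF3] at main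
  rw [← wd _ mF1, ← hZ]
  obtain ⟨W, hW⟩ : ∃ W, W = ENNReal.ofReal (t0 ^ σ) * (∫⁻ x, ENNReal.ofReal (h x) ∂μ) +
    ENNReal.ofReal (2 * η) * ∫⁻ x, ENNReal.ofReal (k x) * ENNReal.ofReal ((2 * k x / c) ^ σ) ∂μ := ⟨_, rfl⟩
  rw [← hW]
  have h5 : Z / 2 ≤ W := by
    refine ENNReal.le_of_add_le_add_right (a := Z / 2) (ENNReal.div_ne_top hZfin two_ne_zero) ?_
    rw [ENNReal.add_halves]
    refine main.trans ?_
    rw [hW, add_assoc, add_comm _ (Z / 2)]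
    gcongr
  calc Z = 2 * (Z / 2) := by rw [ENNReal.mul_div_cancel two_ne_zero (by simp)]
    _ ≤ _ := mul_le_mul_right h5 _

lemma layer {h k : X → ℝ} (hh : Measurable h) (hk : Measurable k) (h0 : ∀ x, 0 ≤ h x)
    (k0 : ∀ x, 0 ≤ k x) {η K c t0 σ : ℝ} (hη : 0 ≤ η) (hK : 0 < K) (hc : 0 < c) (ht0 : 0 ≤ t0)
    (hσ : 0 < σ) (hfin : ∫⁻ x, ENNReal.ofReal (h x) ∂μ ≠ ∞) (hKc : 1 ≤ 2 * K / c)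
    (hsm : 2 * η * (2 * K / c) ^ σ ≤ 1 / 2)
    (hgl : ∀ t, 0 < t → t0 ≤ t → ∫⁻ x in {x | K * t < h x}, ENNReal.ofReal (h x) ∂μ ≤
      ENNReal.ofReal η * ∫⁻ x in {x | c * t < h x + k x}, ENNReal.ofReal (h x + k x) ∂μ) :
    ∫⁻ x, ENNReal.ofReal (h x) * ENNReal.ofReal ((h x / K) ^ σ) ∂μ ≤
      2 * (ENNReal.ofReal (t0 ^ σ) * (∫⁻ x, ENNReal.ofReal (h x) ∂μ) + ENNReal.ofReal (2 * η) *
        ∫⁻ x, ENNReal.ofReal (k x) * ENNReal.ofReal ((2 * k x / c) ^ σ) ∂μ) := by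
  have hnn : ∀ x, 0 ≤ h x / K := fun x => div_nonneg (h0 x) hK.le
  have e : ∀ x, ENNReal.ofReal (h x) * ENNReal.ofReal ((h x / K) ^ σ) =
      ⨆ n : ℕ, ENNReal.ofReal (h x) * ENNReal.ofReal (min (h x / K) n ^ σ) := by
    intro x
    refine le_antisymm ?_ (iSup_le fun n => ?_)
    · obtain ⟨n, hn⟩ := exists_nat_ge (h x / K)
      refine le_trans (le_of_eq ?_) (le_iSup _ n)
      rw [min_eq_left hn]
    · refine mul_le_mul_right (ENNReal.ofReal_le_ofReal (Real.rpow_le_rpow ?_ (min_le_left _ _) hσ.le)) _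
      exact le_min (hnn x) (Nat.cast_nonneg n)
  simp_rw [e]
  rw [lintegral_iSup (fun n => by fun_prop)]
  · exact iSup_le fun n => layer_trunc hh hk h0 k0 hη hK hc ht0 hσ (Nat.cast_nonneg n) hfin hKc hsm hgl
  · intro m n hmn x
    refine mul_le_mul_right (ENNReal.ofReal_le_ofReal (Real.rpow_le_rpow ?_ ?_ hσ.le)) _
    · exact le_min (hnn x) (Nat.cast_nonneg m)
    · exact min_le_min_left _ (Nat.cast_le.2 hmn)

end layercake

section goodlam

variable {d : ℕ}

def wt (U : Set (Ed d)) (x : Ed d) : ℝ := infDist x Uᶜ ^ d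

lemma wt_nonneg (U : Set (Ed d)) (x : Ed d) : 0 ≤ wt U x := pow_nonneg infDist_nonneg _

lemma wt_meas (U : Set (Ed d)) : Measurable (wt U) :=
  ((continuous_infDist_pt _).pow d).measurable

lemma wt_zero (hd : 1 ≤ d) {U : Set (Ed d)} {x : Ed d} (hx : x ∉ U) : wt U x = 0 := by
  rw [wt, infDist_zero_of_mem (show x ∈ Uᶜ from hx), zero_pow (by omega)]

lemma vol_cball (x : Ed d) (hd : 1 ≤ d) {r : ℝ} (hr : 0 < r) :
    volume (closedBall x r) = ENNReal.ofReal (r ^ d * om d) := by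
  have : Nonempty (Fin d) := ⟨⟨0, hd⟩⟩
  rw [Measure.addHaar_closedBall_eq_addHaar_ball, vol_ball x hr]

lemma crossing (hd : 1 ≤ d) {U : Set (Ed d)} (hU : IsOpen U) (hUc : Uᶜ.Nonempty) {φ ψ : Ed d → ℝ}
    (hφ : Measurable φ) (hψ : Measurable ψ) (φ0 : ∀ x, 0 ≤ φ x) (ψ0 : ∀ x, 0 ≤ ψ x)
    (hfin : ∫⁻ x in U, ENNReal.ofReal (φ x + ψ x) ≠ ∞) {K t : ℝ} (ht : 0 < t) (hK : 1 ≤ K * om d)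
    (htU : 2 ^ d * ∫⁻ x in U, ENNReal.ofReal (φ x + ψ x) ≤ ENNReal.ofReal t) :
    ∀ᵐ x, K * t < wt U x * φ x → ∃ r, 0 < r ∧ 16 * r ≤ infDist x Uᶜ / 2 ∧
      ENNReal.ofReal (wt U x) * ∫⁻ y in closedBall x (16 * r), ENNReal.ofReal (φ y + ψ y) ≤
        ENNReal.ofReal (t * (16 * r) ^ d) ∧
      ENNReal.ofReal (t * r ^ d) < ENNReal.ofReal (wt U x) *
        ∫⁻ y in closedBall x r, ENNReal.ofReal (φ y + ψ y) := by
  have ho := om_pos (d := d)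
  have hK0 : 0 < K := by
    by_contra h; push Not at h; nlinarith
  set Φ : Ed d → ℝ≥0∞ := U.indicator fun x => ENNReal.ofReal (φ x + ψ x) with hΦ
  have hΦm : Measurable Φ := (hφ.add hψ).ennreal_ofReal.indicator hU.measurableSet
  have hΦf : ∫⁻ x, Φ x ≠ ∞ := by rw [hΦ, lintegral_indicator hU.measurableSet]; exact hfin
  filter_upwards [(IsUnifLocDoublingMeasure.vitaliFamily (volume : Measure (Ed d)) 1).ae_tendsto_lintegral_div' hΦm hΦf]
    with x hx hxE
  have hxU : x ∈ U := by
    by_contra h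
    rw [wt_zero hd h, zero_mul] at hxE
    nlinarith
  set δ := infDist x Uᶜ with hδ
  have hδ0 : 0 < δ := (hU.isClosed_compl.notMem_iff_infDist_pos hUc).1 (by simpa using hxU)
  have hw : wt U x = δ ^ d := rfl
  set ρ : ℕ → ℝ := fun k => δ / 2 * (1 / 16) ^ k with hρ
  have ρ0 : ∀ k, 0 < ρ k := fun k => by positivity
  have ρle : ∀ k, ρ k ≤ δ / 2 := fun k =>
    mul_le_of_le_one_right (by positivity) (pow_le_one₀ (by norm_num) (by norm_num))
  have sub : ∀ k, closedBall x (ρ k) ⊆ U := by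
    intro k y hy
    by_contra h
    have h1 := infDist_le_dist_of_mem (x := x) (show y ∈ Uᶜ from h)
    rw [mem_closedBall, dist_comm] at hy
    have := ρle k
    linarith
  have eqI : ∀ k, ∫⁻ y in closedBall x (ρ k), Φ y = ∫⁻ y in closedBall x (ρ k), ENNReal.ofReal (φ y + ψ y) := by
    intro k
    refine setLIntegral_congr_fun measurableSet_closedBall fun y hy => ?_
    exact indicator_of_mem (sub k hy) _
  have tend : Tendsto (fun k => (∫⁻ y in closedBall x (ρ k), Φ y) / volume (closedBall x (ρ k))) atTop (𝓝 (Φ x)) := by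
    refine hx.comp (IsUnifLocDoublingMeasure.tendsto_closedBall_filterAt volume (fun _ => x) ρ ?_ ?_)
    · refine tendsto_nhdsWithin_iff.2 ⟨?_, Eventually.of_forall ρ0⟩
      have := (tendsto_pow_atTop_nhds_zero_of_lt_one (r := (1 / 16 : ℝ)) (by norm_num) (by norm_num)).const_mul (δ / 2)
      simpa [hρ] using this
    · exact Eventually.of_forall fun k => mem_closedBall_self (by have := ρ0 k; linarith)
  have hlt : ENNReal.ofReal (t / (δ ^ d * om d)) < Φ x := by
    rw [hΦ, indicator_of_mem hxU]
    refine (ENNReal.ofReal_lt_ofReal_iff_of_nonneg (by positivity)).2 ?_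
    rw [hw] at hxE
    have h1 : t < (δ ^ d * om d) * φ x := by
      calc t ≤ K * om d * t := by nlinarith
        _ = om d * (K * t) := by ring
        _ < om d * (δ ^ d * φ x) := by gcongr
        _ = _ := by ring
    rw [div_lt_iff₀ (by positivity)]
    nlinarith [ψ0 x, mul_pos (pow_pos hδ0 d) ho, mul_nonneg (mul_pos (pow_pos hδ0 d) ho).le (ψ0 x)]
  have hex : ∃ k, ENNReal.ofReal (t * ρ k ^ d) < ENNReal.ofReal (wt U x) *
        ∫⁻ y in closedBall x (ρ k), ENNReal.ofReal (φ y + ψ y) := by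
    obtain ⟨k, hk⟩ := (tend.eventually_const_lt hlt).exists
    refine ⟨k, ?_⟩
    have hv : 0 < ρ k ^ d * om d := by have := ρ0 k; positivity
    rw [vol_cball x hd (ρ0 k), ENNReal.lt_div_iff_mul_lt (Or.inl (by simpa using hv)) (Or.inl ENNReal.ofReal_ne_top),
      ← ENNReal.ofReal_mul (by positivity), eqI] at hk
    have hc : ENNReal.ofReal (δ ^ d) ≠ 0 := by simpa using pow_pos hδ0 d
    rw [hw]
    calc ENNReal.ofReal (t * ρ k ^ d) = ENNReal.ofReal (δ ^ d) * ENNReal.ofReal (t / (δ ^ d * om d) * (ρ k ^ d * om d)) := by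
          rw [← ENNReal.ofReal_mul (by positivity)]; congr 1; field_simp
      _ < _ := (ENNReal.mul_lt_mul_iff_right hc ENNReal.ofReal_ne_top).2 hk
  classical
  have hk := Nat.find_spec hex
  have hmin := fun m hm => Nat.find_min hex (m := m) hm
  generalize Nat.find hex = k at hk hmin
  rcases k with _ | k
  · exfalso
    refine absurd hk (not_lt.2 ?_)
    have e0 : ρ 0 = δ / 2 := by simp [hρ]
    calc _ ≤ ENNReal.ofReal (wt U x) * ∫⁻ y in U, ENNReal.ofReal (φ y + ψ y) := by
          gcongr; exact sub 0
      _ = ENNReal.ofReal ((δ / 2) ^ d) * (2 ^ d * ∫⁻ y in U, ENNReal.ofReal (φ y + ψ y)) := by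
          rw [← mul_assoc]; congr 1
          have : (2 : ℝ≥0∞) ^ d = ENNReal.ofReal (2 ^ d) := by
            rw [ENNReal.ofReal_pow two_pos.le]; simp
          rw [this, ← ENNReal.ofReal_mul (by positivity), hw, ← mul_pow]; congr 2; ring
      _ ≤ ENNReal.ofReal ((δ / 2) ^ d) * ENNReal.ofReal t := by gcongr
      _ = _ := by rw [← ENNReal.ofReal_mul (by positivity), e0, mul_comm]
  · have e1 : 16 * ρ (k + 1) = ρ k := by simp only [hρ, pow_succ]; ring
    refine ⟨ρ (k + 1), ρ0 _, e1 ▸ ρle k, ?_, hk⟩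
    rw [e1]
    exact not_lt.1 (hmin k (Nat.lt_succ_self k))

lemma gl_ball (hd : 1 ≤ d) {U : Set (Ed d)} (hU : IsOpen U) (hUc : Uᶜ.Nonempty) {φ ψ : Ed d → ℝ}
    (hφ : Measurable φ) (hψ : Measurable ψ) (φ0 : ∀ x, 0 ≤ φ x) (ψ0 : ∀ x, 0 ≤ ψ x)
    {C ε γ K t c : ℝ} (hC : 0 ≤ C) (hε : 0 ≤ ε) (ht : 0 < t) (hK : 0 < K) (hc : c = 1 / (2 ^ (d + 1) * om d))
    (LE : ∀ y ρ m s, 0 < ρ → closedBall y ρ ⊆ U → 0 < s → 0 < m →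
      ∫⁻ x in ball y ρ, ENNReal.ofReal (φ x + ψ x) ≤ ENNReal.ofReal (ρ ^ d * m) →
      ∫⁻ x in {x | s < φ x} ∩ ball y (ρ / 2), ENNReal.ofReal (φ x) ≤
        ENNReal.ofReal (C * (ε + (m / s) ^ γ) * (ρ ^ d * m)))
    {b : Ed d} {r : ℝ} (hr : 0 < r) (hrδ : 16 * r ≤ infDist b Uᶜ / 2)
    (ha : ENNReal.ofReal (wt U b) * ∫⁻ y in closedBall b (16 * r), ENNReal.ofReal (φ y + ψ y) ≤
        ENNReal.ofReal (t * (16 * r) ^ d))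
    (hb : ENNReal.ofReal (t * r ^ d) < ENNReal.ofReal (wt U b) *
        ∫⁻ y in closedBall b r, ENNReal.ofReal (φ y + ψ y)) :
    ∫⁻ x in {x | K * t < wt U x * φ x} ∩ ball b (8 * r), ENNReal.ofReal (wt U x * φ x) ≤
      ENNReal.ofReal (2 ^ d * 16 ^ d * 2 ^ (d + 1) * (C * (ε + (2 ^ d / K) ^ γ))) *
        ∫⁻ x in closedBall b r ∩ {x | c * t < wt U x * φ x + wt U x * ψ x},
          ENNReal.ofReal (wt U x * φ x + wt U x * ψ x) := by
  have ho := om_pos (d := d)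
  set δ := infDist b Uᶜ with hδ
  have hδ0 : 0 < δ := by linarith
  set W := wt U b with hW
  have hWe : W = δ ^ d := rfl
  have hW0 : 0 < W := by rw [hWe]; positivity
  have up : ∀ x ∈ ball b (8 * r), wt U x ≤ 2 ^ d * W := by
    intro x hx
    have h1 : infDist x Uᶜ ≤ infDist b Uᶜ + dist x b := infDist_le_infDist_add_dist
    rw [mem_ball] at hx
    rw [hWe, ← mul_pow, wt]
    exact pow_le_pow_left₀ infDist_nonneg (by linarith) _
  have low : ∀ x ∈ closedBall b r, W ≤ 2 ^ d * wt U x := by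
    intro x hx
    have h1 : infDist b Uᶜ ≤ infDist x Uᶜ + dist b x := infDist_le_infDist_add_dist
    rw [mem_closedBall, dist_comm] at hx
    rw [hWe, wt, ← mul_pow]
    exact pow_le_pow_left₀ hδ0.le (by linarith) _
  have sub : closedBall b (16 * r) ⊆ U := by
    intro y hy
    by_contra h
    have h1 := infDist_le_dist_of_mem (x := b) (show y ∈ Uᶜ from h)
    rw [mem_closedBall, dist_comm] at hy
    linarith
  -- upper bound from the ball estimate
  have hm : ∫⁻ x in ball b (16 * r), ENNReal.ofReal (φ x + ψ x) ≤ ENNReal.ofReal ((16 * r) ^ d * (t / W)) := by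
    have hWne : ENNReal.ofReal W ≠ 0 := by simpa using hW0
    refine (ENNReal.mul_le_mul_iff_right hWne ENNReal.ofReal_ne_top).1 ?_
    rw [← ENNReal.ofReal_mul hW0.le]
    refine (mul_le_mul_right (lintegral_mono_set ball_subset_closedBall) _).trans (ha.trans (le_of_eq ?_))
    congr 1; field_simp
  have h1 := LE b (16 * r) (t / W) (K * t / (2 ^ d * W)) (by positivity) sub (by positivity) (by positivity) hm
  rw [show t / W / (K * t / (2 ^ d * W)) = 2 ^ d / K by field_simp, show 16 * r / 2 = 8 * r by ring] at h1
  have h2 : ∫⁻ x in {x | K * t < wt U x * φ x} ∩ ball b (8 * r), ENNReal.ofReal (wt U x * φ x) ≤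
      ENNReal.ofReal (2 ^ d * W) * ∫⁻ x in {x | K * t / (2 ^ d * W) < φ x} ∩ ball b (8 * r), ENNReal.ofReal (φ x) := by
    rw [← lintegral_const_mul _ (by fun_prop)]
    have ms : MeasurableSet ({x | K * t < wt U x * φ x} ∩ ball b (8 * r)) :=
      (measurableSet_lt measurable_const ((wt_meas U).mul hφ)).inter measurableSet_ball
    have hle : ∀ x ∈ ({x | K * t < wt U x * φ x} ∩ ball b (8 * r)),
        wt U x * φ x ≤ 2 ^ d * W * φ x := fun x hx => mul_le_mul_of_nonneg_right (up x hx.2) (φ0 x)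
    refine (setLIntegral_mono' ms fun x hx => ?_).trans (lintegral_mono_set fun x hx => ⟨?_, hx.2⟩)
    · rw [← ENNReal.ofReal_mul (by positivity)]
      exact ENNReal.ofReal_le_ofReal (hle x hx)
    · show K * t / (2 ^ d * W) < φ x
      rw [div_lt_iff₀ (by positivity), mul_comm (φ x)]
      exact lt_of_lt_of_le hx.1 (hle x hx)
  have hbr : 0 ≤ (2 ^ d / K) ^ γ := by positivity
  have h3 : ∫⁻ x in {x | K * t < wt U x * φ x} ∩ ball b (8 * r), ENNReal.ofReal (wt U x * φ x) ≤
      ENNReal.ofReal (2 ^ d * 16 ^ d * (C * (ε + (2 ^ d / K) ^ γ))) * ENNReal.ofReal (t * r ^ d) := by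
    refine h2.trans ((mul_le_mul_right h1 _).trans (le_of_eq ?_))
    rw [← ENNReal.ofReal_mul (by positivity), ← ENNReal.ofReal_mul (by positivity), mul_pow]
    congr 1; field_simp
  refine h3.trans ?_
  rw [show 2 ^ d * 16 ^ d * 2 ^ (d + 1) * (C * (ε + (2 ^ d / K) ^ γ)) =
    (2 ^ d * 16 ^ d * (C * (ε + (2 ^ d / K) ^ γ))) * 2 ^ (d + 1) by ring,
    ENNReal.ofReal_mul (p := 2 ^ d * 16 ^ d * (C * (ε + (2 ^ d / K) ^ γ))) (by positivity),
    mul_assoc (ENNReal.ofReal (2 ^ d * 16 ^ d * (C * (ε + (2 ^ d / K) ^ γ))))]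
  refine mul_le_mul_right (α := ℝ≥0∞) ?_ _
  -- lower bound
  set H : Ed d → ℝ := fun x => wt U x * φ x + wt U x * ψ x with hH
  have Hm : Measurable H := ((wt_meas U).mul hφ).add ((wt_meas U).mul hψ)
  set I := ∫⁻ x in closedBall b r ∩ {x | c * t < H x}, ENNReal.ofReal (H x) with hI
  have h4 : ENNReal.ofReal W * ∫⁻ y in closedBall b r, ENNReal.ofReal (φ y + ψ y) ≤
      ENNReal.ofReal (2 ^ d) * ∫⁻ x in closedBall b r, ENNReal.ofReal (H x) := by
    rw [← lintegral_const_mul _ (by fun_prop), ← lintegral_const_mul _ (by fun_prop)]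
    refine setLIntegral_mono' measurableSet_closedBall fun x hx => ?_
    rw [← ENNReal.ofReal_mul (by positivity), ← ENNReal.ofReal_mul (by positivity)]
    refine ENNReal.ofReal_le_ofReal ?_
    have := mul_le_mul_of_nonneg_right (low x hx) (add_nonneg (φ0 x) (ψ0 x))
    simp only [hH]; linarith
  have h5 : ∫⁻ x in closedBall b r, ENNReal.ofReal (H x) ≤ I + ENNReal.ofReal (c * t * (r ^ d * om d)) := by
    rw [← lintegral_inter_add_diff (B := {x | c * t < H x}) _ _ (measurableSet_lt measurable_const Hm)]
    refine add_le_add_right ?_ _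
    have hc0 : 0 < c := by rw [hc]; positivity
    calc _ ≤ ∫⁻ x in closedBall b r \ {x | c * t < H x}, ENNReal.ofReal (c * t) := by
          refine setLIntegral_mono' (measurableSet_closedBall.diff (measurableSet_lt measurable_const Hm)) fun x hx => ?_
          exact ENNReal.ofReal_le_ofReal (not_lt.1 hx.2)
      _ ≤ ∫⁻ x in closedBall b r, ENNReal.ofReal (c * t) := lintegral_mono_set diff_subset
      _ = _ := by rw [setLIntegral_const, vol_cball b hd hr, ← ENNReal.ofReal_mul (by positivity)]
  have h6 : ENNReal.ofReal (t * r ^ d) ≤ ENNReal.ofReal (2 ^ d) * I + ENNReal.ofReal (t * r ^ d / 2) := by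
    refine hb.le.trans (h4.trans ((mul_le_mul_right h5 _).trans (le_of_eq ?_)))
    rw [mul_add, ← ENNReal.ofReal_mul (by positivity)]
    congr 2
    rw [hc, pow_succ]; field_simp
  have h7 : ENNReal.ofReal (t * r ^ d / 2) ≤ ENNReal.ofReal (2 ^ d) * I := by
    refine ENNReal.le_of_add_le_add_right (a := ENNReal.ofReal (t * r ^ d / 2)) ENNReal.ofReal_ne_top ?_
    rw [← ENNReal.ofReal_add (by positivity) (by positivity)]
    simpa using h6
  calc ENNReal.ofReal (t * r ^ d) = ENNReal.ofReal 2 * ENNReal.ofReal (t * r ^ d / 2) := by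
        rw [← ENNReal.ofReal_mul two_pos.le]; congr 1; ring
    _ ≤ ENNReal.ofReal 2 * (ENNReal.ofReal (2 ^ d) * I) := by gcongr
    _ = _ := by rw [← mul_assoc, ← ENNReal.ofReal_mul two_pos.le, pow_succ, mul_comm 2]

lemma good_lambda (hd : 1 ≤ d) {U : Set (Ed d)} (hU : IsOpen U) (hUc : Uᶜ.Nonempty) {D : ℝ}
    (hD : ∀ x, infDist x Uᶜ ≤ D) {φ ψ : Ed d → ℝ}
    (hφ : Measurable φ) (hψ : Measurable ψ) (φ0 : ∀ x, 0 ≤ φ x) (ψ0 : ∀ x, 0 ≤ ψ x)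
    (hfin : ∫⁻ x in U, ENNReal.ofReal (φ x + ψ x) ≠ ∞)
    {C ε γ K c : ℝ} (hC : 0 ≤ C) (hε : 0 ≤ ε) (hK : 1 ≤ K * om d) (hc : c = 1 / (2 ^ (d + 1) * om d))
    (LE : ∀ y ρ m s, 0 < ρ → closedBall y ρ ⊆ U → 0 < s → 0 < m →
      ∫⁻ x in ball y ρ, ENNReal.ofReal (φ x + ψ x) ≤ ENNReal.ofReal (ρ ^ d * m) →
      ∫⁻ x in {x | s < φ x} ∩ ball y (ρ / 2), ENNReal.ofReal (φ x) ≤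
        ENNReal.ofReal (C * (ε + (m / s) ^ γ) * (ρ ^ d * m)))
    {t : ℝ} (ht : 0 < t)
    (htU : 2 ^ d * ∫⁻ x in U, ENNReal.ofReal (φ x + ψ x) ≤ ENNReal.ofReal t) :
    ∫⁻ x in {x | K * t < wt U x * φ x}, ENNReal.ofReal (wt U x * φ x) ≤
      ENNReal.ofReal (2 ^ d * 16 ^ d * 2 ^ (d + 1) * (C * (ε + (2 ^ d / K) ^ γ))) *
        ∫⁻ x in {x | c * t < wt U x * φ x + wt U x * ψ x},
          ENNReal.ofReal (wt U x * φ x + wt U x * ψ x) := by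
  have ho := om_pos (d := d)
  have hK0 : 0 < K := by
    by_contra h; push Not at h; nlinarith
  set E := {x | K * t < wt U x * φ x} with hE
  have cr := crossing hd hU hUc hφ hψ φ0 ψ0 hfin ht hK htU
  set T := {x | K * t < wt U x * φ x ∧ ∃ r, 0 < r ∧ 16 * r ≤ infDist x Uᶜ / 2 ∧
      ENNReal.ofReal (wt U x) * ∫⁻ y in closedBall x (16 * r), ENNReal.ofReal (φ y + ψ y) ≤
        ENNReal.ofReal (t * (16 * r) ^ d) ∧
      ENNReal.ofReal (t * r ^ d) < ENNReal.ofReal (wt U x) *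
        ∫⁻ y in closedBall x r, ENNReal.ofReal (φ y + ψ y)} with hT
  have hsel : ∀ x, ∃ r, x ∈ T → 0 < r ∧ 16 * r ≤ infDist x Uᶜ / 2 ∧
      ENNReal.ofReal (wt U x) * ∫⁻ y in closedBall x (16 * r), ENNReal.ofReal (φ y + ψ y) ≤
        ENNReal.ofReal (t * (16 * r) ^ d) ∧
      ENNReal.ofReal (t * r ^ d) < ENNReal.ofReal (wt U x) *
        ∫⁻ y in closedBall x r, ENNReal.ofReal (φ y + ψ y) := by
    intro x
    by_cases hx : x ∈ T
    · obtain ⟨_, r, hr⟩ := hx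
      exact ⟨r, fun _ => hr⟩
    · exact ⟨0, fun h => absurd h hx⟩
  choose r hr using hsel
  obtain ⟨u, huT, hdis, hcov⟩ := Vitali.exists_disjoint_subfamily_covering_enlargement_closedBall T id r D
    (fun a ha => by have := hr a ha; have := hD a; linarith) 4 (by norm_num)
  simp only [id] at hdis hcov
  have hcount : u.Countable := hdis.countable_of_nonempty_interior fun a ha => by
    refine ⟨a, ?_⟩
    exact mem_interior.2 ⟨ball a (r a), ball_subset_closedBall, isOpen_ball, mem_ball_self (hr a (huT ha)).1⟩
  have : Countable u := hcount.to_subtype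
  have hsub : E ≤ᵐ[volume] ⋃ b : u, E ∩ ball (b : Ed d) (8 * r b) := by
    filter_upwards [cr] with x hx hxE
    have hxT : x ∈ T := ⟨hxE, hx hxE⟩
    obtain ⟨b, hb, hbs⟩ := hcov x hxT
    refine mem_iUnion.2 ⟨⟨b, hb⟩, hxE, ?_⟩
    have h1 := hbs (mem_closedBall_self (hr x hxT).1.le)
    rw [mem_closedBall] at h1
    have := (hr b (huT hb)).1
    exact mem_ball.2 (by linarith)
  have Hm : Measurable fun x => wt U x * φ x + wt U x * ψ x := ((wt_meas U).mul hφ).add ((wt_meas U).mul hψ)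
  calc _ ≤ ∫⁻ x in ⋃ b : u, E ∩ ball (b : Ed d) (8 * r b), ENNReal.ofReal (wt U x * φ x) :=
        lintegral_mono' (Measure.restrict_mono' hsub le_rfl) le_rfl
    _ ≤ ∑' b : u, ∫⁻ x in E ∩ ball (b : Ed d) (8 * r b), ENNReal.ofReal (wt U x * φ x) := lintegral_iUnion_le _ _
    _ ≤ ∑' b : u, ENNReal.ofReal (2 ^ d * 16 ^ d * 2 ^ (d + 1) * (C * (ε + (2 ^ d / K) ^ γ))) *
        ∫⁻ x in closedBall (b : Ed d) (r b) ∩ {x | c * t < wt U x * φ x + wt U x * ψ x},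
          ENNReal.ofReal (wt U x * φ x + wt U x * ψ x) := by
        refine ENNReal.tsum_le_tsum fun b => ?_
        obtain ⟨h1, h2, h3, h4⟩ := hr b (huT b.2)
        exact gl_ball hd hU hUc hφ hψ φ0 ψ0 hC hε ht hK0 hc LE h1 h2 h3 h4
    _ = ENNReal.ofReal (2 ^ d * 16 ^ d * 2 ^ (d + 1) * (C * (ε + (2 ^ d / K) ^ γ))) *
        ∫⁻ x in ⋃ b ∈ u, (closedBall (b : Ed d) (r b) ∩ {x | c * t < wt U x * φ x + wt U x * ψ x}),
          ENNReal.ofReal (wt U x * φ x + wt U x * ψ x) := by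
        rw [ENNReal.tsum_mul_left, lintegral_biUnion hcount (fun i _ => measurableSet_closedBall.inter
          (measurableSet_lt measurable_const Hm))]
        intro a ha b hb hab
        exact (hdis ha hb hab).mono inter_subset_left inter_subset_left
    _ ≤ _ := by
        refine mul_le_mul_right (lintegral_mono_set ?_) _
        exact iUnion₂_subset fun i _ => inter_subset_right

end goodlam

section localest

variable {d N : ℕ} {p Λ : ℝ}

lemma hi_eq (hp : 2 ≤ p) {s : ℝ} (hs : 0 < s) (a : Mat N d) :
    hi p (s ^ (1 / p)) a = if s < ‖a‖ ^ p then ENNReal.ofReal (‖a‖ ^ p) else 0 := by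
  unfold hi
  have hp0 : 0 < p := by linarith
  have : s ^ (1 / p) < ‖a‖ ↔ s < ‖a‖ ^ p := by
    rw [one_div]
    exact Real.rpow_inv_lt_iff_of_pos hs.le (norm_nonneg _) hp0
  simp only [this, enorm_rp hp]

lemma local_est (hp : 2 ≤ p) (hΛ : 1 ≤ Λ) (hd : 1 ≤ d) (N : ℕ) : ∃ γ C : ℝ, 2 < p * γ ∧ 0 < γ ∧ 0 ≤ C ∧
    ∀ ε, 0 < ε → Λ * ε ≤ 1 / 4 → ∃ B : ℝ, 0 ≤ B ∧
    ∀ (f : Mat N d → Mat N d) (Bm : Ed d →L[ℝ] Ed d), Frozen p Λ f Bm →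
    ∀ (z : Ed d) (r K : ℝ) (v : Ed d → En N) (gv a G : Ed d → Mat N d), 0 < r →
    0 ≤ K → Measurable gv → Appr p z r v gv →
    MemLp a (QQ p) (volume.restrict (ball z r)) →
    MemLp G (QQ p) (volume.restrict (ball z r)) →
    (∀ φ : Ed d → En N, ContDiff ℝ (⊤ : ℕ∞) φ → HasCompactSupport φ → tsupport φ ⊆ ball z r →
      ∫ x in ball z r, ⟪a x, clGrad φ x⟫ = ∫ x in ball z r, ⟪G x, clGrad φ x⟫) →
    (∀ᵐ x ∂volume.restrict (ball z r), ‖f (gv x) - a x‖ ≤ ε * ‖gv x‖ ^ (p - 1) + K) →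
    ∀ m s, 0 < s → 0 < m →
      ∫⁻ x in ball z r, ENNReal.ofReal (‖gv x‖ ^ p + B * (K + ‖G x‖) ^ (p / (p - 1))) ≤
        ENNReal.ofReal (r ^ d * m) →
      ∫⁻ x in {x | s < ‖gv x‖ ^ p} ∩ ball z (r / 2), ENNReal.ofReal (‖gv x‖ ^ p) ≤
        ENNReal.ofReal (C * (ε + (m / s) ^ γ) * (r ^ d * m)) := by
  obtain ⟨Cc, hCc, hcmp⟩ := comparison (N := N) (d := d) hp (by linarith : 0 < Λ) hd
  obtain ⟨γ, Ch, hγ, hCh, hhi⟩ := higher d N hp hΛ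
  have hγ0 : 0 < γ := by
    by_contra h
    push Not at h
    nlinarith
  obtain ⟨C0, hC0⟩ : ∃ C0 : ℝ, C0 = 2 ^ p * 2 := ⟨_, rfl⟩
  have hC00 : 0 < C0 := by rw [hC0]; positivity
  refine ⟨γ, 2 ^ p * (2 * Λ + 1) + 2 ^ p * (Ch * (C0 * 2 ^ p) ^ γ * C0), hγ, hγ0, by positivity, ?_⟩
  intro ε hε hε4
  refine ⟨Cc / ε, by positivity, ?_⟩
  intro f Bm hf z r K v gv a G hr hK hgvm hv ha hG heq hle m s hs hm hS
  obtain ⟨u, g, hu, hsol, hcomp⟩ := hcmp f Bm hf z r ε K v gv a G hr hε.le hε4 hK hv ha hG heq hle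
  have iv := memLp_int hp hv.memg
  have fm : IsFiniteMeasure (volume.restrict (ball z r)) := ⟨by simpa using measure_ball_lt_top⟩
  have iG : Integrable (fun x => (K + ‖G x‖) ^ (p / (p - 1))) (volume.restrict (ball z r)) := by
    have h1 : MemLp (fun x => K + ‖G x‖) (QQ p) (volume.restrict (ball z r)) :=
      (memLp_const K).add hG.norm
    refine (dual_int hp h1).congr (Eventually.of_forall fun x => ?_)
    show ‖K + ‖G x‖‖ ^ _ = _
    rw [Real.norm_of_nonneg (by positivity)]
  set S := r ^ d * m with hSdef
  have hS0 : 0 < S := by positivity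
  have hSr : (∫ x in ball z r, ‖gv x‖ ^ p) + Cc / ε * ∫ x in ball z r, (K + ‖G x‖) ^ (p / (p - 1)) ≤ S := by
    rw [← integral_const_mul, ← integral_add iv (iG.const_mul _)]
    refine (ENNReal.ofReal_le_ofReal_iff hS0.le).1 ?_
    refine le_trans (le_of_eq ?_) hS
    refine ofReal_integral_eq_lintegral_ofReal (iv.add (iG.const_mul _)) (Eventually.of_forall fun x => ?_)
    show 0 ≤ ‖gv x‖ ^ p + Cc / ε * (K + ‖G x‖) ^ (p / (p - 1))
    positivity
  have nv : 0 ≤ ∫ x in ball z r, ‖gv x‖ ^ p := integral_nonneg fun x => by positivity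
  have nG : 0 ≤ ∫ x in ball z r, (K + ‖G x‖) ^ (p / (p - 1)) := integral_nonneg fun x => by positivity
  have hD : ∫ x in ball z r, ‖gv x - g x‖ ^ p ≤ (2 * Λ + 1) * ε * S := by
    have e : Cc * ∫ x in ball z r, (K + ‖G x‖) ^ (p / (p - 1)) =
        ε * (Cc / ε * ∫ x in ball z r, (K + ‖G x‖) ^ (p / (p - 1))) := by field_simp
    have n2 : 0 ≤ Cc / ε * ∫ x in ball z r, (K + ‖G x‖) ^ (p / (p - 1)) := by positivity
    rw [e] at hcomp
    generalize Cc / ε * ∫ x in ball z r, (K + ‖G x‖) ^ (p / (p - 1)) = Y at *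
    generalize ∫ x in ball z r, ‖gv x‖ ^ p = V at *
    have h1 : 2 * Λ * ε * V ≤ 2 * Λ * ε * S := by gcongr; linarith
    have h2 : ε * Y ≤ ε * S := by gcongr; linarith
    linarith
  have hmd : MemLp (fun x => gv x - g x) (PP p) (volume.restrict (ball z r)) := hv.memg.sub hu.memg
  have id := memLp_int hp hmd
  have ig := memLp_int hp hu.memg
  have hg : ∫ x in ball z r, ‖g x‖ ^ p ≤ C0 * S := by
    have h1 : ∫ x in ball z r, ‖g x‖ ^ p ≤ ∫ x in ball z r, 2 ^ p * (‖gv x - g x‖ ^ p + ‖gv x‖ ^ p) := by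
      refine integral_mono ig ((id.add iv).const_mul _) fun x => ?_
      refine le_trans (Real.rpow_le_rpow (norm_nonneg _) ?_ (by linarith)) (add_rpow_le hp (norm_nonneg _) (norm_nonneg _))
      rw [add_comm]
      calc ‖g x‖ = ‖gv x - (gv x - g x)‖ := by rw [sub_sub_cancel]
        _ ≤ _ := norm_sub_le _ _
    rw [integral_const_mul, integral_add id iv] at h1
    refine h1.trans ?_
    rw [hC0, mul_assoc]
    refine mul_le_mul_of_nonneg_left ?_ (by positivity)
    have n2 : 0 ≤ Cc / ε * ∫ x in ball z r, (K + ‖G x‖) ^ (p / (p - 1)) := by positivity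
    have : (2 * Λ + 1) * ε * S ≤ 1 * S := by gcongr; nlinarith
    linarith
  obtain ⟨lam, hlam⟩ : ∃ lam : ℝ, lam = s ^ (1 / p) / 2 := ⟨_, rfl⟩
  have hlam0 : 0 < lam := by rw [hlam]; positivity
  have hlamp : lam ^ p = s / 2 ^ p := by
    rw [hlam, Real.div_rpow (by positivity) two_pos.le, ← Real.rpow_mul hs.le, one_div_mul_cancel (by linarith),
      Real.rpow_one]
  have h2l : 2 * lam = s ^ (1 / p) := by rw [hlam]; ring
  have ng : 0 ≤ ∫ x in ball z r, ‖g x‖ ^ p := integral_nonneg fun x => by positivity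
  have hhg : ∫⁻ x in ball z (r / 2), hi p lam (g x) ≤ ENNReal.ofReal (Ch * (C0 * 2 ^ p) ^ γ * C0 * ((m / s) ^ γ * S)) := by
    refine (hhi f Bm hf z r u g hr hu hsol lam hlam0).trans (ENNReal.ofReal_le_ofReal ?_)
    have e : C0 * S / r ^ d / lam ^ p = C0 * 2 ^ p * (m / s) := by
      rw [hlamp, hSdef]; field_simp
    calc _ ≤ Ch * (C0 * S / r ^ d / lam ^ p) ^ γ * (C0 * S) := by gcongr
      _ = _ := by
        rw [e, Real.mul_rpow (by positivity) (by positivity)]; ring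
  have hsub : ball z (r / 2) ⊆ ball z r := ball_subset_ball (by linarith)
  have ms : MeasurableSet {x | s < ‖gv x‖ ^ p} :=
    measurableSet_lt measurable_const (by fun_prop)
  have hgm : AEMeasurable g (volume.restrict (ball z (r / 2))) :=
    (hu.memg.1.mono_measure (Measure.restrict_mono hsub le_rfl)).aemeasurable
  calc ∫⁻ x in {x | s < ‖gv x‖ ^ p} ∩ ball z (r / 2), ENNReal.ofReal (‖gv x‖ ^ p)
      = ∫⁻ x in ball z (r / 2), hi p (2 * lam) (gv x) := by
        rw [← Measure.restrict_restrict ms, ← lintegral_indicator ms]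
        refine lintegral_congr fun x => ?_
        rw [h2l, hi_eq hp hs]
        rfl
    _ ≤ ∫⁻ x in ball z (r / 2), ENNReal.ofReal (2 ^ p) * (‖g x - gv x‖ₑ ^ p + hi p lam (g x)) :=
        lintegral_mono fun x => hi_split hp lam _ _
    _ = ENNReal.ofReal (2 ^ p) * ((∫⁻ x in ball z (r / 2), ‖g x - gv x‖ₑ ^ p) + ∫⁻ x in ball z (r / 2), hi p lam (g x)) := by
        rw [lintegral_const_mul' _ _ ENNReal.ofReal_ne_top, lintegral_add_left' (by fun_prop)]
    _ ≤ ENNReal.ofReal (2 ^ p) * (ENNReal.ofReal ((2 * Λ + 1) * ε * S) +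
          ENNReal.ofReal (Ch * (C0 * 2 ^ p) ^ γ * C0 * ((m / s) ^ γ * S))) := by
        refine mul_le_mul_right (add_le_add ?_ hhg) _
        refine (lintegral_mono_set hsub).trans ?_
        have e2 : ∫⁻ x in ball z r, ‖g x - gv x‖ₑ ^ p = ∫⁻ x in ball z r, ‖gv x - g x‖ₑ ^ p := by
          refine lintegral_congr fun x => ?_
          rw [← enorm_neg, neg_sub]
        rw [e2, lint_eq_int hp hmd]
        exact ENNReal.ofReal_le_ofReal hD
    _ ≤ _ := by
        have hq : 0 ≤ (m / s) ^ γ := by positivity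
        rw [← ENNReal.ofReal_add (by positivity) (by positivity), ← ENNReal.ofReal_mul (by positivity)]
        refine ENNReal.ofReal_le_ofReal ?_
        have x1 : 0 ≤ 2 ^ p * (2 * Λ + 1) * (m / s) ^ γ * S := by positivity
        have x2 : 0 ≤ 2 ^ p * (Ch * (C0 * 2 ^ p) ^ γ * C0) * ε * S := by positivity
        linarith

end localest

section cubeint

variable {d : ℕ}

lemma cube_open (c : Ed d) (R : ℝ) : IsOpen (cube c R) := by
  have : cube c R = ⋂ i, {x : Ed d | |x i - c i| < R / 2} := by ext x; simp [cube]
  rw [this]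
  exact isOpen_iInter_of_finite fun i => isOpen_lt (by fun_prop) continuous_const

lemma cube_compl (hd : 1 ≤ d) (c x : Ed d) {R : ℝ} (hR : 0 < R) (hx : x ∈ cube c R) :
    x + EuclideanSpace.single ⟨0, hd⟩ R ∈ (cube c R)ᶜ := by
  intro h
  have h1 := h ⟨0, hd⟩
  have h2 := hx ⟨0, hd⟩
  simp only [PiLp.add_apply, EuclideanSpace.single_apply, if_true] at h1
  rw [abs_lt] at h1 h2
  linarith

lemma cube_compl_ne (hd : 1 ≤ d) (c : Ed d) {R : ℝ} (hR : 0 < R) : (cube c R)ᶜ.Nonempty :=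
  ⟨_, cube_compl hd c c hR fun i => by simpa using hR⟩

lemma cube_dist_le (hd : 1 ≤ d) (c x : Ed d) {R : ℝ} (hR : 0 < R) : infDist x (cube c R)ᶜ ≤ R := by
  by_cases hx : x ∈ cube c R
  · refine (infDist_le_dist_of_mem (cube_compl hd c x hR hx)).trans (le_of_eq ?_)
    simp [dist_eq_norm, abs_of_pos hR]
  · rw [infDist_zero_of_mem (show x ∈ (cube c R)ᶜ from hx)]; exact hR.le

lemma cube_le_dist (hd : 1 ≤ d) (c x : Ed d) {R : ℝ} (hR : 0 < R) (hx : x ∈ cube c R) :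
    R ≤ infDist x (cube c (4 * R))ᶜ := by
  refine (le_infDist (cube_compl_ne hd c (by positivity))).2 fun y hy => ?_
  have : ∃ i, 4 * R / 2 ≤ |y i - c i| := by
    by_contra h
    push Not at h
    exact hy h
  obtain ⟨i, hi⟩ := this
  have h1 := hx i
  have h2 : |x i - y i| ≤ dist x y := by
    have := PiLp.norm_apply_le (x - y) i
    rwa [← dist_eq_norm, PiLp.sub_apply, Real.norm_eq_abs] at this
  have h3 : |y i - c i| ≤ |x i - y i| + |x i - c i| := by
    have := abs_sub_le (y i) (x i) (c i)
    rwa [abs_sub_comm (y i) (x i)] at this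
  linarith

lemma abs_int (hd : 1 ≤ d) (cq : Ed d) {R : ℝ} (hR : 0 < R) {φ ψ : Ed d → ℝ}
    (hφ : Measurable φ) (hψ : Measurable ψ) (φ0 : ∀ x, 0 ≤ φ x) (ψ0 : ∀ x, 0 ≤ ψ x) {M : ℝ} (hM : 0 ≤ M)
    (hfin : ∫⁻ x in cube cq (4 * R), ENNReal.ofReal (φ x + ψ x) = ENNReal.ofReal M)
    {C ε γ K c σ : ℝ} (hC : 0 ≤ C) (hε : 0 ≤ ε) (hK : 1 ≤ K * om d) (hc : c = 1 / (2 ^ (d + 1) * om d))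
    (LE : ∀ y ρ m s, 0 < ρ → closedBall y ρ ⊆ cube cq (4 * R) → 0 < s → 0 < m →
      ∫⁻ x in ball y ρ, ENNReal.ofReal (φ x + ψ x) ≤ ENNReal.ofReal (ρ ^ d * m) →
      ∫⁻ x in {x | s < φ x} ∩ ball y (ρ / 2), ENNReal.ofReal (φ x) ≤
        ENNReal.ofReal (C * (ε + (m / s) ^ γ) * (ρ ^ d * m)))
    {η : ℝ} (hη : η = 2 ^ d * 16 ^ d * 2 ^ (d + 1) * (C * (ε + (2 ^ d / K) ^ γ)))
    (hσ : 0 < σ) (hKc : 1 ≤ 2 * K / c) (hsm : 2 * η * (2 * K / c) ^ σ ≤ 1 / 2) :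
    ∫⁻ x in cube cq R, ENNReal.ofReal (φ x ^ (1 + σ)) ≤
      ENNReal.ofReal (2 * K ^ σ * (4 ^ d) ^ (1 + σ) * (1 + 2 * η * (2 / c) ^ σ)) *
      (ENNReal.ofReal (R ^ d * (M / R ^ d) ^ (1 + σ)) + ∫⁻ x in cube cq (4 * R), ENNReal.ofReal (ψ x ^ (1 + σ))) := by
  have ho := om_pos (d := d)
  have hK0 : 0 < K := by
    by_contra h; push Not at h; nlinarith
  have hc0 : 0 < c := by rw [hc]; positivity
  have hη0 : 0 ≤ η := by rw [hη]; positivity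
  set U := cube cq (4 * R) with hU
  have hUo : IsOpen U := cube_open _ _
  have h4 : 0 < 4 * R := by positivity
  have wm := wt_meas U
  have w0 := wt_nonneg U
  obtain ⟨P, hP⟩ : ∃ P, P = R ^ d := ⟨_, rfl⟩
  have hP0 : 0 < P := by rw [hP]; positivity
  obtain ⟨κ, hκ⟩ : ∃ κ : ℝ, κ = 4 ^ d := ⟨_, rfl⟩
  have hκ1 : 2 ^ d ≤ κ := by rw [hκ]; gcongr; norm_num
  have hκ0 : 0 < κ := by rw [hκ]; positivity
  have wle : ∀ x, wt U x ≤ κ * P := fun x => by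
    rw [hκ, hP, ← mul_pow]; exact pow_le_pow_left₀ infDist_nonneg (cube_dist_le hd cq x h4) _
  have wge : ∀ x ∈ cube cq R, P ≤ wt U x := fun x hx => by
    rw [hP]; exact pow_le_pow_left₀ hR.le (cube_le_dist hd cq x hR hx) _
  have hs0 : 1 + σ ≠ 0 := by linarith
  have hh : Measurable fun x => wt U x * φ x := wm.mul hφ
  have hk : Measurable fun x => wt U x * ψ x := wm.mul hψ
  have mU := hUo.measurableSet
  -- the integral of `h`
  have Ih : ∫⁻ x, ENNReal.ofReal (wt U x * φ x) ≤ ENNReal.ofReal (κ * P * M) := by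
    calc _ = ∫⁻ x in U, ENNReal.ofReal (wt U x * φ x) := by
          refine (setLIntegral_eq_of_support_subset ?_).symm
          intro x hx
          by_contra h
          exact hx (by simp [wt_zero hd h])
      _ ≤ ∫⁻ x in U, ENNReal.ofReal (κ * P) * ENNReal.ofReal (φ x + ψ x) := by
          refine lintegral_mono fun x => ?_
          rw [← ENNReal.ofReal_mul (by positivity)]
          refine ENNReal.ofReal_le_ofReal (mul_le_mul (wle x) ?_ (φ0 x) (by positivity))
          linarith [ψ0 x]
      _ = _ := by rw [lintegral_const_mul _ (by fun_prop), hfin, ← ENNReal.ofReal_mul (by positivity)]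
  have Ik : ∫⁻ x, ENNReal.ofReal (wt U x * ψ x) * ENNReal.ofReal ((2 * (wt U x * ψ x) / c) ^ σ) ≤
      ENNReal.ofReal ((2 / c) ^ σ * (κ * P) ^ (1 + σ)) * ∫⁻ x in U, ENNReal.ofReal (ψ x ^ (1 + σ)) := by
    calc _ = ∫⁻ x in U, ENNReal.ofReal (wt U x * ψ x) * ENNReal.ofReal ((2 * (wt U x * ψ x) / c) ^ σ) := by
          refine (setLIntegral_eq_of_support_subset ?_).symm
          intro x hx
          by_contra h
          exact hx (by simp [wt_zero hd h])
      _ ≤ ∫⁻ x in U, ENNReal.ofReal ((2 / c) ^ σ * (κ * P) ^ (1 + σ)) * ENNReal.ofReal (ψ x ^ (1 + σ)) := by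
          refine lintegral_mono fun x => ?_
          have hk0 : 0 ≤ wt U x * ψ x := mul_nonneg (w0 x) (ψ0 x)
          rw [← ENNReal.ofReal_mul hk0, ← ENNReal.ofReal_mul (by positivity)]
          refine ENNReal.ofReal_le_ofReal ?_
          rw [mul_assoc _ _ (ψ x ^ (1 + σ)), ← Real.mul_rpow (by positivity) (ψ0 x),
            show 2 * (wt U x * ψ x) / c = 2 / c * (wt U x * ψ x) by ring, Real.mul_rpow (by positivity) hk0,
            mul_left_comm, ← Real.rpow_one_add' hk0 hs0]
          have := mul_le_mul_of_nonneg_right (wle x) (ψ0 x)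
          gcongr
      _ = _ := lintegral_const_mul _ (by fun_prop)
  have LL := layer (μ := volume) hh hk (fun x => mul_nonneg (w0 x) (φ0 x)) (fun x => mul_nonneg (w0 x) (ψ0 x)) hη0 hK0
    hc0 (t0 := 2 ^ d * M) (by positivity) hσ (ne_top_of_le_ne_top ENNReal.ofReal_ne_top Ih) hKc hsm ?_
  swap
  · intro t ht htt
    rw [hη]
    refine good_lambda hd hUo (cube_compl_ne hd cq h4) (fun x => cube_dist_le hd cq x h4) hφ hψ φ0 ψ0
      (by rw [hfin]; exact ENNReal.ofReal_ne_top) hC hε hK hc LE ht ?_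
    rw [hfin]
    have : (2 : ℝ≥0∞) ^ d = ENNReal.ofReal (2 ^ d) := by
      rw [ENNReal.ofReal_pow two_pos.le]; simp
    rw [this, ← ENNReal.ofReal_mul (by positivity)]
    exact ENNReal.ofReal_le_ofReal htt
  have low : ENNReal.ofReal (P ^ (1 + σ) / K ^ σ) * ∫⁻ x in cube cq R, ENNReal.ofReal (φ x ^ (1 + σ)) ≤
      ∫⁻ x, ENNReal.ofReal (wt U x * φ x) * ENNReal.ofReal ((wt U x * φ x / K) ^ σ) := by
    rw [← lintegral_const_mul _ (by fun_prop)]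
    refine (setLIntegral_mono' (cube_open _ _).measurableSet fun x hx => ?_).trans (setLIntegral_le_lintegral (cube cq R) _)
    have hk0 : 0 ≤ wt U x * φ x := mul_nonneg (w0 x) (φ0 x)
    rw [← ENNReal.ofReal_mul hk0, ← ENNReal.ofReal_mul (by positivity)]
    refine ENNReal.ofReal_le_ofReal ?_
    rw [Real.div_rpow hk0 hK0.le, ← mul_div_assoc, ← Real.rpow_one_add' hk0 hs0, div_mul_eq_mul_div,
      ← Real.mul_rpow hP0.le (φ0 x)]
    have := mul_le_mul_of_nonneg_right (wge x hx) (φ0 x)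
    have := mul_nonneg hP0.le (φ0 x)
    gcongr
  obtain ⟨J, hJ⟩ : ∃ J, J = ∫⁻ x in U, ENNReal.ofReal (ψ x ^ (1 + σ)) := ⟨_, rfl⟩
  obtain ⟨X, hX⟩ : ∃ X, X = ∫⁻ x in cube cq R, ENNReal.ofReal (φ x ^ (1 + σ)) := ⟨_, rfl⟩
  rw [← hJ] at Ik
  rw [← hJ, ← hX, ← hP, ← hκ]
  rw [← hX] at low
  have hA0 : 0 < P ^ (1 + σ) / K ^ σ := by positivity
  have hAne : ENNReal.ofReal (P ^ (1 + σ) / K ^ σ) ≠ 0 := by simpa using hA0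
  refine (ENNReal.mul_le_mul_iff_right hAne ENNReal.ofReal_ne_top).1 (low.trans (LL.trans ?_))
  rw [← mul_assoc, ← ENNReal.ofReal_mul hA0.le]
  have hMP : 0 ≤ M / P := by positivity
  have hc2 : 0 ≤ (2 / c) ^ σ := by positivity
  calc _ ≤ 2 * (ENNReal.ofReal ((2 ^ d * M) ^ σ) * ENNReal.ofReal (κ * P * M) +
        ENNReal.ofReal (2 * η) * (ENNReal.ofReal ((2 / c) ^ σ * (κ * P) ^ (1 + σ)) * J)) := by gcongr
    _ = ENNReal.ofReal (2 * ((2 ^ d * M) ^ σ * (κ * P * M))) +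
        ENNReal.ofReal (2 * (2 * η * ((2 / c) ^ σ * (κ * P) ^ (1 + σ)))) * J := by
        rw [mul_add, ← ENNReal.ofReal_mul (by positivity), ← mul_assoc (ENNReal.ofReal (2 * η)),
          ← ENNReal.ofReal_mul (by positivity), ENNReal.ofReal_mul two_pos.le, ENNReal.ofReal_mul two_pos.le]
        simp only [ENNReal.ofReal_ofNat]
        ring
    _ ≤ _ := by
        rw [mul_add, ← ENNReal.ofReal_mul (by positivity)]
        refine add_le_add (ENNReal.ofReal_le_ofReal ?_) (mul_le_mul_left (ENNReal.ofReal_le_ofReal ?_) _)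
        · have e1 : P ^ (1 + σ) / K ^ σ * (2 * K ^ σ * κ ^ (1 + σ) * (1 + 2 * η * (2 / c) ^ σ)) *
              (P * (M / P) ^ (1 + σ)) = 2 * (κ ^ (1 + σ) * M ^ (1 + σ) * P) * (1 + 2 * η * (2 / c) ^ σ) := by
            rw [Real.div_rpow hM hP0.le]
            field_simp
          rw [e1]
          have h1 : (2 ^ d * M) ^ σ * (κ * P * M) ≤ κ ^ (1 + σ) * M ^ (1 + σ) * P := by
            rw [Real.mul_rpow (by positivity) hM, Real.rpow_one_add' hκ0.le hs0, Real.rpow_one_add' hM hs0]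
            have : ((2 : ℝ) ^ d) ^ σ ≤ κ ^ σ := by gcongr
            calc _ = ((2 : ℝ) ^ d) ^ σ * (M ^ σ * (κ * P * M)) := by ring
              _ ≤ κ ^ σ * (M ^ σ * (κ * P * M)) := by gcongr
              _ = _ := by ring
          have h2 : 0 ≤ κ ^ (1 + σ) * M ^ (1 + σ) * P := by positivity
          have h3 : 0 ≤ 2 * η * (2 / c) ^ σ := by positivity
          nlinarith [mul_nonneg h2 h3]
        · have e1 : P ^ (1 + σ) / K ^ σ * (2 * K ^ σ * κ ^ (1 + σ) * (1 + 2 * η * (2 / c) ^ σ)) =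
              2 * ((κ * P) ^ (1 + σ) * (1 + 2 * η * (2 / c) ^ σ)) := by
            rw [Real.mul_rpow hκ0.le hP0.le]
            field_simp
          rw [e1]
          have h2 : 0 ≤ (κ * P) ^ (1 + σ) := by positivity
          linarith

end cubeint

section mainint

variable {d : ℕ}

lemma vol_cube (c : Ed d) {R : ℝ} (hR : 0 < R) : volume (cube c R) = ENNReal.ofReal (R ^ d) := by
  have e : cube c R = (WithLp.ofLp : Ed d → (Fin d → ℝ)) ⁻¹' (pi univ fun i => Ioo (c i - R / 2) (c i + R / 2)) := by
    ext x
    simp only [cube, mem_ofPred_eq, mem_preimage, Set.mem_pi, mem_univ, forall_true_left, mem_Ioo, abs_lt]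
    refine forall_congr' fun i => ?_
    constructor <;> rintro ⟨h1, h2⟩ <;> constructor <;> linarith
  rw [e, (PiLp.volume_preserving_ofLp (Fin d)).measure_preimage
    (MeasurableSet.univ_pi fun i => measurableSet_Ioo).nullMeasurableSet, Real.volume_pi_Ioo]
  simp only [add_sub_sub_cancel, add_halves, Finset.prod_const, Finset.card_univ, Fintype.card_fin]
  rw [ENNReal.ofReal_pow hR.le]

lemma avg_cube (c : Ed d) {R : ℝ} (hR : 0 < R) (F : Ed d → ℝ) :
    (⨍ x in cube c R, F x) = (∫ x in cube c R, F x) / R ^ d := by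
  rw [setAverage_eq, Measure.real, vol_cube c hR, ENNReal.toReal_ofReal (by positivity), smul_eq_mul,
    div_eq_inv_mul]

lemma add_rpow_le' {s a b : ℝ} (hs : 0 ≤ s) (ha : 0 ≤ a) (hb : 0 ≤ b) :
    (a + b) ^ s ≤ 2 ^ s * (a ^ s + b ^ s) := by
  rcases le_total a b with h | h
  · calc (a + b) ^ s ≤ (2 * b) ^ s := by gcongr; linarith
      _ = 2 ^ s * b ^ s := Real.mul_rpow two_pos.le hb
      _ ≤ _ := by gcongr; have := Real.rpow_nonneg ha s; linarith
  · calc (a + b) ^ s ≤ (2 * a) ^ s := by gcongr; linarith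
      _ = 2 ^ s * a ^ s := Real.mul_rpow two_pos.le ha
      _ ≤ _ := by gcongr; have := Real.rpow_nonneg hb s; linarith

lemma choose_K {A b c γ σ0 : ℝ} (L : ℝ) (hb : 0 < b) (hc : 0 < c) (hσ : σ0 < γ) :
    ∃ K, L ≤ K ∧ 0 < K ∧ A * (b / K) ^ γ * (2 * K / c) ^ σ0 ≤ 1 / 4 := by
  have h1 : Tendsto (fun K : ℝ => A * b ^ γ * (2 / c) ^ σ0 * K ^ (-(γ - σ0))) atTop (𝓝 0) := by
    have := (tendsto_rpow_neg_atTop (sub_pos.2 hσ)).const_mul (A * b ^ γ * (2 / c) ^ σ0)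
    rwa [mul_zero] at this
  obtain ⟨K, h2, h3, h4⟩ := ((h1.eventually_lt_const (by norm_num : (0 : ℝ) < 1 / 4)).and
    ((eventually_ge_atTop L).and (eventually_gt_atTop 0))).exists
  refine ⟨K, h3, h4, le_trans (le_of_eq ?_) h2.le⟩
  rw [Real.div_rpow hb.le h4.le, show 2 * K / c = 2 / c * K by ring, Real.mul_rpow (by positivity) h4.le,
    neg_sub, Real.rpow_sub h4]
  field_simp

/-- Final passage to averages. -/
lemma final_avg (cq : Ed d) {R : ℝ} (hR : 0 < R) {φ ψ : Ed d → ℝ} (φ0 : ∀ x, 0 ≤ φ x) (ψ0 : ∀ x, 0 ≤ ψ x)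
    (hφ : Measurable φ) {s Cst : ℝ} (hs : 1 < s) (hC : 0 ≤ Cst)
    (iφ : IntegrableOn φ (cube cq (4 * R))) (iψ : IntegrableOn ψ (cube cq (4 * R)))
    (iψs : IntegrableOn (fun x => ψ x ^ s) (cube cq (4 * R)))
    (h : ∫⁻ x in cube cq R, ENNReal.ofReal (φ x ^ s) ≤ ENNReal.ofReal Cst *
      (ENNReal.ofReal (R ^ d * (((∫ x in cube cq (4 * R), φ x) + ∫ x in cube cq (4 * R), ψ x) / R ^ d) ^ s) +
        ∫⁻ x in cube cq (4 * R), ENNReal.ofReal (ψ x ^ s))) :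
    IntegrableOn (fun x => φ x ^ s) (cube cq R) ∧
    (⨍ x in cube cq R, φ x ^ s) ≤ Cst * ((4 ^ d) ^ s * 2 ^ s + 4 ^ d) *
      ((⨍ x in cube cq (4 * R), φ x) ^ s + ⨍ x in cube cq (4 * R), ψ x ^ s) := by
  have h4 : 0 < 4 * R := by positivity
  have hP : 0 < R ^ d := by positivity
  have nφ : 0 ≤ ⨍ x in cube cq (4 * R), φ x := by
    rw [avg_cube cq h4]; exact div_nonneg (integral_nonneg φ0) (by positivity)
  have nψ : 0 ≤ ⨍ x in cube cq (4 * R), ψ x := by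
    rw [avg_cube cq h4]; exact div_nonneg (integral_nonneg ψ0) (by positivity)
  have nψs : 0 ≤ ⨍ x in cube cq (4 * R), ψ x ^ s := by
    rw [avg_cube cq h4]; exact div_nonneg (integral_nonneg fun x => Real.rpow_nonneg (ψ0 x) _) (by positivity)
  have jen : (⨍ x in cube cq (4 * R), ψ x) ^ s ≤ ⨍ x in cube cq (4 * R), ψ x ^ s := by
    have h40 : ENNReal.ofReal ((4 * R) ^ d) ≠ 0 := by
      have : 0 < (4 * R) ^ d := by positivity
      simpa using this
    exact (convexOn_rpow hs.le).map_set_average_le (Real.continuous_rpow_const (by linarith)).continuousOn isClosed_Ici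
      (by rwa [vol_cube cq h4]) (by rw [vol_cube cq h4]; exact ENNReal.ofReal_ne_top)
      (Eventually.of_forall ψ0) iψ iψs
  have eM : ((∫ x in cube cq (4 * R), φ x) + ∫ x in cube cq (4 * R), ψ x) / R ^ d =
      4 ^ d * ((⨍ x in cube cq (4 * R), φ x) + ⨍ x in cube cq (4 * R), ψ x) := by
    rw [avg_cube cq h4, avg_cube cq h4, mul_pow]; field_simp
  have eZ : ∫ x in cube cq (4 * R), ψ x ^ s = R ^ d * (4 ^ d * ⨍ x in cube cq (4 * R), ψ x ^ s) := by
    rw [avg_cube cq h4, mul_pow]; field_simp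
  rw [eM, ← ofReal_integral_eq_lintegral_ofReal iψs (Eventually.of_forall fun x => Real.rpow_nonneg (ψ0 x) _), eZ] at h
  set a := ⨍ x in cube cq (4 * R), φ x
  set b := ⨍ x in cube cq (4 * R), ψ x
  set z := ⨍ x in cube cq (4 * R), ψ x ^ s
  rw [← ENNReal.ofReal_add (by positivity) (by positivity), ← ENNReal.ofReal_mul hC] at h
  have hm : Measurable fun x => φ x ^ s := by fun_prop
  have hi : IntegrableOn (fun x => φ x ^ s) (cube cq R) := by
    refine ⟨hm.aestronglyMeasurable, ?_⟩
    rw [hasFiniteIntegral_iff_ofReal (Eventually.of_forall fun x => Real.rpow_nonneg (φ0 x) _)]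
    exact lt_of_le_of_lt h ENNReal.ofReal_lt_top
  refine ⟨hi, ?_⟩
  rw [← ofReal_integral_eq_lintegral_ofReal hi (Eventually.of_forall fun x => Real.rpow_nonneg (φ0 x) _)] at h
  have h5 := (ENNReal.ofReal_le_ofReal_iff (by positivity)).1 h
  rw [avg_cube cq hR, div_le_iff₀ hP]
  refine h5.trans ?_
  have h6 : (4 ^ d * (a + b)) ^ s ≤ (4 ^ d) ^ s * 2 ^ s * (a ^ s + z) := by
    rw [Real.mul_rpow (by positivity) (by positivity), mul_assoc]
    have := add_rpow_le' (by linarith : 0 ≤ s) nφ nψ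
    refine mul_le_mul_of_nonneg_left (this.trans ?_) (by positivity)
    gcongr
  have h7 : 4 ^ d * z ≤ 4 ^ d * (a ^ s + z) := by
    have := Real.rpow_nonneg nφ s
    gcongr; linarith
  calc _ = Cst * R ^ d * ((4 ^ d * (a + b)) ^ s + 4 ^ d * z) := by ring
    _ ≤ Cst * R ^ d * ((4 ^ d) ^ s * 2 ^ s * (a ^ s + z) + 4 ^ d * (a ^ s + z)) := by gcongr
    _ = _ := by ring

end mainint

section mainint2

variable {d : ℕ} {p Λ : ℝ}

lemma hZ_arith {B s q' K T I D : ℝ} (hB : 0 ≤ B) (hK : 0 ≤ K) (hT : 0 < T) (nI : 0 ≤ I)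
    (hD : D = B ^ s * (2 ^ q' * (K ^ q' + 1))) :
    B ^ s * (2 ^ q' * (T * K ^ q' + I)) ≤ D * (1 + I / T) * T := by
  have e : D * (1 + I / T) * T = B ^ s * (2 ^ q' * ((K ^ q' + 1) * (T + I))) := by
    have : (1 + I / T) * T = T + I := by field_simp
    rw [mul_assoc, this, hD]; ring
  rw [e]
  have hKq : 0 ≤ K ^ q' := by positivity
  have hBs : 0 ≤ B ^ s := by positivity
  have h2 : (0:ℝ) ≤ 2 ^ q' := by positivity
  refine mul_le_mul_of_nonneg_left (mul_le_mul_of_nonneg_left ?_ h2) hBs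
  nlinarith [mul_nonneg hKq nI]

lemma fin_arith {D X W Z : ℝ} (hD0 : 0 ≤ D) (hX0 : 0 ≤ X) (hW0 : 0 ≤ W) (hZ : Z ≤ D * (1 + W)) :
    X + Z ≤ (1 + D) * (1 + W + X) := by
  nlinarith [mul_nonneg hD0 hX0, mul_nonneg hD0 hW0]

set_option maxHeartbeats 2000000 in
lemma main_int (hp : 2 ≤ p) (hΛ : 1 ≤ Λ) (hd : 1 ≤ d) (N : ℕ) : ∃ q0 ε : ℝ, p + 2 < q0 ∧ 0 < ε ∧ Λ * ε ≤ 1 / 4 ∧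
    ∀ K, 0 ≤ K → ∀ q, p < q → q < q0 → ∃ c : ℝ, 0 ≤ c ∧
    ∀ (f : Mat N d → Mat N d) (Bm : Ed d →L[ℝ] Ed d), Frozen p Λ f Bm →
    ∀ (cq : Ed d) (R : ℝ) (v : Ed d → En N) (gv a G : Ed d → Mat N d), 0 < R →
    Measurable gv → Measurable G →
    (∀ z r, 0 < r → closedBall z r ⊆ cube cq (4 * R) → Appr p z r v gv) →
    MemLp gv (PP p) (volume.restrict (cube cq (4 * R))) →
    MemLp a (QQ p) (volume.restrict (cube cq (4 * R))) →
    MemLp G (ENNReal.ofReal (q / (p - 1))) (volume.restrict (cube cq (4 * R))) →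
    (∀ φ : Ed d → En N, ContDiff ℝ (⊤ : ℕ∞) φ → HasCompactSupport φ → tsupport φ ⊆ cube cq (4 * R) →
      ∫ x in cube cq (4 * R), ⟪a x, clGrad φ x⟫ = ∫ x in cube cq (4 * R), ⟪G x, clGrad φ x⟫) →
    (∀ᵐ x ∂volume.restrict (cube cq (4 * R)), ‖f (gv x) - a x‖ ≤ ε * ‖gv x‖ ^ (p - 1) + K) →
    MemLp gv (ENNReal.ofReal q) (volume.restrict (cube cq R)) ∧
          (⨍ x in cube cq R, ‖gv x‖ ^ q) ≤
            c * (1 + (⨍ x in cube cq (4 * R), ‖G x‖ ^ (q / (p - 1))) +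
              (⨍ x in cube cq (4 * R), ‖gv x‖ ^ p) ^ (q / p)) := by
  have hp0 : 0 < p := by linarith
  have hp1 : 0 < p - 1 := by linarith
  have ho := om_pos (d := d)
  obtain ⟨γ, C, hγ, hγ0, hC, hloc⟩ := local_est hp hΛ hd N
  obtain ⟨q0, hq0⟩ : ∃ q0, q0 = p + 1 + p * γ / 2 := ⟨_, rfl⟩
  obtain ⟨σ0, hσ0⟩ : ∃ σ0, σ0 = q0 / p - 1 := ⟨_, rfl⟩
  have hσγ : σ0 < γ := by
    rw [hσ0, hq0, sub_lt_iff_lt_add, div_lt_iff₀ hp0]; linarith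
  obtain ⟨c, hc⟩ : ∃ c, c = 1 / (2 ^ (d + 1) * om d) := ⟨_, rfl⟩
  have hc0 : 0 < c := by rw [hc]; positivity
  obtain ⟨A, hA⟩ : ∃ A : ℝ, A = 2 ^ d * 16 ^ d * 2 ^ (d + 1) * C := ⟨_, rfl⟩
  have hA0 : 0 ≤ A := by rw [hA]; positivity
  obtain ⟨K1, hK1, hK10, hK1s⟩ := choose_K (A := 2 * A) (b := 2 ^ d) (c := c) (γ := γ) (σ0 := σ0)
    (max (1 / om d) c) (by positivity) hc0 hσγ
  have hK1o : 1 ≤ K1 * om d := by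
    have := (le_max_left _ _).trans hK1
    rwa [div_le_iff₀ ho] at this
  have hK1c : 1 ≤ 2 * K1 / c := by
    have := (le_max_right _ _).trans hK1
    rw [le_div_iff₀ hc0]; linarith
  obtain ⟨Y, hY⟩ : ∃ Y, Y = (2 * K1 / c) ^ σ0 := ⟨_, rfl⟩
  have hY0 : 0 < Y := by rw [hY]; positivity
  obtain ⟨ε, hε⟩ : ∃ ε, ε = 1 / (4 * Λ + 8 * A * Y) := ⟨_, rfl⟩
  have hε0 : 0 < ε := by rw [hε]; positivity
  have hε4 : Λ * ε ≤ 1 / 4 := by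
    rw [hε, mul_one_div, div_le_div_iff₀ (by positivity) (by norm_num)]
    nlinarith [mul_nonneg hA0 hY0.le]
  have hεA : 2 * A * ε * Y ≤ 1 / 4 := by
    have : 2 * A * ε * Y = 2 * A * Y / (4 * Λ + 8 * A * Y) := by rw [hε]; ring
    rw [this, div_le_div_iff₀ (by positivity) (by norm_num)]
    nlinarith [mul_nonneg hA0 hY0.le]
  obtain ⟨η, hη⟩ : ∃ η : ℝ, η = 2 ^ d * 16 ^ d * 2 ^ (d + 1) * (C * (ε + (2 ^ d / K1) ^ γ)) := ⟨_, rfl⟩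
  have hηn : 0 ≤ η := by rw [hη]; positivity
  have hηY : 2 * η * Y ≤ 1 / 2 := by
    have : 2 * η * Y = 2 * A * ε * Y + 2 * A * (2 ^ d / K1) ^ γ * Y := by rw [hη, hA]; ring
    rw [this]
    rw [← hY] at hK1s
    linarith
  obtain ⟨B, hB, hloc⟩ := hloc ε hε0 hε4
  refine ⟨q0, ε, by rw [hq0]; linarith, hε0, hε4, ?_⟩
  intro K hK q hpq hqq
  obtain ⟨s, hs⟩ : ∃ s, s = q / p := ⟨_, rfl⟩
  have hs1 : 1 < s := by rw [hs, lt_div_iff₀ hp0]; linarith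
  obtain ⟨σ, hσ⟩ : ∃ σ, σ = s - 1 := ⟨_, rfl⟩
  have hσ1 : 1 + σ = s := by rw [hσ]; ring
  have hσp : 0 < σ := by linarith
  have hσle : σ ≤ σ0 := by
    rw [hσ, hs, hσ0]
    have : q / p ≤ q0 / p := by gcongr
    linarith
  have hsm : 2 * η * (2 * K1 / c) ^ σ ≤ 1 / 2 := by
    refine le_trans ?_ hηY
    rw [hY]
    have := Real.rpow_le_rpow_of_exponent_le hK1c hσle
    gcongr
  obtain ⟨q', hq'⟩ : ∃ q', q' = q / (p - 1) := ⟨_, rfl⟩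
  have hq'0 : 0 < q' := by rw [hq']; exact div_pos (by linarith) hp1
  have hq's : p / (p - 1) * s = q' := by rw [hs, hq']; field_simp
  obtain ⟨Cst, hCst⟩ : ∃ Cst : ℝ, Cst = 2 * K1 ^ σ * (4 ^ d) ^ (1 + σ) * (1 + 2 * η * (2 / c) ^ σ) := ⟨_, rfl⟩
  have hCst0 : 0 ≤ Cst := by rw [hCst]; positivity
  obtain ⟨D, hD⟩ : ∃ D : ℝ, D = B ^ s * (2 ^ q' * (K ^ q' + 1)) := ⟨_, rfl⟩
  have hD0 : 0 ≤ D := by rw [hD]; positivity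
  refine ⟨Cst * ((4 ^ d) ^ s * 2 ^ s + 4 ^ d) * (1 + D), by positivity, ?_⟩
  intro f Bm hf cq R v gv a G hR hgm hGm happ hgv ha hG heq hle
  have h4 : 0 < 4 * R := by positivity
  have fm : IsFiniteMeasure (volume.restrict (cube cq (4 * R))) :=
    ⟨by rw [Measure.restrict_apply_univ, vol_cube cq h4]; exact ENNReal.ofReal_lt_top⟩
  have hGQ : MemLp G (QQ p) (volume.restrict (cube cq (4 * R))) := by
    refine hG.mono_exponent ?_
    rw [QQ]
    refine ENNReal.ofReal_le_ofReal ?_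
    gcongr
  set φ : Ed d → ℝ := fun x => ‖gv x‖ ^ p with hφ
  set ψ : Ed d → ℝ := fun x => B * (K + ‖G x‖) ^ (p / (p - 1)) with hψ
  have φ0 : ∀ x, 0 ≤ φ x := fun x => by positivity
  have ψ0 : ∀ x, 0 ≤ ψ x := fun x => by positivity
  have mφ : Measurable φ := by fun_prop
  have mψ : Measurable ψ := by fun_prop
  have iφ : IntegrableOn φ (cube cq (4 * R)) := memLp_int hp hgv
  have iψ : IntegrableOn ψ (cube cq (4 * R)) := by
    have h1 : MemLp (fun x => K + ‖G x‖) (QQ p) (volume.restrict (cube cq (4 * R))) :=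
      (memLp_const K).add hGQ.norm
    refine Integrable.const_mul ((dual_int hp h1).congr (Eventually.of_forall fun x => ?_)) B
    show ‖K + ‖G x‖‖ ^ _ = _
    rw [Real.norm_of_nonneg (by positivity)]
  have ψs : ∀ x, ψ x ^ s = B ^ s * (K + ‖G x‖) ^ q' := fun x => by
    simp only [hψ]
    rw [Real.mul_rpow hB (by positivity), ← Real.rpow_mul (by positivity), hq's]
  have iG : IntegrableOn (fun x => ‖G x‖ ^ q') (cube cq (4 * R)) := by
    rw [← hq'] at hG
    have := hG.integrable_norm_rpow (by simpa using hq'0) ENNReal.ofReal_ne_top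
    rwa [ENNReal.toReal_ofReal hq'0.le] at this
  have ψle : ∀ x, ψ x ^ s ≤ B ^ s * (2 ^ q' * (K ^ q' + ‖G x‖ ^ q')) := fun x => by
    rw [ψs]
    have := add_rpow_le' hq'0.le hK (norm_nonneg (G x))
    gcongr
  have ibd : IntegrableOn (fun x => B ^ s * (2 ^ q' * (K ^ q' + ‖G x‖ ^ q'))) (cube cq (4 * R)) :=
    (((integrable_const (K ^ q')).add iG).const_mul _).const_mul _
  have iψs : IntegrableOn (fun x => ψ x ^ s) (cube cq (4 * R)) := by
    refine ibd.mono' (mψ.pow_const s).aestronglyMeasurable (Eventually.of_forall fun x => ?_)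
    rw [Real.norm_of_nonneg (Real.rpow_nonneg (ψ0 x) _)]
    exact ψle x
  have hM : ∫⁻ x in cube cq (4 * R), ENNReal.ofReal (φ x + ψ x) = ENNReal.ofReal
      ((∫ x in cube cq (4 * R), φ x) + ∫ x in cube cq (4 * R), ψ x) := by
    rw [← integral_add iφ iψ]
    exact (ofReal_integral_eq_lintegral_ofReal (iφ.add iψ)
      (Eventually.of_forall fun x => add_nonneg (φ0 x) (ψ0 x))).symm
  have main := abs_int hd cq hR mφ mψ φ0 ψ0 (add_nonneg (integral_nonneg φ0) (integral_nonneg ψ0)) hM hC hε0.le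
    hK1o hc ?_ hη hσp hK1c hsm
  swap
  · intro y ρ m t hρ hsub ht hm hInt
    have hb : ball y ρ ⊆ cube cq (4 * R) := ball_subset_closedBall.trans hsub
    have hbm := Measure.restrict_mono (μ := volume) hb le_rfl
    refine hloc f Bm hf y ρ K v gv a G hρ hK hgm (happ y ρ hρ hsub) (ha.mono_measure hbm) (hGQ.mono_measure hbm)
      ?_ (ae_mono hbm hle) m t ht hm hInt
    intro χ hχ1 hχ2 hχ3
    have := heq χ hχ1 hχ2 (hχ3.trans hb)
    have red : ∀ F : Ed d → Mat N d, ∫ x in cube cq (4 * R), ⟪F x, clGrad χ x⟫ = ∫ x in ball y ρ, ⟪F x, clGrad χ x⟫ := by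
      intro F
      refine (setIntegral_eq_of_subset_of_forall_diff_eq_zero (cube_open _ _).measurableSet hb fun x hx => ?_)
      rw [clGrad_tsupport χ (fun h => hx.2 (hχ3 h)), inner_zero_right]
    rwa [red, red] at this
  rw [← hCst, hσ1] at main
  obtain ⟨hInt, hav⟩ := final_avg cq hR φ0 ψ0 mφ hs1 hCst0 iφ iψ iψs main
  have φs : ∀ x, φ x ^ s = ‖gv x‖ ^ q := fun x => by
    simp only [hφ]
    rw [← Real.rpow_mul (norm_nonneg _), hs, mul_div_cancel₀ _ hp0.ne']
  simp only [φs] at hInt hav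
  have hq : 0 < q := by linarith
  refine ⟨?_, ?_⟩
  · refine (integrable_norm_rpow_iff hgm.aestronglyMeasurable (by simpa using hq) ENNReal.ofReal_ne_top).1 ?_
    rw [ENNReal.toReal_ofReal hq.le]
    exact hInt
  rw [← hq', ← hs]
  refine hav.trans ?_
  rw [mul_assoc (Cst * _)]
  refine mul_le_mul_of_nonneg_left ?_ (by positivity)
  have hW0 : 0 ≤ ⨍ x in cube cq (4 * R), ‖G x‖ ^ q' := by
    rw [avg_cube cq h4]; exact div_nonneg (integral_nonneg fun x => by positivity) (by positivity)
  have hX0 : 0 ≤ (⨍ x in cube cq (4 * R), φ x) ^ s := by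
    refine Real.rpow_nonneg ?_ _
    rw [avg_cube cq h4]; exact div_nonneg (integral_nonneg φ0) (by positivity)
  have hZ : ⨍ x in cube cq (4 * R), ψ x ^ s ≤ D * (1 + ⨍ x in cube cq (4 * R), ‖G x‖ ^ q') := by
    have h1 : ∫ x in cube cq (4 * R), ψ x ^ s ≤ ∫ x in cube cq (4 * R), B ^ s * (2 ^ q' * (K ^ q' + ‖G x‖ ^ q')) :=
      integral_mono iψs ibd ψle
    rw [integral_const_mul, integral_const_mul, integral_add (integrable_const _) iG, setIntegral_const, smul_eq_mul,
      Measure.real, vol_cube cq h4, ENNReal.toReal_ofReal (by positivity)] at h1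
    rw [avg_cube cq h4, avg_cube cq h4, div_le_iff₀ (by positivity)]
    refine h1.trans ?_
    have hT : 0 < (4 * R) ^ d := by positivity
    have nI : 0 ≤ ∫ x in cube cq (4 * R), ‖G x‖ ^ q' := integral_nonneg fun x => by positivity
    exact hZ_arith hB hK hT nI hD
  exact fin_arith hD0 hX0 hW0 hZ

end mainint2

section assembly

variable {d N : ℕ}

lemma cara_meas {Ω : Set (Ed d)} {A : Ed d → Mat N d → Mat N d}
    (hAmeas : ∀ η, Measurable fun x => A x η)
    (hAcont : ∀ᵐ x ∂volume.restrict Ω, Continuous (A x)) {g : Ed d → Mat N d} (hg : Measurable g) :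
    AEStronglyMeasurable (fun x => A x (g x)) (volume.restrict Ω) := by
  classical
  obtain ⟨S, hSm, hS0, hS⟩ : ∃ S : Set (Ed d), MeasurableSet S ∧ (∀ᵐ x ∂volume.restrict Ω, x ∈ S) ∧
      ∀ x ∈ S, Continuous (A x) := by
    refine ⟨(toMeasurable (volume.restrict Ω) {x | ¬ Continuous (A x)})ᶜ,
      (measurableSet_toMeasurable _ _).compl, ?_, ?_⟩
    · rw [ae_iff]
      simp only [Set.mem_compl_iff, not_not, Set.setOf_mem_eq]
      rw [measure_toMeasurable]
      exact hAcont
    · intro x hx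
      by_contra h
      exact hx (subset_toMeasurable _ _ h)
  have key : Measurable (Function.uncurry fun (η : Mat N d) (x : Ed d) => S.indicator (fun y => A y η) x) := by
    refine measurable_uncurry_of_continuous_of_measurable (fun x => ?_) (fun η => (hAmeas η).indicator hSm)
    by_cases hx : x ∈ S
    · simp only [Set.indicator_of_mem hx]; exact hS x hx
    · simp only [Set.indicator_of_notMem hx]; exact continuous_const
  have h2 : Measurable fun x => S.indicator (fun y => A y (g x)) x := key.comp (hg.prodMk measurable_id)
  refine h2.aestronglyMeasurable.congr (hS0.mono fun x hx => ?_)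
  simp only [Set.indicator_of_mem hx]

lemma cube_dist {c : Ed d} {R : ℝ} (hd : 1 ≤ d) (hR : 0 < R) {x y : Ed d} (hx : x ∈ cube c R) (hy : y ∈ cube c R) :
    dist x y ≤ d * R := by
  rw [EuclideanSpace.dist_eq]
  refine Real.sqrt_le_iff.2 ⟨by positivity, ?_⟩
  have h : ∀ i ∈ Finset.univ, dist (x i) (y i) ^ 2 ≤ R ^ 2 := fun i _ => by
    have h1 := hx i
    have h2 := hy i
    rw [abs_lt] at h1 h2
    have h3 : dist (x i) (y i) ≤ R := by
      rw [Real.dist_eq, abs_le]; constructor <;> linarith [h1.1, h1.2, h2.1, h2.2]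
    exact pow_le_pow_left₀ dist_nonneg h3 2
  refine (Finset.sum_le_card_nsmul _ _ _ h).trans ?_
  rw [Finset.card_univ, Fintype.card_fin, nsmul_eq_mul, mul_pow]
  have : (1:ℝ) ≤ d := by exact_mod_cast hd
  have : (d:ℝ) ≤ (d:ℝ) ^ 2 := by nlinarith
  gcongr

lemma cube_center (c : Ed d) {R : ℝ} (hR : 0 < R) : c ∈ cube c R := by
  intro i; simpa using hR

lemma cube_compact_closure (c : Ed d) {R : ℝ} (hd : 1 ≤ d) (hR : 0 < R) : IsCompact (closure (cube c R)) :=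
  Metric.isCompact_of_isClosed_isBounded isClosed_closure
    (Metric.isBounded_iff.2 ⟨d * R, fun _ hx _ hy => cube_dist hd hR hx hy⟩).closure

lemma memLp_growth {X : Type*} [MeasurableSpace X] {μ : Measure X} [IsFiniteMeasure μ] {p C : ℝ}
    (hp : 2 ≤ p) (hC : 0 ≤ C) {g a : X → Mat N d} (hg : MemLp g (PP p) μ)
    (ha : AEStronglyMeasurable a μ) (hle : ∀ᵐ x ∂μ, ‖a x‖ ≤ C * (1 + ‖g x‖ ^ (p - 1))) : MemLp a (QQ p) μ := by
  have h1 : MemLp (fun x => 1 + ‖g x‖) (PP p) μ := (memLp_const (1:ℝ)).add hg.norm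
  refine memLp_dual_of_le (C := 2 * C) hp h1 ha (hle.mono fun x hx => hx.trans ?_)
  have hn := norm_nonneg (g x)
  rw [Real.norm_of_nonneg (by positivity)]
  have h2 : (1:ℝ) ≤ (1 + ‖g x‖) ^ (p - 1) := Real.one_le_rpow (by linarith) (by linarith)
  have h3 : ‖g x‖ ^ (p - 1) ≤ (1 + ‖g x‖) ^ (p - 1) := Real.rpow_le_rpow hn (by linarith) (by linarith)
  nlinarith

lemma LamC_ge {p a0 a1 : ℝ} (h0 : 0 < a0) (h1 : 0 ≤ a1) : 1 ≤ LamC p a0 a1 := by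
  unfold LamC
  have : 0 ≤ 4 * 4 ^ (p - 2) / a0 := by positivity
  have : 0 ≤ 1 / a0 := by positivity
  linarith

end assembly

/-- **Main theorem.** Gradient `L^q` estimates for non-diagonal nonlinear
elliptic systems: under `(p-1)`-growth and `p`-coercivity of `𝒜`, with asymptotic operator
`F_η` (uniformly approximating `𝒜` at infinity, continuous in the spatial variable,
`p`-uniformly elliptic and satisfying the splitting condition), there are `q₀ > p+2` and
`R₀ > 0` such that for every `q ∈ (p,q₀)` there is `c ≥ 0` with
`⨍_Q |∇v|^q ≤ c[1 + ⨍_{4Q}|G|^{q/(p−1)} + (⨍_{4Q}|∇v|^p)^{q/p}]`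
for every `G ∈ L^{q/(p−1)}_loc`, every distributional solution
`v ∈ W^{1,p}_loc(Ω;ℝ^N)` of `−div 𝒜(x,∇v) = −div G`, and every cube `Q` of sidelength `< R₀`
with `4Q ⊆ Ω`. -/
theorem stmt0 (d N : ℕ) (hd : 2 ≤ d) (hN : 1 ≤ N) (p alpha0 alpha1 : ℝ) (hp : 1 < p)
    (h0 : 0 < alpha0) (h1 : 0 ≤ alpha1)
    (Ω : Set (Ed d)) (hΩ : IsOpen Ω)
    -- the operator 𝒜, Carathéodory with (p−1)-growth and p-coercivity
    (A : Ed d → Mat N d → Mat N d)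
    (hAmeas : ∀ η, Measurable fun x => A x η)
    (hAcont : ∀ᵐ x ∂volume.restrict Ω, Continuous (A x))
    (hgrowth : ∀ᵐ x ∂volume.restrict Ω, ∀ η, ‖A x η‖ ≤ alpha1 * (1 + ‖η‖ ^ (p - 1)))
    (hcoerc : ∀ᵐ x ∂volume.restrict Ω, ∀ η, alpha0 * ‖η‖ ^ p - alpha1 ≤ ⟪A x η, η⟫)
    -- the Carathéodory potential F with Carathéodory gradient F_η
    (F : Ed d → Mat N d → ℝ) (Feta : Ed d → Mat N d → Mat N d)
    (hFmeas : ∀ η, Measurable fun x => F x η)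
    (hFetameas : ∀ η, Measurable fun x => Feta x η)
    (hFetacont : ∀ᵐ x ∂volume.restrict Ω, Continuous (Feta x))
    (hgradF : ∀ᵐ x ∂volume.restrict Ω, ∀ η : Mat N d, η ≠ 0 → HasGradientAt (F x) (Feta x η) η)
    -- (i) F_η is the asymptotic operator of 𝒜, with uniform approximation at infinity
    (hasym : ∀ᵐ x ∂volume.restrict Ω, ∀ η : Mat N d,
      Filter.Tendsto (fun lam : ℝ => (lam ^ (p - 1))⁻¹ • A x (lam • η))
        Filter.atTop (𝓝 (Feta x η)))
    (hunif : ∀ ε : ℝ, 0 < ε → ∃ lam₀ : ℝ, 0 < lam₀ ∧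
      ∀ᵐ x ∂volume.restrict Ω, ∀ η : Mat N d, lam₀ ≤ ‖η‖ →
        ‖Feta x η - A x η‖ ≤ ε * ‖η‖ ^ (p - 1))
    -- (ii) continuity of F_η in the spatial variable
    (hspace : ∀ ε : ℝ, 0 < ε → ∃ δ : ℝ, 0 < δ ∧
      ∀ x₁ ∈ Ω, ∀ x₂ ∈ Ω, dist x₁ x₂ ≤ δ →
        ∀ η : Mat N d, ‖Feta x₁ η - Feta x₂ η‖ ≤ ε * ‖η‖ ^ (p - 1))
    -- (iii) F(x,·) is C² away from 0 with p-uniform Hessian bounds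
    (hC2 : ∀ᵐ x ∂volume.restrict Ω, ContDiffOn ℝ 2 (F x) {0}ᶜ ∧
      ∀ η : Mat N d, η ≠ 0 → ∀ ξ,
        alpha0 * ‖η‖ ^ (p - 2) * ‖ξ‖ ^ 2 ≤ iteratedFDeriv ℝ 2 (F x) η ![ξ, ξ] ∧
        iteratedFDeriv ℝ 2 (F x) η ![ξ, ξ] ≤ alpha1 * ‖η‖ ^ (p - 2) * ‖ξ‖ ^ 2)
    -- (iv) the splitting condition
    (Asp : Ed d → Mat N d → Matrix (Fin N) (Fin N) ℝ)
    (bmat : Ed d → Matrix (Fin d) (Fin d) ℝ)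
    (hAspmeas : ∀ η a b, Measurable fun x => Asp x η a b)
    (hAspcont : ∀ᵐ x ∂volume.restrict Ω, Continuous (Asp x))
    (hAspsymm : ∀ᵐ x ∂volume.restrict Ω, ∀ η a b, Asp x η a b = Asp x η b a)
    (hAspell : ∀ᵐ x ∂volume.restrict Ω, ∀ η : Mat N d, η ≠ 0 → ∀ μ : En N,
      alpha0 * ‖η‖ ^ (p - 2) * ‖μ‖ ^ 2 ≤ ∑ a, ∑ b, Asp x η a b * μ a * μ b ∧
      ∑ a, ∑ b, Asp x η a b * μ a * μ b ≤ alpha1 * ‖η‖ ^ (p - 2) * ‖μ‖ ^ 2)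
    (hbmeas : ∀ i j, Measurable fun x => bmat x i j)
    (hbsymm : ∀ᵐ x ∂volume.restrict Ω, ∀ i j, bmat x i j = bmat x j i)
    (hbell : ∀ᵐ x ∂volume.restrict Ω, ∀ w : Ed d,
      alpha0 * ‖w‖ ^ 2 ≤ ∑ i, ∑ j, bmat x i j * w i * w j ∧
      ∑ i, ∑ j, bmat x i j * w i * w j ≤ alpha1 * ‖w‖ ^ 2)
    (hsplit : ∀ᵐ x ∂volume.restrict Ω, ∀ (η : Mat N d) (a : Fin N) (i : Fin d),
      Feta x η (a, i) = ∑ b : Fin N, ∑ j : Fin d, Asp x η a b * bmat x i j * η (b, j)) :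
    ∃ q₀ R₀ : ℝ, p + 2 < q₀ ∧ 0 < R₀ ∧
      ∀ q : ℝ, p < q → q < q₀ →
      ∃ c : ℝ, 0 ≤ c ∧
        ∀ G : Ed d → Mat N d,
          (∀ K : Set (Ed d), IsCompact K → K ⊆ Ω →
            MemLp G (ENNReal.ofReal (q / (p - 1))) (volume.restrict K)) →
        ∀ (v : Ed d → En N) (gv : Ed d → Mat N d),
          (∀ K : Set (Ed d), IsCompact K → K ⊆ Ω →
            MemLp v (ENNReal.ofReal p) (volume.restrict K) ∧
            MemLp gv (ENNReal.ofReal p) (volume.restrict K)) →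
          IsWeakGrad Ω v gv →
          (∀ φ : Ed d → En N, ContDiff ℝ (⊤ : ℕ∞) φ → HasCompactSupport φ → tsupport φ ⊆ Ω →
            ∫ x in Ω, ⟪A x (gv x), clGrad φ x⟫ = ∫ x in Ω, ⟪G x, clGrad φ x⟫) →
        ∀ (cq : Ed d) (R : ℝ), 0 < R → R < R₀ → closure (cube cq (4 * R)) ⊆ Ω →
          MemLp gv (ENNReal.ofReal q) (volume.restrict (cube cq R)) ∧
          (⨍ x in cube cq R, ‖gv x‖ ^ q) ≤
            c * (1 + (⨍ x in cube cq (4 * R), ‖G x‖ ^ (q / (p - 1))) +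
              (⨍ x in cube cq (4 * R), ‖gv x‖ ^ p) ^ (q / p)) := by
  have hd1 : 1 ≤ d := by omega
  rcases Set.eq_empty_or_nonempty Ω with rfl | hne
  · refine ⟨p + 3, 1, by linarith, one_pos, fun q _ _ => ⟨0, le_rfl, ?_⟩⟩
    intro G _ v gv _ _ _ cq R hR _ hsub
    exact absurd (hsub (subset_closure (cube_center cq (by positivity : 0 < 4 * R)))) (Set.notMem_empty _)
  have exgood : ∀ {P : Ed d → Prop} (U : Set (Ed d)), IsOpen U → U.Nonempty → U ⊆ Ω →
      (∀ᵐ x ∂volume.restrict Ω, P x) → ∃ x ∈ U, P x := by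
    intro P U hU hUn hUΩ hP
    have h1 : ∀ᵐ x ∂volume.restrict U, P x := ae_mono (Measure.restrict_mono hUΩ le_rfl) hP
    have h2 : ∀ᵐ x ∂volume.restrict U, x ∈ U := ae_restrict_mem hU.measurableSet
    have h3 : (ae (volume.restrict U)).NeBot := by
      rw [ae_neBot, Ne, Measure.restrict_eq_zero]
      exact (hU.measure_pos volume hUn).ne'
    obtain ⟨x, hx1, hx2⟩ := (h2.and h1).exists
    exact ⟨x, hx1, hx2⟩
  obtain ⟨hp2, h01⟩ : 2 ≤ p ∧ alpha0 ≤ alpha1 := by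
    obtain ⟨x, _, hx1, hx2⟩ := exgood Ω hΩ hne subset_rfl (hAspcont.and hAspell)
    exact p_ge_two hd hN p alpha0 alpha1 h0 (Asp x) hx1 hx2
  have h1' : 0 < alpha1 := h0.trans_le h01
  have good : ∀ᵐ x ∂volume.restrict Ω, ∃ Bm, Frozen p (LamC p alpha0 alpha1) (Feta x) Bm := by
    filter_upwards [hFetacont, hgradF, hasym, hC2, hAspsymm, hAspell, hbsymm, hbell, hsplit] with x
      g1 g2 g3 g4 g5 g6 g7 g8 g9
    exact frozen_of hd hN p alpha0 alpha1 hp2 h0 h1' (A x) (F x) (Feta x) g1 g2 g3 g4 (Asp x) (bmat x)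
      g5 g6 g7 g8 g9
  have hΛ : 1 ≤ LamC p alpha0 alpha1 := LamC_ge h0 h1
  obtain ⟨q0, ε, hq0, hε, -, hmain⟩ := main_int hp2 hΛ hd1 N
  obtain ⟨lam, hlam, hun⟩ := hunif (ε / 2) (by positivity)
  obtain ⟨δ, hδ, hsp⟩ := hspace (ε / 2) (by positivity)
  have hdpos : (0 : ℝ) < d := by exact_mod_cast hd1
  refine ⟨q0, δ / (4 * d), hq0, by positivity, ?_⟩
  intro q hpq hqq
  have hK : 0 ≤ LamC p alpha0 alpha1 * lam ^ (p - 1) + alpha1 * (1 + lam ^ (p - 1)) := by positivity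
  obtain ⟨c, hc, hest⟩ := hmain _ hK q hpq hqq
  refine ⟨c, hc, ?_⟩
  intro G hG v gv hv hw heq cq R hR hRR hsub
  have h4 : 0 < 4 * R := by positivity
  have hQΩ : cube cq (4 * R) ⊆ Ω := subset_closure.trans hsub
  have hQo : IsOpen (cube cq (4 * R)) := cube_open _ _
  obtain ⟨x0, hx0, Bm, hf⟩ := exgood _ hQo ⟨cq, cube_center cq h4⟩ hQΩ good
  have hcomp := cube_compact_closure cq hd1 h4
  have hres : volume.restrict (cube cq (4 * R)) ≤ volume.restrict (closure (cube cq (4 * R))) :=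
    Measure.restrict_mono subset_closure le_rfl
  have hresΩ : volume.restrict (cube cq (4 * R)) ≤ volume.restrict Ω := Measure.restrict_mono hQΩ le_rfl
  have hRsub : cube cq R ⊆ cube cq (4 * R) := fun x hx i => (hx i).trans (by linarith)
  have hresR : volume.restrict (cube cq R) ≤ volume.restrict (cube cq (4 * R)) := Measure.restrict_mono hRsub le_rfl
  have mG := (hG _ hcomp hsub).mono_measure hres
  have mg := ((hv _ hcomp hsub).2).mono_measure hres
  have fm : IsFiniteMeasure (volume.restrict (cube cq (4 * R))) :=
    ⟨by rw [Measure.restrict_apply_univ, vol_cube cq h4]; exact ENNReal.ofReal_lt_top⟩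
  obtain ⟨g', hg'm, hg'e⟩ : ∃ g', Measurable g' ∧ gv =ᵐ[volume.restrict (cube cq (4 * R))] g' :=
    ⟨_, mg.1.stronglyMeasurable_mk.measurable, mg.1.ae_eq_mk⟩
  obtain ⟨G', hG'm, hG'e⟩ : ∃ G', Measurable G' ∧ G =ᵐ[volume.restrict (cube cq (4 * R))] G' :=
    ⟨_, mG.1.stronglyMeasurable_mk.measurable, mG.1.ae_eq_mk⟩
  have mg' := mg.ae_eq hg'e
  have ma : MemLp (fun x => A x (g' x)) (QQ p) (volume.restrict (cube cq (4 * R))) := by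
    refine memLp_growth hp2 h1 mg' ((cara_meas hAmeas hAcont hg'm).mono_measure hresΩ) ?_
    filter_upwards [ae_mono hresΩ hgrowth] with x hx using hx _
  have fin := hest (Feta x0) Bm hf cq R v g' (fun x => A x (g' x)) G' hR hg'm hG'm ?_ mg' ma (mG.ae_eq hG'e) ?_ ?_
  · have hg'R : gv =ᵐ[volume.restrict (cube cq R)] g' := ae_mono hresR hg'e
    refine ⟨fin.1.ae_eq hg'R.symm, ?_⟩
    have e1 : (⨍ x in cube cq R, ‖gv x‖ ^ q) = ⨍ x in cube cq R, ‖g' x‖ ^ q :=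
      average_congr (hg'R.mono fun x hx => by simp only [hx])
    have e2 : (⨍ x in cube cq (4 * R), ‖gv x‖ ^ p) = ⨍ x in cube cq (4 * R), ‖g' x‖ ^ p :=
      average_congr (hg'e.mono fun x hx => by simp only [hx])
    have e3 : (⨍ x in cube cq (4 * R), ‖G x‖ ^ (q / (p - 1))) = ⨍ x in cube cq (4 * R), ‖G' x‖ ^ (q / (p - 1)) :=
      average_congr (hG'e.mono fun x hx => by simp only [hx])
    rw [e1, e2, e3]
    exact fin.2
  · intro z r hr hzr
    refine (appr_of_weak hp2 hΩ hv hw (hzr.trans hQΩ)).congr (ae_eq_refl _) ?_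
    exact ae_mono (Measure.restrict_mono (ball_subset_closedBall.trans hzr) le_rfl) hg'e
  · intro φ hφ1 hφ2 hφ3
    have red : ∀ W : Ed d → Mat N d, ∫ x in Ω, ⟪W x, clGrad φ x⟫ = ∫ x in cube cq (4 * R), ⟪W x, clGrad φ x⟫ := by
      intro W
      refine (setIntegral_eq_of_subset_of_forall_sdiff_eq_zero hΩ.measurableSet hQΩ fun x hx => ?_)
      rw [clGrad_tsupport φ (fun h => hx.2 (hφ3 h)), inner_zero_right]
    have := heq φ hφ1 hφ2 (hφ3.trans hQΩ)
    rw [red fun x => A x (gv x), red] at this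
    have e1 : ∫ x in cube cq (4 * R), ⟪A x (gv x), clGrad φ x⟫ = ∫ x in cube cq (4 * R), ⟪A x (g' x), clGrad φ x⟫ :=
      integral_congr_ae (hg'e.mono fun x hx => by simp only [hx])
    have e2 : ∫ x in cube cq (4 * R), ⟪G x, clGrad φ x⟫ = ∫ x in cube cq (4 * R), ⟪G' x, clGrad φ x⟫ :=
      integral_congr_ae (hG'e.mono fun x hx => by simp only [hx])
    rw [← e1, ← e2]
    exact this
  · filter_upwards [ae_mono hresΩ hgrowth, ae_mono hresΩ hun, ae_restrict_mem hQo.measurableSet] with x hx1 hx2 hx3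
    have hdist : dist x0 x ≤ δ := by
      refine (cube_dist hd1 h4 hx0 hx3).trans ?_
      rw [lt_div_iff₀ (by positivity)] at hRR
      linarith
    have hn := norm_nonneg (g' x)
    have hnp : 0 ≤ ‖g' x‖ ^ (p - 1) := by positivity
    rcases le_total lam ‖g' x‖ with hl | hl
    · have a1 := hx2 _ hl
      have a2 := hsp x0 (hQΩ hx0) x (hQΩ hx3) hdist (g' x)
      have a3 := norm_sub_le_norm_sub_add_norm_sub (Feta x0 (g' x)) (Feta x (g' x)) (A x (g' x))
      linarith
    · have a0 : ‖g' x‖ ^ (p - 1) ≤ lam ^ (p - 1) := Real.rpow_le_rpow hn hl (by linarith)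
      have a1 := hx1 (g' x)
      have a2 := hf.growth hp2 (g' x)
      have a3 := norm_sub_le (Feta x0 (g' x)) (A x (g' x))
      have a4 : LamC p alpha0 alpha1 * ‖g' x‖ ^ (p - 1) ≤ LamC p alpha0 alpha1 * lam ^ (p - 1) :=
        mul_le_mul_of_nonneg_left a0 (by linarith)
      have a5 : alpha1 * (1 + ‖g' x‖ ^ (p - 1)) ≤ alpha1 * (1 + lam ^ (p - 1)) :=
        mul_le_mul_of_nonneg_left (by linarith) h1
      have a6 : 0 ≤ ε * ‖g' x‖ ^ (p - 1) := by positivity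
      linarith
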